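/- Let p ≥ 3 be a prime, let σ be an integer with 1 ≤ σ ≤ 10, and let N be the supersingular K3 lattice of characteristic p and Artin invariant σ. Then there exists a primitive sublattice M ⊆ N with M isometric to Γ(2) such that no vector x ∈ N with ⟨x,x⟩ = −2 is orthogonal to M, if and only if σ ≤ 5. -/

import Mathlib

open Matrix

noncomputable section

/-- The bilinear form on `ℤ^n` given by a Gram matrix `G`. -/
def bilin {n : ℕ} (G : Matrix (Fin n) (Fin n) ℤ) (x y : Fin n → ℤ) : ℤ :=
  x ⬝ᵥ G.mulVec y

/-- The `ℚ`-bilinear extension of the form given by `G`. -/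
def bilinQ {n : ℕ} (G : Matrix (Fin n) (Fin n) ℤ) (x y : Fin n → ℚ) : ℚ :=
  x ⬝ᵥ (G.map (Int.cast : ℤ → ℚ)).mulVec y

/-- A Gram matrix of the even unimodular lattice `Γ = U ⊕ E8(-1)` of signature `(1,9)`. -/
def GammaGram : Matrix (Fin 10) (Fin 10) ℤ :=
  !![0,1,0,0,0,0,0,0,0,0;
     1,0,0,0,0,0,0,0,0,0;
     0,0,-2,1,0,0,0,0,0,0;
     0,0,1,-2,1,0,0,0,0,0;
     0,0,0,1,-2,1,0,0,0,0;
     0,0,0,0,1,-2,1,0,0,0;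
     0,0,0,0,0,1,-2,1,0,1;
     0,0,0,0,0,0,1,-2,1,0;
     0,0,0,0,0,0,0,1,-2,0;
     0,0,0,0,0,0,1,0,0,-2]

/-- A Gram matrix of `Γ(2)`. -/
def GammaTwoGram : Matrix (Fin 10) (Fin 10) ℤ := (2 : ℤ) • GammaGram

/-- `G` is a Gram matrix of the supersingular K3 lattice of characteristic `p` and Artin
invariant `σ`: an even lattice of rank 22 and signature `(1,21)` which is `p`-elementary
with discriminant `-p^(2σ)`. -/
def IsSSK3Gram (p σ : ℕ) (G : Matrix (Fin 22) (Fin 22) ℤ) : Prop :=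
  G.IsSymm ∧
  (∀ x : Fin 22 → ℤ, 2 ∣ bilin G x x) ∧
  G.det = -((p : ℤ) ^ (2 * σ)) ∧
  (∀ v : Fin 22 → ℤ, ∃ w : Fin 22 → ℤ, G.mulVec w = (p : ℤ) • v) ∧
  (∃ S : Matrix (Fin 22) (Fin 22) ℝ, IsUnit S.det ∧
    Sᵀ * G.map (Int.cast : ℤ → ℝ) * S =
      Matrix.diagonal (fun i => if i = 0 then (1 : ℝ) else -1))

/-- A submodule `M` is a primitive sublattice if the quotient by it is torsion-free. -/
def IsPrimitiveSub {n : ℕ} (M : Submodule ℤ (Fin n → ℤ)) : Prop :=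
  ∀ (c : ℤ) (x : Fin n → ℤ), c ≠ 0 → c • x ∈ M → x ∈ M

/-- `P` is (the matrix of) an isometry of the lattice with Gram matrix `G`. -/
def IsIsom {n : ℕ} (G P : Matrix (Fin n) (Fin n) ℤ) : Prop :=
  IsUnit P.det ∧ Pᵀ * G * P = G

/-- The set `𝔐` of primitive sublattices of `N` isometric to `Γ(2)` such that no vector of
square `-2` is orthogonal to them. -/
def EnriquesSet (G : Matrix (Fin 22) (Fin 22) ℤ) : Set (Submodule ℤ (Fin 22 → ℤ)) :=
  {M | IsPrimitiveSub M ∧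
    (∃ e : Matrix (Fin 22) (Fin 10) ℤ,
        LinearMap.range e.mulVecLin = M ∧ eᵀ * G * e = GammaTwoGram) ∧
    ∀ x : Fin 22 → ℤ, bilin G x x = -2 → ¬ (∀ m ∈ M, bilin G x m = 0)}

namespace Enriques

/-- Nonzero integers all of whose prime factors are smaller than `q`. -/
def Smooth (q : ℕ) (n : ℤ) : Prop := n ≠ 0 ∧ ∀ r : ℕ, r.Prime → (r : ℤ) ∣ n → r < q

lemma Smooth.mul {q : ℕ} {a b : ℤ} (ha : Smooth q a) (hb : Smooth q b) : Smooth q (a * b) := by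
  refine ⟨mul_ne_zero ha.1 hb.1, fun r hr h => ?_⟩
  rcases (Nat.prime_iff_prime_int.mp hr).dvd_or_dvd h with h | h
  exacts [ha.2 r hr h, hb.2 r hr h]

lemma Smooth.of_dvd {q : ℕ} {a b : ℤ} (hb : Smooth q b) (h : a ∣ b) : Smooth q a :=
  ⟨fun h0 => hb.1 (by simpa [h0] using h), fun r hr h' => hb.2 r hr (h'.trans h)⟩

lemma smooth_of_abs_lt {q : ℕ} {a : ℤ} (h0 : a ≠ 0) (h : |a| < q) : Smooth q a := by
  refine ⟨h0, fun r hr hd => ?_⟩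
  have := Int.le_of_dvd (abs_pos.mpr h0) ((dvd_abs _ _).mpr hd)
  omega

lemma Smooth.not_dvd {q : ℕ} (hq : q.Prime) {a : ℤ} (ha : Smooth q a) : ¬ (q : ℤ) ∣ a :=
  fun h => lt_irrefl q (ha.2 q hq h)

lemma Smooth.cast_ne_zero {q : ℕ} [Fact q.Prime] {a : ℤ} (ha : Smooth q a) :
    (a : ZMod q) ≠ 0 := fun h =>
  ha.not_dvd Fact.out ((ZMod.intCast_zmod_eq_zero_iff_dvd a q).mp h)

/-- A function on integers satisfying the relations of the Grothendieck–Witt group. -/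
structure IsWittSymbol {Q : Type*} [AddCommGroup Q] (φ : ℤ → Q) : Prop where
  sq : ∀ a b : ℤ, a ≠ 0 → b ≠ 0 → φ (a * b ^ 2) = φ a
  add : ∀ a b : ℤ, a ≠ 0 → b ≠ 0 → a + b ≠ 0 → φ a + φ b = φ (a + b) + φ (a * b * (a + b))
  neg : ∀ a : ℤ, a ≠ 0 → φ a + φ (-a) = φ 1 + φ (-1)

section
variable {Q : Type*} [AddCommGroup Q] {φ : ℤ → Q}

lemma IsWittSymbol.tate_base {q : ℕ} (hq : q.Prime) (hφ : IsWittSymbol φ)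
    (h0 : ∀ n, Smooth q n → φ n = 0) {n₁ n₂ r s : ℤ} (h₁ : n₁ ≠ 0) (h₁' : |n₁| < q)
    (h₂ : n₂ ≠ 0) (h₂' : |n₂| < q) (hr : r ≠ 0) (hr' : |r| < q) (hs : Smooth q s)
    (h : (q : ℤ) ∣ n₁ * n₂ - r) : φ (q * (n₁ * n₂) * s) = φ (q * r * s) := by
  obtain ⟨l, hl⟩ := h
  have hq0 : (0 : ℤ) < q := by exact_mod_cast hq.pos
  rcases eq_or_ne l 0 with rfl | hl0
  · rw [show n₁ * n₂ = r by linarith]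
  have hlq : |l| < q := by
    have h1 : (q : ℤ) * |l| = |n₁ * n₂ - r| := by rw [hl, abs_mul, abs_of_pos hq0]
    have h2 : |n₁ * n₂ - r| ≤ |n₁| * |n₂| + |r| := by
      rw [← abs_mul]; exact abs_sub _ _
    have h3 : |n₁| * |n₂| ≤ (q - 1) * (q - 1) :=
      mul_le_mul (by omega) (by omega) (abs_nonneg _) (by omega)
    by_contra hc
    nlinarith
  have e : n₁ * n₂ = r + q * l := by linarith
  have hsum : q * r * s + q ^ 2 * l * s = q * (n₁ * n₂) * s := by rw [e]; ring
  have hne : q * (n₁ * n₂) * s ≠ 0 := by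
    have := hs.1
    positivity
  have key := hφ.add (q * r * s) (q ^ 2 * l * s) (by have := hs.1; positivity)
    (by have := hs.1; positivity) (by rwa [hsum])
  rw [hsum] at key
  have hls := (smooth_of_abs_lt hl0 hlq).mul hs
  have e1 : φ (q ^ 2 * l * s) = 0 := by
    rw [show (q : ℤ) ^ 2 * l * s = (l * s) * q ^ 2 by ring, hφ.sq _ _ hls.1 hq0.ne']
    exact h0 _ hls
  have hbig := (((smooth_of_abs_lt hr hr').mul hls).mul
    (smooth_of_abs_lt h₁ h₁')).mul (smooth_of_abs_lt h₂ h₂')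
  have e2 : φ (q * r * s * (q ^ 2 * l * s) * (q * (n₁ * n₂) * s)) = 0 := by
    rw [show q * r * s * (q ^ 2 * l * s) * (q * (n₁ * n₂) * s)
      = (r * (l * s) * n₁ * n₂) * (q ^ 2 * s) ^ 2 by ring,
      hφ.sq _ _ hbig.1 (by have := hs.1; positivity)]
    exact h0 _ hbig
  rw [e1, e2, add_zero, add_zero] at key
  exact key.symm

lemma exists_small_rep {q : ℕ} (hq : q.Prime) {n : ℤ} (h : ¬ (q : ℤ) ∣ n) :
    ∃ r : ℤ, r ≠ 0 ∧ |r| < q ∧ (q : ℤ) ∣ n - r := by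
  have hq0 : (0 : ℤ) < q := by exact_mod_cast hq.pos
  refine ⟨n % q, fun h' => h (Int.dvd_of_emod_eq_zero h'), ?_, Int.dvd_self_sub_emod⟩
  rw [abs_of_nonneg (Int.emod_nonneg _ hq0.ne')]
  exact Int.emod_lt_of_pos _ hq0

lemma IsWittSymbol.tate_smooth {q : ℕ} (hq : q.Prime) (hφ : IsWittSymbol φ)
    (h0 : ∀ n, Smooth q n → φ n = 0) (k : ℕ) : ∀ n : ℤ, n.natAbs = k → Smooth q n →
    ∀ s, Smooth q s → ∀ r : ℤ, r ≠ 0 → |r| < q → (q : ℤ) ∣ n - r →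
    φ (q * n * s) = φ (q * r * s) := by
  induction k using Nat.strong_induction_on with
  | _ k ih =>
  intro n hk hn s hs r hr hr' hd
  have hq2 : (2 : ℤ) ≤ q := by exact_mod_cast hq.two_le
  by_cases h1 : n.natAbs = 1
  · have hn1 : |n| = 1 := by rw [Int.abs_eq_natAbs, h1]; rfl
    have := hφ.tate_base hq h0 (n₁ := n) (n₂ := 1) hn.1 (by omega) one_ne_zero
      (by simp; omega) hr hr' hs (by simpa using hd)
    simpa using this
  · obtain ⟨t, ht, htd⟩ := Nat.exists_prime_and_dvd h1
    have htd' : (t : ℤ) ∣ n := Int.natCast_dvd.mpr htd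
    obtain ⟨m, rfl⟩ := htd'
    have htq := hn.2 t ht (dvd_mul_right _ _)
    have hm : Smooth q m := hn.of_dvd (dvd_mul_left _ _)
    have ht0 : (t : ℤ) ≠ 0 := by exact_mod_cast ht.ne_zero
    have hts : Smooth q (t : ℤ) := hn.of_dvd (dvd_mul_right _ _)
    have hlt : m.natAbs < k := by
      rw [← hk, Int.natAbs_mul, Int.natAbs_natCast]
      have := Int.natAbs_pos.mpr hm.1
      nlinarith [ht.two_le]
    obtain ⟨r', hr0, hrq, hrd⟩ := exists_small_rep hq (hm.not_dvd hq)
    have e1 := ih _ hlt m rfl hm (t * s) (hts.mul hs) r' hr0 hrq hrd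
    have e2 := hφ.tate_base hq h0 (n₁ := r') (n₂ := t) (r := r) (s := s) hr0 hrq ht0
      (by rw [abs_of_nonneg (by positivity)]; exact_mod_cast htq) hr hr' hs (by
        have : r' * t - r = (t * m - r) - (m - r') * t := by ring
        rw [this]
        exact dvd_sub hd (hrd.mul_right _))
    calc φ (q * (t * m) * s) = φ (q * m * (t * s)) := by ring_nf
      _ = φ (q * (r' * t) * s) := by rw [e1]; ring_nf
      _ = _ := e2

lemma IsWittSymbol.tate_congr {q : ℕ} (hq : q.Prime) (hφ : IsWittSymbol φ)
    (h0 : ∀ n, Smooth q n → φ n = 0) {m n : ℤ} (hm : Smooth q m) (hn : Smooth q n)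
    (h : (q : ℤ) ∣ m - n) : φ (q * m) = φ (q * n) := by
  have hs : Smooth q 1 := smooth_of_abs_lt one_ne_zero (by simpa using hq.one_lt)
  obtain ⟨r, hr, hr', hd⟩ := exists_small_rep hq (hm.not_dvd hq)
  have e1 := hφ.tate_smooth hq h0 _ m rfl hm 1 hs r hr hr' hd
  have e2 := hφ.tate_smooth hq h0 _ n rfl hn 1 hs r hr hr' (by
    have : n - r = (m - r) - (m - n) := by ring
    rw [this]; exact dvd_sub hd h)
  simpa using e1.trans e2.symm

/-- The residue symbol at `q` attached to a Witt symbol killing `q`-smooth integers. -/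
def resSymbol (φ : ℤ → Q) (q : ℕ) (x : ZMod q) : Q := φ (q * x.valMinAbs)

variable {q : ℕ} [Fact q.Prime]

lemma smooth_valMinAbs {x : ZMod q} (hx : x ≠ 0) : Smooth q x.valMinAbs := by
  refine smooth_of_abs_lt (by simpa using hx) ?_
  have h1 := ZMod.natAbs_valMinAbs_le x
  have h2 : 2 ≤ q := (Fact.out : q.Prime).two_le
  rw [Int.abs_eq_natAbs]
  omega

lemma IsWittSymbol.resSymbol_eq (hφ : IsWittSymbol φ) (h0 : ∀ n, Smooth q n → φ n = 0)
    {n : ℤ} (hn : Smooth q n) : φ (q * n) = resSymbol φ q (n : ZMod q) := by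
  refine hφ.tate_congr Fact.out h0 hn (smooth_valMinAbs hn.cast_ne_zero) ?_
  rw [← ZMod.intCast_zmod_eq_zero_iff_dvd]
  simp

lemma IsWittSymbol.resSymbol_sq (hφ : IsWittSymbol φ) (h0 : ∀ n, Smooth q n → φ n = 0)
    {x y : ZMod q} (hx : x ≠ 0) (hy : y ≠ 0) :
    resSymbol φ q (x * y ^ 2) = resSymbol φ q x := by
  have h1 := smooth_valMinAbs hx
  have h2 := smooth_valMinAbs hy
  have hq0 : (q : ℤ) ≠ 0 := by exact_mod_cast (Fact.out : q.Prime).ne_zero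
  have := hφ.resSymbol_eq h0 (h1.mul (h2.mul h2))
  rw [show (q : ℤ) * (x.valMinAbs * (y.valMinAbs * y.valMinAbs)) =
    (q * x.valMinAbs) * y.valMinAbs ^ 2 by ring, hφ.sq _ _ (mul_ne_zero hq0 h1.1) h2.1] at this
  have e : resSymbol φ q x = φ (q * x.valMinAbs) := rfl
  rw [e, this]
  congr 1
  push_cast
  ring

lemma IsWittSymbol.resSymbol_neg (hφ : IsWittSymbol φ) (h0 : ∀ n, Smooth q n → φ n = 0)
    {x : ZMod q} (hx : x ≠ 0) : resSymbol φ q x + resSymbol φ q (-x) = 0 := by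
  have h1 := smooth_valMinAbs hx
  have hq0 : (q : ℤ) ≠ 0 := by exact_mod_cast (Fact.out : q.Prime).ne_zero
  have h2q : (2 : ℤ) ≤ q := by exact_mod_cast (Fact.out : q.Prime).two_le
  have h2 : Smooth q (-x.valMinAbs) := h1.of_dvd (by simp)
  have e := hφ.resSymbol_eq h0 h2
  have key := hφ.neg _ (mul_ne_zero hq0 h1.1)
  rw [h0 1 (smooth_of_abs_lt one_ne_zero (by simp; omega)),
    h0 (-1) (smooth_of_abs_lt (by simp) (by simp; omega)), ← mul_neg, e] at key
  simpa [resSymbol] using key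

lemma IsWittSymbol.resSymbol_add (hq : q ≠ 2) (hφ : IsWittSymbol φ)
    (h0 : ∀ n, Smooth q n → φ n = 0)
    {x y : ZMod q} (hx : x ≠ 0) (hy : y ≠ 0) (hxy : x + y ≠ 0) :
    resSymbol φ q x + resSymbol φ q y =
      resSymbol φ q (x + y) + resSymbol φ q (x * y * (x + y)) := by
  have h1 := smooth_valMinAbs hx
  have h2 := smooth_valMinAbs hy
  have hq0 : (q : ℤ) ≠ 0 := by exact_mod_cast (Fact.out : q.Prime).ne_zero
  have hodd : q % 2 = 1 := (Fact.out : q.Prime).eq_two_or_odd.resolve_left hq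
  have hs : Smooth q (x.valMinAbs + y.valMinAbs) := by
    refine smooth_of_abs_lt (fun h => hxy ?_) ?_
    · have := congrArg (Int.cast : ℤ → ZMod q) h
      simpa using this
    · have h1 := ZMod.natAbs_valMinAbs_le x
      have h2 := ZMod.natAbs_valMinAbs_le y
      have h3 := (Fact.out : q.Prime).pos
      rw [Int.abs_eq_natAbs]
      omega
  have key := hφ.add _ _ (mul_ne_zero hq0 h1.1) (mul_ne_zero hq0 h2.1)
    (by rw [← mul_add]; exact mul_ne_zero hq0 hs.1)
  rw [← mul_add, hφ.resSymbol_eq h0 hs,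
    show (q * x.valMinAbs * (q * y.valMinAbs) * (q * (x.valMinAbs + y.valMinAbs)) : ℤ)
    = q * (x.valMinAbs * y.valMinAbs * (x.valMinAbs + y.valMinAbs)) * (q : ℤ) ^ 2 by ring,
    hφ.sq _ _ (mul_ne_zero hq0 ((h1.mul h2).mul hs).1) hq0,
    hφ.resSymbol_eq h0 ((h1.mul h2).mul hs)] at key
  simpa [resSymbol] using key

lemma IsWittSymbol.resSymbol_mul (hq : q ≠ 2) (hφ : IsWittSymbol φ)
    (h0 : ∀ n, Smooth q n → φ n = 0) {r s : ZMod q} (hr : r ≠ 0) (hs : s ≠ 0) :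
    resSymbol φ q r + resSymbol φ q s = resSymbol φ q 1 + resSymbol φ q (r * s) := by
  obtain ⟨x, y, hxy⟩ : ∃ x y : ZMod q, r * x ^ 2 + s * y ^ 2 = 1 := by
    open Polynomial in
    have := FiniteField.exists_root_sum_quadratic (R := ZMod q)
      (f := C r * X ^ 2) (g := C s * X ^ 2 - C 1)
      (by rw [degree_C_mul_X_pow _ hr]; rfl)
      (by rw [degree_sub_C, degree_C_mul_X_pow _ hs]; rfl
          rw [degree_C_mul_X_pow _ hs]; norm_num)
      (by rw [ZMod.card]; exact (Fact.out : q.Prime).eq_two_or_odd.resolve_left hq)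
    obtain ⟨a, b, hab⟩ := this
    refine ⟨a, b, ?_⟩
    simp at hab
    linear_combination hab
  rcases eq_or_ne x 0 with rfl | hx
  · have hy : y ≠ 0 := by rintro rfl; simp at hxy
    have hy1 : s * y ^ 2 = 1 := by simpa using hxy
    rw [← hφ.resSymbol_sq h0 hs hy, hy1, ← hφ.resSymbol_sq h0 (mul_ne_zero hr hs) hy,
      mul_assoc, hy1, mul_one, add_comm]
  rcases eq_or_ne y 0 with rfl | hy
  · have hy1 : r * x ^ 2 = 1 := by simpa using hxy
    rw [← hφ.resSymbol_sq h0 hr hx, hy1, ← hφ.resSymbol_sq h0 (mul_ne_zero hr hs) hx,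
      mul_right_comm, hy1, one_mul]
  have := hφ.resSymbol_add hq h0 (mul_ne_zero hr (pow_ne_zero 2 hx))
    (mul_ne_zero hs (pow_ne_zero 2 hy)) (by rw [hxy]; exact one_ne_zero)
  rw [hxy, hφ.resSymbol_sq h0 hr hx, hφ.resSymbol_sq h0 hs hy, mul_one,
    show r * x ^ 2 * (s * y ^ 2) = r * s * (x * y) ^ 2 by ring,
    hφ.resSymbol_sq h0 (mul_ne_zero hr hs) (mul_ne_zero hx hy)] at this
  exact this

lemma IsWittSymbol.resSymbol_sum (hq : q ≠ 2) (hφ : IsWittSymbol φ)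
    (h0 : ∀ n, Smooth q n → φ n = 0) {J : Type*} (S : Finset J) (b : J → ZMod q)
    (hb : ∀ j, b j ≠ 0) : ∑ j ∈ S, resSymbol φ q (b j) + resSymbol φ q 1 =
      S.card • resSymbol φ q 1 + resSymbol φ q (∏ j ∈ S, b j) := by
  classical
  induction S using Finset.induction_on with
  | empty => simp
  | insert a S ha ih =>
    rw [Finset.sum_insert ha, Finset.prod_insert ha, Finset.card_insert_of_notMem ha, add_assoc,
      ih, add_left_comm, hφ.resSymbol_mul hq h0 (hb a) (Finset.prod_ne_zero_iff.mpr fun j _ => hb j),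
      succ_nsmul]
    abel

lemma IsWittSymbol.resSymbol_sum_eq_zero (hq : q ≠ 2) (hφ : IsWittSymbol φ)
    (h0 : ∀ n, Smooth q n → φ n = 0) {J : Type*} [Fintype J] (b : J → ZMod q)
    (hb : ∀ j, b j ≠ 0) {m : ℕ} (hm : Fintype.card J = 2 * m) {s : ZMod q}
    (hs : ∏ j, b j = (-1) ^ m * s ^ 2) : ∑ j, resSymbol φ q (b j) = 0 := by
  have h := hφ.resSymbol_sum hq h0 Finset.univ b hb
  have hs0 : s ≠ 0 := by
    rintro rfl
    exact (Finset.prod_ne_zero_iff.mpr fun j _ => hb j) (hs.trans (by simp))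
  have hm1 : ((-1 : ZMod q)) ^ m ≠ 0 := pow_ne_zero _ (by simp)
  rw [hs, hφ.resSymbol_sq h0 hm1 hs0, Finset.card_univ, hm] at h
  have hneg := hφ.resSymbol_neg h0 (x := (1 : ZMod q)) one_ne_zero
  have hmul := hφ.resSymbol_mul hq h0 (r := (-1 : ZMod q)) (s := -1) (by simp) (by simp)
  rw [neg_mul_neg, one_mul] at hmul
  have hneg' : resSymbol φ q (-1) = - resSymbol φ q 1 := eq_neg_of_add_eq_zero_right hneg
  have h4 : (4 : ℕ) • resSymbol φ q 1 = 0 := by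
    rw [hneg'] at hmul
    have : (resSymbol φ q 1 + resSymbol φ q 1) + (resSymbol φ q 1 + resSymbol φ q 1) = 0 := by
      nth_rewrite 1 [← hmul]; abel
    rw [← this]; abel
  rcases Nat.even_or_odd' m with ⟨k, rfl | rfl⟩
  · rw [(even_two_mul k).neg_one_pow, show 2 * (2 * k) = k * 4 by ring, mul_nsmul', h4,
      nsmul_zero, zero_add] at h
    simpa using h
  · rw [(odd_two_mul_add_one k).neg_one_pow, show 2 * (2 * k + 1) = k * 4 + 2 by ring, add_nsmul,
      mul_nsmul', h4, nsmul_zero, zero_add, hneg', two_nsmul, add_neg_cancel_right] at h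
    simpa using h

/-- Tate's descent: a form over `𝔽_q` with a Lagrangian has trivial residue. -/
lemma IsWittSymbol.sum_eq_zero (hφ : IsWittSymbol φ)
    (h0 : ∀ n, Smooth q n → φ n = 0) {J : Type*} [Fintype J] (b : J → ℤ)
    (hb : ∀ j, Smooth q (b j)) {m : ℕ} (hm : Fintype.card J = 2 * m) {s : ZMod q}
    (hs : ∏ j, (b j : ZMod q) = (-1) ^ m * s ^ 2) : ∑ j, φ (q * b j) = 0 := by
  rcases eq_or_ne q 2 with rfl | hq
  · have hone : φ 1 = 0 := h0 1 (smooth_of_abs_lt one_ne_zero (by simp))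
    have h2 : φ 2 + φ 2 = 0 := by
      have := hφ.add 1 1 one_ne_zero one_ne_zero (by norm_num)
      norm_num [hone] at this
      exact this.symm
    have hc : ∀ j, φ ((2 : ℕ) * b j) = φ 2 := by
      intro j
      have := hφ.tate_congr Nat.prime_two h0 (hb j)
        (n := 1) (smooth_of_abs_lt one_ne_zero (by simp)) (by
          have := (hb j).not_dvd Nat.prime_two
          push_cast at *; omega)
      simpa using this
    rw [Finset.sum_congr rfl fun j _ => hc j, Finset.sum_const, Finset.card_univ, hm,
      mul_nsmul, two_nsmul, h2, nsmul_zero]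
  · rw [Finset.sum_congr rfl fun j _ => hφ.resSymbol_eq h0 (hb j)]
    exact hφ.resSymbol_sum_eq_zero hq h0 _ (fun j => (hb j).cast_ne_zero) hm hs

end

end Enriques

namespace Enriques
open LinearMap (BilinForm)

section isometries
variable {V V' W : Type*} [AddCommGroup V] [Module ℚ V] [AddCommGroup V'] [Module ℚ V']
  [AddCommGroup W] [Module ℚ W]

/-- A linear equivalence preserving the given bilinear forms. -/
def Isometry (B : BilinForm ℚ V) (B' : BilinForm ℚ V') (e : V ≃ₗ[ℚ] V') : Prop :=
  ∀ x y, B' (e x) (e y) = B x y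

lemma Isometry.symm {B : BilinForm ℚ V} {B' : BilinForm ℚ V'} {e : V ≃ₗ[ℚ] V'}
    (h : Isometry B B' e) : Isometry B' B e.symm := fun x y => by
  rw [← h, e.apply_symm_apply, e.apply_symm_apply]

lemma Isometry.trans {B : BilinForm ℚ V} {B' : BilinForm ℚ V'} {B₂ : BilinForm ℚ W}
    {e : V ≃ₗ[ℚ] V'} {e' : V' ≃ₗ[ℚ] W} (h : Isometry B B' e) (h' : Isometry B' B₂ e') :
    Isometry B B₂ (e.trans e') := fun x y => by
  rw [← h, ← h']; rfl

lemma Isometry.refl (B : BilinForm ℚ V) : Isometry B B (LinearEquiv.refl ℚ V) := fun _ _ => rfl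

lemma exists_reflection {B : BilinForm ℚ V} (hB : B.IsSymm) {v : V} (hv : B v v ≠ 0) :
    ∃ g : V ≃ₗ[ℚ] V, Isometry B B g ∧ ∀ x, g x = x - (2 * B v x / B v v) • v := by
  have h2 : ((2 / B v v) • B v : Module.Dual ℚ V) v = 2 := by
    simp [div_mul_cancel₀ _ hv]
  refine ⟨Module.reflection h2, fun x y => ?_, fun x => ?_⟩
  · simp only [Module.reflection_apply, map_sub, LinearMap.sub_apply, map_smul,
      LinearMap.smul_apply, smul_eq_mul]
    rw [hB.eq x v]
    field_simp
    ring
  · simp [Module.reflection_apply, div_mul_eq_mul_div]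

/-- Witt's theorem for a single anisotropic vector. -/
lemma exists_isometry_map_eq {B : BilinForm ℚ V} (hB : B.IsSymm) {x y : V} (h : B x x = B y y)
    (hx : B x x ≠ 0) : ∃ g : V ≃ₗ[ℚ] V, Isometry B B g ∧ g x = y := by
  have hxy := hB.eq x y
  by_cases h1 : B (x - y) (x - y) = 0
  · have h2 : B (x + y) (x + y) ≠ 0 := by
      intro h2
      simp only [map_sub, map_add, LinearMap.sub_apply, LinearMap.add_apply] at h1 h2
      exact hx (by linarith)
    obtain ⟨g, hg, hgx⟩ := exists_reflection hB h2
    refine ⟨g.trans (LinearEquiv.neg ℚ), hg.trans (fun a b => by simp), ?_⟩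
    have : 2 * B (x + y) x / B (x + y) (x + y) = 1 := by
      rw [div_eq_one_iff_eq h2]
      simp only [map_add, LinearMap.add_apply]
      linarith
    rw [LinearEquiv.trans_apply, hgx, this, one_smul]
    simp
  · obtain ⟨g, hg, hgx⟩ := exists_reflection hB h1
    refine ⟨g, hg, ?_⟩
    have : 2 * B (x - y) x / B (x - y) (x - y) = 1 := by
      rw [div_eq_one_iff_eq h1]
      simp only [map_sub, LinearMap.sub_apply]
      linarith
    rw [hgx, this, one_smul]
    simp

end isometries

section diagonal
variable {ι κ ι' κ' μ : Type} [Fintype ι] [Fintype κ] [Fintype ι'] [Fintype κ'] [Fintype μ]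

/-- The diagonal bilinear form with weights `f`. -/
def dform (f : ι → ℚ) : BilinForm ℚ (ι → ℚ) :=
  LinearMap.mk₂ ℚ (fun x y => ∑ i, f i * x i * y i)
    (fun x x' y => by simp [mul_add, add_mul, Finset.sum_add_distrib])
    (fun c x y => by
      simp only [Pi.smul_apply, smul_eq_mul, Finset.mul_sum]
      exact Finset.sum_congr rfl fun _ _ => by ring)
    (fun x y y' => by simp [mul_add, Finset.sum_add_distrib])
    (fun c x y => by
      simp only [Pi.smul_apply, smul_eq_mul, Finset.mul_sum]
      exact Finset.sum_congr rfl fun _ _ => by ring)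

lemma dform_apply (f x y : ι → ℚ) : dform f x y = ∑ i, f i * x i * y i := rfl

lemma dform_isSymm (f : ι → ℚ) : (dform f).IsSymm :=
  ⟨fun x y => by simp only [dform_apply]
                 exact Finset.sum_congr rfl fun _ _ => by ring⟩

/-- Two diagonal forms are isometric. -/
def DIso (f : ι → ℚ) (g : κ → ℚ) : Prop :=
  ∃ e : (ι → ℚ) ≃ₗ[ℚ] (κ → ℚ), Isometry (dform f) (dform g) e

lemma DIso.refl (f : ι → ℚ) : DIso f f := ⟨_, Isometry.refl _⟩

lemma DIso.symm {f : ι → ℚ} {g : κ → ℚ} (h : DIso f g) : DIso g f := ⟨_, h.choose_spec.symm⟩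

lemma DIso.trans {f : ι → ℚ} {g : κ → ℚ} {h : μ → ℚ} (h₁ : DIso f g) (h₂ : DIso g h) : DIso f h :=
  ⟨_, h₁.choose_spec.trans h₂.choose_spec⟩

lemma DIso.of_equiv (σ : ι ≃ κ) {f : ι → ℚ} {g : κ → ℚ} (h : ∀ i, g (σ i) = f i) : DIso f g := by
  refine ⟨LinearEquiv.funCongrLeft ℚ ℚ σ.symm, fun x y => ?_⟩
  simp only [dform_apply, LinearEquiv.funCongrLeft_apply, LinearMap.funLeft_apply]
  rw [← σ.sum_comp]
  simp [h]

lemma dform_sumElim (f : ι → ℚ) (g : κ → ℚ) (x y : ι ⊕ κ → ℚ) :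
    dform (Sum.elim f g) x y = dform f (x ∘ Sum.inl) (y ∘ Sum.inl)
      + dform g (x ∘ Sum.inr) (y ∘ Sum.inr) := by
  simp [dform_apply]

lemma DIso.sum {f : ι → ℚ} {g : κ → ℚ} {f' : ι' → ℚ} {g' : κ' → ℚ} (h : DIso f g)
    (h' : DIso f' g') : DIso (Sum.elim f f') (Sum.elim g g') := by
  obtain ⟨e, he⟩ := h
  obtain ⟨e', he'⟩ := h'
  refine ⟨(LinearEquiv.sumArrowLequivProdArrow ι ι' ℚ ℚ).trans ((e.prodCongr e').trans
    (LinearEquiv.sumArrowLequivProdArrow κ κ' ℚ ℚ).symm), fun x y => ?_⟩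
  rw [dform_sumElim, dform_sumElim, ← he, ← he']
  rfl

lemma DIso.cancel_unit {a : ℚ} (ha : a ≠ 0) {f : ι → ℚ} {g : κ → ℚ}
    (h : DIso (Sum.elim (fun _ : Unit => a) f) (Sum.elim (fun _ : Unit => a) g)) : DIso f g := by
  obtain ⟨e₁, he₁⟩ := h
  obtain ⟨r, hr, hrx⟩ := exists_isometry_map_eq
    (dform_isSymm (Sum.elim (fun _ : Unit => a) g)) (x := e₁ (Sum.elim (fun _ : Unit => (1 : ℚ)) (fun _ : ι => (0 : ℚ))))
    (y := Sum.elim (fun _ : Unit => (1 : ℚ)) (fun _ : κ => (0 : ℚ)))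
    (by rw [he₁]; simp [dform_apply]) (by rw [he₁]; simpa [dform_apply])
  set e := e₁.trans r with hedef
  have he := he₁.trans hr
  have he0 : e (Sum.elim (fun _ : Unit => (1 : ℚ)) (fun _ : ι => (0 : ℚ))) = Sum.elim (fun _ : Unit => (1 : ℚ)) (fun _ : κ => (0 : ℚ)) := hrx
  have hes : e.symm (Sum.elim (fun _ : Unit => (1 : ℚ)) (fun _ : κ => (0 : ℚ))) = Sum.elim (fun _ : Unit => (1 : ℚ)) (fun _ : ι => (0 : ℚ)) := by
    rw [LinearEquiv.symm_apply_eq, he0]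
  have h1 : ∀ x : ι → ℚ, e (Sum.elim (0 : Unit → ℚ) x) = Sum.elim (0 : Unit → ℚ) (e (Sum.elim (0 : Unit → ℚ) x) ∘ Sum.inr) := by
    intro x
    have := he (Sum.elim (fun _ : Unit => (1 : ℚ)) (fun _ : ι => (0 : ℚ))) (Sum.elim (0 : Unit → ℚ) x)
    rw [← hedef, he0] at this
    simp only [dform_sumElim] at this
    simp [dform_apply, ha] at this
    ext (i | i)
    · simpa using this
    · simp
  have h2 : ∀ x : κ → ℚ, e.symm (Sum.elim (0 : Unit → ℚ) x) = Sum.elim (0 : Unit → ℚ) (e.symm (Sum.elim (0 : Unit → ℚ) x) ∘ Sum.inr) := by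
    intro x
    have := he.symm (Sum.elim (fun _ : Unit => (1 : ℚ)) (fun _ : κ => (0 : ℚ))) (Sum.elim (0 : Unit → ℚ) x)
    rw [← hedef, hes] at this
    simp only [dform_sumElim] at this
    simp [dform_apply, ha] at this
    ext (i | i)
    · simpa using this
    · simp
  let i₁ : (ι → ℚ) →ₗ[ℚ] (Unit ⊕ ι → ℚ) :=
    (LinearEquiv.sumArrowLequivProdArrow Unit ι ℚ ℚ).symm.toLinearMap ∘ₗ LinearMap.inr ℚ _ _
  let i₂ : (κ → ℚ) →ₗ[ℚ] (Unit ⊕ κ → ℚ) :=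
    (LinearEquiv.sumArrowLequivProdArrow Unit κ ℚ ℚ).symm.toLinearMap ∘ₗ LinearMap.inr ℚ _ _
  have hi₁ : ∀ x, i₁ x = Sum.elim (0 : Unit → ℚ) x := fun x => by ext (i | i) <;> rfl
  have hi₂ : ∀ x, i₂ x = Sum.elim (0 : Unit → ℚ) x := fun x => by ext (i | i) <;> rfl
  refine ⟨LinearEquiv.ofLinearMap
    (LinearMap.funLeft ℚ ℚ Sum.inr ∘ₗ e.toLinearMap ∘ₗ i₁)
    (LinearMap.funLeft ℚ ℚ Sum.inr ∘ₗ e.symm.toLinearMap ∘ₗ i₂) ?_ ?_, fun x y => ?_⟩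
  · ext1 x
    ext j
    simp only [LinearMap.comp_apply, hi₁, hi₂, LinearEquiv.coe_coe, LinearMap.id_apply,
      LinearMap.funLeft_apply]
    change e (Sum.elim (0 : Unit → ℚ) (e.symm (Sum.elim (0 : Unit → ℚ) _) ∘ Sum.inr)) _ = _
    rw [← h2, e.apply_symm_apply]
    rfl
  · ext1 x
    ext j
    simp only [LinearMap.comp_apply, hi₁, hi₂, LinearEquiv.coe_coe, LinearMap.id_apply,
      LinearMap.funLeft_apply]
    change e.symm (Sum.elim (0 : Unit → ℚ) (e (Sum.elim (0 : Unit → ℚ) _) ∘ Sum.inr)) _ = _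
    rw [← h1, e.symm_apply_apply]
    rfl
  · have := he (Sum.elim (0 : Unit → ℚ) x) (Sum.elim (0 : Unit → ℚ) y)
    rw [← hedef, h1, h1, dform_sumElim, dform_sumElim] at this
    simp only [Sum.elim_comp_inl, Sum.elim_comp_inr, map_zero, zero_add, LinearMap.zero_apply] at this
    rw [← this]
    simp only [LinearEquiv.coe_ofLinearMap, LinearMap.comp_apply, hi₁, LinearEquiv.coe_coe]
    rfl

/-- Witt cancellation for diagonal forms. -/
lemma DIso.cancel {h : μ → ℚ} (hh : ∀ i, h i ≠ 0) {f : ι → ℚ} {g : κ → ℚ}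
    (H : DIso (Sum.elim h f) (Sum.elim h g)) : DIso f g := by
  classical
  induction hn : Fintype.card μ generalizing μ with
  | zero =>
    have : IsEmpty μ := Fintype.card_eq_zero_iff.mp hn
    refine (DIso.of_equiv (Equiv.emptySum μ ι).symm ?_).trans
      (H.trans (DIso.of_equiv (Equiv.emptySum μ κ) ?_))
    · intro i; simp
    · rintro (i | i)
      · exact isEmptyElim i
      · simp
  | succ n ih =>
    obtain ⟨e⟩ : Nonempty (μ ≃ Unit ⊕ Fin n) := ⟨Fintype.equivOfCardEq (by simp [hn, add_comm])⟩
    have key : ∀ {τ : Type} [Fintype τ] (t : τ → ℚ), DIso (Sum.elim h t)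
        (Sum.elim (fun _ : Unit => h (e.symm (Sum.inl ())))
          (Sum.elim (fun i : Fin n => h (e.symm (Sum.inr i))) t)) := by
      intro τ _ t
      refine DIso.of_equiv ((e.sumCongr (Equiv.refl τ)).trans (Equiv.sumAssoc _ _ _)) ?_
      rintro (i | i)
      · obtain ⟨j, rfl⟩ := e.symm.surjective i
        rcases j with j | j <;> simp
      · simp
    refine ih (h := fun i : Fin n => h (e.symm (Sum.inr i))) (fun i => hh _) ?_ (by simp)
    exact DIso.cancel_unit (hh _) ((key f).symm.trans (H.trans (key g)))

end diagonal

end Enriques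

namespace Enriques
open LinearMap (BilinForm)

section GW
variable {ι κ ι' κ' : Type} [Fintype ι'] [Fintype κ'] [Fintype ι] [Fintype κ]

/-- The formal sum of the weights of a diagonal form. -/
noncomputable def wsum (f : ι → ℚ) : ℚ →₀ ℤ := ∑ i, Finsupp.single (f i) 1

lemma wsum_sumElim (f : ι → ℚ) (g : κ → ℚ) : wsum (Sum.elim f g) = wsum f + wsum g := by
  simp [wsum]

lemma exists_equiv_of_wsum_eq {f : ι → ℚ} {g : κ → ℚ} (h : wsum f = wsum g) :
    ∃ σ : ι ≃ κ, ∀ i, g (σ i) = f i := by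
  classical
  have key : ∀ {τ : Type} [Fintype τ] (t : τ → ℚ) (c : ℚ),
      wsum t c = Fintype.card {i // t i = c} := by
    intro τ _ t c
    simp [wsum, Finsupp.finsetSum_apply, Finsupp.single_apply, Fintype.card_subtype]
  have : ∀ c, Nonempty ({i // f i = c} ≃ {j // g j = c}) := fun c => by
    refine ⟨Fintype.equivOfCardEq ?_⟩
    have := DFunLike.congr_fun h c
    rw [key, key] at this
    exact_mod_cast this
  let e := fun c => (this c).some
  exact ⟨Equiv.ofFiberEquiv e, fun i => Equiv.ofFiberEquiv_map e i⟩

/-- Relations coming from isometries of nondegenerate diagonal forms. -/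
def wittRel : AddSubgroup (ℚ →₀ ℤ) where
  carrier := {x | ∃ (ι κ : Type) (_ : Fintype ι) (_ : Fintype κ) (f : ι → ℚ) (g : κ → ℚ),
    (∀ i, f i ≠ 0) ∧ (∀ i, g i ≠ 0) ∧ DIso f g ∧ x = wsum f - wsum g}
  add_mem' := by
    rintro _ _ ⟨ι, κ, _, _, f, g, hf, hg, h, rfl⟩ ⟨ι', κ', _, _, f', g', hf', hg', h', rfl⟩
    refine ⟨ι ⊕ ι', κ ⊕ κ', inferInstance, inferInstance, Sum.elim f f', Sum.elim g g',
      by simp [hf, hf'], by simp [hg, hg'], h.sum h', ?_⟩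
    rw [wsum_sumElim, wsum_sumElim]
    abel
  zero_mem' := ⟨Empty, Empty, inferInstance, inferInstance, Empty.elim, Empty.elim, by simp,
    by simp, DIso.refl _, by simp⟩
  neg_mem' := by
    rintro _ ⟨ι, κ, _, _, f, g, hf, hg, h, rfl⟩
    exact ⟨κ, ι, inferInstance, inferInstance, g, f, hg, hf, h.symm, by simp⟩

lemma DIso.of_mem_wittRel {f : ι → ℚ} {g : κ → ℚ} (h : wsum f - wsum g ∈ wittRel) :
    DIso f g := by
  obtain ⟨ι', κ', _, _, f', g', hf', hg', h', he⟩ := h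
  have : wsum (Sum.elim f' g) = wsum (Sum.elim g' f) := by
    rw [wsum_sumElim, wsum_sumElim]
    rw [sub_eq_sub_iff_add_eq_add] at he
    rw [add_comm (wsum g'), he]
  obtain ⟨σ, hσ⟩ := exists_equiv_of_wsum_eq this
  have h1 := DIso.of_equiv σ hσ
  exact (DIso.cancel hg' (((h'.symm.sum (DIso.refl g)).trans h1))).symm

/-- The Grothendieck–Witt group of `ℚ`. -/
abbrev GW : Type := (ℚ →₀ ℤ) ⧸ wittRel

/-- The class of a one-dimensional form. -/
noncomputable def gw (a : ℚ) : GW := QuotientAddGroup.mk (Finsupp.single a 1)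

lemma sum_gw (f : ι → ℚ) : ∑ i, gw (f i) = (QuotientAddGroup.mk (wsum f) : GW) := by
  have := map_sum (QuotientAddGroup.mk' wittRel) (fun i => Finsupp.single (f i) (1 : ℤ))
    Finset.univ
  exact this.symm

lemma DIso.of_sum_gw {f : ι → ℚ} {g : κ → ℚ} (h : ∑ i, gw (f i) = ∑ i, gw (g i)) :
    DIso f g := by
  rw [sum_gw, sum_gw, QuotientAddGroup.eq] at h
  refine DIso.symm (DIso.of_mem_wittRel ?_)
  rwa [sub_eq_neg_add]

lemma DIso.sum_gw_eq {f : ι → ℚ} {g : κ → ℚ} (hf : ∀ i, f i ≠ 0) (hg : ∀ i, g i ≠ 0)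
    (h : DIso f g) : ∑ i, gw (f i) = ∑ i, gw (g i) := by
  rw [sum_gw, sum_gw, QuotientAddGroup.eq, ← sub_eq_neg_add]
  exact ⟨κ, ι, inferInstance, inferInstance, g, f, hg, hf, h.symm, rfl⟩

lemma gw_sq {a b : ℚ} (ha : a ≠ 0) (hb : b ≠ 0) : gw (a * b ^ 2) = gw a := by
  have : DIso (fun _ : Unit => a * b ^ 2) (fun _ : Unit => a) := by
    refine ⟨LinearEquiv.smulOfUnit (Units.mk0 b hb), fun x y => ?_⟩
    have h : ∀ z, LinearEquiv.smulOfUnit (Units.mk0 b hb) z = fun i : Unit => b * z i :=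
      fun _ => rfl
    simp only [dform_apply, h, Finset.univ_unique, Finset.sum_singleton]
    ring
  simpa using this.sum_gw_eq (by simp [ha, hb]) (by simp [ha])

lemma DIso.of_matrix {f : Fin 2 → ℚ} {g : Fin 2 → ℚ} (P : Matrix (Fin 2) (Fin 2) ℚ)
    (hP : P.det ≠ 0) (h00 : g 0 * P 0 0 ^ 2 + g 1 * P 1 0 ^ 2 = f 0)
    (h11 : g 0 * P 0 1 ^ 2 + g 1 * P 1 1 ^ 2 = f 1)
    (h01 : g 0 * P 0 0 * P 0 1 + g 1 * P 1 0 * P 1 1 = 0) : DIso f g := by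
  refine ⟨LinearEquiv.ofIsUnitDet (v := Pi.basisFun ℚ (Fin 2)) (v' := Pi.basisFun ℚ (Fin 2))
    (f := Matrix.toLin' P) (by simpa using hP), fun x y => ?_⟩
  simp [dform_apply, LinearEquiv.ofIsUnitDet_apply, Matrix.toLin'_apply,
    Fin.sum_univ_two]
  linear_combination (x 0 * y 0) * h00 + (x 1 * y 1) * h11 + (x 0 * y 1 + x 1 * y 0) * h01

lemma gw_add {a b : ℚ} (ha : a ≠ 0) (hb : b ≠ 0) (hab : a + b ≠ 0) :
    gw a + gw b = gw (a + b) + gw (a * b * (a + b)) := by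
  have : DIso ![a + b, a * b * (a + b)] ![a, b] :=
    DIso.of_matrix !![1, b; 1, -a] (by rw [Matrix.det_fin_two_of]; intro h; exact hab (by linarith))
      (by simp) (by simp; ring) (by simp; ring)
  have := this.sum_gw_eq (by intro i; fin_cases i <;> simp [ha, hb, hab])
    (by intro i; fin_cases i <;> simp [ha, hb])
  simpa [Fin.sum_univ_two] using this.symm

lemma gw_neg {a : ℚ} (ha : a ≠ 0) : gw a + gw (-a) = gw 1 + gw (-1) := by
  have : DIso ![a, -a] ![1, -1] :=
    DIso.of_matrix !![(a + 1) / 2, (a - 1) / 2; (a - 1) / 2, (a + 1) / 2]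
      (by rw [Matrix.det_fin_two_of]; intro h; exact ha (by linear_combination h))
      (by simp; ring) (by simp; ring) (by simp; ring)
  have := this.sum_gw_eq (by intro i; fin_cases i <;> simp [ha])
    (by intro i; fin_cases i <;> simp)
  simpa [Fin.sum_univ_two] using this

lemma gw_intDen {a : ℚ} (ha : a ≠ 0) : gw a = gw ((a.num * a.den : ℤ) : ℚ) := by
  have hd : (a.den : ℚ) ≠ 0 := by exact_mod_cast a.den_nz
  rw [← gw_sq ha hd]
  congr 1
  push_cast
  nth_rewrite 1 [← Rat.num_div_den a]
  field_simp

lemma DIso.card_eq {f : ι → ℚ} {g : κ → ℚ} (h : DIso f g) : Fintype.card ι = Fintype.card κ := by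
  obtain ⟨e, -⟩ := h
  simpa using e.finrank_eq

lemma DIso.card_pos_eq {f : ι → ℚ} {g : κ → ℚ} (h : DIso f g) :
    {i | 0 < f i}.ncard = {i | 0 < g i}.ncard := by
  obtain ⟨e, he⟩ := h
  rw [← QuadraticForm.sigPos_weightedSumSquares, ← QuadraticForm.sigPos_weightedSumSquares]
  refine QuadraticMap.Equivalent.sigPos_eq ⟨⟨e, fun x => ?_⟩⟩
  have := he x x
  simpa [dform_apply, QuadraticMap.weightedSumSquares_apply, mul_assoc] using this

end GW
end Enriques

namespace Enriques
open LinearMap (BilinForm)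
open Module Submodule

section lattices
variable {V V' : Type*} [AddCommGroup V] [Module ℚ V] [AddCommGroup V'] [Module ℚ V']

lemma exists_rat_basis (Λ : Submodule ℤ V) [IsLattice ℚ Λ] :
    ∃ (ι : Type) (_ : Fintype ι) (b : Basis ι ℚ V), Λ = span ℤ (Set.range b) := by
  have := Submodule.IsLattice.free ℚ Λ
  have : Module.Finite ℤ Λ := Submodule.IsLattice.finite ℚ Λ
  let b := Module.finBasis ℤ Λ
  refine ⟨Fin _, inferInstance, b.extendOfIsLattice ℚ, ?_⟩
  have h : (Set.range (b.extendOfIsLattice ℚ)) = Λ.subtype '' Set.range b := by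
    rw [← Set.range_comp]
    congr 1
    ext i
    simp
  rw [h, ← Submodule.map_span, b.span_eq, Submodule.map_top, Submodule.range_subtype]

lemma isLattice_span_basis {ι : Type*} [Finite ι] (b : Basis ι ℚ V) :
    IsLattice ℚ (span ℤ (Set.range b)) :=
  ⟨Submodule.fg_span (Set.finite_range b), by rw [Submodule.span_span_of_tower, b.span_eq]⟩

lemma exists_smul_mem (Λ : Submodule ℤ V) [IsLattice ℚ Λ] (x : V) :
    ∃ n : ℤ, n ≠ 0 ∧ n • x ∈ Λ := by
  have hx : x ∈ span ℚ (Λ : Set V) := by rw [IsLattice.span_eq_top]; trivial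
  induction hx using Submodule.span_induction with
  | mem x h => exact ⟨1, one_ne_zero, by simpa using h⟩
  | zero => exact ⟨1, one_ne_zero, by simp⟩
  | add x y _ _ hx hy =>
    obtain ⟨m, hm, hmx⟩ := hx
    obtain ⟨n, hn, hny⟩ := hy
    refine ⟨m * n, mul_ne_zero hm hn, ?_⟩
    rw [smul_add]
    refine add_mem ?_ ?_
    · rw [mul_comm, mul_smul]; exact Λ.smul_mem _ hmx
    · rw [mul_smul]; exact Λ.smul_mem _ hny
  | smul a x _ hx =>
    obtain ⟨m, hm, hmx⟩ := hx
    refine ⟨m * a.den, mul_ne_zero hm (by exact_mod_cast a.den_nz), ?_⟩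
    have : (m * a.den : ℤ) • a • x = a.num • m • x := by
      rw [← Int.cast_smul_eq_zsmul ℚ, ← Int.cast_smul_eq_zsmul ℚ, ← Int.cast_smul_eq_zsmul ℚ,
        smul_smul, smul_smul]
      congr 1
      push_cast
      rw [mul_assoc, mul_comm (a.den : ℚ), Rat.mul_den_eq_num, mul_comm]
    rw [this]
    exact Λ.smul_mem _ hmx

lemma isLattice_of_fg_of_smul {Λ : Submodule ℤ V} (hfg : Λ.FG)
    (h : ∀ x : V, ∃ n : ℤ, n ≠ 0 ∧ n • x ∈ Λ) : IsLattice ℚ Λ := by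
  refine ⟨hfg, eq_top_iff.mpr fun x _ => ?_⟩
  obtain ⟨n, hn, hx⟩ := h x
  have : x = (n : ℚ)⁻¹ • (n • x) := by
    rw [← Int.cast_smul_eq_zsmul ℚ, smul_smul, inv_mul_cancel₀ (by exact_mod_cast hn), one_smul]
  rw [this]
  exact Submodule.smul_mem _ _ (Submodule.subset_span hx)

variable {B : BilinForm ℚ V}

lemma mem_dual_iff {Λ : Submodule ℤ V} {x : V} :
    x ∈ B.dualSubmodule Λ ↔ ∀ y ∈ Λ, ∃ k : ℤ, B x y = k := by
  simp only [LinearMap.BilinForm.mem_dualSubmodule, Submodule.mem_one]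
  simp [eq_comm]

lemma dual_anti {Λ Λ' : Submodule ℤ V} (h : Λ ≤ Λ') : B.dualSubmodule Λ' ≤ B.dualSubmodule Λ :=
  fun _ hx y hy => hx y (h hy)

lemma dual_sup (Λ Λ' : Submodule ℤ V) :
    B.dualSubmodule (Λ ⊔ Λ') = B.dualSubmodule Λ ⊓ B.dualSubmodule Λ' := by
  refine le_antisymm (le_inf (dual_anti le_sup_left) (dual_anti le_sup_right)) ?_
  rintro x ⟨h, h'⟩ y hy
  obtain ⟨a, ha, b, hb, rfl⟩ := Submodule.mem_sup.mp hy
  rw [map_add]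
  exact add_mem (h a ha) (h' b hb)

lemma dual_isLattice (hB : B.Nondegenerate) (Λ : Submodule ℤ V) [IsLattice ℚ Λ] :
    IsLattice ℚ (B.dualSubmodule Λ) := by
  classical
  obtain ⟨ι, _, b, hb⟩ := exists_rat_basis Λ
  have := b.finiteDimensional_of_finite
  rw [hb, LinearMap.BilinForm.dualSubmodule_span_of_basis _ hB]
  exact isLattice_span_basis _

lemma dual_dual (hB : B.Nondegenerate) (hB' : B.IsSymm) (Λ : Submodule ℤ V) [IsLattice ℚ Λ] :
    B.dualSubmodule (B.dualSubmodule Λ) = Λ := by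
  obtain ⟨ι, _, b, hb⟩ := exists_rat_basis Λ
  rw [hb, LinearMap.BilinForm.dualSubmodule_dualSubmodule_of_basis _ hB hB']

lemma dual_inf [FiniteDimensional ℚ V] (hB : B.Nondegenerate) (hB' : B.IsSymm)
    (Λ Λ' : Submodule ℤ V) [IsLattice ℚ Λ] [IsLattice ℚ Λ'] :
    B.dualSubmodule (Λ ⊓ Λ') = B.dualSubmodule Λ ⊔ B.dualSubmodule Λ' := by
  have h1 := dual_isLattice hB Λ
  have h2 := dual_isLattice hB Λ'
  rw [← dual_dual hB hB' (B.dualSubmodule Λ ⊔ B.dualSubmodule Λ'), dual_sup, dual_dual hB hB',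
    dual_dual hB hB']

/-- Norms of vectors of the lattice are even integers. -/
def IsEvenLat (B : BilinForm ℚ V) (Λ : Submodule ℤ V) : Prop :=
  ∀ x ∈ Λ, ∃ k : ℤ, B x x = 2 * k

lemma IsEvenLat.mono {Λ Λ' : Submodule ℤ V} (h : IsEvenLat B Λ') (hle : Λ ≤ Λ') :
    IsEvenLat B Λ := fun x hx => h x (hle hx)

lemma IsEvenLat.exists_int {Λ : Submodule ℤ V} (hB : B.IsSymm) (h : IsEvenLat B Λ) {x y : V}
    (hx : x ∈ Λ) (hy : y ∈ Λ) : ∃ k : ℤ, B x y = k := by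
  obtain ⟨a, ha⟩ := h _ (add_mem hx hy)
  obtain ⟨b, hb⟩ := h _ hx
  obtain ⟨c, hc⟩ := h _ hy
  refine ⟨a - b - c, ?_⟩
  have := hB.eq x y
  simp only [map_add, LinearMap.add_apply] at ha
  push_cast
  linarith

lemma IsEvenLat.le_dual {Λ : Submodule ℤ V} (hB : B.IsSymm) (h : IsEvenLat B Λ) :
    Λ ≤ B.dualSubmodule Λ := fun _ hx => mem_dual_iff.mpr fun _ hy => h.exists_int hB hx hy

lemma IsEvenLat.sup {Λ Λ' : Submodule ℤ V} (hB : B.IsSymm) (h : IsEvenLat B Λ)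
    (h' : IsEvenLat B Λ') (hh : ∀ x ∈ Λ, ∀ y ∈ Λ', ∃ k : ℤ, B x y = k) :
    IsEvenLat B (Λ ⊔ Λ') := by
  intro z hz
  obtain ⟨x, hx, y, hy, rfl⟩ := Submodule.mem_sup.mp hz
  obtain ⟨a, ha⟩ := h _ hx
  obtain ⟨b, hb⟩ := h' _ hy
  obtain ⟨c, hc⟩ := hh x hx y hy
  refine ⟨a + b + c, ?_⟩
  have := hB.eq x y
  simp only [map_add, LinearMap.add_apply]
  push_cast
  linarith

lemma isEvenLat_span_singleton {x : V} {k : ℤ} (h : B x x = 2 * k) : IsEvenLat B (span ℤ {x}) := by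
  intro y hy
  obtain ⟨n, rfl⟩ := Submodule.mem_span_singleton.mp hy
  refine ⟨n ^ 2 * k, ?_⟩
  simp [h]
  ring

lemma IsEvenLat.sup_span_singleton {Λ : Submodule ℤ V} (hB : B.IsSymm) (h : IsEvenLat B Λ)
    {x : V} (hx : x ∈ B.dualSubmodule Λ) {k : ℤ} (hxx : B x x = 2 * k) :
    IsEvenLat B (Λ ⊔ span ℤ {x}) := by
  refine h.sup hB (isEvenLat_span_singleton hxx) fun y hy z hz => ?_
  obtain ⟨n, rfl⟩ := Submodule.mem_span_singleton.mp hz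
  obtain ⟨m, hm⟩ := mem_dual_iff.mp hx y hy
  refine ⟨n * m, ?_⟩
  have := hB.eq x y
  rw [map_zsmul, ← this, hm]
  simp

/-- The image of a lattice under a linear equivalence. -/
def mapLat (e : V ≃ₗ[ℚ] V') (Λ : Submodule ℤ V) : Submodule ℤ V' :=
  Λ.map (e.toLinearMap.restrictScalars ℤ)

lemma mem_mapLat {e : V ≃ₗ[ℚ] V'} {Λ : Submodule ℤ V} {y : V'} :
    y ∈ mapLat e Λ ↔ e.symm y ∈ Λ := by
  constructor
  · rintro ⟨x, hx, rfl⟩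
    simpa using hx
  · intro h
    exact ⟨_, h, by simp⟩

lemma mapLat_isLattice (e : V ≃ₗ[ℚ] V') (Λ : Submodule ℤ V) [IsLattice ℚ Λ] :
    IsLattice ℚ (mapLat e Λ) := by
  refine isLattice_of_fg_of_smul (Submodule.FG.map _ (IsLattice.fg (A := ℚ))) fun x => ?_
  obtain ⟨n, hn, h⟩ := exists_smul_mem Λ (e.symm x)
  exact ⟨n, hn, mem_mapLat.mpr (by simpa using h)⟩

lemma mapLat_dual {B' : BilinForm ℚ V'} {e : V ≃ₗ[ℚ] V'} (he : Isometry B B' e)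
    (Λ : Submodule ℤ V) : B'.dualSubmodule (mapLat e Λ) = mapLat e (B.dualSubmodule Λ) := by
  ext y
  rw [mem_mapLat, mem_dual_iff, mem_dual_iff]
  constructor
  · intro h x hx
    obtain ⟨k, hk⟩ := h (e x) (mem_mapLat.mpr (by simpa using hx))
    exact ⟨k, by rw [← hk, ← he]; simp⟩
  · intro h x hx
    obtain ⟨k, hk⟩ := h _ (mem_mapLat.mp hx)
    exact ⟨k, by rw [← hk, ← he]; simp⟩

lemma IsEvenLat.map {B' : BilinForm ℚ V'} {e : V ≃ₗ[ℚ] V'} (he : Isometry B B' e)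
    {Λ : Submodule ℤ V} (h : IsEvenLat B Λ) : IsEvenLat B' (mapLat e Λ) := by
  intro y hy
  obtain ⟨k, hk⟩ := h _ (mem_mapLat.mp hy)
  exact ⟨k, by rw [← hk, ← he]; simp⟩

end lattices
end Enriques

namespace Enriques
open LinearMap (BilinForm)
open Module Submodule

section lagrangian
variable {F : Type*} [Field F]

lemma det_fromBlocks_zero_left {n : Type} [Fintype n] [DecidableEq n] (X Z Y : Matrix n n F) :
    (Matrix.fromBlocks 0 X Z Y).det = (-1) ^ Fintype.card n * (X.det * Z.det) := by
  have h1 : (Matrix.fromBlocks (0 : Matrix n n F) (1 : Matrix n n F) (-1 : Matrix n n F)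
      (0 : Matrix n n F)).det = 1 := by
    have : (Matrix.fromBlocks (0 : Matrix n n F) (1 : Matrix n n F) (-1 : Matrix n n F)
        (0 : Matrix n n F)) =
        Matrix.fromBlocks (1 : Matrix n n F) (1 : Matrix n n F) 0 (1 : Matrix n n F) *
        Matrix.fromBlocks (1 : Matrix n n F) 0 (-1) (1 : Matrix n n F) *
        Matrix.fromBlocks (1 : Matrix n n F) (1 : Matrix n n F) 0 (1 : Matrix n n F) := by
      simp [Matrix.fromBlocks_multiply]
    rw [this]
    simp
  have h2 : Matrix.fromBlocks 0 X Z Y * Matrix.fromBlocks (0 : Matrix n n F) (1 : Matrix n n F)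
      (-1 : Matrix n n F) (0 : Matrix n n F) =
      Matrix.fromBlocks (-X) 0 (-Y) Z := by simp [Matrix.fromBlocks_multiply]
  have h3 := congrArg Matrix.det h2
  rw [Matrix.det_mul, h1, mul_one, Matrix.det_fromBlocks_zero₁₂, Matrix.det_neg] at h3
  rw [h3]
  ring

/-- Discriminant of a nondegenerate form possessing a Lagrangian. -/
lemma exists_prod_eq_of_lagrangian {J : Type*} [Fintype J] (b : J → F) (hb : ∀ j, b j ≠ 0)
    (I : Submodule F (J → F)) (hI : ∀ y, y ∈ I ↔ ∀ x ∈ I, ∑ j, b j * x j * y j = 0) :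
    ∃ (m : ℕ) (s : F), Fintype.card J = 2 * m ∧ ∏ j, b j = (-1) ^ m * s ^ 2 := by
  classical
  let B : BilinForm F (J → F) := Matrix.toBilin' (Matrix.diagonal b)
  have hBa : ∀ x y, B x y = ∑ j, b j * x j * y j := by
    intro x y
    rw [Matrix.toBilin'_apply']
    simp only [dotProduct, Matrix.mulVec_diagonal]
    exact Finset.sum_congr rfl fun _ _ => by ring
  have hdet : (Matrix.diagonal b).det ≠ 0 := by
    rw [Matrix.det_diagonal]; exact Finset.prod_ne_zero_iff.mpr fun j _ => hb j
  have hBn : B.Nondegenerate := LinearMap.BilinForm.nondegenerate_toBilin'_of_det_ne_zero' _ hdet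
  have hBs : B.IsSymm := ⟨fun x y => by
    rw [hBa, hBa]; exact Finset.sum_congr rfl fun _ _ => by ring⟩
  have hIo : B.orthogonal I = I := by
    ext y
    rw [LinearMap.BilinForm.mem_orthogonal_iff, hI]
    simp only [hBa]
  have hfin := LinearMap.BilinForm.finrank_orthogonal hBn I
  rw [hIo, Module.finrank_fintype_fun_eq_card] at hfin
  have hle := Submodule.finrank_le I
  rw [Module.finrank_fintype_fun_eq_card] at hle
  set m := finrank F I with hm
  obtain ⟨I', hI'⟩ := Submodule.exists_isCompl I
  have hsum := Submodule.finrank_add_eq_of_isCompl hI'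
  rw [Module.finrank_fintype_fun_eq_card] at hsum
  have hcard : Fintype.card J = 2 * m := by omega
  let c₁ : Basis (Fin m) F I := finBasisOfFinrankEq F I rfl
  let c₂ : Basis (Fin m) F I' := finBasisOfFinrankEq F I' (by omega)
  let v : Basis (Fin m ⊕ Fin m) F (J → F) := (c₁.prod c₂).map (Submodule.prodEquivOfIsCompl I I' hI')
  have e : J ≃ Fin m ⊕ Fin m := Fintype.equivOfCardEq (by simp [hcard]; ring)
  let u : Basis (Fin m ⊕ Fin m) F (J → F) := (Pi.basisFun F J).reindex e
  have key := congrArg Matrix.det (LinearMap.BilinForm.toMatrix_mul_basis_toMatrix u v B)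
  rw [Matrix.det_mul, Matrix.det_mul, Matrix.det_transpose] at key
  have hu : (LinearMap.BilinForm.toMatrix u B).det = ∏ j, b j := by
    rw [← Matrix.det_diagonal, ← Matrix.det_reindex_self e]
    congr 1
    ext i j
    simp only [LinearMap.BilinForm.toMatrix_apply, u, Basis.reindex_apply, Pi.basisFun_apply, hBa,
      Matrix.reindex_apply, Matrix.submatrix_apply, Matrix.diagonal_apply, Pi.single_apply]
    by_cases h : i = j
    · simp [h]
    · simp [h, Ne.symm h]
  have hv : (LinearMap.BilinForm.toMatrix v B) = Matrix.fromBlocks 0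
      (LinearMap.BilinForm.toMatrix v B).toBlocks₁₂ (LinearMap.BilinForm.toMatrix v B).toBlocks₁₂.transpose
      (LinearMap.BilinForm.toMatrix v B).toBlocks₂₂ := by
    ext (i | i) (j | j)
    · simp only [Matrix.fromBlocks_apply₁₁, Matrix.zero_apply, LinearMap.BilinForm.toMatrix_apply]
      have h1 : v (Sum.inl i) ∈ I := by simp [v]
      have h2 : v (Sum.inl j) ∈ I := by simp [v]
      rw [hBa]
      exact (hI _).mp h2 _ h1
    · rfl
    · simp only [Matrix.fromBlocks_apply₂₁, Matrix.transpose_apply, Matrix.toBlocks₁₂, Matrix.of_apply,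
        LinearMap.BilinForm.toMatrix_apply]
      exact hBs.eq _ _
    · rfl
  rw [hu, hv, det_fromBlocks_zero_left, Matrix.det_transpose, Fintype.card_fin] at key
  have hinv : (u.toMatrix v).det ≠ 0 := by
    have h := congrArg Matrix.det (u.toMatrix_mul_toMatrix_flip v)
    rw [Matrix.det_mul, Matrix.det_one] at h
    exact left_ne_zero_of_mul_eq_one h
  refine ⟨m, (LinearMap.BilinForm.toMatrix v B).toBlocks₁₂.det / (u.toMatrix v).det, hcard, ?_⟩
  field_simp
  linear_combination key

end lagrangian

section residue
variable {q : ℕ} [Fact q.Prime] {J₀ J₁ : Type} [Fintype J₀] [Fintype J₁]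

lemma sum_nondegenerate {ι : Type} [Fintype ι] {f : ι → ℚ} (hf : ∀ i, f i ≠ 0) :
    (dform f).Nondegenerate := by
  classical
  have h : dform f = Matrix.toBilin' (Matrix.diagonal f) := by
    refine LinearMap.ext₂ fun x y => ?_
    rw [Matrix.toBilin'_apply', dform_apply]
    simp only [dotProduct, Matrix.mulVec_diagonal]
    exact Finset.sum_congr rfl fun _ _ => by ring
  rw [h]
  refine LinearMap.BilinForm.nondegenerate_toBilin'_of_det_ne_zero' _ ?_
  rw [Matrix.det_diagonal]
  exact Finset.prod_ne_zero_iff.mpr fun j _ => hf j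

/-- Vectors with integral coordinates after multiplication by the given weights. -/
def boxLat {ι : Type} [Fintype ι] (d : ι → ℤ) : Submodule ℤ (ι → ℚ) where
  carrier := {x | ∀ i, ∃ k : ℤ, d i * x i = k}
  add_mem' {x y} hx hy i := by
    obtain ⟨k, hk⟩ := hx i
    obtain ⟨l, hl⟩ := hy i
    exact ⟨k + l, by simp [mul_add, hk, hl]⟩
  zero_mem' i := ⟨0, by simp⟩
  smul_mem' c x hx i := by
    obtain ⟨k, hk⟩ := hx i
    refine ⟨c * k, ?_⟩
    simp only [Pi.smul_apply, zsmul_eq_mul]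
    push_cast
    rw [← hk]; ring

lemma boxLat_isLattice {ι : Type} [Fintype ι] {d : ι → ℤ} (hd : ∀ i, d i ≠ 0) :
    IsLattice ℚ (boxLat d) := by
  classical
  let b : Basis ι ℚ (ι → ℚ) := (Pi.basisFun ℚ ι).unitsSMul fun i =>
    (Units.mk0 (d i : ℚ) (by exact_mod_cast hd i))⁻¹
  have hb : ∀ i, b i = Pi.single i ((d i : ℚ)⁻¹) := by
    intro i
    ext j
    simp [b, Basis.unitsSMul_apply, Units.smul_def, Pi.single_apply]
  have : boxLat d = span ℤ (Set.range b) := by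
    apply le_antisymm
    · intro x hx
      choose k hk using hx
      have : x = ∑ i, k i • b i := by
        ext j
        have h0 : (d j : ℚ) ≠ 0 := by exact_mod_cast hd j
        simp only [Finset.sum_apply, Pi.smul_apply, hb, Pi.single_apply]
        simp [← hk]
        field_simp
      rw [this]
      exact sum_mem fun i _ => Submodule.smul_mem _ _ (Submodule.subset_span ⟨i, rfl⟩)
    · rw [Submodule.span_le]
      rintro _ ⟨i, rfl⟩ j
      rw [hb]
      rcases eq_or_ne j i with rfl | h
      · have h0 : (d j : ℚ) ≠ 0 := by exact_mod_cast hd j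
        exact ⟨1, by simp [h0]⟩
      · exact ⟨0, by simp [h]⟩
  rw [this]
  exact isLattice_span_basis b

lemma dual_boxLat_le {ι : Type} [Fintype ι] {d c : ι → ℤ} {f : ι → ℚ} (hd : ∀ i, d i ≠ 0)
    (h : ∀ i, f i = d i * c i) :
    (dform f).dualSubmodule (boxLat d) ≤ boxLat c := by
  classical
  intro y hy i
  have h0 : (d i : ℚ) ≠ 0 := by exact_mod_cast hd i
  obtain ⟨k, hk⟩ := mem_dual_iff.mp hy (Pi.single i ((d i : ℚ)⁻¹)) (by
    intro j
    rcases eq_or_ne j i with rfl | h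
    · exact ⟨1, by simp [h0]⟩
    · exact ⟨0, by simp [h]⟩)
  refine ⟨k, ?_⟩
  rw [← hk, dform_apply]
  simp [Pi.single_apply, h]
  field_simp

/-- The residue form of a diagonal form containing a self-dual lattice has a Lagrangian. -/
lemma exists_residue_of_selfDual (c : J₀ → ℤ) (b : J₁ → ℤ) (hc : ∀ j, ¬ (q : ℤ) ∣ c j)
    (hb : ∀ j, ¬ (q : ℤ) ∣ b j) {f : J₀ ⊕ J₁ → ℚ} (hf0 : ∀ j, f (Sum.inl j) = c j)
    (hf1 : ∀ j, f (Sum.inr j) = q * b j) (H : Submodule ℤ (J₀ ⊕ J₁ → ℚ)) [IsLattice ℚ H]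
    (hH : (dform f).dualSubmodule H = H) :
    ∃ (m : ℕ) (s : ZMod q), Fintype.card J₁ = 2 * m ∧ ∏ j, (b j : ZMod q) = (-1) ^ m * s ^ 2 := by
  have hqp : q.Prime := Fact.out
  have hq0 : (q : ℚ) ≠ 0 := by exact_mod_cast hqp.ne_zero
  have hc0 : ∀ j, c j ≠ 0 := fun j h => hc j (by simp [h])
  have hb0 : ∀ j, b j ≠ 0 := fun j h => hb j (by simp [h])
  have hf : ∀ i, f i ≠ 0 := by
    rintro (j | j)
    · rw [hf0]; exact_mod_cast hc0 j
    · rw [hf1]; exact mul_ne_zero hq0 (by exact_mod_cast hb0 j)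
  let d : J₀ ⊕ J₁ → ℤ := Sum.elim (fun _ => 1) (fun _ => q)
  let d' : J₀ ⊕ J₁ → ℤ := Sum.elim c b
  have hd : ∀ i, d i ≠ 0 := by
    rintro (j | j)
    · exact one_ne_zero
    · show (q : ℤ) ≠ 0
      exact_mod_cast hqp.ne_zero
  have hlE := boxLat_isLattice hd
  let E := H ⊓ boxLat d
  have hdual : (dform f).dualSubmodule E ≤ H ⊔ boxLat d' := by
    rw [dual_inf (sum_nondegenerate hf) (dform_isSymm f), hH]
    refine sup_le_sup_left (dual_boxLat_le hd ?_) _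
    rintro (j | j)
    · simp [hf0, d, d']
    · simp [hf1, d, d']
  let I : Submodule (ZMod q) (J₁ → ZMod q) :=
    { carrier := {y | ∃ x ∈ E, ∃ k : J₁ → ℤ, ∀ j, q * x (Sum.inr j) = k j ∧ y j = k j}
      add_mem' := by
        rintro y y' ⟨x, hx, k, hk⟩ ⟨x', hx', k', hk'⟩
        exact ⟨x + x', add_mem hx hx', k + k', fun j => by
          simp [mul_add, hk j, hk' j]⟩
      zero_mem' := ⟨0, zero_mem _, 0, fun j => by simp⟩
      smul_mem' := by
        rintro a y ⟨x, hx, k, hk⟩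
        refine ⟨a.valMinAbs • x, Submodule.smul_mem _ _ hx, a.valMinAbs • k, fun j => ?_⟩
        simp only [Pi.smul_apply, zsmul_eq_mul, smul_eq_mul, Int.cast_mul,
          ZMod.coe_valMinAbs, (hk j).2, and_true]
        rw [← (hk j).1]; ring }
  refine exists_prod_eq_of_lagrangian (fun j => (b j : ZMod q))
    (fun j h => hb j ((ZMod.intCast_zmod_eq_zero_iff_dvd _ _).mp h)) I fun y => ⟨?_, ?_⟩
  · rintro ⟨x, hx, k, hk⟩ y' ⟨x', hx', k', hk'⟩
    obtain ⟨n, hn⟩ : ∃ n : ℤ, dform f x' x = n := by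
      refine mem_dual_iff.mp ?_ x hx.1
      rw [hH]; exact hx'.1
    have h1 : ∀ j, ∃ t : ℤ, x (Sum.inl j) = t := fun j => by simpa [d] using hx.2 (Sum.inl j)
    have h2 : ∀ j, ∃ t : ℤ, x' (Sum.inl j) = t := fun j => by simpa [d] using hx'.2 (Sum.inl j)
    choose t ht using h1
    choose t' ht' using h2
    have : (∑ j, b j * k' j * k j : ℤ) = q * (n - ∑ j, c j * t' j * t j) := by
      have : ((∑ j, b j * k' j * k j : ℤ) : ℚ) = ((q * (n - ∑ j, c j * t' j * t j) : ℤ) : ℚ) := by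
        push_cast
        rw [← hn, dform_apply, Fintype.sum_sum_type]
        simp only [hf0, hf1, ht, ht', ← (hk _).1, ← (hk' _).1, add_sub_cancel_left, Finset.mul_sum]
        exact Finset.sum_congr rfl fun _ _ => by ring
      exact_mod_cast this
    have := congrArg (Int.cast : ℤ → ZMod q) this
    push_cast at this
    simpa [(hk _).2, (hk' _).2] using this
  · intro hy
    let y₀ : J₀ ⊕ J₁ → ℚ := Sum.elim 0 (fun j => ((y j).valMinAbs : ℚ) / q)
    have hy₀ : y₀ ∈ (dform f).dualSubmodule E := by
      refine mem_dual_iff.mpr fun x hx => ?_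
      have h1 : ∀ j, ∃ t : ℤ, q * x (Sum.inr j) = t := fun j => by
        simpa [d] using hx.2 (Sum.inr j)
      choose t ht using h1
      have h2 := hy (fun j => t j) ⟨x, hx, t, fun j => ⟨ht j, rfl⟩⟩
      have h3 : (q : ℤ) ∣ ∑ j, b j * t j * (y j).valMinAbs := by
        rw [← ZMod.intCast_zmod_eq_zero_iff_dvd]
        push_cast
        simpa using h2
      obtain ⟨n, hn⟩ := h3
      refine ⟨n, ?_⟩
      have hn' : ∑ j, (b j : ℚ) * t j * (y j).valMinAbs = q * n := by exact_mod_cast hn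
      apply mul_left_cancel₀ hq0
      rw [← hn', dform_apply, Fintype.sum_sum_type]
      simp only [y₀, Sum.elim_inl, Sum.elim_inr, hf1, Pi.zero_apply, mul_zero, zero_mul,
        Finset.sum_const_zero, zero_add, Finset.mul_sum]
      refine Finset.sum_congr rfl fun j _ => ?_
      rw [← ht]
      field_simp
    obtain ⟨h, hh, e, he, hsum⟩ := Submodule.mem_sup.mp (hdual hy₀)
    let D : ℤ := (∏ j, c j) * ∏ j, b j
    have hD : ((D : ℤ) : ZMod q) ≠ 0 := by
      simp only [D, Int.cast_mul, Int.cast_prod]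
      refine mul_ne_zero (Finset.prod_ne_zero_iff.mpr fun j _ h => hc j ?_)
        (Finset.prod_ne_zero_iff.mpr fun j _ h => hb j ?_)
      all_goals exact (ZMod.intCast_zmod_eq_zero_iff_dvd _ _).mp h
    have hDe : ∀ i, ∃ t : ℤ, D * e i = t := by
      intro i
      obtain ⟨k, hk⟩ := he i
      have : d' i ∣ D := by
        rcases i with j | j
        · exact (Finset.dvd_prod_of_mem c (Finset.mem_univ j)).mul_right _
        · exact (Finset.dvd_prod_of_mem b (Finset.mem_univ j)).mul_left _
      obtain ⟨r, hr⟩ := this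
      refine ⟨r * k, ?_⟩
      rw [hr]; push_cast; rw [← hk]; ring
    choose t ht using hDe
    have hDh : ∀ i, (D • h) i = D * y₀ i - t i := by
      intro i
      rw [← hsum, ← ht]
      simp; ring
    have hmem : ((D : ℤ) : ZMod q) • y ∈ I := by
      refine ⟨D • h, ⟨Submodule.smul_mem _ _ hh, ?_⟩,
        fun j => D * (y j).valMinAbs - q * t (Sum.inr j), fun j => ⟨?_, ?_⟩⟩
      · rintro (j | j)
        · refine ⟨- t (Sum.inl j), ?_⟩
          rw [hDh]; simp [d, y₀]
        · refine ⟨D * (y j).valMinAbs - q * t (Sum.inr j), ?_⟩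
          rw [hDh]; simp [d, y₀]; field_simp
      · rw [hDh]; simp [y₀]; field_simp
      · simp
    have := I.smul_mem ((D : ℤ) : ZMod q)⁻¹ hmem
    rwa [smul_smul, inv_mul_cancel₀ hD, one_smul] at this

end residue
end Enriques

namespace Enriques
open LinearMap (BilinForm)
open Module Submodule

section selfdual
variable {ι κ : Type} [Fintype ι] [Fintype κ]

/-- The diagonal form contains a self-dual lattice of full rank. -/
def HasSelfDual (f : ι → ℚ) : Prop :=
  ∃ H : Submodule ℤ (ι → ℚ), IsLattice ℚ H ∧ (dform f).dualSubmodule H = H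

lemma HasSelfDual.of_DIso {f : ι → ℚ} {g : κ → ℚ} (h : HasSelfDual f) (hfg : DIso f g) :
    HasSelfDual g := by
  obtain ⟨H, hl, hH⟩ := h
  obtain ⟨e, he⟩ := hfg
  exact ⟨mapLat e H, mapLat_isLattice e H, by rw [mapLat_dual he, hH]⟩

lemma dual_boxLat_one {s : ι → ℚ} (hs : ∀ i, s i = 1 ∨ s i = -1) :
    (dform s).dualSubmodule (boxLat fun _ => 1) = boxLat fun _ => 1 := by
  apply le_antisymm
  · have h : ∀ i, ∃ c : ℤ, s i = c ∧ (c = 1 ∨ c = -1) := fun i => by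
      rcases hs i with h | h
      · exact ⟨1, by simp [h], by simp⟩
      · exact ⟨-1, by simp [h], by simp⟩
    choose c hc hc' using h
    refine (dual_boxLat_le (c := c) (by simp) (by simp [hc])).trans fun x hx i => ?_
    obtain ⟨k, hk⟩ := hx i
    rcases hc' i with h | h
    · exact ⟨k, by simp [← hk, h]⟩
    · exact ⟨-k, by simp [← hk, h]⟩
  · intro x hx
    refine mem_dual_iff.mpr fun y hy => ?_
    choose k hk using hx
    choose l hl using hy
    simp only [Int.cast_one, one_mul] at hk hl
    have h : ∀ i, ∃ c : ℤ, s i = c := fun i => by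
      rcases hs i with h | h
      · exact ⟨1, by simp [h]⟩
      · exact ⟨-1, by simp [h]⟩
    choose c hc using h
    exact ⟨∑ i, c i * k i * l i, by simp [dform_apply, hk, hl, hc]⟩

lemma hasSelfDual_of_sign {s : ι → ℚ} (hs : ∀ i, s i = 1 ∨ s i = -1) : HasSelfDual s :=
  ⟨_, boxLat_isLattice (by simp), dual_boxLat_one hs⟩

lemma HasSelfDual.sum {f : ι → ℚ} {g : κ → ℚ} (hf : HasSelfDual f) (hg : HasSelfDual g) :
    HasSelfDual (Sum.elim f g) := by
  obtain ⟨H, hl, hH⟩ := hf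
  obtain ⟨H', hl', hH'⟩ := hg
  let e := (LinearEquiv.sumArrowLequivProdArrow ι κ ℤ ℚ).symm
  have hmem : ∀ x, x ∈ (H.prod H').map e.toLinearMap ↔ x ∘ Sum.inl ∈ H ∧ x ∘ Sum.inr ∈ H' := by
    intro x
    constructor
    · rintro ⟨⟨a, b⟩, ⟨ha, hb⟩, rfl⟩
      exact ⟨ha, hb⟩
    · rintro ⟨ha, hb⟩
      exact ⟨(x ∘ Sum.inl, x ∘ Sum.inr), ⟨ha, hb⟩, by ext (i | i) <;> rfl⟩
  refine ⟨(H.prod H').map e.toLinearMap, isLattice_of_fg_of_smul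
    (Submodule.FG.map _ ((IsLattice.fg (A := ℚ)).prod (IsLattice.fg (A := ℚ)))) fun x => ?_, ?_⟩
  · obtain ⟨n, hn, h⟩ := exists_smul_mem H (x ∘ Sum.inl)
    obtain ⟨n', hn', h'⟩ := exists_smul_mem H' (x ∘ Sum.inr)
    refine ⟨n * n', mul_ne_zero hn hn', (hmem _).mpr ⟨?_, ?_⟩⟩
    · have := H.smul_mem n' h
      rwa [smul_smul, mul_comm] at this
    · have := H'.smul_mem n h'
      rwa [smul_smul] at this
  · ext x
    rw [hmem, mem_dual_iff]
    constructor
    · intro h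
      constructor
      · rw [← hH, mem_dual_iff]
        intro y hy
        obtain ⟨k, hk⟩ := h (Sum.elim y 0) ((hmem _).mpr ⟨by simpa using hy, by
          rw [Sum.elim_comp_inr]; exact zero_mem _⟩)
        exact ⟨k, by rw [← hk, dform_sumElim]; simp⟩
      · rw [← hH', mem_dual_iff]
        intro y hy
        obtain ⟨k, hk⟩ := h (Sum.elim 0 y) ((hmem _).mpr ⟨by
          rw [Sum.elim_comp_inl]; exact zero_mem _, by simpa using hy⟩)
        exact ⟨k, by rw [← hk, dform_sumElim]; simp⟩
    · rintro ⟨h, h'⟩ y hy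
      rw [hmem] at hy
      rw [← hH, mem_dual_iff] at h
      rw [← hH', mem_dual_iff] at h'
      obtain ⟨k, hk⟩ := h _ hy.1
      obtain ⟨k', hk'⟩ := h' _ hy.2
      exact ⟨k + k', by rw [dform_sumElim, hk, hk']; simp⟩

end selfdual

section descent
variable {ι : Type} [Fintype ι]

/-- The subgroup generated by forms whose coefficients only involve primes below `q`. -/
noncomputable def smoothGW (q : ℕ) : AddSubgroup GW := AddSubgroup.closure {x | ∃ n : ℤ, Smooth q n ∧ x = gw n}

lemma gw_mem_smoothGW {q : ℕ} {n : ℤ} (h : Smooth q n) : gw n ∈ smoothGW q :=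
  AddSubgroup.subset_closure ⟨n, h, rfl⟩

lemma smooth_unit {q : ℕ} {n : ℤ} (h : IsUnit n) : Smooth q n :=
  ⟨h.ne_zero, fun _ hr hd => absurd (isUnit_of_dvd_unit hd h) (Nat.prime_iff_prime_int.mp hr).not_isUnit⟩

lemma exists_sum_of_mem_smoothGW {q : ℕ} {x : GW} (hx : x ∈ smoothGW q) :
    ∃ (k : ℕ) (J : Type) (_ : Fintype J) (c : J → ℤ), (∀ j, Smooth q (c j)) ∧
      x + k • (gw 1 + gw (-1)) = ∑ j, gw (c j) := by
  induction hx using AddSubgroup.closure_induction with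
  | mem x h =>
    obtain ⟨n, hn, rfl⟩ := h
    exact ⟨0, Unit, inferInstance, fun _ => n, fun _ => hn, by simp⟩
  | zero => exact ⟨0, Empty, inferInstance, fun _ => 1, by simp, by simp⟩
  | add x y _ _ hx hy =>
    obtain ⟨k, J, _, c, hc, h⟩ := hx
    obtain ⟨k', J', _, c', hc', h'⟩ := hy
    refine ⟨k + k', J ⊕ J', inferInstance, Sum.elim c c', by simp [hc, hc'], ?_⟩
    simp only [Fintype.sum_sum_type, Sum.elim_inl, Sum.elim_inr, ← h, ← h']
    module
  | neg x _ hx =>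
    obtain ⟨k, J, _, c, hc, h⟩ := hx
    refine ⟨Fintype.card J, (Fin k ⊕ Fin k) ⊕ J, inferInstance,
      Sum.elim (Sum.elim (fun _ => 1) fun _ => -1) fun j => - c j, ?_, ?_⟩
    · rintro ((j | j) | j)
      · exact smooth_unit isUnit_one
      · exact smooth_unit isUnit_one.neg
      · exact (hc j).of_dvd (by simp)
    · have h1 : ∑ j, gw (c j) + ∑ j, gw (((-c j : ℤ)) : ℚ) =
          Fintype.card J • (gw 1 + gw (-1)) := by
        rw [← Finset.sum_add_distrib, Finset.sum_congr rfl (g := fun _ => gw 1 + gw (-1))]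
        · simp
        · intro j _
          push_cast
          exact gw_neg (by exact_mod_cast (hc j).1)
      simp only [Fintype.sum_sum_type, Sum.elim_inl, Sum.elim_inr, Finset.sum_const,
        Finset.card_univ, Fintype.card_fin, Int.cast_one, Int.cast_neg] at h1 ⊢
      rw [← h1, ← h]
      module

lemma exists_smooth_rep {q : ℕ} (hq : q.Prime) {c : ℤ} (hc : Smooth (q + 1) c) :
    ∃ b : ℤ, Smooth q b ∧ (gw c = gw b ∨ gw c = gw (q * b : ℤ)) := by
  have hfin : FiniteMultiplicity (q : ℤ) c :=
    Int.finiteMultiplicity_iff.mpr ⟨by simpa using hq.one_lt.ne', hc.1⟩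
  obtain ⟨m, hm, hnd⟩ := hfin.exists_eq_pow_mul_and_not_dvd
  have hb : Smooth q m := by
    refine ⟨fun h => hnd (by simp [h]), fun r hr hd => ?_⟩
    have h1 := hc.2 r hr (hm ▸ Dvd.dvd.mul_left hd _)
    have h2 : r ≠ q := fun h => hnd (h ▸ hd)
    omega
  have hm0 : (m : ℚ) ≠ 0 := by exact_mod_cast hb.1
  have hq0 : (q : ℚ) ≠ 0 := by exact_mod_cast hq.ne_zero
  refine ⟨m, hb, ?_⟩
  rcases Nat.even_or_odd' (multiplicity (q : ℤ) c) with ⟨t, ht | ht⟩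
  · left
    rw [← gw_sq hm0 (pow_ne_zero t hq0), hm, ht]
    congr 1
    push_cast; ring
  · right
    rw [← gw_sq (a := (q * m : ℤ)) (by push_cast; exact mul_ne_zero hq0 hm0) (pow_ne_zero t hq0),
      hm, ht]
    congr 1
    push_cast; ring

lemma isWittSymbol_gw (S : AddSubgroup GW) :
    IsWittSymbol fun n : ℤ => (QuotientAddGroup.mk (gw n) : GW ⧸ S) where
  sq a b ha hb := by
    have := gw_sq (a := a) (b := b) (by exact_mod_cast ha) (by exact_mod_cast hb)
    simp only [Int.cast_mul, Int.cast_pow, this]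
  add a b ha hb hab := by
    have := gw_add (a := a) (b := b) (by exact_mod_cast ha) (by exact_mod_cast hb)
      (by exact_mod_cast hab)
    rw [← QuotientAddGroup.mk_add, this]
    simp
  neg a ha := by
    have := gw_neg (a := a) (by exact_mod_cast ha)
    simp only [Int.cast_neg, Int.cast_one, ← QuotientAddGroup.mk_add, this]

lemma HasSelfDual.mem_smoothGW_step {f : ι → ℚ} (hH : HasSelfDual f) {q : ℕ}
    (h : ∑ i, gw (f i) ∈ smoothGW (q + 1)) : ∑ i, gw (f i) ∈ smoothGW q := by
  classical
  by_cases hq : q.Prime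
  · obtain ⟨k, J, _, c, hc, hsum⟩ := exists_sum_of_mem_smoothGW h
    choose b hb hbc using fun j => exists_smooth_rep hq (hc j)
    have : Fact q.Prime := ⟨hq⟩
    let P : J → Prop := fun j => gw (c j) = gw (b j)
    have hP : ∀ j, ¬ P j → gw (c j) = gw (q * b j : ℤ) := fun j hj => (hbc j).resolve_left hj
    let g : {j // P j} ⊕ {j // ¬ P j} → ℚ := Sum.elim (fun j => b j) fun j => q * b j
    have hsplit : ∑ j, gw (c j) = ∑ j : {j // P j}, gw (b j) + ∑ j : {j // ¬ P j}, gw (q * b j : ℤ) := by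
      rw [← Fintype.sum_subtype_add_sum_subtype P]
      congr 1
      · exact Finset.sum_congr rfl fun j _ => j.2
      · exact Finset.sum_congr rfl fun j _ => hP _ j.2
    let f' : ι ⊕ (Fin k ⊕ Fin k) → ℚ := Sum.elim f (Sum.elim (fun _ => 1) fun _ => -1)
    have hf' : HasSelfDual f' := hH.sum (hasSelfDual_of_sign (by simp))
    have hiso : DIso f' g := by
      apply DIso.of_sum_gw
      simp only [f', g, Fintype.sum_sum_type, Sum.elim_inl, Sum.elim_inr, Finset.sum_const,
        Finset.card_univ, Fintype.card_fin]
      rw [← nsmul_add, hsum, hsplit]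
      simp
    obtain ⟨H, hl, hH⟩ := hf'.of_DIso hiso
    obtain ⟨m, s, hm, hs⟩ := exists_residue_of_selfDual (q := q) (fun j : {j // P j} => b j)
      (fun j : {j // ¬ P j} => b j) (fun j => (hb j).not_dvd hq) (fun j => (hb j).not_dvd hq)
      (f := g) (fun j => rfl) (fun j => rfl) H hH
    have hφ := isWittSymbol_gw (smoothGW q)
    have h0 : ∀ n, Smooth q n → (QuotientAddGroup.mk (gw n) : GW ⧸ smoothGW q) = 0 := fun n hn =>
      (QuotientAddGroup.eq_zero_iff _).mpr (gw_mem_smoothGW hn)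
    have hz := hφ.sum_eq_zero h0 _ (fun j : {j // ¬ P j} => hb j) hm hs
    have hz' : ∑ j : {j // ¬ P j}, gw (q * b j : ℤ) ∈ smoothGW q := by
      rw [← QuotientAddGroup.eq_zero_iff, ← hz]
      exact map_sum (QuotientAddGroup.mk' (smoothGW q)) _ _
    have hk : k • (gw 1 + gw (-1)) ∈ smoothGW q := by
      refine nsmul_mem (add_mem ?_ ?_) k
      · simpa using gw_mem_smoothGW (q := q) (smooth_unit isUnit_one)
      · simpa using gw_mem_smoothGW (q := q) (smooth_unit (n := -1) (by simp))
    rw [← AddSubgroup.add_mem_cancel_right _ hk, hsum, hsplit]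
    exact add_mem (sum_mem fun j _ => gw_mem_smoothGW (hb j)) hz'
  · refine (AddSubgroup.closure_mono ?_ : smoothGW (q + 1) ≤ smoothGW q) h
    rintro _ ⟨n, hn, rfl⟩
    refine ⟨n, ⟨hn.1, fun r hr hd => ?_⟩, rfl⟩
    have h1 := hn.2 r hr hd
    have h2 : r ≠ q := fun h => hq (h ▸ hr)
    omega

lemma HasSelfDual.mem_smoothGW {f : ι → ℚ} (hf : ∀ i, f i ≠ 0) (hH : HasSelfDual f) :
    ∑ i, gw (f i) ∈ smoothGW 2 := by
  let M : ℕ := ∑ i, ((f i).num * (f i).den).natAbs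
  have hM : ∑ i, gw (f i) ∈ smoothGW (2 + (M + 1)) := by
    refine sum_mem fun i _ => ?_
    rw [gw_intDen (hf i)]
    refine gw_mem_smoothGW (smooth_of_abs_lt ?_ ?_)
    · exact mul_ne_zero (by simpa using hf i) (by exact_mod_cast (f i).den_nz)
    · have : ((f i).num * (f i).den).natAbs ≤ M :=
        Finset.single_le_sum (f := fun i => ((f i).num * (f i).den).natAbs) (fun _ _ => Nat.zero_le _)
          (Finset.mem_univ i)
      rw [Int.abs_eq_natAbs]
      omega
  generalize M + 1 = t at hM
  induction t with
  | zero => exact hM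
  | succ t ih => exact ih (hH.mem_smoothGW_step hM)

/-- The sign of a nonzero rational number, with value `-1` at zero. -/
def sgn (a : ℚ) : ℚ := if 0 < a then 1 else -1

lemma sgn_eq (a : ℚ) : sgn a = 1 ∨ sgn a = -1 := by
  unfold sgn; split_ifs <;> simp

lemma sum_gw_sgn (f : ι → ℚ) : ∑ i, gw (sgn (f i)) =
    {i | 0 < f i}.ncard • (gw 1 - gw (-1)) + Fintype.card ι • gw (-1) := by
  classical
  have h : ∀ i, gw (sgn (f i)) = (if 0 < f i then gw 1 - gw (-1) else 0) + gw (-1) := by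
    intro i; unfold sgn; split_ifs <;> simp
  simp only [h, Finset.sum_add_distrib, ← Finset.sum_filter, Finset.sum_const, Finset.card_univ]
  congr 2
  rw [Set.ncard_eq_toFinset_card']
  congr 1
  ext; simp

/-- A rational quadratic form containing a self-dual lattice is a sum of signs. -/
theorem HasSelfDual.dIso_sgn {f : ι → ℚ} (hf : ∀ i, f i ≠ 0) (hH : HasSelfDual f) :
    DIso f (fun i => sgn (f i)) := by
  obtain ⟨k, J, _, c, hc, hsum⟩ := exists_sum_of_mem_smoothGW (hH.mem_smoothGW hf)
  have hc' : ∀ j, sgn (c j) = c j := by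
    intro j
    have hu : IsUnit (c j) := by
      rw [Int.isUnit_iff_natAbs_eq]
      by_contra h
      obtain ⟨r, hr, hd⟩ := Nat.exists_prime_and_dvd h
      have := (hc j).2 r hr (Int.natCast_dvd.mpr hd)
      exact absurd hr.two_le (by omega)
    rcases Int.isUnit_iff.mp hu with h | h <;> simp [h, sgn] 
  let f' : ι ⊕ (Fin k ⊕ Fin k) → ℚ := Sum.elim f (Sum.elim (fun _ => 1) fun _ => -1)
  have hs' : ∑ i, gw (f' i) = ∑ i, gw (f i) + k • (gw 1 + gw (-1)) := by
    simp [f', Fintype.sum_sum_type, nsmul_add]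
  have hiso : DIso f' (fun j => (c j : ℚ)) := by
    apply DIso.of_sum_gw
    rw [hs', hsum]
  have h1 := hiso.card_eq
  have h2 := hiso.card_pos_eq
  have h3 : ∑ i, gw (sgn (f' i)) = ∑ i, gw (sgn (f i)) + k • (gw 1 + gw (-1)) := by
    have h1 : sgn 1 = 1 := by norm_num [sgn]
    have h2 : sgn (-1) = -1 := by norm_num [sgn]
    simp [f', Fintype.sum_sum_type, h1, h2, nsmul_add]
  apply DIso.of_sum_gw
  have h4 := sum_gw_sgn f'
  have h5 := sum_gw_sgn (fun j => (c j : ℚ))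
  rw [h1, h2, ← h5, h3] at h4
  simp only [hc'] at h4
  rw [← hsum] at h4
  exact (add_right_cancel h4).symm

end descent
end Enriques

namespace Enriques
open LinearMap (BilinForm)
open Module Submodule

section blij
variable {ι : Type} [Fintype ι]

lemma eight_dvd_of_even_sign {s : ι → ℚ} (hs : ∀ i, s i = 1 ∨ s i = -1)
    (H : Submodule ℤ (ι → ℚ)) [IsLattice ℚ H] (hH : (dform s).dualSubmodule H = H)
    (he : IsEvenLat (dform s) H) : ∃ k : ℤ, ∑ i, s i = 8 * k := by
  have hl : IsLattice ℚ (boxLat fun _ : ι => (1 : ℤ)) := boxLat_isLattice (by simp)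
  have h0 : ∀ i, s i ≠ 0 := fun i h => by rcases hs i with h' | h' <;> norm_num [h] at h'
  have hz : ∀ i, ∃ c : ℤ, s i = c := fun i => by
    rcases hs i with h | h
    · exact ⟨1, by simp [h]⟩
    · exact ⟨-1, by simp [h]⟩
  choose c hc using hz
  have hmem : (fun _ => 1 / 2 : ι → ℚ) ∈ (dform s).dualSubmodule (H ⊓ boxLat fun _ => 1) := by
    refine mem_dual_iff.mpr fun x hx => ?_
    obtain ⟨m, hm⟩ := he x hx.1
    choose k hk using hx.2
    simp only [Int.cast_one, one_mul] at hk
    have h2 : ∀ i, ∃ t : ℤ, k i = k i * k i + 2 * t := fun i => by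
      obtain ⟨t, ht⟩ := (Int.even_mul_succ_self (k i - 1))
      exact ⟨-t, by linear_combination -ht⟩
    choose t ht using h2
    refine ⟨m + ∑ i, c i * t i, ?_⟩
    have h3 : ∑ i, s i * x i * x i = 2 * m := hm
    have h4 : (m : ℚ) = ∑ i, s i * x i * x i / 2 := by
      rw [← Finset.sum_div, h3]; ring
    rw [dform_apply]
    push_cast
    rw [h4, ← Finset.sum_add_distrib]
    refine Finset.sum_congr rfl fun i _ => ?_
    have h5 : (k i : ℚ) = k i * k i + 2 * t i := by exact_mod_cast ht i
    rw [hk i, ← hc i]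
    linear_combination (s i / 2) * h5
  rw [dual_inf (sum_nondegenerate h0) (dform_isSymm s), hH, dual_boxLat_one hs] at hmem
  obtain ⟨h, hh, d, hd, hsum⟩ := Submodule.mem_sup.mp hmem
  choose k hk using hd
  simp only [Int.cast_one, one_mul] at hk
  obtain ⟨m, hm⟩ := he h hh
  have h2 : ∀ i, ∃ t : ℤ, (1 - 2 * k i) ^ 2 = 1 + 8 * t := fun i => by
    obtain ⟨t, ht⟩ := (Int.even_mul_succ_self (k i - 1))
    exact ⟨t, by linear_combination 4 * ht⟩
  choose t ht using h2
  refine ⟨m - ∑ i, c i * t i, ?_⟩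
  have h3 : ∑ i, s i * h i * h i = 2 * m := hm
  have h4 : (m : ℚ) = ∑ i, s i * h i * h i / 2 := by
    rw [← Finset.sum_div, h3]; ring
  push_cast
  rw [h4, ← Finset.sum_sub_distrib, Finset.mul_sum]
  refine Finset.sum_congr rfl fun i _ => ?_
  have h5 : (1 - 2 * k i : ℚ) ^ 2 = 1 + 8 * t i := by exact_mod_cast ht i
  have h6 : h i = 1 / 2 - k i := by
    rw [← hk, ← congrFun hsum i]; simp
  rw [h6, ← hc i]
  linear_combination (-s i) * h5

lemma sum_sgn (f : ι → ℚ) : ∑ i, sgn (f i) = 2 * {i | 0 < f i}.ncard - Fintype.card ι := by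
  classical
  have h : ∀ i, sgn (f i) = (if 0 < f i then 2 else 0) - 1 := by
    intro i; unfold sgn; split_ifs <;> norm_num
  simp only [h, Finset.sum_sub_distrib, ← Finset.sum_filter, Finset.sum_const, Finset.card_univ]
  rw [Set.ncard_eq_toFinset_card']
  simp [mul_comm]

/-- The signature of an even self-dual lattice is divisible by eight. -/
theorem eight_dvd_of_even_selfDual {f : ι → ℚ} (hf : ∀ i, f i ≠ 0) (H : Submodule ℤ (ι → ℚ))
    [IsLattice ℚ H] (hH : (dform f).dualSubmodule H = H) (he : IsEvenLat (dform f) H) :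
    (8 : ℤ) ∣ 2 * {i | 0 < f i}.ncard - Fintype.card ι := by
  obtain ⟨e, hiso⟩ := HasSelfDual.dIso_sgn hf ⟨H, inferInstance, hH⟩
  have := mapLat_isLattice e H
  obtain ⟨k, hk⟩ := eight_dvd_of_even_sign (fun i => sgn_eq (f i)) (mapLat e H)
    (by rw [mapLat_dual hiso, hH]) (he.map hiso)
  rw [sum_sgn] at hk
  exact ⟨k, by exact_mod_cast hk⟩

end blij
end Enriques

namespace Enriques
open LinearMap (BilinForm)
open Module Submodule

set_option linter.unusedSectionVars false

section gram
variable {V : Type} [AddCommGroup V] [Module ℚ V] {B : BilinForm ℚ V}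

/-- Nondegenerate forms can be diagonalised. -/
lemma exists_diag [FiniteDimensional ℚ V] (hB : B.Nondegenerate) (hs : B.IsSymm) :
    ∃ (f : Fin (finrank ℚ V) → ℚ) (e : V ≃ₗ[ℚ] (Fin (finrank ℚ V) → ℚ)),
      (∀ i, f i ≠ 0) ∧ Isometry B (dform f) e := by
  obtain ⟨v, hv⟩ := LinearMap.BilinForm.exists_orthogonal_basis (B := B) ⟨hs.eq⟩
  refine ⟨fun i => B (v i) (v i), v.equivFun, ?_, fun x y => ?_⟩
  · intro i
    exact LinearMap.IsOrthoᵢ.not_isOrtho_basis_self_of_separatingLeft hv hB.1 i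
  · conv_rhs => rw [← v.sum_equivFun x, ← v.sum_equivFun y]
    simp only [map_sum, LinearMap.sum_apply, map_smul, LinearMap.smul_apply, smul_eq_mul,
      dform_apply]
    refine Finset.sum_congr rfl fun i _ => ?_
    rw [Finset.sum_eq_single i]
    · ring
    · intro j _ hj
      rw [LinearMap.isOrthoᵢ_def.mp hv j i hj]; simp
    · simp

lemma eight_dvd_of_isometry {κ : Type} [Fintype κ] {f : κ → ℚ} (hf : ∀ i, f i ≠ 0)
    {e : V ≃ₗ[ℚ] (κ → ℚ)} (he : Isometry B (dform f) e) (H : Submodule ℤ V) [IsLattice ℚ H]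
    (hH : B.dualSubmodule H = H) (hev : IsEvenLat B H) :
    (8 : ℤ) ∣ 2 * {i | 0 < f i}.ncard - Fintype.card κ := by
  have := mapLat_isLattice e H
  exact eight_dvd_of_even_selfDual hf (mapLat e H) (by rw [mapLat_dual he, hH]) (hev.map he)

variable {ι : Type} [Fintype ι] [DecidableEq ι]

/-- The rational bilinear form with the given integral Gram matrix. -/
noncomputable def gramForm (G : Matrix ι ι ℤ) : BilinForm ℚ (ι → ℚ) :=
  Matrix.toBilin' (G.map Int.cast)

/-- The standard lattice. -/
def stdLat (ι : Type) [Fintype ι] : Submodule ℤ (ι → ℚ) := boxLat fun _ => 1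

/-- An integral vector as a rational one. -/
def intVec (z : ι → ℤ) : ι → ℚ := fun i => z i

lemma mem_stdLat {x : ι → ℚ} : x ∈ stdLat ι ↔ ∃ z, x = intVec z := by
  constructor
  · intro h
    choose k hk using h
    exact ⟨k, funext fun i => by simpa [intVec] using hk i⟩
  · rintro ⟨z, rfl⟩ i
    exact ⟨z i, by simp [intVec]⟩

lemma intVec_mem (z : ι → ℤ) : intVec z ∈ stdLat ι := mem_stdLat.mpr ⟨z, rfl⟩

instance : IsLattice ℚ (stdLat ι) := boxLat_isLattice (by simp)

lemma intVec_injective : Function.Injective (intVec (ι := ι)) := fun x y h => by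
  ext i
  exact Int.cast_injective (α := ℚ) (congrFun h i)

lemma gramForm_apply (G : Matrix ι ι ℤ) (x y : ι → ℚ) :
    gramForm G x y = x ⬝ᵥ (G.map Int.cast).mulVec y := by
  rw [gramForm, Matrix.toBilin'_apply']

lemma gramForm_intVec (G : Matrix ι ι ℤ) (x y : ι → ℤ) :
    gramForm G (intVec x) (intVec y) = ((x ⬝ᵥ G.mulVec y : ℤ) : ℚ) := by
  rw [gramForm_apply]
  simp [dotProduct, Matrix.mulVec, intVec]

lemma gramForm_isSymm {G : Matrix ι ι ℤ} (hG : G.IsSymm) : (gramForm G).IsSymm := ⟨fun x y => by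
  have h : (G.map (Int.cast : ℤ → ℚ)).transpose = G.map Int.cast := by
    rw [← Matrix.transpose_map, hG.eq]
  rw [gramForm_apply, gramForm_apply, Matrix.dotProduct_mulVec, ← Matrix.mulVec_transpose, h,
    dotProduct_comm]⟩

lemma gramForm_nondegenerate {G : Matrix ι ι ℤ} (hG : G.det ≠ 0) : (gramForm G).Nondegenerate := by
  refine LinearMap.BilinForm.nondegenerate_toBilin'_of_det_ne_zero' _ ?_
  have : (G.map (Int.cast : ℤ → ℚ)).det = (G.det : ℚ) := by
    simpa using (Int.cast_det (R := ℚ) G).symm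
  rw [this]
  exact_mod_cast hG

lemma equivalent_of_transpose_mul_mul {κ : Type} [Fintype κ] [DecidableEq κ] {H : Matrix ι ι ℝ}
    {A : Matrix ι κ ℝ} {A' : Matrix κ ι ℝ} (h : A * A' = 1) (h' : A' * A = 1) {w : κ → ℝ}
    (hA : A.transpose * H * A = Matrix.diagonal w) :
    QuadraticMap.Equivalent (QuadraticMap.weightedSumSquares ℝ w)
      (Matrix.toBilin' H).toQuadraticMap := by
  refine ⟨⟨Matrix.toLin'OfInv h' h, fun x => ?_⟩⟩
  have h1 : Matrix.toLin'OfInv h' h x = A.mulVec x := rfl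
  have h2 : A.mulVec x ⬝ᵥ H.mulVec (A.mulVec x) = x ⬝ᵥ (A.transpose * H * A).mulVec x := by
    rw [Matrix.mul_assoc, ← Matrix.mulVec_mulVec, ← Matrix.mulVec_mulVec, Matrix.dotProduct_mulVec x,
      Matrix.vecMul_transpose]
  rw [LinearEquiv.toFun_eq_coe, h1, LinearMap.BilinMap.toQuadraticMap_apply,
    Matrix.toBilin'_apply', h2, hA, QuadraticMap.weightedSumSquares_apply]
  simp only [dotProduct, Matrix.mulVec_diagonal, smul_eq_mul]
  exact Finset.sum_congr rfl fun _ _ => by ring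

/-- The index of inertia of a rational diagonalisation, computed over the reals. -/
lemma card_pos_eq_of_real {κ : Type} [Fintype κ] {G : Matrix ι ι ℤ} {f : κ → ℚ}
    {e : (ι → ℚ) ≃ₗ[ℚ] (κ → ℚ)} (he : Isometry (gramForm G) (dform f) e)
    {S : Matrix ι ι ℝ} (hS : IsUnit S.det) {w : ι → ℝ}
    (hSG : S.transpose * G.map (Int.cast : ℤ → ℝ) * S = Matrix.diagonal w) :
    {i | 0 < f i}.ncard = {i | 0 < w i}.ncard := by
  classical
  have hS' : IsUnit S := (Matrix.isUnit_iff_isUnit_det S).mpr hS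
  have e1 := equivalent_of_transpose_mul_mul (Matrix.mul_nonsing_inv S hS)
    (Matrix.nonsing_inv_mul S hS) hSG
  let R : Matrix ι κ ℚ := LinearMap.toMatrix' e.symm.toLinearMap
  let R' : Matrix κ ι ℚ := LinearMap.toMatrix' e.toLinearMap
  have h1 : R * R' = 1 := by
    rw [← LinearMap.toMatrix'_comp]; simp
  have h2 : R' * R = 1 := by
    rw [← LinearMap.toMatrix'_comp]; simp
  have h3 : R.transpose * G.map (Int.cast : ℤ → ℚ) * R = Matrix.diagonal f := by
    have key : ∀ x y, gramForm G (R.mulVec x) (R.mulVec y) = dform f x y := by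
      intro x y
      have : ∀ x, R.mulVec x = e.symm x := fun x => by
        rw [← Matrix.toLin'_apply]; simp [R]
      rw [this, this, ← he]; simp
    apply Matrix.toBilin'.injective
    rw [← Matrix.toBilin'_comp]
    refine LinearMap.ext₂ fun x y => ?_
    rw [LinearMap.BilinForm.comp_apply, Matrix.toLin'_apply, Matrix.toLin'_apply]
    rw [Matrix.toBilin'_apply' (Matrix.diagonal f)]
    refine (key x y).trans ?_
    simp only [dotProduct, Matrix.mulVec_diagonal, dform_apply]
    exact Finset.sum_congr rfl fun _ _ => by ring
  let c : ℚ →+* ℝ := Rat.castHom ℝ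
  have e2 := equivalent_of_transpose_mul_mul (H := G.map (Int.cast : ℤ → ℝ)) (A := R.map c)
    (A' := R'.map c) (w := fun i => (f i : ℝ)) (by rw [← Matrix.map_mul, h1]; simp)
    (by rw [← Matrix.map_mul, h2]; simp) (by
      have := congrArg (fun M => M.map c) h3
      simp only [Matrix.map_mul, Matrix.transpose_map, Matrix.map_map] at this
      rw [Matrix.diagonal_map (map_zero c)] at this
      have hG : G.map (⇑c ∘ Int.cast) = G.map (Int.cast : ℤ → ℝ) := by ext i j; simp [c]
      rw [hG] at this
      exact this)
  have := (e1.trans e2.symm).sigPos_eq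
  rw [QuadraticForm.sigPos_weightedSumSquares, QuadraticForm.sigPos_weightedSumSquares] at this
  simpa using this.symm

end gram
end Enriques

namespace Enriques
open LinearMap (BilinForm)
open Module Submodule

set_option linter.unusedSectionVars false

section rank
variable {ι : Type} [Fintype ι] [DecidableEq ι]

lemma card_quotient_range_mulVecLin {Q : Matrix ι ι ℤ} (hQ : Q.det ≠ 0) :
    Nat.card ((ι → ℤ) ⧸ LinearMap.range Q.mulVecLin) = Q.det.natAbs := by
  have hinj : Function.Injective Q.mulVecLin := by
    rw [injective_iff_map_eq_zero]
    exact fun x hx => Matrix.eq_zero_of_mulVec_eq_zero hQ hx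
  let e := LinearEquiv.ofInjective Q.mulVecLin hinj
  have := Submodule.natAbs_det_equiv (LinearMap.range Q.mulVecLin) e
  rw [← this, ← LinearMap.det_toLin' Q]
  congr 2

/-- Reduction of integral vectors modulo `p`. -/
def redVec (p : ℕ) : (ι → ℤ) →+ (ι → ZMod p) where
  toFun z i := z i
  map_zero' := by ext; simp
  map_add' x y := by ext; simp

@[simp] lemma redVec_apply (p : ℕ) (z : ι → ℤ) (i : ι) : redVec p z i = z i := rfl

lemma redVec_surjective (p : ℕ) : Function.Surjective (redVec (ι := ι) p) := fun y => by
  choose z hz using fun i => ZMod.intCast_surjective (y i)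
  exact ⟨z, funext hz⟩

lemma redVec_eq_zero {p : ℕ} {z : ι → ℤ} : redVec p z = 0 ↔ ∃ w, z = (p : ℤ) • w := by
  constructor
  · intro h
    choose w hw using fun i => (ZMod.intCast_zmod_eq_zero_iff_dvd (z i) p).mp (congrFun h i)
    exact ⟨w, funext fun i => by simpa using hw i⟩
  · rintro ⟨w, rfl⟩
    ext i
    simp

lemma redVec_mulVec {κ : Type} [Fintype κ] (p : ℕ) (Q : Matrix κ ι ℤ) (z : ι → ℤ) :
    redVec p (Q.mulVec z) = (Q.map (Int.cast : ℤ → ZMod p)).mulVec (redVec p z) := by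
  ext i
  simp [Matrix.mulVec, dotProduct]

lemma redVec_smul (p : ℕ) (c : ℤ) (z : ι → ℤ) :
    redVec p (c • z) = (c : ZMod p) • redVec p z := by
  ext i
  simp

/-- The corank modulo `p` of an integral matrix whose cokernel is killed by `p`. -/
lemma finrank_range_of_det {p : ℕ} [Fact p.Prime] {Q : Matrix ι ι ℤ} {j : ℕ}
    (hQ : ∀ v, ∃ w, Q.mulVec w = (p : ℤ) • v) (hd : Q.det.natAbs = p ^ j) :
    finrank (ZMod p) (LinearMap.range (Q.map (Int.cast : ℤ → ZMod p)).mulVecLin) + j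
      = Fintype.card ι := by
  have hp := (Fact.out : p.Prime)
  set R := LinearMap.range (Q.map (Int.cast : ℤ → ZMod p)).mulVecLin
  have hQ0 : Q.det ≠ 0 := by
    rw [← Int.natAbs_ne_zero, hd]; exact pow_ne_zero _ hp.ne_zero
  let φ : (ι → ℤ) →+ ((ι → ZMod p) ⧸ R) := R.mkQ.toAddMonoidHom.comp (redVec p)
  have hφ : Function.Surjective φ := (Submodule.mkQ_surjective R).comp (redVec_surjective p)
  have hker : φ.ker = (LinearMap.range Q.mulVecLin).toAddSubgroup := by
    ext x
    have : x ∈ φ.ker ↔ redVec p x ∈ R := by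
      rw [AddMonoidHom.mem_ker]
      exact Submodule.Quotient.mk_eq_zero R
    rw [this]
    constructor
    · rintro ⟨y, hy⟩
      obtain ⟨z, rfl⟩ := redVec_surjective p y
      rw [Matrix.mulVecLin_apply, ← redVec_mulVec] at hy
      obtain ⟨w, hw⟩ := redVec_eq_zero.mp (show redVec p (x - Q.mulVec z) = 0 by
        rw [map_sub, hy, sub_self])
      obtain ⟨w', hw'⟩ := hQ w
      refine ⟨w' + z, ?_⟩
      rw [Matrix.mulVecLin_apply, Matrix.mulVec_add, hw', ← hw, sub_add_cancel]
    · rintro ⟨z, rfl⟩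
      exact ⟨redVec p z, by simp [redVec_mulVec]⟩
  have h1 : Nat.card ((ι → ZMod p) ⧸ R) = p ^ j := by
    rw [← hd, ← card_quotient_range_mulVecLin hQ0]
    have e := QuotientAddGroup.quotientKerEquivOfSurjective φ hφ
    rw [← Nat.card_congr e.toEquiv]
    have := AddSubgroup.index_eq_card φ.ker
    rw [← this, hker]
    exact AddSubgroup.index_eq_card _
  rw [Module.natCard_eq_pow_finrank (K := ZMod p), Nat.card_zmod] at h1
  rw [← Nat.pow_right_injective hp.two_le h1, add_comm, Submodule.finrank_quotient_add_finrank]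
  simp

end rank
end Enriques

namespace Enriques

/-- The inverse of the Gram matrix of `Γ`. -/
def gammaInv : Matrix (Fin 10) (Fin 10) ℤ :=
  !![0,1,0,0,0,0,0,0,0,0;
     1,0,0,0,0,0,0,0,0,0;
     0,0,-2,-3,-4,-5,-6,-4,-2,-3;
     0,0,-3,-6,-8,-10,-12,-8,-4,-6;
     0,0,-4,-8,-12,-15,-18,-12,-6,-9;
     0,0,-5,-10,-15,-20,-24,-16,-8,-12;
     0,0,-6,-12,-18,-24,-30,-20,-10,-15;
     0,0,-4,-8,-12,-16,-20,-14,-7,-10;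
     0,0,-2,-4,-6,-8,-10,-7,-4,-5;
     0,0,-3,-6,-9,-12,-15,-10,-5,-8]

/-- The standard isotropic vectors of `U` and eight orthogonal roots of `E8`. -/
def frameMat : Matrix (Fin 10) (Fin 10) ℤ :=
  !![1,0,0,0,0,0,0,0,0,0;
     0,1,0,0,0,0,0,0,0,0;
     0,0,0,0,0,0,0,0,1,0;
     0,0,0,0,0,0,0,0,0,1;
     0,0,0,1,0,0,0,0,0,0;
     0,0,0,0,0,1,0,0,0,0;
     0,0,0,0,0,1,2,2,1,1;
     0,0,0,1,2,2,2,2,1,1;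
     0,0,0,1,2,3,4,2,1,2;
     0,0,2,3,4,5,6,4,2,3]

/-- The Gram matrix of the rows of `frameMat`. -/
def frameGram : Matrix (Fin 10) (Fin 10) ℤ :=
  !![0,1,0,0,0,0,0,0,0,0;
     1,0,0,0,0,0,0,0,0,0;
     0,0,-2,0,0,0,0,0,0,0;
     0,0,0,-2,0,0,0,0,0,0;
     0,0,0,0,-2,0,0,0,0,0;
     0,0,0,0,0,-2,0,0,0,0;
     0,0,0,0,0,0,-2,0,0,0;
     0,0,0,0,0,0,0,-2,0,0;
     0,0,0,0,0,0,0,0,-2,0;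
     0,0,0,0,0,0,0,0,0,-2]

/-- Twice the inverse of `frameGram`. -/
def frameCogram : Matrix (Fin 10) (Fin 10) ℤ :=
  !![0,2,0,0,0,0,0,0,0,0;
     2,0,0,0,0,0,0,0,0,0;
     0,0,-1,0,0,0,0,0,0,0;
     0,0,0,-1,0,0,0,0,0,0;
     0,0,0,0,-1,0,0,0,0,0;
     0,0,0,0,0,-1,0,0,0,0;
     0,0,0,0,0,0,-1,0,0,0;
     0,0,0,0,0,0,0,-1,0,0;
     0,0,0,0,0,0,0,0,-1,0;
     0,0,0,0,0,0,0,0,0,-1]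

set_option maxRecDepth 100000 in
lemma gamma_mul_inv : GammaGram * gammaInv = 1 := by decide

set_option maxRecDepth 100000 in
lemma frame_gram : frameMat * GammaGram * frameMatᵀ = frameGram := by decide

set_option maxRecDepth 100000 in
lemma gram_frame : (frameMat * GammaGram)ᵀ * frameCogram * (frameMat * GammaGram) =
    (2 : ℤ) • GammaGram := by decide

set_option maxRecDepth 100000 in
lemma gamma_transpose : GammaGramᵀ = GammaGram := by decide

lemma gammaGram_det_ne_zero : GammaGram.det ≠ 0 := fun h => by
  have := congrArg Matrix.det gamma_mul_inv
  rw [Matrix.det_mul, h, Matrix.det_one, zero_mul] at this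
  exact zero_ne_one this

lemma mulVec_dotProduct_mulVec {R ι κ l m : Type} [CommRing R] [Fintype ι] [Fintype κ] [Fintype l]
    [Fintype m] (A : Matrix κ ι R) (M : Matrix κ l R) (N : Matrix l m R) (x : ι → R) (y : m → R) :
    (A *ᵥ x) ⬝ᵥ (M *ᵥ (N *ᵥ y)) = x ⬝ᵥ (Aᵀ * M * N) *ᵥ y := by
  rw [← Matrix.mulVec_mulVec, ← Matrix.mulVec_mulVec, Matrix.dotProduct_mulVec x,
    Matrix.vecMul_transpose]

lemma bilin_gamma (c c' : Fin 10 → ℤ) (z z' : Fin 10 → ℤ)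
    (hz : z = (frameMat * GammaGram) *ᵥ c) (hz' : z' = (frameMat * GammaGram) *ᵥ c') :
    2 * (c ⬝ᵥ GammaGram *ᵥ c') = 2 * (z 0 * z' 1 + z 1 * z' 0) - (z 2 * z' 2 + z 3 * z' 3 +
      z 4 * z' 4 + z 5 * z' 5 + z 6 * z' 6 + z 7 * z' 7 + z 8 * z' 8 + z 9 * z' 9) := by
  have h : 2 * (c ⬝ᵥ GammaGram *ᵥ c') = z ⬝ᵥ frameCogram *ᵥ z' := by
    rw [hz, hz', mulVec_dotProduct_mulVec, gram_frame, Matrix.smul_mulVec, dotProduct_smul,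
      smul_eq_mul]
  rw [h]
  simp [dotProduct, Matrix.mulVec, frameCogram, Fin.sum_univ_succ]
  ring

/-- Coordinates, in the frame `frameMat`, of five vectors which span a Lagrangian of `Γ` modulo
a divisor of `1 + a ^ 2 + b ^ 2`. -/
def lagrMat (a b : ℤ) : Matrix (Fin 5) (Fin 10) ℤ :=
  !![1,0,0,0,0,0,0,0,0,0;
     0,0,1,0,a,b,0,0,0,0;
     0,0,0,1,-b,a,0,0,0,0;
     0,0,0,0,0,0,1,0,a,b;
     0,0,0,0,0,0,0,1,-b,a]

lemma exists_sq_add_sq (p : ℕ) (hp : p.Prime) : ∃ a b : ℤ, (p : ℤ) ∣ 1 + a ^ 2 + b ^ 2 := by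
  have := Fact.mk hp
  obtain ⟨a, b, h⟩ := ZMod.sq_add_sq p (-1)
  obtain ⟨a, rfl⟩ := ZMod.intCast_surjective a
  obtain ⟨b, rfl⟩ := ZMod.intCast_surjective b
  refine ⟨a, b, (ZMod.intCast_zmod_eq_zero_iff_dvd _ p).mp ?_⟩
  push_cast
  linear_combination h

/-- `Γ` modulo an odd prime has a Lagrangian subspace. -/
lemma exists_lagrangian_gamma (p : ℕ) (hp : p.Prime) (hp3 : 3 ≤ p) :
    ∃ f : Fin 5 → Fin 10 → ℤ, (∀ i j, (p : ℤ) ∣ f i ⬝ᵥ GammaGram *ᵥ f j) ∧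
      ∀ c c', (∀ i, (p : ℤ) ∣ f i ⬝ᵥ GammaGram *ᵥ c) → (∀ i, (p : ℤ) ∣ f i ⬝ᵥ GammaGram *ᵥ c') →
        (p : ℤ) ∣ c ⬝ᵥ GammaGram *ᵥ c' := by
  obtain ⟨a, b, q, hq⟩ := exists_sq_add_sq p hp
  have key : ∀ i c, frameMatᵀ *ᵥ (lagrMat a b i) ⬝ᵥ GammaGram *ᵥ c =
      lagrMat a b i ⬝ᵥ (frameMat * GammaGram) *ᵥ c := fun i c => by
    have := mulVec_dotProduct_mulVec frameMatᵀ GammaGram 1 (lagrMat a b i) c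
    rwa [Matrix.one_mulVec, Matrix.transpose_transpose, Matrix.mul_one] at this
  refine ⟨fun i => frameMatᵀ *ᵥ (lagrMat a b i), fun i j => ?_, fun c c' h h' => ?_⟩
  · have : frameMatᵀ *ᵥ (lagrMat a b i) ⬝ᵥ GammaGram *ᵥ frameMatᵀ *ᵥ (lagrMat a b j) =
        lagrMat a b i ⬝ᵥ frameGram *ᵥ lagrMat a b j := by
      rw [mulVec_dotProduct_mulVec, Matrix.transpose_transpose, frame_gram]
    rw [this]
    fin_cases i <;> fin_cases j <;>
      simp [lagrMat, frameGram, dotProduct, Matrix.mulVec, Fin.sum_univ_succ] <;>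
      first | exact ⟨0, by ring1⟩ | exact ⟨-2 * q, by linear_combination -2 * hq⟩
  · obtain ⟨z, hz⟩ : ∃ z, z = (frameMat * GammaGram) *ᵥ c := ⟨_, rfl⟩
    obtain ⟨z', hz'⟩ : ∃ z, z = (frameMat * GammaGram) *ᵥ c' := ⟨_, rfl⟩
    simp only [key, ← hz] at h
    simp only [key, ← hz'] at h'
    simp only [Fin.forall_fin_succ, lagrMat, dotProduct, Fin.sum_univ_succ] at h h'
    simp at h h'
    have h2 := bilin_gamma c c' z z' hz hz'
    obtain ⟨⟨k0, e0⟩, ⟨k1, e1⟩, ⟨k2, e2⟩, ⟨k3, e3⟩, k4, e4⟩ := h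
    obtain ⟨⟨l0, d0⟩, ⟨l1, d1⟩, ⟨l2, d2⟩, ⟨l3, d3⟩, l4, d4⟩ := h'
    have h3 : (p : ℤ) ∣ 2 * (c ⬝ᵥ GammaGram *ᵥ c') := by
      refine ⟨2 * (k0 * z' 1 + z 1 * l0) - (k1 * z' 2 - (a * z 4 + b * z 5) * l1 + k2 * z' 3 -
        (-(b * z 4) + a * z 5) * l2 + k3 * z' 6 - (a * z 8 + b * z 9) * l3 + k4 * z' 7 -
        (-(b * z 8) + a * z 9) * l4 + q * (z 4 * z' 4 + z 5 * z' 5 + z 8 * z' 8 + z 9 * z' 9)), ?_⟩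
      linear_combination h2 + 2 * e0 * z' 1 + 2 * z 1 * d0 - (e1 * z' 2 - (a * z 4 + b * z 5) * d1
        + e2 * z' 3 - (-(b * z 4) + a * z 5) * d2 + e3 * z' 6 - (a * z 8 + b * z 9) * d3 + e4 * z' 7
        - (-(b * z 8) + a * z 9) * d4
        + hq * (z 4 * z' 4 + z 5 * z' 5 + z 8 * z' 8 + z 9 * z' 9))
    refine (Nat.prime_iff_prime_int.mp hp).dvd_mul.mp h3 |>.resolve_left ?_
    intro h
    have := Int.le_of_dvd two_pos h
    lia

end Enriques

namespace Enriques
open LinearMap (BilinForm)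
open Module Submodule

set_option linter.unusedSectionVars false

section
variable {ι : Type} [Fintype ι] [DecidableEq ι] {G : Matrix ι ι ℤ}

lemma dotProduct_symm (hs : G.IsSymm) (x y : ι → ℤ) : x ⬝ᵥ G *ᵥ y = y ⬝ᵥ G *ᵥ x := by
  rw [Matrix.dotProduct_mulVec, ← Matrix.mulVec_transpose, hs.eq, dotProduct_comm]

lemma smul_mem_stdLat_of_mem_dual {p : ℕ} (hs : G.IsSymm) (hd : G.det ≠ 0)
    (hP : ∀ v, ∃ w, G *ᵥ w = (p : ℤ) • v) {a : ι → ℚ}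
    (ha : a ∈ (gramForm G).dualSubmodule (stdLat ι)) : (p : ℚ) • a ∈ stdLat ι := by
  choose k hk using fun i : ι => mem_dual_iff.mp ha _ (intVec_mem (Pi.single i 1))
  obtain ⟨w, hw⟩ := hP k
  refine mem_stdLat.mpr ⟨w, ?_⟩
  rw [← sub_eq_zero]
  refine (gramForm_nondegenerate hd).1 _ fun y => ?_
  suffices h : gramForm G ((p : ℚ) • a - intVec w) = 0 by rw [h]; rfl
  refine (Pi.basisFun ℚ ι).ext fun i => ?_
  have h1 : Pi.basisFun ℚ ι i = intVec (Pi.single i 1) := by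
    ext j; simp [intVec, Pi.single_apply]
  rw [h1, map_sub, map_smul, LinearMap.sub_apply, LinearMap.smul_apply, hk,
    gramForm_intVec, dotProduct_symm hs, hw]
  simp

lemma isLattice_sup_of_fg {V : Type} [AddCommGroup V] [Module ℚ V] (Λ T : Submodule ℤ V)
    [IsLattice ℚ Λ] (hT : T.FG) : IsLattice ℚ (Λ ⊔ T : Submodule ℤ V) :=
  isLattice_of_fg_of_smul ((IsLattice.fg (A := ℚ)).sup hT) fun x => by
    obtain ⟨n, hn, h⟩ := exists_smul_mem Λ x
    exact ⟨n, hn, le_sup_left (a := Λ) h⟩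

end

lemma ncard_pos_lorentz (n : ℕ) :
    {i : Fin (n + 1) | (0 : ℝ) < if i = 0 then (1 : ℝ) else -1}.ncard = 1 := by
  rw [Set.ncard_eq_one]
  refine ⟨0, Set.ext fun i => ?_⟩
  by_cases h : i = 0 <;> simp [h]

lemma Isometry.smul {V V' : Type*} [AddCommGroup V] [Module ℚ V] [AddCommGroup V'] [Module ℚ V']
    {B : BilinForm ℚ V} {B' : BilinForm ℚ V'} {e : V ≃ₗ[ℚ] V'} (h : Isometry B B' e) (c : ℚ) :
    Isometry (c • B) (c • B') e := fun x y => by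
  simp [h x y]

lemma dvd_of_orthogonal {p σ : ℕ} (hp : p.Prime) (hp3 : 3 ≤ p) (hσ : 6 ≤ σ)
    {G : Matrix (Fin 22) (Fin 22) ℤ} (hd : G.det.natAbs = p ^ (2 * σ))
    (hP : ∀ v, ∃ w, G *ᵥ w = (p : ℤ) • v)
    {e : Matrix (Fin 22) (Fin 10) ℤ} (he : eᵀ * G * e = GammaTwoGram) {k k' : Fin 22 → ℤ}
    (hk : k ᵥ* (G * e) = 0) (hk' : (eᵀ * G) *ᵥ k' = 0) : (p : ℤ) ∣ k ⬝ᵥ G *ᵥ k' := by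
  have := Fact.mk hp
  let c := Int.castRingHom (ZMod p)
  have hr := finrank_range_of_det hP hd
  have hr' : (G.map c).rank ≤ 10 := by
    have : (G.map c).rank + 2 * σ = 22 := hr.trans (by simp)
    lia
  let C := Matrix.fromCols e (Matrix.replicateCol Unit k)
  let C' := Matrix.fromCols e (Matrix.replicateCol Unit k')
  have hC : Cᵀ * G * C' = Matrix.fromBlocks GammaTwoGram 0 0
      (Matrix.of fun _ _ : Unit => k ⬝ᵥ G *ᵥ k') := by
    ext (i | i) (j | j)
    · exact congrFun (congrFun he i) j
    · exact congrFun hk' i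
    · rw [Matrix.mul_assoc]
      exact congrFun hk j
    · rw [Matrix.mul_assoc]
      rfl
  by_contra hcon
  have hdet : ((Cᵀ * G * C').map c).det ≠ 0 := by
    have hc : (c 2 : ZMod p) ≠ 0 := by
      intro h
      have h2 : ((2 : ℕ) : ZMod p) = 0 := by simpa [c] using h
      have := Nat.le_of_dvd two_pos ((ZMod.natCast_eq_zero_iff 2 p).mp h2)
      lia
    have h1 : c GammaGram.det ≠ 0 := fun h => by
      have := congrArg (fun M => c M.det) gamma_mul_inv
      simp only [Matrix.det_mul, map_mul, h, zero_mul, Matrix.det_one, map_one] at this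
      exact zero_ne_one this
    have hz : (0 : Matrix Unit (Fin 10) ℤ).map c = 0 := by ext; simp
    rw [hC, Matrix.fromBlocks_map, hz, Matrix.det_fromBlocks_zero₂₁]
    refine mul_ne_zero ?_ ?_
    · rw [← RingHom.mapMatrix_apply, ← RingHom.map_det, GammaTwoGram, Matrix.det_smul, map_mul,
        map_pow]
      exact mul_ne_zero (pow_ne_zero _ hc) h1
    · rw [Matrix.det_unique]
      exact fun h => hcon ((ZMod.intCast_zmod_eq_zero_iff_dvd _ p).mp h)
  have := Matrix.rank_of_isUnit _ ((Matrix.isUnit_iff_isUnit_det _).mpr hdet.isUnit)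
  rw [Matrix.map_mul, Matrix.map_mul] at this
  have h3 := (Matrix.rank_mul_le_left (Cᵀ.map c * G.map c) (C'.map c)).trans
    (Matrix.rank_mul_le_right (Cᵀ.map c) (G.map c))
  rw [this] at h3
  simp at h3
  lia

/-- A supersingular lattice of Artin invariant at least six does not contain `Γ(2)`. -/
theorem not_exists_gammaTwo {p σ : ℕ} (hp : p.Prime) (hp3 : 3 ≤ p) (hσ : 6 ≤ σ)
    {G : Matrix (Fin 22) (Fin 22) ℤ} (hG : IsSSK3Gram p σ G)
    {e : Matrix (Fin 22) (Fin 10) ℤ} (he : eᵀ * G * e = GammaTwoGram) : False := by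
  obtain ⟨hs, hev, hd, hP, S, hS, hSG⟩ := hG
  have hp0 : (p : ℚ) ≠ 0 := by exact_mod_cast hp.ne_zero
  have hpp := Nat.prime_iff_prime_int.mp hp
  have hd' : G.det.natAbs = p ^ (2 * σ) := by
    rw [hd, Int.natAbs_neg, Int.natAbs_pow, Int.natAbs_natCast]
  have hd0 : G.det ≠ 0 := by
    rw [← Int.natAbs_ne_zero, hd']; exact pow_ne_zero _ hp.ne_zero
  have h2 : ∀ n : ℤ, (p : ℤ) ∣ 2 * n → (p : ℤ) ∣ n := fun n h =>
    (hpp.dvd_mul.mp h).resolve_left fun h => by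
      have := Int.le_of_dvd two_pos h
      lia
  set B := gramForm G with hB
  have hBs : B.IsSymm := gramForm_isSymm hs
  have hBn : B.Nondegenerate := gramForm_nondegenerate hd0
  obtain ⟨f, hf, hf'⟩ := exists_lagrangian_gamma p hp hp3
  have hprod : ∀ x y : Fin 10 → ℤ, (e *ᵥ x) ⬝ᵥ G *ᵥ (e *ᵥ y) = 2 * (x ⬝ᵥ GammaGram *ᵥ y) := by
    intro x y
    rw [mulVec_dotProduct_mulVec, he, GammaTwoGram, Matrix.smul_mulVec, dotProduct_smul,
      smul_eq_mul]
  let m : Fin 5 → Fin 22 → ℚ := fun i => (p : ℚ)⁻¹ • intVec (e *ᵥ f i)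
  let T : Submodule ℤ (Fin 22 → ℚ) := span ℤ (Set.range m)
  have hT : T.FG := Submodule.fg_span (Set.finite_range m)
  have := dual_isLattice hBn (stdLat (Fin 22))
  have hW := isLattice_sup_of_fg (B.dualSubmodule (stdLat (Fin 22))) T hT
  have hTd : ∀ x, x ∈ B.dualSubmodule T ↔ ∀ i, ∃ k : ℤ, B x (m i) = k := by
    intro x
    rw [mem_dual_iff]
    refine ⟨fun h i => h _ (subset_span ⟨i, rfl⟩), fun h y hy => ?_⟩
    induction hy using Submodule.span_induction with
    | mem y hy => obtain ⟨i, rfl⟩ := hy; exact h i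
    | zero => exact ⟨0, by simp⟩
    | add y z _ _ hy hz =>
      obtain ⟨a, ha⟩ := hy
      obtain ⟨b, hb⟩ := hz
      exact ⟨a + b, by simp [ha, hb]⟩
    | smul n y _ hy =>
      obtain ⟨a, ha⟩ := hy
      exact ⟨n * a, by rw [map_zsmul, ha]; simp⟩
  set N := stdLat (Fin 22) ⊓ B.dualSubmodule T with hN
  have hN' : N = B.dualSubmodule (B.dualSubmodule (stdLat (Fin 22)) ⊔ T) := by
    rw [dual_sup, dual_dual hBn hBs]
  have hNl : IsLattice ℚ N := by rw [hN']; exact dual_isLattice hBn _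
  have hNd : B.dualSubmodule N = B.dualSubmodule (stdLat (Fin 22)) ⊔ T := by
    rw [hN', dual_dual hBn hBs]
  have hNm : ∀ z : Fin 22 → ℤ, intVec z ∈ N → ∀ i, (p : ℤ) ∣ z ⬝ᵥ G *ᵥ (e *ᵥ f i) := by
    intro z hz i
    obtain ⟨k, hk⟩ := (hTd _).mp hz.2 i
    refine ⟨k, ?_⟩
    rw [map_smul, gramForm_intVec, smul_eq_mul, inv_mul_eq_iff_eq_mul₀ hp0] at hk
    exact_mod_cast hk
  have hprods : ∀ z z' : Fin 22 → ℤ, intVec z ∈ N → intVec z' ∈ N → (p : ℤ) ∣ z ⬝ᵥ G *ᵥ z' := by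
    have hz : ∀ z : Fin 22 → ℤ, intVec z ∈ N → ∃ c k, (2 : ℤ) • z = e *ᵥ c + k ∧
        (eᵀ * G) *ᵥ k = 0 ∧ ∀ i, (p : ℤ) ∣ f i ⬝ᵥ GammaGram *ᵥ c := by
      intro z hz
      refine ⟨gammaInv *ᵥ (eᵀ * G) *ᵥ z, (2 : ℤ) • z - e *ᵥ (gammaInv *ᵥ (eᵀ * G) *ᵥ z), by abel,
        ?_, fun i => ?_⟩
      · rw [Matrix.mulVec_sub, Matrix.mulVec_mulVec, he, Matrix.mulVec_mulVec, GammaTwoGram,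
          Matrix.smul_mul, gamma_mul_inv, Matrix.mulVec_smul, Matrix.smul_mulVec,
          Matrix.one_mulVec, sub_self]
      · rw [Matrix.mulVec_mulVec, gamma_mul_inv, Matrix.one_mulVec]
        have := hNm z hz i
        rw [dotProduct_symm hs] at this
        have h3 := mulVec_dotProduct_mulVec e G 1 (f i) z
        rw [Matrix.one_mulVec, Matrix.mul_one] at h3
        rwa [← h3]
    intro z z' h h'
    obtain ⟨c, k, hz1, hk, hc⟩ := hz z h
    obtain ⟨c', k', hz1', hk', hc'⟩ := hz z' h'
    have hkk : k ᵥ* (G * e) = 0 := by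
      rw [← Matrix.mulVec_transpose, Matrix.transpose_mul, hs.eq, hk]
    have h1 : k ⬝ᵥ G *ᵥ (e *ᵥ c') = 0 := by
      rw [Matrix.mulVec_mulVec, Matrix.dotProduct_mulVec, hkk, zero_dotProduct]
    have h3 : (e *ᵥ c) ⬝ᵥ G *ᵥ k' = 0 := by
      have h3 := mulVec_dotProduct_mulVec e G 1 c k'
      rwa [Matrix.one_mulVec, Matrix.mul_one, hk', dotProduct_zero] at h3
    have h4 : 2 * (2 * (z ⬝ᵥ G *ᵥ z')) = 2 * (c ⬝ᵥ GammaGram *ᵥ c') + k ⬝ᵥ G *ᵥ k' := by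
      have : ((2 : ℤ) • z) ⬝ᵥ G *ᵥ ((2 : ℤ) • z') =
          2 * (c ⬝ᵥ GammaGram *ᵥ c') + k ⬝ᵥ G *ᵥ k' := by
        rw [hz1, hz1', Matrix.mulVec_add, add_dotProduct, dotProduct_add, dotProduct_add, h1, h3,
          hprod]
        ring
      rw [← this, Matrix.mulVec_smul, dotProduct_smul, smul_dotProduct]
      simp
    refine h2 _ (h2 _ ?_)
    rw [h4]
    exact dvd_add ((hf' c c' hc hc').mul_left 2) (dvd_of_orthogonal hp hp3 hσ hd' hP he hkk hk')
  have hself : ((p : ℚ)⁻¹ • B).dualSubmodule N = N := by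
    refine le_antisymm (fun x hx => ?_) (fun x hx => ?_)
    · have hx' : (p : ℚ)⁻¹ • x ∈ B.dualSubmodule N := by
        rw [mem_dual_iff] at hx ⊢
        simpa using hx
      rw [hNd] at hx'
      obtain ⟨a, ha, t, ht, hat⟩ := Submodule.mem_sup.mp hx'
      have hxe : x = (p : ℚ) • a + (p : ℚ) • t := by
        rw [← smul_add, hat, smul_smul, mul_inv_cancel₀ hp0, one_smul]
      have hpt : (p : ℚ) • t ∈ N := by
        clear hx' hat hxe
        induction ht using Submodule.span_induction with
        | mem y hy =>
          obtain ⟨i, rfl⟩ := hy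
          have hm : (p : ℚ) • m i = intVec (e *ᵥ f i) := by simp [m, smul_smul, hp0]
          rw [hm]
          refine ⟨intVec_mem _, (hTd _).mpr fun j => ?_⟩
          obtain ⟨k, hk⟩ := hf i j
          exact ⟨2 * k, by rw [map_smul, hB, gramForm_intVec, hprod, hk]; simp; field_simp⟩
        | zero => simp
        | add y z _ _ hy hz => rw [smul_add]; exact add_mem hy hz
        | smul n y _ hy => rw [smul_comm]; exact N.smul_mem n hy
      rw [hxe]
      refine add_mem ⟨smul_mem_stdLat_of_mem_dual hs hd0 hP ha, (hTd _).mpr fun i => ?_⟩ hpt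
      obtain ⟨k, hk⟩ := mem_dual_iff.mp ha _ (intVec_mem (e *ᵥ f i))
      exact ⟨k, by simp [m, hk, hp0]⟩
    · rw [mem_dual_iff]
      intro y hy
      obtain ⟨z, rfl⟩ := mem_stdLat.mp hx.1
      obtain ⟨z', rfl⟩ := mem_stdLat.mp hy.1
      obtain ⟨k, hk⟩ := hprods z z' hx hy
      refine ⟨k, ?_⟩
      simp [hB, gramForm_intVec, hk, hp0]
  have hNe : IsEvenLat ((p : ℚ)⁻¹ • B) N := by
    intro x hx
    obtain ⟨z, rfl⟩ := mem_stdLat.mp hx.1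
    obtain ⟨k, hk⟩ := hprods z z hx hx
    obtain ⟨l, hl⟩ := hev z
    have h4 : (2 : ℤ) ∣ p * k := ⟨l, by rw [← hk, ← hl]; rfl⟩
    obtain ⟨j, rfl⟩ := (Int.prime_two.dvd_mul.mp h4).resolve_left fun h => by
      have := (Nat.prime_dvd_prime_iff_eq Nat.prime_two hp).mp (by exact_mod_cast h)
      lia
    refine ⟨j, ?_⟩
    simp [hB, gramForm_intVec, hk, hp0]
  obtain ⟨d, g, hd1, hg⟩ := exists_diag hBn hBs
  have hcard := card_pos_eq_of_real hg hS hSG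
  rw [ncard_pos_lorentz] at hcard
  have h8 := eight_dvd_of_isometry (f := fun i => (p : ℚ)⁻¹ * d i)
    (fun i => mul_ne_zero (inv_ne_zero hp0) (hd1 i)) (B := (p : ℚ)⁻¹ • B) (e := g) (fun x y => by
      simp [dform_apply, ← hg x y, Finset.mul_sum, mul_assoc]) N hself hNe
  have hpos : ∀ i, 0 < (p : ℚ)⁻¹ * d i ↔ 0 < d i := fun i =>
    mul_pos_iff_of_pos_left (by positivity)
  simp only [hpos, hcard] at h8
  simp at h8

end Enriques

namespace Enriques
open LinearMap (BilinForm)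
open Module Submodule

set_option linter.unusedSectionVars false

section
variable {V : Type} [AddCommGroup V] [Module ℚ V] {B : BilinForm ℚ V}

/-- Maximal even lattices. -/
def IsMaxEven (B : BilinForm ℚ V) (Λ : Submodule ℤ V) : Prop :=
  IsEvenLat B Λ ∧ ∀ x ∈ B.dualSubmodule Λ, (∃ k : ℤ, B x x = 2 * k) → x ∈ Λ

lemma exists_isMaxEven (hB : B.Nondegenerate) (hs : B.IsSymm) (Λ : Submodule ℤ V) [IsLattice ℚ Λ]
    (he : IsEvenLat B Λ) : ∃ Λ', Λ ≤ Λ' ∧ IsLattice ℚ Λ' ∧ IsMaxEven B Λ' := by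
  have hD := dual_isLattice hB Λ
  set D := B.dualSubmodule Λ
  have : Module.Finite ℤ D := Submodule.IsLattice.finite ℚ D
  have hle : ∀ Λ', Λ ≤ Λ' → IsEvenLat B Λ' → Λ' ≤ D := fun Λ' h h' =>
    (h'.le_dual hs).trans (dual_anti h)
  let S : Set (Submodule ℤ D) := {X | Λ ≤ X.map D.subtype ∧ IsEvenLat B (X.map D.subtype)}
  have hmap : ∀ Λ', Λ' ≤ D → (Λ'.comap D.subtype).map D.subtype = Λ' := fun Λ' h => by
    rw [Submodule.map_comap_subtype, inf_eq_right.mpr h]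
  have hS : S.Nonempty := by
    have := hmap Λ (hle Λ le_rfl he)
    exact ⟨Λ.comap D.subtype, by rw [this], by rwa [this]⟩
  obtain ⟨X, ⟨hX, hXe⟩, hmax⟩ := set_has_maximal_iff_noetherian.mpr
    (inferInstance : IsNoetherian ℤ D) S hS
  refine ⟨X.map D.subtype, hX, ?_, hXe, fun x hx hxx => ?_⟩
  · refine isLattice_of_fg_of_smul ((IsNoetherian.noetherian X).map _) fun x => ?_
    obtain ⟨n, hn, h⟩ := exists_smul_mem Λ x
    exact ⟨n, hn, hX h⟩
  · obtain ⟨k, hk⟩ := hxx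
    have h1 := hXe.sup_span_singleton hs hx hk
    have h2 := hX.trans (le_sup_left (b := span ℤ {x}))
    have h3 := hmap _ (hle _ h2 h1)
    have h4 := hmax ((X.map D.subtype ⊔ span ℤ {x}).comap D.subtype) (by
      refine ⟨by rw [h3]; exact h2, by rw [h3]; exact h1⟩)
    have h5 : X = (X.map D.subtype ⊔ span ℤ {x}).comap D.subtype := by
      refine (lt_or_eq_of_le fun y hy => ?_).resolve_left h4
      exact le_sup_left (a := X.map D.subtype) ⟨y, hy, rfl⟩
    rw [h5, h3]
    exact le_sup_right (a := X.map D.subtype) (mem_span_singleton_self x)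

end

section
variable {ι : Type} [Fintype ι] [DecidableEq ι]

lemma intVec_single (i : ι) : intVec (Pi.single i 1) = Pi.single i (1 : ℚ) := by
  ext j; simp [intVec, Pi.single_apply]

lemma exists_equiv_stdLat (Λ : Submodule ℤ (ι → ℚ)) [IsLattice ℚ Λ] :
    ∃ e : (ι → ℚ) ≃ₗ[ℚ] (ι → ℚ), mapLat e Λ = stdLat ι := by
  obtain ⟨κ, _, b, hb⟩ := exists_rat_basis Λ
  have hc : Fintype.card κ = Fintype.card ι := by
    rw [← Module.finrank_eq_card_basis b, Module.finrank_fintype_fun_eq_card]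
  obtain ⟨b', hb'⟩ : ∃ b' : Basis ι ℚ (ι → ℚ), Λ = span ℤ (Set.range b') :=
    ⟨b.reindex (Fintype.equivOfCardEq hc), by rw [hb]; simp⟩
  refine ⟨b'.equivFun, ?_⟩
  ext x
  have hx : ∀ i, b'.repr (b'.equivFun.symm x) i = x i := fun i => by
    rw [← Basis.equivFun_apply, LinearEquiv.apply_symm_apply]
  rw [mem_mapLat, hb', b'.mem_span_iff_repr_mem ℤ, mem_stdLat]
  simp only [hx]
  constructor
  · intro h
    choose z hz using h
    refine ⟨z, funext fun i => ?_⟩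
    exact (hz i).symm
  · rintro ⟨z, rfl⟩ i
    exact ⟨z i, rfl⟩

lemma exists_intMatrix {κ : Type} [Fintype κ] [DecidableEq κ] (h : (ι → ℚ) →ₗ[ℚ] (κ → ℚ))
    (hh : ∀ x ∈ stdLat ι, h x ∈ stdLat κ) :
    ∃ A : Matrix κ ι ℤ, ∀ z, h (intVec z) = intVec (A *ᵥ z) := by
  choose a ha using fun i => mem_stdLat.mp (hh _ (intVec_mem (Pi.single i 1)))
  refine ⟨Matrix.of fun k i => a i k, fun z => ?_⟩
  have : intVec z = ∑ i, (z i : ℚ) • intVec (Pi.single i 1) := by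
    ext j
    simp [intVec, Finset.sum_apply, Pi.single_apply]
  rw [this, map_sum]
  ext k
  simp only [map_smul, ha, Finset.sum_apply]
  simp [intVec, Matrix.mulVec, dotProduct, mul_comm]

lemma gram_ext {G G' : Matrix ι ι ℤ} (h : ∀ x y, x ⬝ᵥ G *ᵥ y = x ⬝ᵥ G' *ᵥ y) : G = G' := by
  ext i j
  simpa using h (Pi.single i 1) (Pi.single j 1)

lemma eq_transpose_mul_mul {κ : Type} [Fintype κ] [DecidableEq κ] {G : Matrix ι ι ℤ}
    {G' : Matrix κ κ ℤ} {e : (ι → ℚ) ≃ₗ[ℚ] (κ → ℚ)} (he : Isometry (gramForm G) (gramForm G') e)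
    {A : Matrix κ ι ℤ} (hA : ∀ z, e (intVec z) = intVec (A *ᵥ z)) : G = Aᵀ * G' * A := by
  refine gram_ext fun x y => ?_
  rw [← mulVec_dotProduct_mulVec]
  have := he (intVec x) (intVec y)
  rw [hA, hA, gramForm_intVec, gramForm_intVec] at this
  exact_mod_cast this.symm

/-- A bilinear form which is integral on a lattice is given by an integral Gram matrix. -/
lemma exists_gram {V : Type} [AddCommGroup V] [Module ℚ V] {B : BilinForm ℚ V} {Λ : Submodule ℤ V}
    (hB : ∀ x ∈ Λ, ∀ y ∈ Λ, ∃ k : ℤ, B x y = k) (e : V ≃ₗ[ℚ] (ι → ℚ)) (he : mapLat e Λ = stdLat ι) :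
    ∃ G : Matrix ι ι ℤ, Isometry B (gramForm G) e := by
  have hmem : ∀ i : ι, e.symm (intVec (Pi.single i 1)) ∈ Λ := fun i =>
    mem_mapLat.mp (he ▸ intVec_mem _)
  choose G hG using fun i j => hB _ (hmem i) _ (hmem j)
  refine ⟨Matrix.of G, fun x y => ?_⟩
  have key : (gramForm (Matrix.of G)) = B.compl₁₂ e.symm.toLinearMap e.symm.toLinearMap := by
    refine (Pi.basisFun ℚ ι).ext fun i => (Pi.basisFun ℚ ι).ext fun j => ?_
    have h1 : ∀ i, Pi.basisFun ℚ ι i = intVec (Pi.single i 1) := fun i => by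
      rw [intVec_single]; simp
    rw [h1, h1, gramForm_intVec]
    simp [hG]
  rw [key]
  simp

end
end Enriques

namespace Enriques
open LinearMap (BilinForm)
open Module Submodule

set_option linter.unusedSectionVars false

/-- A ternary quadratic form has a nontrivial zero modulo `p`. -/
lemma exists_ternary_zero {p : ℕ} (hp : p.Prime) (m : Fin 3 → Fin 3 → ℤ) :
    ∃ t : Fin 3 → ℤ, (∃ i, ¬ (p : ℤ) ∣ t i) ∧ (p : ℤ) ∣ ∑ i, ∑ j, t i * t j * m i j := by
  classical
  have := Fact.mk hp
  let f : MvPolynomial (Fin 3) (ZMod p) := ∑ i, ∑ j,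
    MvPolynomial.X i * MvPolynomial.X j * MvPolynomial.C (m i j : ZMod p)
  have hf : f.totalDegree < Fintype.card (Fin 3) := by
    refine lt_of_le_of_lt (b := 2) ?_ (by simp)
    refine MvPolynomial.totalDegree_finsetSum_le fun i _ =>
      MvPolynomial.totalDegree_finsetSum_le fun j _ => ?_
    refine (MvPolynomial.totalDegree_mul _ _).trans ?_
    refine (add_le_add (MvPolynomial.totalDegree_mul _ _) le_rfl).trans ?_
    rw [MvPolynomial.totalDegree_X, MvPolynomial.totalDegree_X, MvPolynomial.totalDegree_C]
  have h := char_dvd_card_solutions p hf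
  have h0 : 1 < Fintype.card {x : Fin 3 → ZMod p // MvPolynomial.eval x f = 0} := by
    refine hp.one_lt.trans_le (Nat.le_of_dvd (Fintype.card_pos_iff.mpr ⟨⟨0, ?_⟩⟩) h)
    simp [f]
  have := Fintype.one_lt_card_iff_nontrivial.mp h0
  obtain ⟨⟨x, hx⟩, hx0⟩ := exists_ne (⟨0, by simp [f]⟩ : {x // MvPolynomial.eval x f = 0})
  choose t ht using fun i => ZMod.intCast_surjective (x i)
  refine ⟨t, ?_, ?_⟩
  · by_contra! hc
    refine hx0 (Subtype.ext (funext fun i => ?_))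
    have := (ZMod.intCast_zmod_eq_zero_iff_dvd _ _).mpr (hc i)
    simpa [← ht] using this
  · rw [← ZMod.intCast_zmod_eq_zero_iff_dvd]
    simpa [f, ht] using hx

section
variable {V : Type} [AddCommGroup V] [Module ℚ V] {B : BilinForm ℚ V} {Λ : Submodule ℤ V} {p : ℕ}

lemma IsMaxEven.exists_sum_mem (h : IsMaxEven B Λ) (hp : p.Prime) (hp3 : 3 ≤ p)
    (hD : ∀ x ∈ B.dualSubmodule Λ, (p : ℤ) • x ∈ Λ) {x : Fin 3 → V}
    (hx : ∀ i, x i ∈ B.dualSubmodule Λ) :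
    ∃ t : Fin 3 → ℤ, (∃ i, ¬ (p : ℤ) ∣ t i) ∧ ∑ i, t i • x i ∈ Λ := by
  have hp0 : (p : ℚ) ≠ 0 := by exact_mod_cast hp.ne_zero
  choose m hm using fun i j => mem_dual_iff.mp (hx i) _ (hD _ (hx j))
  obtain ⟨t, ht, k, hk⟩ := exists_ternary_zero hp m
  have hmem : ∑ i, t i • x i ∈ B.dualSubmodule Λ := sum_mem fun i _ => zsmul_mem (hx i) _
  refine ⟨t, ht, h.2 _ hmem ?_⟩
  have hBx : ∀ i j, B (x i) (x j) = m i j / p := fun i j => by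
    rw [eq_div_iff hp0, ← hm, map_zsmul]; simp [mul_comm]
  have h1 : B (∑ i, t i • x i) (∑ i, t i • x i) = k := by
    have : B (∑ i, t i • x i) (∑ i, t i • x i) = (∑ i, ∑ j, t i * t j * m i j : ℤ) / p := by
      simp only [map_sum, LinearMap.sum_apply, map_zsmul, LinearMap.smul_apply, hBx,
        zsmul_eq_mul]
      push_cast
      simp only [Finset.sum_div, Finset.mul_sum]
      rw [Finset.sum_comm]
      refine Finset.sum_congr rfl fun i _ => Finset.sum_congr rfl fun j _ => ?_
      ring
    rw [this, hk]
    push_cast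
    field_simp
  obtain ⟨l, hl⟩ := h.1 _ (hD _ hmem)
  have h2 : (p : ℤ) * (p * k) = 2 * l := by
    rw [map_zsmul, LinearMap.map_smul_of_tower, LinearMap.smul_apply, h1] at hl
    simp only [zsmul_eq_mul, Int.cast_natCast] at hl
    exact_mod_cast hl
  have hodd : ¬ (2 : ℤ) ∣ p := fun h => by
    have := (Nat.prime_dvd_prime_iff_eq Nat.prime_two hp).mp (by exact_mod_cast h)
    lia
  have h3 : (2 : ℤ) ∣ k :=
    (Int.prime_two.dvd_mul.mp ((Int.prime_two.dvd_mul.mp ⟨l, h2⟩).resolve_left hodd)).resolve_left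
      hodd
  obtain ⟨j, rfl⟩ := h3
  exact ⟨j, by rw [h1]; push_cast; ring⟩

end

section
variable {ι : Type} [Fintype ι] [DecidableEq ι]

lemma exists_mulVec_eq {G : Matrix ι ι ℤ} (hs : G.IsSymm) (hd : G.det ≠ 0) {p : ℕ}
    (h : ∀ x ∈ (gramForm G).dualSubmodule (stdLat ι), (p : ℤ) • x ∈ stdLat ι) (v : ι → ℤ) :
    ∃ w, G *ᵥ w = (p : ℤ) • v := by
  have hu : IsUnit (G.map (Int.cast : ℤ → ℚ)).det := by
    rw [isUnit_iff_ne_zero]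
    have : (G.map Int.cast).det = (G.det : ℚ) := by
      simpa using (Int.cast_det (R := ℚ) G).symm
    rw [this]
    exact_mod_cast hd
  set y := (G.map (Int.cast : ℤ → ℚ))⁻¹ *ᵥ intVec v with hy
  have hGy : G.map (Int.cast : ℤ → ℚ) *ᵥ y = intVec v := by
    rw [hy, Matrix.mulVec_mulVec, Matrix.mul_nonsing_inv _ hu, Matrix.one_mulVec]
  have hyD : y ∈ (gramForm G).dualSubmodule (stdLat ι) := by
    rw [mem_dual_iff]
    intro z hz
    obtain ⟨z, rfl⟩ := mem_stdLat.mp hz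
    have hc : ∀ x y, gramForm G x y = gramForm G y x := (gramForm_isSymm hs).eq
    rw [hc, gramForm_apply, hGy]
    exact ⟨z ⬝ᵥ v, by simp [intVec, dotProduct]⟩
  obtain ⟨w, hw⟩ := mem_stdLat.mp (h y hyD)
  refine ⟨w, ?_⟩
  apply intVec_injective
  have : intVec (G *ᵥ w) = G.map (Int.cast : ℤ → ℚ) *ᵥ intVec w := by
    ext i; simp [intVec, Matrix.mulVec, dotProduct]
  rw [this, ← hw, Matrix.mulVec_smul, hGy]
  ext i; simp [intVec]

/-- An even lattice with `p`-elementary discriminant group of square order embeds into a maximal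
even lattice with Gram matrix of determinant an even power of `p`. -/
lemma exists_maximal_gram {G : Matrix ι ι ℤ} (hs : G.IsSymm) (hev : ∀ x, 2 ∣ x ⬝ᵥ G *ᵥ x) {p s : ℕ}
    (hp : p.Prime) (hdet : G.det.natAbs = p ^ (2 * s)) (hP : ∀ v, ∃ w, G *ᵥ w = (p : ℤ) • v) :
    ∃ (G' P : Matrix ι ι ℤ) (j : ℕ) (e : (ι → ℚ) ≃ₗ[ℚ] (ι → ℚ)), G = Pᵀ * G' * P ∧
      Isometry (gramForm G) (gramForm G') e ∧ IsMaxEven (gramForm G') (stdLat ι) ∧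
      (∀ v, ∃ w, G' *ᵥ w = (p : ℤ) • v) ∧ G'.IsSymm ∧ G'.det.natAbs = p ^ (2 * j) ∧
      (∀ z, e (intVec z) = intVec (P *ᵥ z)) := by
  have hd : G.det ≠ 0 := by
    rw [← Int.natAbs_ne_zero, hdet]; exact pow_ne_zero _ hp.ne_zero
  have hB := gramForm_nondegenerate hd
  have hBs := gramForm_isSymm hs
  have hE : IsEvenLat (gramForm G) (stdLat ι) := by
    intro x hx
    obtain ⟨z, rfl⟩ := mem_stdLat.mp hx
    obtain ⟨k, hk⟩ := hev z
    exact ⟨k, by rw [gramForm_intVec, hk]; simp⟩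
  obtain ⟨Λ, hle, hΛ, hmax⟩ := exists_isMaxEven hB hBs (stdLat ι) hE
  obtain ⟨e, he⟩ := exists_equiv_stdLat Λ
  obtain ⟨G', hG'⟩ := exists_gram (fun x hx y hy => hmax.1.exists_int hBs hx hy) e he
  obtain ⟨P, hPm⟩ := exists_intMatrix e.toLinearMap fun x hx => by
    rw [← he]; exact mem_mapLat.mpr (by simpa using hle hx)
  have hGP : G = Pᵀ * G' * P := eq_transpose_mul_mul hG' hPm
  have hdet' : G.det = P.det ^ 2 * G'.det := by
    rw [hGP, Matrix.det_mul, Matrix.det_mul, Matrix.det_transpose]; ring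
  have hd' : G'.det ≠ 0 := fun h => hd (by rw [hdet', h, mul_zero])
  have hs' : G'.IsSymm := by
    refine gram_ext fun x y => ?_
    have := hG' (e.symm (intVec x)) (e.symm (intVec y))
    have h2 := hG' (e.symm (intVec y)) (e.symm (intVec x))
    have hc : ∀ x y, gramForm G x y = gramForm G y x := hBs.eq
    rw [hc, ← h2] at this
    simp only [LinearEquiv.apply_symm_apply, gramForm_intVec] at this
    have h3 : x ⬝ᵥ G' *ᵥ y = y ⬝ᵥ G' *ᵥ x := by exact_mod_cast this
    rw [h3, Matrix.mulVec_transpose, dotProduct_comm, ← Matrix.dotProduct_mulVec]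
  have hmax' : IsMaxEven (gramForm G') (stdLat ι) := by
    rw [← he]
    refine ⟨hmax.1.map hG', fun x hx hk => ?_⟩
    rw [mapLat_dual hG'] at hx
    rw [mem_mapLat] at hx ⊢
    exact hmax.2 _ hx (by rwa [← hG', e.apply_symm_apply])
  have hP' : ∀ v, ∃ w, G' *ᵥ w = (p : ℤ) • v := by
    refine exists_mulVec_eq hs' hd' fun x hx => ?_
    rw [← he, mapLat_dual hG', mem_mapLat] at hx
    have := smul_mem_stdLat_of_mem_dual hs hd hP (dual_anti hle hx)
    rw [← he, mem_mapLat]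
    have h2 := hle this
    rwa [map_zsmul, ← Int.cast_smul_eq_zsmul ℚ, Int.cast_natCast]
  have hdn : P.det.natAbs ^ 2 * G'.det.natAbs = p ^ (2 * s) := by
    rw [← hdet, hdet', Int.natAbs_mul, Int.natAbs_pow]
  obtain ⟨k, -, hk⟩ := (Nat.dvd_prime_pow hp).mp ⟨_, hdn.symm⟩
  obtain ⟨i, -, hi⟩ := (Nat.dvd_prime_pow hp).mp ((dvd_pow_self _ two_ne_zero).trans ⟨_, hdn.symm⟩)
  obtain ⟨j, -, hj⟩ := (Nat.dvd_prime_pow hp).mp (Dvd.intro_left _ hdn)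
  rw [hi, hj, ← pow_mul, ← pow_add] at hdn
  have := Nat.pow_right_injective hp.two_le hdn
  obtain ⟨j', rfl⟩ : ∃ j', j = 2 * j' := ⟨s - i, by lia⟩
  exact ⟨G', P, j', e, hGP, hG', hmax', hP', hs', hj, hPm⟩

end
end Enriques

namespace Enriques
open LinearMap (BilinForm)
open Module Submodule

set_option linter.unusedSectionVars false

section
variable {ι κ : Type} [Fintype ι] [Fintype κ]

/-- The orthogonal sum of two lattices. -/
def sumLat (Λ : Submodule ℤ (ι → ℚ)) (Λ' : Submodule ℤ (κ → ℚ)) : Submodule ℤ (ι ⊕ κ → ℚ) :=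
  (Λ.prod Λ').map (LinearEquiv.sumArrowLequivProdArrow ι κ ℤ ℚ).symm.toLinearMap

lemma mem_sumLat {Λ : Submodule ℤ (ι → ℚ)} {Λ' : Submodule ℤ (κ → ℚ)} {x : ι ⊕ κ → ℚ} :
    x ∈ sumLat Λ Λ' ↔ x ∘ Sum.inl ∈ Λ ∧ x ∘ Sum.inr ∈ Λ' := by
  constructor
  · rintro ⟨⟨a, b⟩, ⟨ha, hb⟩, rfl⟩
    exact ⟨ha, hb⟩
  · rintro ⟨ha, hb⟩
    exact ⟨(x ∘ Sum.inl, x ∘ Sum.inr), ⟨ha, hb⟩, by ext (i | i) <;> rfl⟩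

lemma sumLat_isLattice (Λ : Submodule ℤ (ι → ℚ)) (Λ' : Submodule ℤ (κ → ℚ)) [IsLattice ℚ Λ]
    [IsLattice ℚ Λ'] : IsLattice ℚ (sumLat Λ Λ') := by
  refine isLattice_of_fg_of_smul
    (Submodule.FG.map _ ((IsLattice.fg (A := ℚ)).prod (IsLattice.fg (A := ℚ)))) fun x => ?_
  obtain ⟨n, hn, h⟩ := exists_smul_mem Λ (x ∘ Sum.inl)
  obtain ⟨n', hn', h'⟩ := exists_smul_mem Λ' (x ∘ Sum.inr)
  refine ⟨n * n', mul_ne_zero hn hn', mem_sumLat.mpr ⟨?_, ?_⟩⟩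
  · have := Λ.smul_mem n' h
    rwa [smul_smul, mul_comm] at this
  · have := Λ'.smul_mem n h'
    rwa [smul_smul] at this

lemma mem_dual_sumLat {f : ι → ℚ} {g : κ → ℚ} {Λ : Submodule ℤ (ι → ℚ)}
    {Λ' : Submodule ℤ (κ → ℚ)} {x : ι ⊕ κ → ℚ} :
    x ∈ (dform (Sum.elim f g)).dualSubmodule (sumLat Λ Λ') ↔
      x ∘ Sum.inl ∈ (dform f).dualSubmodule Λ ∧ x ∘ Sum.inr ∈ (dform g).dualSubmodule Λ' := by
  simp only [mem_dual_iff]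
  constructor
  · intro h
    constructor
    · intro y hy
      obtain ⟨k, hk⟩ := h (Sum.elim y 0) (mem_sumLat.mpr ⟨by simpa using hy, by
        rw [Sum.elim_comp_inr]; exact zero_mem _⟩)
      exact ⟨k, by rw [← hk, dform_sumElim]; simp⟩
    · intro y hy
      obtain ⟨k, hk⟩ := h (Sum.elim 0 y) (mem_sumLat.mpr ⟨by
        rw [Sum.elim_comp_inl]; exact zero_mem _, by simpa using hy⟩)
      exact ⟨k, by rw [← hk, dform_sumElim]; simp⟩
  · rintro ⟨h, h'⟩ y hy
    rw [mem_sumLat] at hy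
    obtain ⟨k, hk⟩ := h _ hy.1
    obtain ⟨l, hl⟩ := h' _ hy.2
    exact ⟨k + l, by rw [dform_sumElim, hk, hl]; simp⟩

end

section
variable {V : Type} [AddCommGroup V] [Module ℚ V]

/-- An integral lattice whose discriminant form is an anisotropic plane over `𝔽_p`. -/
structure AnisoPlane (B : BilinForm ℚ V) (Λ : Submodule ℤ V) (p : ℕ) (a₁ a₂ : V) (α₁ α₂ : ℤ) :
    Prop where
  le_dual : Λ ≤ B.dualSubmodule Λ
  mem₁ : a₁ ∈ B.dualSubmodule Λ
  mem₂ : a₂ ∈ B.dualSubmodule Λ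
  smul₁ : (p : ℤ) • a₁ ∈ Λ
  smul₂ : (p : ℤ) • a₂ ∈ Λ
  sq₁ : B a₁ a₁ = α₁ / p
  sq₂ : B a₂ a₂ = α₂ / p
  mul : ∃ k : ℤ, B a₁ a₂ = k
  span : ∀ x ∈ B.dualSubmodule Λ, ∃ t₁ t₂ : ℤ, x - (t₁ • a₁ + t₂ • a₂) ∈ Λ
  aniso : ∀ t₁ t₂ : ℤ, (p : ℤ) ∣ α₁ * t₁ ^ 2 + α₂ * t₂ ^ 2 → (p : ℤ) ∣ t₁ ∧ (p : ℤ) ∣ t₂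

lemma AnisoPlane.not_dvd₁ {B : BilinForm ℚ V} {Λ : Submodule ℤ V} {p : ℕ} {a₁ a₂ : V} {α₁ α₂ : ℤ}
    (h : AnisoPlane B Λ p a₁ a₂ α₁ α₂) (hp : p.Prime) : ¬ (p : ℤ) ∣ α₁ := fun hd =>
  (Nat.prime_iff_prime_int.mp hp).not_dvd_one (h.aniso 1 0 (by simpa using hd)).1

lemma AnisoPlane.not_dvd₂ {B : BilinForm ℚ V} {Λ : Submodule ℤ V} {p : ℕ} {a₁ a₂ : V} {α₁ α₂ : ℤ}
    (h : AnisoPlane B Λ p a₁ a₂ α₁ α₂) (hp : p.Prime) : ¬ (p : ℤ) ∣ α₂ := fun hd =>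
  (Nat.prime_iff_prime_int.mp hp).not_dvd_one (h.aniso 0 1 (by simpa using hd)).2

lemma AnisoPlane.not_isSquare {B : BilinForm ℚ V} {Λ : Submodule ℤ V} {p : ℕ} {a₁ a₂ : V}
    {α₁ α₂ : ℤ} (h : AnisoPlane B Λ p a₁ a₂ α₁ α₂) (hp : p.Prime) :
    ¬ IsSquare (-(α₁ * α₂) : ZMod p) := by
  rintro ⟨r, hr⟩
  obtain ⟨r, rfl⟩ := ZMod.intCast_surjective r
  have h1 : (p : ℤ) ∣ α₁ * r ^ 2 + α₂ * α₁ ^ 2 := by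
    rw [← ZMod.intCast_zmod_eq_zero_iff_dvd]
    push_cast
    linear_combination -(α₁ : ZMod p) * hr
  exact h.not_dvd₁ hp (h.aniso _ _ h1).2

lemma AnisoPlane.neg {B : BilinForm ℚ V} {Λ : Submodule ℤ V} {p : ℕ} {a₁ a₂ : V}
    {α₁ α₂ : ℤ} (h : AnisoPlane B Λ p a₁ a₂ α₁ α₂) : AnisoPlane (-B) Λ p a₁ a₂ (-α₁) (-α₂) := by
  have hd : (-B).dualSubmodule Λ = B.dualSubmodule Λ := by
    ext x
    rw [mem_dual_iff, mem_dual_iff]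
    constructor <;> intro hx y hy <;> obtain ⟨k, hk⟩ := hx y hy
    · exact ⟨-k, by simp [← hk]⟩
    · exact ⟨-k, by simp [← hk]⟩
  obtain ⟨k, hk⟩ := h.mul
  refine ⟨hd ▸ h.le_dual, hd ▸ h.mem₁, hd ▸ h.mem₂, h.smul₁, h.smul₂, ?_, ?_, ⟨-k, by simp [hk]⟩,
    hd ▸ h.span, fun t₁ t₂ ht => h.aniso t₁ t₂ ?_⟩
  · simp [h.sq₁, neg_div]
  · simp [h.sq₂, neg_div]
  · have h1 := dvd_neg.mpr ht
    rwa [show -(-α₁ * t₁ ^ 2 + -α₂ * t₂ ^ 2) = α₁ * t₁ ^ 2 + α₂ * t₂ ^ 2 by ring] at h1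

lemma AnisoPlane.map {V' : Type} [AddCommGroup V'] [Module ℚ V'] {B : BilinForm ℚ V}
    {B' : BilinForm ℚ V'} {e : V ≃ₗ[ℚ] V'} (he : Isometry B B' e)
    {Λ : Submodule ℤ V} {p : ℕ} {a₁ a₂ : V}
    {α₁ α₂ : ℤ} (h : AnisoPlane B Λ p a₁ a₂ α₁ α₂) :
    AnisoPlane B' (mapLat e Λ) p (e a₁) (e a₂) α₁ α₂ := by
  have hm : ∀ {Λ : Submodule ℤ V} {x}, x ∈ Λ → e x ∈ mapLat e Λ := fun hx =>
    mem_mapLat.mpr (by simpa using hx)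
  refine ⟨?_, ?_, ?_, ?_, ?_, by rw [he, h.sq₁], by rw [he, h.sq₂], by rw [he]; exact h.mul, ?_,
    h.aniso⟩
  · rw [mapLat_dual he]
    exact fun x hx => mem_mapLat.mpr (h.le_dual (mem_mapLat.mp hx))
  · rw [mapLat_dual he]; exact hm h.mem₁
  · rw [mapLat_dual he]; exact hm h.mem₂
  · rw [← map_zsmul]; exact hm h.smul₁
  · rw [← map_zsmul]; exact hm h.smul₂
  · intro x hx
    rw [mapLat_dual he, mem_mapLat] at hx
    obtain ⟨t₁, t₂, ht⟩ := h.span _ hx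
    exact ⟨t₁, t₂, by simpa [mem_mapLat] using ht⟩

/-- Existence of an anti-isometry between two anisotropic planes of opposite discriminant. -/
lemma exists_glue_coeff {p : ℕ} (hp : p.Prime) (hp3 : 3 ≤ p) {α₁ α₂ β₁ β₂ : ℤ}
    (hα₁ : ¬ (p : ℤ) ∣ α₁) (hβ₁ : ¬ (p : ℤ) ∣ β₁) (hβ₂ : ¬ (p : ℤ) ∣ β₂)
    (hα : ¬ IsSquare (-(α₁ * α₂) : ZMod p)) (hβ : ¬ IsSquare (-(β₁ * β₂) : ZMod p)) :
    ∃ c₁ c₂ s : ℤ, (p : ℤ) ∣ β₁ * c₁ ^ 2 + β₂ * c₂ ^ 2 + α₁ ∧ (p : ℤ) ∣ β₁ * β₂ * α₁ * s ^ 2 - α₂ := by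
  classical
  have := Fact.mk hp
  have hα₁' : (α₁ : ZMod p) ≠ 0 := fun h => hα₁ ((ZMod.intCast_zmod_eq_zero_iff_dvd _ _).mp h)
  have hβ₁' : (β₁ : ZMod p) ≠ 0 := fun h => hβ₁ ((ZMod.intCast_zmod_eq_zero_iff_dvd _ _).mp h)
  have hβ₂' : (β₂ : ZMod p) ≠ 0 := fun h => hβ₂ ((ZMod.intCast_zmod_eq_zero_iff_dvd _ _).mp h)
  have hc2 : ringChar (ZMod p) ≠ 2 := by rw [ZMod.ringChar_zmod_n]; lia
  have hodd : Fintype.card (ZMod p) % 2 = 1 := by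
    rw [ZMod.card]
    exact (hp.eq_two_or_odd).resolve_left (by lia)
  obtain ⟨x, y, hxy⟩ := FiniteField.exists_root_sum_quadratic
    (f := Polynomial.C (β₁ : ZMod p) * Polynomial.X ^ 2)
    (g := Polynomial.C (β₂ : ZMod p) * Polynomial.X ^ 2 + Polynomial.C 0 * Polynomial.X
      + Polynomial.C (α₁ : ZMod p))
    (Polynomial.degree_C_mul_X_pow 2 hβ₁') (Polynomial.degree_quadratic hβ₂') hodd
  have hne : ∀ z : ZMod p, ¬ IsSquare z → z ≠ 0 := fun z hz h => hz (h ▸ IsSquare.zero)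
  have h1 := quadraticChar_neg_one_iff_not_isSquare.mpr hα
  have h2 := quadraticChar_neg_one_iff_not_isSquare.mpr hβ
  have h3 : quadraticChar (ZMod p) (-(α₁ * α₂) * -(β₁ * β₂)) = 1 := by rw [map_mul, h1, h2]; rfl
  obtain ⟨r, hr⟩ := (quadraticChar_one_iff_isSquare (mul_ne_zero (hne _ hα) (hne _ hβ))).mp h3
  obtain ⟨c₁, rfl⟩ := ZMod.intCast_surjective x
  obtain ⟨c₂, rfl⟩ := ZMod.intCast_surjective y
  obtain ⟨s, hs⟩ := ZMod.intCast_surjective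
    (r / ((α₁ : ZMod p) * (β₁ : ZMod p) * (β₂ : ZMod p)))
  refine ⟨c₁, c₂, s, ?_, ?_⟩
  · rw [← ZMod.intCast_zmod_eq_zero_iff_dvd]
    push_cast
    simpa [add_assoc] using hxy
  · rw [← ZMod.intCast_zmod_eq_zero_iff_dvd]
    push_cast
    rw [hs]
    field_simp
    linear_combination -hr

end

section
variable {ι κ : Type} [Fintype ι] [Fintype κ]

lemma mem_dual_span_singleton {V : Type} [AddCommGroup V] [Module ℚ V] {B : BilinForm ℚ V} {x z : V} :
    x ∈ B.dualSubmodule (span ℤ {z}) ↔ ∃ k : ℤ, B x z = k := by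
  rw [mem_dual_iff]
  refine ⟨fun h => h _ (mem_span_singleton_self z), ?_⟩
  rintro ⟨k, hk⟩ y hy
  obtain ⟨n, rfl⟩ := Submodule.mem_span_singleton.mp hy
  exact ⟨n * k, by simp [hk]⟩

/-- Two anisotropic discriminant planes can be glued to a self-dual lattice. -/
lemma hasSelfDual_of_anisoPlane {f : ι → ℚ} {g : κ → ℚ} {Λ : Submodule ℤ (ι → ℚ)}
    {Λ' : Submodule ℤ (κ → ℚ)} [IsLattice ℚ Λ] [IsLattice ℚ Λ'] {p : ℕ} (hp : p.Prime) (hp3 : 3 ≤ p)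
    {a₁ a₂ : ι → ℚ} {b₁ b₂ : κ → ℚ} {α₁ α₂ β₁ β₂ : ℤ}
    (hf : AnisoPlane (dform f) Λ p a₁ a₂ α₁ α₂) (hg : AnisoPlane (dform g) Λ' p b₁ b₂ β₁ β₂) :
    HasSelfDual (Sum.elim f g) := by
  have hp0 : (p : ℚ) ≠ 0 := by exact_mod_cast hp.ne_zero
  have hpp := Nat.prime_iff_prime_int.mp hp
  obtain ⟨c₁, c₂, s, ⟨k₁, hk₁⟩, ⟨k₂, hk₂⟩⟩ := exists_glue_coeff hp hp3 (hf.not_dvd₁ hp) (hg.not_dvd₁ hp)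
    (hg.not_dvd₂ hp) (hf.not_isSquare hp) (hg.not_isSquare hp)
  have hk₁' : (β₁ * c₁ ^ 2 + β₂ * c₂ ^ 2 + α₁ : ℚ) = p * k₁ := by exact_mod_cast hk₁
  have hk₂' : (β₁ * β₂ * α₁ * s ^ 2 - α₂ : ℚ) = p * k₂ := by exact_mod_cast hk₂
  have hsp : ¬ (p : ℤ) ∣ s := fun h => hf.not_dvd₂ hp (by
    have h1 : α₂ = β₁ * β₂ * α₁ * s ^ 2 - p * k₂ := by linear_combination -hk₂
    rw [h1]
    exact dvd_sub ((dvd_pow h two_ne_zero).mul_left _) (dvd_mul_right _ _))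
  obtain ⟨m, hm⟩ := hf.mul
  obtain ⟨n, hn⟩ := hg.mul
  have hn' : dform g b₂ b₁ = n := by
    rw [← hn]; exact (dform_isSymm g).eq _ _
  have hm' : dform f a₂ a₁ = m := by
    rw [← hm]; exact (dform_isSymm f).eq _ _
  set y₁ := c₁ • b₁ + c₂ • b₂ with hy₁
  set y₂ := (-(s * β₂ * c₂)) • b₁ + (s * β₁ * c₁) • b₂ with hy₂
  set z₁ : ι ⊕ κ → ℚ := Sum.elim a₁ y₁ with hz₁
  set z₂ : ι ⊕ κ → ℚ := Sum.elim a₂ y₂ with hz₂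
  set B := dform (Sum.elim f g) with hB
  have hBs : ∀ x y, B x y = B y x := (dform_isSymm _).eq
  have h11 : ∃ k : ℤ, B z₁ z₁ = k := by
    refine ⟨k₁ + 2 * c₁ * c₂ * n, ?_⟩
    simp only [hB, dform_sumElim, hz₁, hy₁, Sum.elim_comp_inl, Sum.elim_comp_inr, map_add, map_zsmul,
      LinearMap.add_apply, LinearMap.smul_apply, hf.sq₁, hg.sq₁, hg.sq₂, hn, hn']
    simp only [zsmul_eq_mul]
    push_cast
    field_simp
    linear_combination hk₁'
  have h22 : ∃ k : ℤ, B z₂ z₂ = k := by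
    refine ⟨s ^ 2 * β₁ * β₂ * k₁ - k₂ - 2 * (s * β₂ * c₂) * (s * β₁ * c₁) * n, ?_⟩
    simp only [hB, dform_sumElim, hz₂, hy₂, Sum.elim_comp_inl, Sum.elim_comp_inr, map_add, map_zsmul,
      LinearMap.add_apply, LinearMap.smul_apply, hf.sq₂, hg.sq₁, hg.sq₂, hn, hn']
    simp only [zsmul_eq_mul]
    push_cast
    field_simp
    linear_combination s ^ 2 * β₁ * β₂ * hk₁' - hk₂'
  have h12 : ∃ k : ℤ, B z₁ z₂ = k := by
    refine ⟨m + (c₁ * (s * β₁ * c₁) - c₂ * (s * β₂ * c₂)) * n, ?_⟩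
    simp only [hB, dform_sumElim, hz₁, hz₂, hy₁, hy₂, Sum.elim_comp_inl, Sum.elim_comp_inr, map_add,
      map_zsmul, LinearMap.add_apply, LinearMap.smul_apply, hm, hg.sq₁, hg.sq₂, hn, hn']
    simp only [zsmul_eq_mul]
    push_cast
    field_simp
    ring
  have h21 : ∃ k : ℤ, B z₂ z₁ = k := by rw [hBs]; exact h12
  have := sumLat_isLattice Λ Λ'
  have hFG : (span ℤ {z₁} ⊔ span ℤ {z₂}).FG :=
    (Submodule.fg_span_singleton _).sup (Submodule.fg_span_singleton _)
  refine ⟨sumLat Λ Λ' ⊔ (span ℤ {z₁} ⊔ span ℤ {z₂}), isLattice_sup_of_fg _ _ hFG, ?_⟩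
  have hz₁D : z₁ ∈ B.dualSubmodule (sumLat Λ Λ') := mem_dual_sumLat.mpr
    ⟨hf.mem₁, add_mem (zsmul_mem hg.mem₁ _) (zsmul_mem hg.mem₂ _)⟩
  have hz₂D : z₂ ∈ B.dualSubmodule (sumLat Λ Λ') := mem_dual_sumLat.mpr
    ⟨hf.mem₂, add_mem (zsmul_mem hg.mem₁ _) (zsmul_mem hg.mem₂ _)⟩
  have hsym : ∀ z ∈ B.dualSubmodule (sumLat Λ Λ'), sumLat Λ Λ' ≤ B.dualSubmodule (span ℤ {z}) :=
    fun z hz x hx => mem_dual_span_singleton.mpr (by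
      rw [hBs]; exact mem_dual_iff.mp hz x hx)
  rw [dual_sup, dual_sup]
  refine le_antisymm ?_ (sup_le (le_inf ?_ (le_inf ?_ ?_)) (sup_le ?_ ?_))
  · rintro x ⟨hx, hx1, hx2⟩
    rw [SetLike.mem_coe, mem_dual_span_singleton] at hx1 hx2
    obtain ⟨hxl, hxr⟩ := mem_dual_sumLat.mp hx
    obtain ⟨t₁, t₂, ht⟩ := hf.span _ hxl
    set x' := x - (t₁ • z₁ + t₂ • z₂) with hx'
    have hl : x' ∘ Sum.inl ∈ Λ := ht
    have hr : x' ∘ Sum.inr ∈ (dform g).dualSubmodule Λ' :=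
      (mem_dual_sumLat.mp (sub_mem hx (add_mem (zsmul_mem hz₁D t₁) (zsmul_mem hz₂D t₂)))).2
    have hi : ∀ z, (∃ k : ℤ, B x z = k) → (∃ k : ℤ, B z₁ z = k) → (∃ k : ℤ, B z₂ z = k) →
        ∃ k : ℤ, B x' z = k := by
      rintro z ⟨k, hk⟩ ⟨k', hk'⟩ ⟨k'', hk''⟩
      refine ⟨k - (t₁ * k' + t₂ * k''), ?_⟩
      simp only [hx', map_sub, map_add, map_zsmul, LinearMap.sub_apply, LinearMap.add_apply,
        LinearMap.smul_apply, hk, hk', hk'']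
      simp only [zsmul_eq_mul]
      push_cast
      ring
    have hy' : ∀ a : ι → ℚ, a ∈ (dform f).dualSubmodule Λ → ∀ y : κ → ℚ,
        (∃ k : ℤ, B x' (Sum.elim a y) = k) → ∃ k : ℤ, dform g (x' ∘ Sum.inr) y = k := by
      rintro a ha y ⟨k, hk⟩
      obtain ⟨l, hl⟩ := mem_dual_iff.mp ha _ hl
      have hl' : dform f (x' ∘ Sum.inl) a = l := by rw [← hl]; exact (dform_isSymm f).eq _ _
      refine ⟨k - l, ?_⟩
      rw [hB, dform_sumElim, Sum.elim_comp_inl, Sum.elim_comp_inr, hl'] at hk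
      push_cast
      linear_combination hk
    obtain ⟨k, hk⟩ := hy' _ hf.mem₁ _ (hi _ hx1 h11 h21)
    obtain ⟨l, hl'⟩ := hy' _ hf.mem₂ _ (hi _ hx2 h12 h22)
    obtain ⟨s₁, s₂, hs⟩ := hg.span _ hr
    set w := x' ∘ Sum.inr - (s₁ • b₁ + s₂ • b₂) with hw
    have hxw : x' ∘ Sum.inr = w + (s₁ • b₁ + s₂ • b₂) := by rw [hw]; abel
    obtain ⟨i, hi⟩ := mem_dual_iff.mp (hg.le_dual hs) _ (hg.smul₁)
    obtain ⟨w₁, hw₁⟩ := mem_dual_iff.mp hg.mem₁ _ hs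
    obtain ⟨w₂, hw₂⟩ := mem_dual_iff.mp hg.mem₂ _ hs
    have hw₁' : dform g w b₁ = w₁ := by rw [← hw₁]; exact (dform_isSymm g).eq _ _
    have hw₂' : dform g w b₂ = w₂ := by rw [← hw₂]; exact (dform_isSymm g).eq _ _
    rw [hxw] at hk hl'
    simp only [hy₁, hy₂, map_add, map_zsmul, LinearMap.add_apply, LinearMap.smul_apply, hg.sq₁,
      hg.sq₂, hn, hn', hw₁', hw₂'] at hk hl'
    simp only [zsmul_eq_mul] at hk hl'
    push_cast at hk hl'
    field_simp at hk hl'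
    have e1 : (p : ℤ) ∣ c₁ * β₁ * s₁ + c₂ * β₂ * s₂ := by
      refine ⟨k - (c₁ * w₁ + c₂ * w₂ + c₁ * s₂ * n + c₂ * s₁ * n), ?_⟩
      have : (c₁ * β₁ * s₁ + c₂ * β₂ * s₂ : ℚ) =
        p * (k - (c₁ * w₁ + c₂ * w₂ + c₁ * s₂ * n + c₂ * s₁ * n)) := by linear_combination hk
      exact_mod_cast this
    have e2 : (p : ℤ) ∣ s * (β₁ * β₂ * (c₁ * s₂ - c₂ * s₁)) := by
      refine ⟨l - (-(s * β₂ * c₂) * w₁ + s * β₁ * c₁ * w₂ + -(s * β₂ * c₂) * s₂ * n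
        + s * β₁ * c₁ * s₁ * n), ?_⟩
      have : (s * (β₁ * β₂ * (c₁ * s₂ - c₂ * s₁)) : ℚ) =
        p * (l - (-(s * β₂ * c₂) * w₁ + s * β₁ * c₁ * w₂ + -(s * β₂ * c₂) * s₂ * n
          + s * β₁ * c₁ * s₁ * n)) := by linear_combination hl'
      exact_mod_cast this
    have e3 := (hpp.dvd_mul.mp e2).resolve_left hsp
    have e4 : (p : ℤ) ∣ c₁ * s₂ - c₂ * s₁ :=
      ((hpp.dvd_mul.mp e3).resolve_left fun h => (hpp.dvd_mul.mp h).elim (hg.not_dvd₁ hp)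
        (hg.not_dvd₂ hp))
    have e5 : (p : ℤ) ∣ α₁ * s₁ := by
      have : α₁ * s₁ = p * (k₁ * s₁) - c₁ * (c₁ * β₁ * s₁ + c₂ * β₂ * s₂)
          + c₂ * β₂ * (c₁ * s₂ - c₂ * s₁) := by linear_combination s₁ * hk₁
      rw [this]
      exact dvd_add (dvd_sub (dvd_mul_right _ _) (e1.mul_left _)) (e4.mul_left _)
    have e6 : (p : ℤ) ∣ α₁ * s₂ := by
      have : α₁ * s₂ = p * (k₁ * s₂) - c₂ * (c₁ * β₁ * s₁ + c₂ * β₂ * s₂)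
          - c₁ * β₁ * (c₁ * s₂ - c₂ * s₁) := by linear_combination s₂ * hk₁
      rw [this]
      exact dvd_sub (dvd_sub (dvd_mul_right _ _) (e1.mul_left _)) (e4.mul_left _)
    obtain ⟨u₁, rfl⟩ := (hpp.dvd_mul.mp e5).resolve_left (hf.not_dvd₁ hp)
    obtain ⟨u₂, rfl⟩ := (hpp.dvd_mul.mp e6).resolve_left (hf.not_dvd₁ hp)
    have hr' : x' ∘ Sum.inr ∈ Λ' := by
      rw [hxw]
      refine add_mem hs (add_mem ?_ ?_)
      · rw [mul_comm, mul_smul]; exact zsmul_mem hg.smul₁ _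
      · rw [mul_comm, mul_smul]; exact zsmul_mem hg.smul₂ _
    have hxx : x = x' + (t₁ • z₁ + t₂ • z₂) := by rw [hx']; abel
    rw [hxx]
    exact add_mem_sup (mem_sumLat.mpr ⟨hl, hr'⟩) (add_mem_sup (mem_span_singleton.mpr ⟨_, rfl⟩)
      (mem_span_singleton.mpr ⟨_, rfl⟩))
  · intro x hx
    obtain ⟨h1, h2⟩ := mem_sumLat.mp hx
    exact mem_dual_sumLat.mpr ⟨hf.le_dual h1, hg.le_dual h2⟩
  · exact hsym _ hz₁D
  · exact hsym _ hz₂D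
  · rw [span_singleton_le_iff_mem]
    exact ⟨hz₁D, mem_dual_span_singleton.mpr h11, mem_dual_span_singleton.mpr h12⟩
  · rw [span_singleton_le_iff_mem]
    exact ⟨hz₂D, mem_dual_span_singleton.mpr h21, mem_dual_span_singleton.mpr h22⟩

lemma DIso.of_hasSelfDual_sum_neg {f : ι → ℚ} {g : κ → ℚ} (hf : ∀ i, f i ≠ 0) (hg : ∀ i, g i ≠ 0)
    (h : HasSelfDual (Sum.elim f (-g))) (hc : Fintype.card ι = Fintype.card κ)
    (hpos : {i | 0 < f i}.ncard = {i | 0 < g i}.ncard) : DIso f g := by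
  have h0 : ∀ i, Sum.elim f (-g) i ≠ 0 := by
    rintro (i | i)
    · exact hf i
    · exact neg_ne_zero.mpr (hg i)
  have hs0 : ∀ a : ℚ, sgn a ≠ 0 := fun a => by unfold sgn; split_ifs <;> norm_num
  have h1 := (h.dIso_sgn h0).sum_gw_eq h0 fun i => hs0 _
  simp only [Fintype.sum_sum_type, Sum.elim_inl, Sum.elim_inr, Pi.neg_apply] at h1
  have h2 : ∀ i, gw (-g i) = gw 1 + gw (-1) - gw (g i) := fun i => by
    rw [← gw_neg (hg i)]; abel
  have h3 : ∀ i, gw (sgn (-g i)) = gw 1 + gw (-1) - gw (sgn (g i)) := fun i => by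
    have : sgn (-g i) = -sgn (g i) := by
      have := hg i
      unfold sgn
      rcases lt_or_gt_of_ne this with h | h
      · rw [if_pos (by linarith), if_neg (by linarith)]; norm_num
      · rw [if_neg (by linarith), if_pos h]
    rw [this, ← gw_neg (hs0 _)]; abel
  simp only [h2, h3, Finset.sum_sub_distrib, sum_gw_sgn, hc, hpos] at h1
  refine DIso.of_sum_gw ?_
  have h4 : ∀ a b c d : GW, a + (b - c) = d + (b - d) → a = c := fun a b c d h => by
    have : a - c = 0 := by
      have h5 : a + (b - c) - b = d + (b - d) - b := by rw [h]
      have h6 : a + (b - c) - b = a - c := by abel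
      have h7 : d + (b - d) - b = 0 := by abel
      rw [← h6, h5, h7]
    exact sub_eq_zero.mp this
  exact h4 _ _ _ _ h1

end
end Enriques

namespace Enriques
open LinearMap (BilinForm)
open Module Submodule

set_option linter.unusedSectionVars false

section
variable {ι : Type} [Fintype ι] [DecidableEq ι]

lemma dual_stdLat_eq {G : Matrix ι ι ℤ} (hs : G.IsSymm) (hd : G.det.natAbs = 1) :
    (gramForm G).dualSubmodule (stdLat ι) = stdLat ι := by
  have hu : IsUnit G.det := Int.isUnit_iff_natAbs_eq.mpr hd
  refine le_antisymm (fun x hx => ?_) (fun x hx => mem_dual_iff.mpr fun y hy => ?_)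
  · have := smul_mem_stdLat_of_mem_dual (p := 1) hs hu.ne_zero (fun v => ⟨G⁻¹ *ᵥ v, by
      rw [Matrix.mulVec_mulVec, Matrix.mul_nonsing_inv _ hu]; simp⟩) hx
    simpa using this
  · obtain ⟨z, rfl⟩ := mem_stdLat.mp hx
    obtain ⟨w, rfl⟩ := mem_stdLat.mp hy
    exact ⟨_, gramForm_intVec _ _ _⟩

/-- A nontrivial `p`-elementary maximal even lattice has an anisotropic discriminant plane. -/
lemma IsMaxEven.exists_anisoPlane {G : Matrix ι ι ℤ} (hmax : IsMaxEven (gramForm G) (stdLat ι))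
    {p j : ℕ} (hp : p.Prime) (hp3 : 3 ≤ p) (hs : G.IsSymm) (hdet : G.det.natAbs = p ^ (2 * j))
    (hj : j ≠ 0) (hP : ∀ v, ∃ w, G *ᵥ w = (p : ℤ) • v) :
    ∃ a₁ a₂ α₁ α₂, AnisoPlane (gramForm G) (stdLat ι) p a₁ a₂ α₁ α₂ := by
  have := Fact.mk hp
  have hp0 : (p : ℚ) ≠ 0 := by exact_mod_cast hp.ne_zero
  have hpp := Nat.prime_iff_prime_int.mp hp
  have hd : G.det ≠ 0 := by
    intro h
    rw [h] at hdet
    exact (pow_pos hp.pos (2 * j)).ne' (by simpa using hdet.symm)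
  set B := gramForm G with hB
  have hBs : ∀ x y, B x y = B y x := (gramForm_isSymm hs).eq
  have hD : ∀ x ∈ B.dualSubmodule (stdLat ι), (p : ℤ) • x ∈ stdLat ι := fun x hx => by
    have := smul_mem_stdLat_of_mem_dual hs hd hP hx
    rwa [← Int.cast_smul_eq_zsmul ℚ, Int.cast_natCast]
  have hint : ∀ x ∈ stdLat ι, ∀ y ∈ stdLat ι, ∃ k : ℤ, B x y = k := by
    intro x hx y hy
    obtain ⟨z, rfl⟩ := mem_stdLat.mp hx
    obtain ⟨w, rfl⟩ := mem_stdLat.mp hy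
    exact ⟨_, gramForm_intVec _ _ _⟩
  have hker : 1 < finrank (ZMod p) (LinearMap.ker (G.map (Int.cast : ℤ → ZMod p)).mulVecLin) := by
    have h1 := finrank_range_of_det hP hdet
    have h2 := LinearMap.finrank_range_add_finrank_ker (G.map (Int.cast : ℤ → ZMod p)).mulVecLin
    rw [finrank_fintype_fun_eq_card] at h2
    lia
  obtain ⟨v₁, hv₁⟩ : ∃ v : LinearMap.ker (G.map (Int.cast : ℤ → ZMod p)).mulVecLin, v ≠ 0 := by
    have := Module.nontrivial_of_finrank_pos (lt_trans zero_lt_one hker)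
    exact exists_ne 0
  obtain ⟨v₂, hv⟩ := exists_linearIndependent_pair_of_one_lt_finrank hker hv₁
  rw [LinearIndependent.pair_iff] at hv
  obtain ⟨w₁, hw₁⟩ := redVec_surjective p v₁.1
  obtain ⟨w₂, hw₂⟩ := redVec_surjective p v₂.1
  have hu : ∀ (v : LinearMap.ker (G.map (Int.cast : ℤ → ZMod p)).mulVecLin) w,
      redVec p w = v.1 → ∃ u, G *ᵥ w = (p : ℤ) • u := fun v w h => by
    rw [← redVec_eq_zero, redVec_mulVec, h]
    exact v.2
  obtain ⟨u₁, hu₁⟩ := hu _ _ hw₁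
  obtain ⟨u₂, hu₂⟩ := hu _ _ hw₂
  have hind : ∀ t₁ t₂ : ℤ, (∃ w, t₁ • w₁ + t₂ • w₂ = (p : ℤ) • w) → (p : ℤ) ∣ t₁ ∧ (p : ℤ) ∣ t₂ := by
    rintro t₁ t₂ h
    rw [← redVec_eq_zero, map_add, redVec_smul, redVec_smul, hw₁, hw₂] at h
    obtain ⟨h1, h2⟩ := hv (t₁ : ZMod p) (t₂ : ZMod p) (Subtype.ext h)
    exact ⟨(ZMod.intCast_zmod_eq_zero_iff_dvd _ _).mp h1, (ZMod.intCast_zmod_eq_zero_iff_dvd _ _).mp h2⟩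
  set a₁ : ι → ℚ := (p : ℚ)⁻¹ • intVec w₁ with ha₁
  set a₂ : ι → ℚ := (p : ℚ)⁻¹ • intVec w₂ with ha₂
  have hpa₁ : (p : ℤ) • a₁ = intVec w₁ := by
    rw [← Int.cast_smul_eq_zsmul ℚ, ha₁, smul_smul, Int.cast_natCast, mul_inv_cancel₀ hp0, one_smul]
  have hpa₂ : (p : ℤ) • a₂ = intVec w₂ := by
    rw [← Int.cast_smul_eq_zsmul ℚ, ha₂, smul_smul, Int.cast_natCast, mul_inv_cancel₀ hp0, one_smul]
  have hmem : ∀ w u : ι → ℤ, G *ᵥ w = (p : ℤ) • u →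
      (p : ℚ)⁻¹ • intVec w ∈ B.dualSubmodule (stdLat ι) := by
    intro w u h
    rw [mem_dual_iff]
    intro y hy
    obtain ⟨z, rfl⟩ := mem_stdLat.mp hy
    refine ⟨z ⬝ᵥ u, ?_⟩
    rw [hBs, map_smul, hB, gramForm_intVec, h, dotProduct_smul]
    simp [hp0]
  have hm₁ : a₁ ∈ B.dualSubmodule (stdLat ι) := hmem _ _ hu₁
  have hm₂ : a₂ ∈ B.dualSubmodule (stdLat ι) := hmem _ _ hu₂
  have hval : ∀ w w' u : ι → ℤ, G *ᵥ w' = (p : ℤ) • u →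
      B ((p : ℚ)⁻¹ • intVec w) ((p : ℚ)⁻¹ • intVec w') = (w ⬝ᵥ u : ℤ) / p := by
    intro w w' u h
    rw [map_smul, map_smul, LinearMap.smul_apply, hB, gramForm_intVec, h, dotProduct_smul]
    simp [hp0]
    field_simp
  have h11 : B a₁ a₁ = (w₁ ⬝ᵥ u₁ : ℤ) / p := hval _ _ _ hu₁
  have h12 : B a₁ a₂ = (w₁ ⬝ᵥ u₂ : ℤ) / p := hval _ _ _ hu₂
  have h22 : B a₂ a₂ = (w₂ ⬝ᵥ u₂ : ℤ) / p := hval _ _ _ hu₂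
  have h21 : B a₂ a₁ = (w₁ ⬝ᵥ u₂ : ℤ) / p := by rw [hBs, h12]
  generalize w₁ ⬝ᵥ u₁ = α at h11
  generalize w₁ ⬝ᵥ u₂ = β at h12 h21
  generalize w₂ ⬝ᵥ u₂ = γ at h22
  have hind' : ∀ t₁ t₂ : ℤ, t₁ • a₁ + t₂ • a₂ ∈ stdLat ι → (p : ℤ) ∣ t₁ ∧ (p : ℤ) ∣ t₂ := by
    intro t₁ t₂ h
    obtain ⟨w, hw⟩ := mem_stdLat.mp h
    refine hind _ _ ⟨w, intVec_injective ?_⟩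
    have h1 : intVec (t₁ • w₁ + t₂ • w₂) = (p : ℤ) • (t₁ • a₁ + t₂ • a₂) := by
      rw [smul_add, smul_comm, hpa₁, smul_comm, hpa₂]
      ext i
      simp [intVec]
    rw [h1, hw]
    ext i
    simp [intVec]
  have han : ∀ t₁ t₂ : ℤ, (p : ℤ) ∣ α * t₁ ^ 2 + 2 * β * t₁ * t₂ + γ * t₂ ^ 2 →
      (p : ℤ) ∣ t₁ ∧ (p : ℤ) ∣ t₂ := by
    rintro t₁ t₂ ⟨k, hk⟩
    have hk' : (α * t₁ ^ 2 + 2 * β * t₁ * t₂ + γ * t₂ ^ 2 : ℚ) = p * k := by exact_mod_cast hk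
    have hx : t₁ • a₁ + t₂ • a₂ ∈ B.dualSubmodule (stdLat ι) :=
      add_mem (zsmul_mem hm₁ _) (zsmul_mem hm₂ _)
    have hsq : B (t₁ • a₁ + t₂ • a₂) (t₁ • a₁ + t₂ • a₂) = k := by
      simp only [map_add, map_zsmul, LinearMap.add_apply, LinearMap.smul_apply, h11, h12, h21, h22]
      simp only [zsmul_eq_mul]
      field_simp
      linear_combination hk'
    refine hind' _ _ (hmax.2 _ hx ?_)
    obtain ⟨l, hl⟩ := hmax.1 _ (hD _ hx)
    rw [map_zsmul, LinearMap.map_smul_of_tower, LinearMap.smul_apply, hsq, zsmul_eq_mul,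
      zsmul_eq_mul] at hl
    have hl' : (p : ℤ) * (p * k) = 2 * l := by exact_mod_cast hl
    have h2p : ¬ (2 : ℤ) ∣ p := fun h => by
      have := (Nat.prime_dvd_prime_iff_eq Nat.prime_two hp).mp (by exact_mod_cast h)
      lia
    obtain ⟨m, hm⟩ := (Int.prime_two.dvd_mul.mp ((Int.prime_two.dvd_mul.mp
      ⟨l, hl'⟩).resolve_left h2p)).resolve_left h2p
    exact ⟨m, by rw [hsq, hm]; push_cast; ring⟩
  have hα : ¬ (p : ℤ) ∣ α := fun h => hpp.not_dvd_one (han 1 0 (by simpa using h)).1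
  have hinv : ∀ s : ℤ, ¬ (p : ℤ) ∣ s → ∃ r m : ℤ, r * s = 1 + m * p := by
    intro s h
    obtain ⟨r, m, hrm⟩ := (hpp.coprime_iff_not_dvd.mpr h).symm
    exact ⟨r, -m, by linear_combination hrm⟩
  have hspan : ∀ x ∈ B.dualSubmodule (stdLat ι), ∃ t₁ t₂ : ℤ,
      x - (t₁ • a₁ + t₂ • a₂) ∈ stdLat ι := by
    intro x hx
    obtain ⟨t, ⟨i, hi⟩, ht⟩ := hmax.exists_sum_mem hp hp3 hD (x := ![x, a₁, a₂]) (by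
      intro i
      fin_cases i
      exacts [hx, hm₁, hm₂])
    rw [Fin.sum_univ_three] at ht
    change t 0 • x + t 1 • a₁ + t 2 • a₂ ∈ stdLat ι at ht
    have h0 : ¬ (p : ℤ) ∣ t 0 := by
      rintro ⟨m, hm⟩
      have h1 : t 1 • a₁ + t 2 • a₂ ∈ stdLat ι := by
        have h2 := sub_mem ht (zsmul_mem (hD _ hx) m)
        have h3 : t 0 • x + t 1 • a₁ + t 2 • a₂ - m • (p : ℤ) • x = t 1 • a₁ + t 2 • a₂ := by
          rw [hm, smul_smul]; module
        rwa [h3] at h2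
      obtain ⟨h2, h3⟩ := hind' _ _ h1
      fin_cases i
      exacts [hi ⟨m, hm⟩, hi h2, hi h3]
    obtain ⟨r, m, hr⟩ := hinv _ h0
    refine ⟨-(r * t 1), -(r * t 2), ?_⟩
    have h2 := sub_mem (zsmul_mem ht r) (zsmul_mem (hD _ hx) m)
    have h3 : r • (t 0 • x + t 1 • a₁ + t 2 • a₂) - m • (p : ℤ) • x
        = (r * t 0 - m * p) • x + ((r * t 1) • a₁ + (r * t 2) • a₂) := by module
    rw [h3, show r * t 0 - m * p = 1 by rw [hr]; ring, one_smul] at h2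
    rw [neg_smul, neg_smul, ← neg_add, sub_neg_eq_add]
    exact h2
  refine ⟨a₁, α • a₂ - β • a₁, α, α * (α * γ - β ^ 2), ⟨?_, hm₁, sub_mem (zsmul_mem hm₂ _)
    (zsmul_mem hm₁ _), ?_, ?_, h11, ?_, ⟨0, ?_⟩, ?_, ?_⟩⟩
  · exact fun x hx => mem_dual_iff.mpr fun y hy => hint _ hx _ hy
  · rw [hpa₁]; exact intVec_mem _
  · rw [smul_sub, smul_comm, hpa₂, smul_comm, hpa₁]
    exact sub_mem (zsmul_mem (intVec_mem _) _) (zsmul_mem (intVec_mem _) _)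
  · simp only [map_sub, map_zsmul, LinearMap.sub_apply, LinearMap.smul_apply, h11, h12, h21, h22]
    simp only [zsmul_eq_mul]
    push_cast
    field_simp
    ring
  · simp only [map_sub, map_zsmul, h11, h12]
    simp only [zsmul_eq_mul]
    push_cast
    field_simp
    ring
  · intro x hx
    obtain ⟨t₁, t₂, ht⟩ := hspan x hx
    obtain ⟨r, m, hr⟩ := hinv _ hα
    refine ⟨t₁ + r * t₂ * β, r * t₂, ?_⟩
    have h2 := sub_mem ht (zsmul_mem (hD _ hm₂) (t₂ * m))
    have h3 : x - (t₁ • a₁ + t₂ • a₂) - (t₂ * m) • (p : ℤ) • a₂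
        = x - ((t₁ + r * t₂ * β) • a₁ + (r * t₂) • (α • a₂ - β • a₁))
          + (t₂ * (r * α) - t₂ * (1 + m * p)) • a₂ := by module
    rw [h3, hr, sub_self, zero_smul, add_zero] at h2
    exact h2
  · rintro t₁ t₂ ⟨k, hk⟩
    obtain ⟨h1, h2⟩ := han (t₁ - t₂ * β) (t₂ * α) ⟨k, by rw [← hk]; ring⟩
    have h3 := (hpp.dvd_mul.mp h2).resolve_right hα
    refine ⟨?_, h3⟩
    have := dvd_add h1 (h3.mul_right β)
    simpa using this

lemma exists_isometry_of_anisoPlane {κ μ ν : Type} [Fintype κ] [DecidableEq κ] [Fintype μ]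
    [Fintype ν] {G : Matrix ι ι ℤ} {H : Matrix κ κ ℤ} {f : μ → ℚ} {g : ν → ℚ}
    (hf : ∀ i, f i ≠ 0) (hg : ∀ i, g i ≠ 0) {e : (ι → ℚ) ≃ₗ[ℚ] (μ → ℚ)}
    {e' : (κ → ℚ) ≃ₗ[ℚ] (ν → ℚ)} (he : Isometry (gramForm G) (dform f) e)
    (he' : Isometry (gramForm H) (dform g) e') (hc : Fintype.card μ = Fintype.card ν)
    (hpos : {i | 0 < f i}.ncard = {i | 0 < g i}.ncard) {p : ℕ} (hp : p.Prime) (hp3 : 3 ≤ p)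
    {a₁ a₂ b₁ b₂} {α₁ α₂ β₁ β₂ : ℤ} (h : AnisoPlane (gramForm G) (stdLat ι) p a₁ a₂ α₁ α₂)
    (h' : AnisoPlane (gramForm H) (stdLat κ) p b₁ b₂ β₁ β₂) :
    ∃ φ, Isometry (gramForm G) (gramForm H) φ := by
  have i1 := mapLat_isLattice e (stdLat ι)
  have i2 := mapLat_isLattice e' (stdLat κ)
  have hneg : -dform g = dform (-g) := by
    ext x y
    simp [dform_apply]
  have h1 := (h'.map he').neg
  rw [hneg] at h1
  obtain ⟨φ, hφ⟩ := DIso.of_hasSelfDual_sum_neg hf hg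
    (hasSelfDual_of_anisoPlane hp hp3 (h.map he) h1) hc hpos
  exact ⟨(e.trans φ).trans e'.symm, fun x y => by
    rw [← he x y, ← hφ, ← he']
    simp⟩

/-- A `p`-elementary even lattice of determinant `± p ^ 2` in a space without even unimodular
lattices is maximal. -/
lemma isMaxEven_of_det {G : Matrix ι ι ℤ} (hs : G.IsSymm) (hev : ∀ x, 2 ∣ x ⬝ᵥ G *ᵥ x) {p : ℕ}
    (hp : p.Prime) (hdet : G.det.natAbs = p ^ 2) (hP : ∀ v, ∃ w, G *ᵥ w = (p : ℤ) • v)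
    {μ : Type} [Fintype μ] {f : μ → ℚ} (hf : ∀ i, f i ≠ 0) {e : (ι → ℚ) ≃ₗ[ℚ] (μ → ℚ)}
    (he : Isometry (gramForm G) (dform f) e)
    (h8 : ¬ (8 : ℤ) ∣ 2 * {i | 0 < f i}.ncard - Fintype.card μ) :
    IsMaxEven (gramForm G) (stdLat ι) := by
  obtain ⟨G', P, j, g, hG, hg, hmax, hP', hs', hd', hgP⟩ :=
    exists_maximal_gram (s := 1) hs hev hp hdet hP
  have hj : j ≠ 0 := by
    rintro rfl
    refine h8 (eight_dvd_of_isometry hf (B := gramForm G') (e := g.symm.trans e) (fun x y => ?_)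
      (stdLat ι) (dual_stdLat_eq hs' (by simpa using hd')) hmax.1)
    have h1 := hg (g.symm x) (g.symm y)
    rw [g.apply_symm_apply, g.apply_symm_apply] at h1
    rw [h1, ← he]
    rfl
  have hPd : IsUnit P.det := by
    have h1 : G.det.natAbs = P.det.natAbs * P.det.natAbs * G'.det.natAbs := by
      rw [hG, det_mul, det_mul, det_transpose, Int.natAbs_mul, Int.natAbs_mul]; ring
    rw [hdet, hd'] at h1
    obtain ⟨i, rfl⟩ := Nat.exists_eq_succ_of_ne_zero hj
    have h2 : P.det.natAbs * P.det.natAbs * p ^ (2 * i) = 1 := by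
      have : p ^ 2 * (P.det.natAbs * P.det.natAbs * p ^ (2 * i)) = p ^ 2 * 1 := by
        rw [mul_one]; conv_rhs => rw [h1]
        rw [Nat.succ_eq_add_one]; ring
      exact Nat.eq_of_mul_eq_mul_left (pow_pos hp.pos 2) this
    rw [Int.isUnit_iff_natAbs_eq]
    exact Nat.eq_one_of_mul_eq_one_left (Nat.eq_one_of_mul_eq_one_right h2)
  have hgm : mapLat g.symm (stdLat ι) = stdLat ι := by
    ext x
    rw [mem_mapLat, LinearEquiv.symm_symm]
    constructor
    · intro h
      obtain ⟨z, hz⟩ := mem_stdLat.mp h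
      have h1 : g (intVec (P⁻¹ *ᵥ z)) = g x := by
        rw [hgP, Matrix.mulVec_mulVec, Matrix.mul_nonsing_inv _ hPd, one_mulVec, hz]
      rw [← g.injective h1]
      exact intVec_mem _
    · intro h
      obtain ⟨z, rfl⟩ := mem_stdLat.mp h
      rw [hgP]
      exact intVec_mem _
  refine ⟨?_, fun x hx hk => ?_⟩
  · have := hmax.1.map hg.symm
    rwa [hgm] at this
  · have h1 : g x ∈ (gramForm G').dualSubmodule (stdLat ι) := by
      rw [← hgm, mapLat_dual hg.symm, mem_mapLat] at hx
      simpa using hx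
    have h2 := hmax.2 _ h1 (by rwa [hg])
    rw [← hgm, mem_mapLat]
    simpa using h2

end
end Enriques

namespace Enriques
open LinearMap (BilinForm)
open Module Submodule

set_option linter.unusedSectionVars false

section
variable {V : Type} [AddCommGroup V] [Module ℚ V] {B : BilinForm ℚ V}

lemma exists_eichler (hs : ∀ x y, B x y = B y x) {u w : V} (hu : B u u = 0) (hw : B u w = 0) :
    ∃ E : V ≃ₗ[ℚ] V, Isometry B B E ∧
      (∀ x, E x = x + B x u • w - B x w • u - (B w w / 2 * B x u) • u) ∧
      ∀ x, E.symm x = x - B x u • w + B x w • u - (B w w / 2 * B x u) • u := by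
  have hw' : B w u = 0 := by rw [hs, hw]
  let f : V → V →ₗ[ℚ] V := fun w =>
    { toFun := fun x => x + B x u • w - B x w • u - (B w w / 2 * B x u) • u
      map_add' := fun x y => by
        simp only [map_add, LinearMap.add_apply]
        module
      map_smul' := fun c x => by
        simp only [map_smul, LinearMap.smul_apply, RingHom.id_apply, smul_eq_mul]
        module }
  have hf : ∀ w x, f w x = x + B x u • w - B x w • u - (B w w / 2 * B x u) • u := fun _ _ => rfl
  have hff : ∀ w, B u w = 0 → B w u = 0 → ∀ x, f w (f (-w) x) = x := by
    intro w hw hw' x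
    rw [hf w, hf (-w)]
    simp only [map_add, map_sub, map_smul, map_neg, LinearMap.add_apply, LinearMap.sub_apply,
      LinearMap.smul_apply, LinearMap.neg_apply, smul_eq_mul, hu, hw, hw']
    module
  refine ⟨LinearEquiv.ofLinearMap (f w) (f (-w)) (LinearMap.ext (hff w hw hw'))
    (LinearMap.ext fun x => ?_), fun x y => ?_, hf w, fun x => ?_⟩
  · have := hff (-w) (by simp [hw]) (by simp [hw']) x
    rwa [neg_neg] at this
  · change B (f w x) (f w y) = _
    rw [hf, hf]
    simp only [map_add, map_sub, map_smul, LinearMap.add_apply, LinearMap.sub_apply,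
      LinearMap.smul_apply, smul_eq_mul, hu, hw, hw', hs w y, hs u y]
    ring
  · change f (-w) x = _
    rw [hf]
    simp only [map_neg, LinearMap.neg_apply]
    module

lemma exists_hyperbolic_scaling (hs : ∀ x y, B x y = B y x) {u v : V} (hu : B u u = 0)
    (hv : B v v = 0) (huv : B u v = 1) {t : ℚ} (ht : t ≠ 0) :
    ∃ E : V ≃ₗ[ℚ] V, Isometry B B E ∧
      ∀ x, E.symm x = x + ((t - 1) * B x v) • u + ((t⁻¹ - 1) * B x u) • v := by
  have hvu : B v u = 1 := by rw [hs, huv]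
  let f : ℚ → V →ₗ[ℚ] V := fun t =>
    { toFun := fun x => x + ((t - 1) * B x v) • u + ((t⁻¹ - 1) * B x u) • v
      map_add' := fun x y => by
        simp only [map_add, LinearMap.add_apply]
        module
      map_smul' := fun c x => by
        simp only [map_smul, LinearMap.smul_apply, RingHom.id_apply, smul_eq_mul]
        module }
  have hf : ∀ t x, f t x = x + ((t - 1) * B x v) • u + ((t⁻¹ - 1) * B x u) • v := fun _ _ => rfl
  have hff : ∀ t, t ≠ 0 → ∀ x, f t (f t⁻¹ x) = x := by
    intro t ht x
    rw [hf t, hf]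
    simp only [map_add, map_smul, LinearMap.add_apply,
      LinearMap.smul_apply, smul_eq_mul, hu, hv, huv, hvu, inv_inv]
    match_scalars
    all_goals field_simp
    all_goals try ring
  have hff' : ∀ x, f t⁻¹ (f t x) = x := fun x => by
    have := hff t⁻¹ (inv_ne_zero ht) x
    rwa [inv_inv] at this
  refine ⟨LinearEquiv.ofLinearMap (f t⁻¹) (f t) (LinearMap.ext hff')
    (LinearMap.ext (hff t ht)), fun x y => ?_, hf t⟩
  change B (f t⁻¹ x) (f t⁻¹ y) = _
  rw [hf, hf]
  simp only [map_add, map_smul, LinearMap.add_apply,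
    LinearMap.smul_apply, smul_eq_mul, hu, hv, huv, hvu, hs u y, hs v y, inv_inv]
  field_simp
  ring

lemma mapLat_eq_self {e : V ≃ₗ[ℚ] V} {Λ : Submodule ℤ V} (h : ∀ x ∈ Λ, e x ∈ Λ)
    (h' : ∀ x ∈ Λ, e.symm x ∈ Λ) : mapLat e Λ = Λ := by
  ext x
  rw [mem_mapLat]
  exact ⟨fun hx => by simpa using h _ hx, h' x⟩

lemma apply_mem_of_mapLat {e : V ≃ₗ[ℚ] V} {Λ : Submodule ℤ V} (h : mapLat e Λ = Λ) {x : V} :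
    e x ∈ Λ ↔ x ∈ Λ := by
  conv_lhs => rw [← h, mem_mapLat, e.symm_apply_apply]

lemma mapLat_trans {e e' : V ≃ₗ[ℚ] V} {Λ : Submodule ℤ V} (h : mapLat e Λ = Λ)
    (hΛ : mapLat e' Λ = Λ) : mapLat (e.trans e') Λ = Λ := by
  ext x
  rw [mem_mapLat, LinearEquiv.symm_trans_apply, ← mem_mapLat, h, ← mem_mapLat, hΛ]

/-- A hyperbolic pair inside an even lattice. -/
structure HypPair (B : BilinForm ℚ V) (Λ : Submodule ℤ V) (u v : V) : Prop where
  symm : ∀ x y, B x y = B y x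
  even : IsEvenLat B Λ
  int : ∀ x ∈ Λ, ∀ y ∈ Λ, ∃ k : ℤ, B x y = k
  mem₁ : u ∈ Λ
  mem₂ : v ∈ Λ
  sq₁ : B u u = 0
  sq₂ : B v v = 0
  mul : B u v = 1

lemma HypPair.swap {Λ : Submodule ℤ V} {u v : V} (h : HypPair B Λ u v) : HypPair B Λ v u :=
  ⟨h.symm, h.even, h.int, h.mem₂, h.mem₁, h.sq₂, h.sq₁, by rw [h.symm, h.mul]⟩

lemma qsmul_mem {Λ : Submodule ℤ V} {x : V} (hx : x ∈ Λ) {a : ℚ} (ha : ∃ k : ℤ, a = k) :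
    a • x ∈ Λ := by
  obtain ⟨k, rfl⟩ := ha
  rw [Int.cast_smul_eq_zsmul]
  exact zsmul_mem hx k

lemma HypPair.exists_swap {Λ : Submodule ℤ V} {u v : V} (h : HypPair B Λ u v) :
    ∃ E : V ≃ₗ[ℚ] V, Isometry B B E ∧ mapLat E Λ = Λ ∧ E u = v ∧ E v = u := by
  have hvu := h.swap.mul
  let f : V →ₗ[ℚ] V :=
    { toFun := fun x => x + B x (u - v) • (u - v)
      map_add' := fun x y => by
        simp only [map_add, LinearMap.add_apply]
        module
      map_smul' := fun c x => by
        simp only [map_smul, LinearMap.smul_apply, RingHom.id_apply, smul_eq_mul]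
        module }
  have hf : ∀ x, f x = x + B x (u - v) • (u - v) := fun _ => rfl
  have hff : ∀ x, f (f x) = x := by
    intro x
    simp only [hf, map_add, map_sub, map_smul, LinearMap.add_apply, LinearMap.sub_apply,
      LinearMap.smul_apply, smul_eq_mul, h.sq₁, h.sq₂, h.mul, hvu]
    module
  have hmem : ∀ x ∈ Λ, f x ∈ Λ := fun x hx => by
    have := sub_mem h.mem₁ h.mem₂
    exact add_mem hx (qsmul_mem this (h.int _ hx _ this))
  refine ⟨LinearEquiv.ofLinearMap f f (LinearMap.ext hff) (LinearMap.ext hff), fun x y => ?_,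
    mapLat_eq_self hmem hmem, ?_, ?_⟩
  · change B (f x) (f y) = _
    simp only [hf, map_add, map_sub, map_smul, LinearMap.add_apply, LinearMap.sub_apply,
      LinearMap.smul_apply, smul_eq_mul, h.sq₁, h.sq₂, h.mul, hvu, h.symm u y, h.symm v y]
    ring
  · change f u = v
    rw [hf, map_sub, h.sq₁, h.mul]
    module
  · change f v = u
    rw [hf, map_sub, h.sq₂, hvu]
    module

lemma HypPair.exists_eichler {Λ : Submodule ℤ V} {u v : V} (h : HypPair B Λ u v) {w : V}
    (hw : w ∈ Λ) (huw : B u w = 0) :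
    ∃ E : V ≃ₗ[ℚ] V, Isometry B B E ∧ mapLat E Λ = Λ ∧
      ∀ x, E x = x + B x u • w - B x w • u - (B w w / 2 * B x u) • u := by
  obtain ⟨E, hE, h1, h2⟩ := Enriques.exists_eichler h.symm h.sq₁ huw
  have hk : ∀ x ∈ Λ, ∃ k : ℤ, B w w / 2 * B x u = k := fun x hx => by
    obtain ⟨k, hk⟩ := h.even _ hw
    obtain ⟨l, hl⟩ := h.int _ hx _ h.mem₁
    exact ⟨k * l, by rw [hk, hl]; push_cast; ring⟩
  refine ⟨E, hE, mapLat_eq_self (fun x hx => ?_) (fun x hx => ?_), h1⟩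
  · rw [h1]
    exact sub_mem (sub_mem (add_mem hx (qsmul_mem hw (h.int _ hx _ h.mem₁)))
      (qsmul_mem h.mem₁ (h.int _ hx _ hw))) (qsmul_mem h.mem₁ (hk _ hx))
  · rw [h2]
    exact sub_mem (add_mem (sub_mem hx (qsmul_mem hw (h.int _ hx _ h.mem₁)))
      (qsmul_mem h.mem₁ (h.int _ hx _ hw))) (qsmul_mem h.mem₁ (hk _ hx))

lemma HypPair.exists_isometry_of_not_dvd {Λ : Submodule ℤ V} {u v : V} (h : HypPair B Λ u v)
    {q : ℕ} (hq : q.Prime) {y : V} (hy : y ∈ Λ) {k : ℤ} (hk : B y y = 2 * (q * k)) {b : ℤ}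
    (hb : B y u = b) (hqb : ¬ (q : ℤ) ∣ b) :
    ∃ E : V ≃ₗ[ℚ] V, Isometry B B E ∧ mapLat E Λ = Λ ∧
      ∃ c : ℤ, ¬ (q : ℤ) ∣ c ∧ ∃ l ∈ Λ, E y = c • v + (q : ℤ) • l := by
  have hqq := Nat.prime_iff_prime_int.mp hq
  obtain ⟨a, ha⟩ := h.int _ hy _ h.mem₂
  obtain ⟨r, m, hrm⟩ : ∃ r m : ℤ, r * b = 1 + m * q := by
    obtain ⟨r, m, hrm⟩ := (hqq.coprime_iff_not_dvd.mpr hqb).symm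
    exact ⟨r, -m, by linear_combination hrm⟩
  set y₀ := y - (a : ℚ) • u - (b : ℚ) • v with hy₀
  have hvu := h.swap.mul
  have hy₀Λ : y₀ ∈ Λ := sub_mem (sub_mem hy (qsmul_mem h.mem₁ ⟨a, rfl⟩)) (qsmul_mem h.mem₂ ⟨b, rfl⟩)
  have huy₀ : B u y₀ = 0 := by
    simp only [hy₀, map_sub, map_smul, h.sq₁, h.mul, h.symm u y, hb, smul_eq_mul]
    ring
  obtain ⟨E, hE, hEΛ, hEx⟩ := h.exists_eichler (w := (-r) • y₀) (zsmul_mem hy₀Λ _)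
    (by rw [map_zsmul, huy₀, smul_zero])
  refine ⟨E, hE, hEΛ, b, hqb, ?_⟩
  set d := a - (B y ((-r) • y₀) + (B ((-r) • y₀) ((-r) • y₀) / 2 * b)) with hd
  have hEy : E y = d • u + (b : ℚ) • v + (-m * q : ℚ) • y₀ := by
    have h1 : E y = y + (b : ℚ) • (-r) • y₀ - (a - d) • u := by
      rw [hEx, hd, hb]
      module
    have hrm' : (r * b : ℚ) = 1 + m * q := by exact_mod_cast hrm
    have h2 : y = y₀ + (a : ℚ) • u + (b : ℚ) • v := by rw [hy₀]; abel
    rw [h1, ← Int.cast_smul_eq_zsmul ℚ (-r) y₀, smul_smul]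
    conv_lhs => rw [h2]
    push_cast
    rw [show (b * -r : ℚ) = -1 - m * q by linear_combination -hrm']
    module
  have hvy₀ : B v y₀ = 0 := by
    simp only [hy₀, map_sub, map_smul, h.sq₂, hvu, h.symm v y, ha, smul_eq_mul]
    ring
  obtain ⟨d', hd'⟩ := h.int _ ((apply_mem_of_mapLat hEΛ).mpr hy) _ h.mem₂
  have hdd : d = d' := by
    rw [← hd', hEy]
    simp only [map_add, map_smul, LinearMap.add_apply, LinearMap.smul_apply, h.mul, h.sq₂,
      h.symm y₀ v, hvy₀, smul_eq_mul]
    ring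
  obtain ⟨j, hj⟩ := h.even _ hy₀Λ
  have hn := hE y y
  rw [hEy, hk, hdd] at hn
  simp only [map_add, map_smul, LinearMap.add_apply, LinearMap.smul_apply, h.mul, h.sq₂, h.sq₁, hvu,
      h.symm y₀ v, h.symm y₀ u, hvy₀, huy₀, hj, smul_eq_mul] at hn
  have hdb : (q : ℤ) ∣ d' * b := by
    refine ⟨k - m ^ 2 * q * j, ?_⟩
    have : (d' * b : ℚ) = q * (k - m ^ 2 * q * j) := by linear_combination hn / 2
    exact_mod_cast this
  obtain ⟨f, rfl⟩ := (hqq.dvd_mul.mp hdb).resolve_right hqb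
  refine ⟨f • u - m • y₀, sub_mem (zsmul_mem h.mem₁ _) (zsmul_mem hy₀Λ _), ?_⟩
  rw [hEy, hdd, ← Int.cast_smul_eq_zsmul ℚ b, ← Int.cast_smul_eq_zsmul ℚ (q : ℤ)]
  push_cast
  module

lemma HypPair.exists_isometry_of_dual {Λ : Submodule ℤ V} {u v : V} (h : HypPair B Λ u v)
    {q : ℕ} (hq : q.Prime) {y : V} (hy : y ∈ Λ) {k : ℤ} (hk : B y y = 2 * (q * k)) {l : V}
    (hl : l ∈ Λ) {n : ℤ} (hn : B y l = n) (hqn : ¬ (q : ℤ) ∣ n) :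
    ∃ E : V ≃ₗ[ℚ] V, Isometry B B E ∧ mapLat E Λ = Λ ∧
      ∃ c : ℤ, ¬ (q : ℤ) ∣ c ∧ ∃ l ∈ Λ, E y = c • u + (q : ℤ) • l := by
  obtain ⟨a, ha⟩ := h.int _ hy _ h.mem₂
  by_cases hqa : (q : ℤ) ∣ a
  swap
  · exact h.swap.exists_isometry_of_not_dvd hq hy hk ha hqa
  obtain ⟨b, hb⟩ := h.int _ hy _ h.mem₁
  by_cases hqb : (q : ℤ) ∣ b
  swap
  · obtain ⟨E, hE, hEΛ, c, hc, l, hl, hEl⟩ := h.exists_isometry_of_not_dvd hq hy hk hb hqb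
    obtain ⟨S, hS, hSΛ, hSu, hSv⟩ := h.exists_swap
    refine ⟨E.trans S, hE.trans hS, mapLat_trans hEΛ hSΛ, c, hc, S l,
      (apply_mem_of_mapLat hSΛ).mpr hl, ?_⟩
    rw [LinearEquiv.trans_apply, hEl, map_add, map_zsmul, map_zsmul, hSv]
  obtain ⟨s, hs⟩ := h.int _ hl _ h.mem₂
  obtain ⟨t, ht⟩ := h.int _ hl _ h.mem₁
  have hvu := h.swap.mul
  set w := l - (s : ℚ) • u - (t : ℚ) • v with hw
  have hwΛ : w ∈ Λ := sub_mem (sub_mem hl (qsmul_mem h.mem₁ ⟨s, rfl⟩)) (qsmul_mem h.mem₂ ⟨t, rfl⟩)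
  have huw : B u w = 0 := by
    simp only [hw, map_sub, map_smul, h.sq₁, h.mul, h.symm u l, ht, smul_eq_mul]
    ring
  have hvw : B v w = 0 := by
    simp only [hw, map_sub, map_smul, h.sq₂, hvu, h.symm v l, hs, smul_eq_mul]
    ring
  have hyw : B y w = n - s * b - t * a := by
    simp only [hw, map_sub, map_smul, ha, hb, hn, smul_eq_mul]
  obtain ⟨j, hj⟩ := h.even _ hwΛ
  obtain ⟨E, hE, hEΛ, hEx⟩ := h.exists_eichler hwΛ huw
  have hEv : B (E y) v = ((a - (n - s * b - t * a) - j * b : ℤ) : ℚ) := by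
    rw [hEx]
    simp only [map_add, map_sub, map_smul, LinearMap.add_apply, LinearMap.sub_apply,
      LinearMap.smul_apply, ha, hb, h.symm w v, hvw, h.mul, hyw, hj, smul_eq_mul]
    push_cast
    ring
  obtain ⟨E', hE', hE'Λ, c, hc, l', hl', hEl⟩ := h.swap.exists_isometry_of_not_dvd hq
    ((apply_mem_of_mapLat hEΛ).mpr hy) (by rw [hE, hk]) hEv (fun hd => hqn (by
      have : n = a + s * b + t * a - j * b - (a - (n - s * b - t * a) - j * b) := by ring
      rw [this]
      exact dvd_sub (dvd_sub (dvd_add (dvd_add hqa (hqb.mul_left _)) (hqa.mul_left _))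
        (hqb.mul_left _)) hd))
  exact ⟨E.trans E', hE.trans hE', mapLat_trans hEΛ hE'Λ, c, hc, l', hl', hEl⟩

lemma exists_prime_smul_mem {Λ : Submodule ℤ V} [IsLattice ℚ Λ] {M : Submodule ℤ V}
    (h : ¬ M ≤ Λ) : ∃ x ∈ M, x ∉ Λ ∧ ∃ q : ℕ, q.Prime ∧ (q : ℤ) • x ∈ Λ := by
  classical
  obtain ⟨x, hx, hxΛ⟩ := SetLike.not_le_iff_exists.mp h
  have hex : ∃ n : ℕ, 0 < n ∧ (n : ℤ) • x ∈ Λ := by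
    obtain ⟨n, hn, hnx⟩ := exists_smul_mem Λ x
    refine ⟨n.natAbs, Int.natAbs_pos.mpr hn, ?_⟩
    rcases Int.natAbs_eq n with h | h
    · rwa [← h]
    · rw [h, neg_smul, neg_mem_iff] at hnx
      exact hnx
  obtain ⟨hn, hnx⟩ := Nat.find_spec hex
  have hmin : ∀ m, m < Nat.find hex → ¬ (0 < m ∧ (m : ℤ) • x ∈ Λ) := fun m => Nat.find_min hex
  generalize Nat.find hex = n at hn hnx hmin
  have hn1 : n ≠ 1 := by
    rintro rfl
    exact hxΛ (by simpa using hnx)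
  obtain ⟨q, hq, m, rfl⟩ := Nat.exists_prime_and_dvd hn1
  have hm : 0 < m := Nat.pos_of_mul_pos_left hn
  refine ⟨(m : ℤ) • x, zsmul_mem hx _, fun hmx => hmin m ?_ ⟨hm, hmx⟩, q, hq, ?_⟩
  · nlinarith [hq.two_le]
  · rw [smul_smul]
    exact_mod_cast hnx

/-- Every even lattice can be moved into a given maximal even lattice containing a hyperbolic
plane. -/
theorem HypPair.exists_le_mapLat {Λ : Submodule ℤ V} [IsLattice ℚ Λ] {u v : V}
    (h : HypPair B Λ u v) (hmax : IsMaxEven B Λ) {M : Submodule ℤ V} (hfg : M.FG)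
    (hM : IsEvenLat B M) : ∃ g : V ≃ₗ[ℚ] V, Isometry B B g ∧ M ≤ mapLat g Λ := by
  have hBs : B.IsSymm := ⟨h.symm⟩
  have : IsNoetherian ℤ M := isNoetherian_of_fg_of_noetherian M hfg
  obtain ⟨_, ⟨⟨g, hg⟩, rfl⟩, hgm⟩ := (wellFounded_gt (α := Submodule ℤ M)).has_min
    (Set.range fun g : {g : V ≃ₗ[ℚ] V // Isometry B B g} => (mapLat g.1 Λ).comap M.subtype)
    ⟨_, ⟨⟨_, Isometry.refl B⟩, rfl⟩⟩
  refine ⟨g, hg, ?_⟩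
  by_contra hle
  have hle' : ¬ mapLat g.symm M ≤ Λ := fun hh => hle fun x hx => mem_mapLat.mpr
    (hh (mem_mapLat.mpr (by simpa using hx)))
  obtain ⟨x, hx, hxΛ, q, hq, hqx⟩ := exists_prime_smul_mem hle'
  have hM' : IsEvenLat B (mapLat g.symm M) := hM.map hg.symm
  have hq0 : (q : ℚ) ≠ 0 := by exact_mod_cast hq.ne_zero
  have hqq := Nat.prime_iff_prime_int.mp hq
  obtain ⟨k, hk⟩ := hM' _ hx
  obtain ⟨l, hl, n, hn, hqn⟩ : ∃ l ∈ Λ, ∃ n : ℤ, B ((q : ℤ) • x) l = n ∧ ¬ (q : ℤ) ∣ n := by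
    by_contra! hcon
    refine hxΛ (hmax.2 x (mem_dual_iff.mpr fun l hl => ?_) ⟨k, hk⟩)
    obtain ⟨n, hn⟩ := h.int _ hqx _ hl
    obtain ⟨m, rfl⟩ := hcon l hl n hn
    refine ⟨m, ?_⟩
    rw [map_zsmul, LinearMap.smul_apply, zsmul_eq_mul] at hn
    push_cast at hn
    exact mul_left_cancel₀ hq0 hn
  obtain ⟨E, hE, hEΛ, c, hc, l', hl', hEl⟩ := h.exists_isometry_of_dual hq hqx (k := q * k) (by
    rw [map_zsmul, LinearMap.map_smul_of_tower, LinearMap.smul_apply, hk, zsmul_eq_mul,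
      zsmul_eq_mul]
    push_cast
    ring) hl hn hqn
  obtain ⟨F, hF, hFx⟩ := exists_hyperbolic_scaling h.symm h.sq₁ h.sq₂ h.mul hq0
  have hvu := h.swap.mul
  have hEx : E x = (c / q : ℚ) • u + l' := by
    rw [map_zsmul] at hEl
    have h1 : (q : ℚ)⁻¹ • (q : ℤ) • E x = E x := by
      rw [← Int.cast_smul_eq_zsmul ℚ, smul_smul, Int.cast_natCast, inv_mul_cancel₀ hq0, one_smul]
    rw [← h1, hEl, ← Int.cast_smul_eq_zsmul ℚ, ← Int.cast_smul_eq_zsmul ℚ, smul_add, smul_smul,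
      smul_smul, Int.cast_natCast, inv_mul_cancel₀ hq0, one_smul]
    congr 2
    ring
  have hFmem : ∀ z ∈ Λ, (∃ m : ℤ, B z u = q * m) → F.symm z ∈ Λ := by
    rintro z hz ⟨m, hm⟩
    rw [hFx]
    refine add_mem (add_mem hz (qsmul_mem h.mem₁ ?_)) (qsmul_mem h.mem₂ ?_)
    · obtain ⟨i, hi⟩ := h.int _ hz _ h.mem₂
      exact ⟨(q - 1) * i, by rw [hi]; push_cast; ring⟩
    · exact ⟨m - q * m, by rw [hm]; push_cast; field_simp⟩
  have hdvd : ∀ z ∈ Λ, (∃ i : ℤ, c / q * B z u = i) → ∃ m : ℤ, B z u = q * m := by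
    rintro z hz ⟨i, hi⟩
    obtain ⟨j, hj⟩ := h.int _ hz _ h.mem₁
    rw [hj] at hi
    have h1 : c * j = q * i := by
      field_simp at hi
      exact_mod_cast hi
    obtain ⟨m, rfl⟩ := (hqq.dvd_mul.mp ⟨i, h1⟩).resolve_left hc
    exact ⟨m, by rw [hj]; push_cast; ring⟩
  set g' : V ≃ₗ[ℚ] V := (F.trans E.symm).trans g with hg'
  have hgs : ∀ z, g'.symm z = F.symm (E (g.symm z)) := fun _ => rfl
  refine hgm _ ⟨⟨g', (hF.trans hE.symm).trans hg⟩, rfl⟩ ?_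
  change (mapLat g Λ).comap M.subtype < (mapLat g' Λ).comap M.subtype
  have hgx : g x ∈ M := by simpa using mem_mapLat.mp hx
  refine lt_of_le_of_ne (fun z hz => ?_) fun heq => ?_
  · rw [mem_comap, mem_mapLat, Submodule.subtype_apply] at hz ⊢
    rw [hgs]
    have hzΛ : E (g.symm z) ∈ Λ := (apply_mem_of_mapLat hEΛ).mpr hz
    refine hFmem _ hzΛ (hdvd _ hzΛ ?_)
    obtain ⟨i, hi⟩ := hM'.exists_int hBs (y := x) (mem_mapLat.mpr (by simp)) hx
      (x := g.symm z)
    obtain ⟨j, hj⟩ := h.int _ hzΛ _ hl'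
    rw [← hE, hEx, map_add, map_smul, smul_eq_mul, hj] at hi
    exact ⟨i - j, by push_cast; linear_combination hi⟩
  · have h1 : (⟨g x, hgx⟩ : M) ∈ (mapLat g' Λ).comap M.subtype := by
      rw [mem_comap, mem_mapLat, hgs]
      change F.symm (E (g.symm (g x))) ∈ Λ
      rw [g.symm_apply_apply, hEx]
      obtain ⟨m, hm⟩ := hdvd _ hl' (by
        have h2 := hE x x
        rw [hk, hEx] at h2
        simp only [map_add, map_smul, LinearMap.add_apply, LinearMap.smul_apply, h.sq₁, smul_eq_mul,
          h.symm u l'] at h2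
        obtain ⟨j, hj⟩ := h.even _ hl'
        exact ⟨k - j, by push_cast; linear_combination h2 / 2 - hj / 2⟩)
      rw [map_add]
      refine add_mem ?_ (hFmem _ hl' ⟨m, hm⟩)
      rw [hFx, map_smul, LinearMap.smul_apply, LinearMap.smul_apply, h.sq₁, h.mul]
      have : (c / q : ℚ) • u + ((q - 1 : ℚ) * (c / q : ℚ) • (1 : ℚ)) • u
          + (((q : ℚ)⁻¹ - 1) * (c / q : ℚ) • (0 : ℚ)) • v = (c : ℚ) • u := by
        simp only [smul_eq_mul, mul_zero, zero_smul, add_zero, mul_one, ← add_smul]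
        congr 1
        field_simp
        ring
      rw [this]
      exact qsmul_mem h.mem₁ ⟨c, rfl⟩
    rw [← heq, mem_comap, mem_mapLat] at h1
    exact hxΛ (by simpa using h1)

end
end Enriques

namespace Enriques
open LinearMap (BilinForm)
open Module Submodule

set_option linter.unusedSectionVars false

section
variable {K X : Type} [Field K] [AddCommGroup X] [Module K X] [FiniteDimensional K X]
  {b : BilinForm K X}

lemma orthogonal_orthogonal_of_le (hs : ∀ x y, b x y = b y x) {Y : Submodule K X}
    (hY : b.orthogonal ⊤ ≤ Y) : b.orthogonal (b.orthogonal Y) = Y := by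
  have hr : b.IsRefl := fun x y h => by rw [hs, h]
  have h1 := LinearMap.BilinForm.finrank_add_finrank_orthogonal hr Y
  have h2 := LinearMap.BilinForm.finrank_add_finrank_orthogonal hr (b.orthogonal Y)
  rw [inf_eq_right.mpr hY] at h1
  rw [inf_eq_right.mpr (LinearMap.BilinForm.orthogonal_le le_top)] at h2
  exact (eq_of_le_of_finrank_eq (LinearMap.BilinForm.le_orthogonal_orthogonal hr) (by lia)).symm

lemma le_finrank_orthogonal (hs : ∀ x y, b x y = b y x) (Y : Submodule K X) :
    finrank K X ≤ finrank K Y + finrank K (b.orthogonal Y) := by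
  have hr : b.IsRefl := fun x y h => by rw [hs, h]
  have h1 := LinearMap.BilinForm.finrank_add_finrank_orthogonal hr Y
  lia

lemma exists_anisotropic (hs : ∀ x y, b x y = b y x) (h2 : (2 : K) ≠ 0) {Q : Submodule K X}
    (h : finrank K X + finrank K (b.orthogonal ⊤) < 2 * finrank K Q) : ∃ n ∈ Q, b n n ≠ 0 := by
  by_contra! hcon
  have hr : b.IsRefl := fun x y h => by rw [hs, h]
  have hle : Q ≤ b.orthogonal Q := fun x hx y hy => by
    have h3 := hcon _ (add_mem hx hy)
    simp only [map_add, LinearMap.add_apply, hcon _ hx, hcon _ hy, hs x y] at h3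
    have h4 : 2 * b y x = 0 := by linear_combination h3
    exact (mul_eq_zero.mp h4).resolve_left h2
  have h3 := LinearMap.BilinForm.finrank_add_finrank_orthogonal hr Q
  have h4 := finrank_mono hle
  have h5 := finrank_mono (inf_le_right : Q ⊓ b.orthogonal ⊤ ≤ _)
  lia

lemma ringChar_ne_two {K : Type} [Field K] (h2 : (2 : K) ≠ 0) : ringChar K ≠ 2 := fun h => by
  have := ringChar.Nat.cast_ringChar (R := K)
  rw [h] at this
  exact h2 (by exact_mod_cast this)

lemma finrank_sup_span_singleton_le (Y : Submodule K X) (t : X) :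
    finrank K (Y ⊔ K ∙ t : Submodule K X) ≤ finrank K Y + 1 :=
  (finrank_add_le_finrank_add_finrank _ _).trans (Nat.add_le_add_left
    ((finrank_span_le_card _).trans (by simp)) _)

/-- A vector spanning hyperbolic planes with both of `x` and `y`. -/
lemma exists_isotropic_partner [Fintype K] (hs : ∀ x y, b x y = b y x) (h2 : (2 : K) ≠ 0)
    {C : Submodule K X} {x y : X} (hR : b.orthogonal ⊤ ≤ C)
    (hxC : x ∉ C ⊔ K ∙ (y - x))
    (hdim : 2 * finrank K C + finrank K (b.orthogonal ⊤) + 8 < finrank K X) :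
    ∃ z ∈ b.orthogonal C, b z z = 0 ∧ b z x = 1 ∧ b z y = 1 := by
  obtain ⟨z, hz, hzx⟩ : ∃ z ∈ b.orthogonal (C ⊔ K ∙ (y - x)), b z x ≠ 0 := by
    by_contra! hcon
    refine hxC ?_
    rw [← orthogonal_orthogonal_of_le hs (hR.trans (le_sup_left : C ≤ C ⊔ K ∙ (y - x)))]
    exact fun z hz => hcon z hz
  have hzC : z ∈ b.orthogonal C := LinearMap.BilinForm.orthogonal_le le_sup_left hz
  have hzy : b z y = b z x := by
    have := hz (y - x) (mem_sup_right (mem_span_singleton_self _))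
    rw [hs, map_sub] at this
    linear_combination this
  have hspan := finrank_sup_span_singleton_le (K := K) (X := X)
  obtain ⟨Q, hQ⟩ : ∃ Q, Q = C ⊔ K ∙ x ⊔ K ∙ y ⊔ K ∙ z := ⟨_, rfl⟩
  have hQd : finrank K Q ≤ finrank K C + 3 := by
    have h3 := hspan (C ⊔ K ∙ x ⊔ K ∙ y) z
    have h4 := hspan (C ⊔ K ∙ x) y
    have h5 := hspan C x
    rw [hQ]
    lia
  have hQ1 := le_finrank_orthogonal hs Q
  obtain ⟨n₁, hn₁, hnn₁⟩ := exists_anisotropic hs h2 (Q := b.orthogonal Q) (by lia)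
  have hQ2 := le_finrank_orthogonal hs (Q ⊔ K ∙ n₁)
  have hQd2 := hspan Q n₁
  obtain ⟨n₂, hn₂, hnn₂⟩ := exists_anisotropic hs h2 (Q := b.orthogonal (Q ⊔ K ∙ n₁)) (by lia)
  have hn₁₂ : b n₁ n₂ = 0 := hn₂ _ (mem_sup_right (mem_span_singleton_self _))
  have hn₂Q : n₂ ∈ b.orthogonal Q := LinearMap.BilinForm.orthogonal_le le_sup_left hn₂
  have hxQ : x ∈ Q := hQ ▸ mem_sup_left (mem_sup_left (mem_sup_right (mem_span_singleton_self _)))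
  have hyQ : y ∈ Q := hQ ▸ mem_sup_left (mem_sup_right (mem_span_singleton_self _))
  have hzQ : z ∈ Q := hQ ▸ mem_sup_right (mem_span_singleton_self _)
  have hCQ : C ≤ Q := hQ ▸ le_sup_left.trans (le_sup_left.trans le_sup_left)
  obtain ⟨s, t, hst⟩ := FiniteField.exists_root_sum_quadratic
    (f := Polynomial.C (b n₁ n₁) * Polynomial.X ^ 2)
    (g := Polynomial.C (b n₂ n₂) * Polynomial.X ^ 2 + Polynomial.C 0 * Polynomial.X
      + Polynomial.C (b z z))
    (Polynomial.degree_C_mul_X_pow 2 hnn₁) (Polynomial.degree_quadratic hnn₂)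
    (FiniteField.odd_card_of_char_ne_two (ringChar_ne_two h2))
  have hst' : b n₁ n₁ * s ^ 2 + b n₂ n₂ * t ^ 2 + b z z = 0 := by
    simpa [add_assoc] using hst
  have hb : ∀ w ∈ Q, b (z + s • n₁ + t • n₂) w = b z w := fun w hw => by
    rw [hs, map_add, map_add, map_smul, map_smul, hn₁ w hw, hn₂Q w hw, hs w z]
    simp
  refine ⟨(b z x)⁻¹ • (z + s • n₁ + t • n₂), ?_, ?_, ?_, ?_⟩
  · refine smul_mem _ _ (add_mem (add_mem hzC (smul_mem _ _ ?_)) (smul_mem _ _ ?_))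
    · exact LinearMap.BilinForm.orthogonal_le hCQ hn₁
    · exact LinearMap.BilinForm.orthogonal_le hCQ hn₂Q
  · have : b (z + s • n₁ + t • n₂) (z + s • n₁ + t • n₂) = 0 := by
      simp only [map_add, map_smul, LinearMap.add_apply, LinearMap.smul_apply, smul_eq_mul,
        hn₁ z hzQ, hn₂Q z hzQ, hs n₁ z, hs n₂ z, hs n₂ n₁, hn₁₂]
      linear_combination hst'
    rw [LinearMap.map_smul, LinearMap.map_smul₂, this, smul_zero, smul_zero]
  · rw [map_smul, LinearMap.smul_apply, hb x hxQ, smul_eq_mul, inv_mul_cancel₀ hzx]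
  · rw [map_smul, LinearMap.smul_apply, hb y hyQ, hzy, smul_eq_mul, inv_mul_cancel₀ hzx]

/-- An isotropic vector orthogonal to, and outside of, a small subspace. -/
lemma exists_isotropic_notMem [Fintype K] (hs : ∀ x y, b x y = b y x) (h2 : (2 : K) ≠ 0)
    (Y : Submodule K X) (hdim : 2 * finrank K Y + finrank K (b.orthogonal ⊤) + 4 < finrank K X) :
    ∃ t ∈ b.orthogonal Y, b t t = 0 ∧ t ∉ Y := by
  have hspan := finrank_sup_span_singleton_le (K := K) (X := X)
  have hQ1 := le_finrank_orthogonal hs Y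
  obtain ⟨n₁, hn₁, hnn₁⟩ := exists_anisotropic hs h2 (Q := b.orthogonal Y) (by lia)
  have hQ2 := le_finrank_orthogonal hs (Y ⊔ K ∙ n₁)
  have hd2 := hspan Y n₁
  obtain ⟨n₂, hn₂, hnn₂⟩ := exists_anisotropic hs h2 (Q := b.orthogonal (Y ⊔ K ∙ n₁)) (by lia)
  have hQ3 := le_finrank_orthogonal hs (Y ⊔ K ∙ n₁ ⊔ K ∙ n₂)
  have hd3 := hspan (Y ⊔ K ∙ n₁) n₂
  obtain ⟨n₃, hn₃, hnn₃⟩ := exists_anisotropic hs h2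
    (Q := b.orthogonal (Y ⊔ K ∙ n₁ ⊔ K ∙ n₂)) (by lia)
  have h12 : b n₁ n₂ = 0 := hn₂ _ (mem_sup_right (mem_span_singleton_self _))
  have h13 : b n₁ n₃ = 0 := hn₃ _ (mem_sup_left (mem_sup_right (mem_span_singleton_self _)))
  have h23 : b n₂ n₃ = 0 := hn₃ _ (mem_sup_right (mem_span_singleton_self _))
  have hn₂Y : n₂ ∈ b.orthogonal Y := LinearMap.BilinForm.orthogonal_le le_sup_left hn₂
  have hn₃Y : n₃ ∈ b.orthogonal Y :=
    LinearMap.BilinForm.orthogonal_le (le_sup_left.trans le_sup_left) hn₃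
  obtain ⟨s, t, hst⟩ := FiniteField.exists_root_sum_quadratic
    (f := Polynomial.C (b n₁ n₁) * Polynomial.X ^ 2)
    (g := Polynomial.C (b n₂ n₂) * Polynomial.X ^ 2 + Polynomial.C 0 * Polynomial.X
      + Polynomial.C (b n₃ n₃))
    (Polynomial.degree_C_mul_X_pow 2 hnn₁) (Polynomial.degree_quadratic hnn₂)
    (FiniteField.odd_card_of_char_ne_two (ringChar_ne_two h2))
  have hst' : b n₁ n₁ * s ^ 2 + b n₂ n₂ * t ^ 2 + b n₃ n₃ = 0 := by
    simpa [add_assoc] using hst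
  refine ⟨s • n₁ + t • n₂ + n₃, add_mem (add_mem (smul_mem _ _ hn₁) (smul_mem _ _ hn₂Y)) hn₃Y,
    ?_, fun h => hnn₃ ?_⟩
  · simp only [map_add, map_smul, LinearMap.add_apply, LinearMap.smul_apply, smul_eq_mul,
      hs n₂ n₁, hs n₃ n₁, hs n₃ n₂, h12, h13, h23]
    linear_combination hst'
  · have := hn₃Y _ h
    simpa [h13, h23] using this

/-- Closure of a set of isometries under composition with Eichler transvections. -/
def EichlerClosed (b : BilinForm K X) (𝒢 : Set (X ≃ₗ[K] X)) : Prop :=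
  ∀ φ ∈ 𝒢, ∀ z w, b z z = 0 → b w w = 0 → b z w = 0 → (∃ t, b z t ≠ 0) →
    ∃ ψ ∈ 𝒢, ∀ t, ψ t = φ t + b (φ t) z • w - b (φ t) w • z

variable {𝒢 : Set (X ≃ₗ[K] X)}

lemma exists_swap_of_orthogonal [Fintype K] (hE : EichlerClosed b 𝒢)
    (hs : ∀ x y, b x y = b y x) (h2 : (2 : K) ≠ 0)
    {φ : X ≃ₗ[K] X} (hφ : φ ∈ 𝒢)
    {C : Submodule K X} {x y : X} (hR : b.orthogonal ⊤ ≤ C)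
    (hxC : x ∉ C ⊔ K ∙ (y - x)) (hx : x ∈ b.orthogonal C) (hy : y ∈ b.orthogonal C)
    (hxx : b x x = 0) (hxy : b x y = 0) (hyy : b y y = 0)
    (hdim : 2 * finrank K C + finrank K (b.orthogonal ⊤) + 8 < finrank K X) :
    ∃ ψ ∈ 𝒢, (∀ c, φ c ∈ C → ψ c = φ c) ∧ ∀ c, φ c = x → ψ c = y := by
  obtain ⟨z, hzC, hzz, hzx, hzy⟩ := exists_isotropic_partner hs h2 hR hxC hdim
  have hyx : b y x = 0 := by rw [hs, hxy]
  obtain ⟨ψ, hψ, hψt⟩ := hE φ hφ z (y - x) hzz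
    (by simp [hxx, hxy, hyy, hyx]) (by simp [hzx, hzy]) ⟨x, by simp [hzx]⟩
  refine ⟨ψ, hψ, fun c hc => ?_, fun c hc => ?_⟩
  · have h3 : b (φ c) z = 0 := hzC _ hc
    have h4 : b (φ c) (y - x) = 0 := by rw [map_sub, hx _ hc, hy _ hc, sub_zero]
    rw [hψt, h3, h4]
    simp
  · rw [hψt, hc, hs x z, hzx, map_sub, hxx, hxy]
    simp

lemma exists_swap [Fintype K] (hE : EichlerClosed b 𝒢)
    (hs : ∀ x y, b x y = b y x) (h2 : (2 : K) ≠ 0)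
    {φ : X ≃ₗ[K] X} (hφ : φ ∈ 𝒢)
    {C : Submodule K X} {x y : X} (hR : b.orthogonal ⊤ ≤ C)
    (hxC : x ∉ C) (hyC : y ∉ C) (hx : x ∈ b.orthogonal C) (hy : y ∈ b.orthogonal C)
    (hxx : b x x = 0) (hyy : b y y = 0)
    (hdim : 2 * finrank K C + finrank K (b.orthogonal ⊤) + 8 < finrank K X) :
    ∃ ψ ∈ 𝒢, (∀ c, φ c ∈ C → ψ c = φ c) ∧ ∀ c, φ c = x → ψ c = y := by
  have hspan := finrank_sup_span_singleton_le (K := K) (X := X)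
  have hd1 := hspan C x
  have hd2 := hspan (C ⊔ K ∙ x) y
  obtain ⟨t, ht, htt, htY⟩ := exists_isotropic_notMem hs h2 (C ⊔ K ∙ x ⊔ K ∙ y) (by lia)
  have htC : t ∈ b.orthogonal C :=
    LinearMap.BilinForm.orthogonal_le (le_sup_left.trans le_sup_left) ht
  have hxt : b x t = 0 := ht _ (mem_sup_left (mem_sup_right (mem_span_singleton_self _)))
  have hyt : b y t = 0 := ht _ (mem_sup_right (mem_span_singleton_self _))
  have hCY : C ≤ C ⊔ K ∙ x ⊔ K ∙ y := le_sup_left.trans le_sup_left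
  have hxY : x ∈ C ⊔ K ∙ x ⊔ K ∙ y :=
    mem_sup_left (mem_sup_right (mem_span_singleton_self _))
  have hyY : y ∈ C ⊔ K ∙ x ⊔ K ∙ y := mem_sup_right (mem_span_singleton_self _)
  obtain ⟨ψ, hψ, h3, h4⟩ := exists_swap_of_orthogonal hE hs h2 hφ hR (x := x) (y := t)
    (fun h => by
      obtain ⟨c, hc, _, hu, h⟩ := mem_sup.mp h
      obtain ⟨k, rfl⟩ := mem_span_singleton.mp hu
      by_cases hk : k = 0
      · rw [hk, zero_smul, add_zero] at h
        exact hxC (h ▸ hc)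
      · refine htY ?_
        have : t = k⁻¹ • ((1 + k) • x - c) := by
          rw [eq_inv_smul_iff₀ hk, add_smul, one_smul]
          nth_rewrite 1 [← h]
          module
        rw [this]
        exact smul_mem _ _ (sub_mem (smul_mem _ _ hxY) (hCY hc)))
    hx htC hxx hxt htt hdim
  obtain ⟨ψ', hψ', h5, h6⟩ := exists_swap_of_orthogonal hE hs h2 hψ hR (x := t) (y := y)
    (fun h => by
      obtain ⟨c, hc, _, hu, h⟩ := mem_sup.mp h
      obtain ⟨k, rfl⟩ := mem_span_singleton.mp hu
      have h7 : (1 + k) • t = c + k • y := by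
        rw [add_smul, one_smul]
        nth_rewrite 1 [← h]
        module
      by_cases hk : 1 + k = 0
      · have hk' : k = -1 := by linear_combination hk
        rw [hk, hk', zero_smul] at h7
        have h8 : c - y = 0 := by rw [h7]; module
        exact hyC (sub_eq_zero.mp h8 ▸ hc)
      · refine htY ?_
        rw [(eq_inv_smul_iff₀ hk).mpr h7]
        exact smul_mem _ _ (add_mem (hCY hc) (smul_mem _ _ hyY)))
    htC hy htt (by rw [hs, hyt]) hyy hdim
  exact ⟨ψ', hψ', fun c hc => (h5 c (by rwa [h3 c hc])).trans (h3 c hc),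
    fun c hc => h6 c (h4 c hc)⟩

/-- If a set of isometries is closed under composition with Eichler transformations, some member
maps a totally isotropic subspace `D` into another one of at least the same dimension. -/
lemma exists_map_le_of_eichler [Fintype K] (hE : EichlerClosed b 𝒢)
    (hs : ∀ x y, b x y = b y x) (h2 : (2 : K) ≠ 0)
    (h1 : LinearEquiv.refl K X ∈ 𝒢)
    (hiso : ∀ φ ∈ 𝒢, ∀ x y, b (φ x) (φ y) = b x y)
    {D F : Submodule K X} (hRD : b.orthogonal ⊤ ≤ D) (hRF : b.orthogonal ⊤ ≤ F)
    (hD : D ≤ b.orthogonal D) (hF : F ≤ b.orthogonal F) (hDF : finrank K D ≤ finrank K F)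
    (hdim : 2 * finrank K D + finrank K (b.orthogonal ⊤) + 6 < finrank K X) :
    ∃ φ ∈ 𝒢, D.map φ.toLinearMap ≤ F := by
  obtain ⟨_, ⟨⟨φ, hφ⟩, rfl⟩, hmax⟩ := (wellFounded_gt (α := Submodule K X)).has_min
    (Set.range fun φ : 𝒢 => D.map φ.1.toLinearMap ⊓ F) ⟨_, ⟨⟨_, h1⟩, rfl⟩⟩
  refine ⟨φ, hφ, ?_⟩
  by_contra hle
  change ∀ x ∈ _, ¬ D.map φ.toLinearMap ⊓ F < x at hmax
  set D' := D.map φ.toLinearMap with hD'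
  have hDd : finrank K D' = finrank K D := LinearEquiv.finrank_map_eq φ D
  have hRD' : b.orthogonal ⊤ ≤ D' := fun r hr => by
    refine ⟨φ.symm r, hRD fun t _ => ?_, φ.apply_symm_apply r⟩
    rw [← hiso φ hφ]
    simpa using hr (φ t) trivial
  have hDi : D' ≤ b.orthogonal D' := by
    rintro _ ⟨x, hx, rfl⟩ _ ⟨y, hy, rfl⟩
    have := hiso φ hφ y x
    exact this.trans (hD hx y hy)
  have hCd : finrank K (D' ⊓ F : Submodule K X) < finrank K D' :=
    finrank_lt_finrank_of_lt (lt_of_le_of_ne inf_le_left fun h => hle (inf_eq_left.mp h))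
  have hFD : ¬ F ≤ D' := fun h => by
    rw [inf_eq_right.mpr h] at hCd
    lia
  obtain ⟨x, hx, hxF⟩ := SetLike.not_le_iff_exists.mp hle
  obtain ⟨y, hy, hyD⟩ := SetLike.not_le_iff_exists.mp hFD
  have hx0 : x ∈ b.orthogonal (D' ⊓ F) := LinearMap.BilinForm.orthogonal_le inf_le_left (hDi hx)
  have hy0 : y ∈ b.orthogonal (D' ⊓ F) := LinearMap.BilinForm.orthogonal_le inf_le_right (hF hy)
  obtain ⟨ψ, hψ, h3, h4⟩ := exists_swap hE hs h2 hφ (le_inf hRD' hRF) (fun h => hxF h.2)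
    (fun h => hyD h.1) hx0 hy0 (hDi hx x hx) (hF hy y hy) (by lia)
  refine hmax _ ⟨⟨ψ, hψ⟩, rfl⟩ (lt_of_le_of_ne ?_ fun h => hyD ?_)
  · rintro _ ⟨⟨c, hc, rfl⟩, hcF⟩
    exact ⟨⟨c, hc, h3 c ⟨⟨c, hc, rfl⟩, hcF⟩⟩, hcF⟩
  · obtain ⟨c, hc, hcx⟩ := hx
    have : y ∈ D.map φ.toLinearMap ⊓ F := by
      rw [h]
      exact ⟨⟨c, hc, h4 c hcx⟩, hy⟩
    exact this.1

end

end Enriques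

namespace Enriques
open LinearMap (BilinForm)
open Module Submodule

set_option linter.unusedSectionVars false

section
variable {V : Type} [AddCommGroup V] [Module ℚ V] {B : BilinForm ℚ V}

lemma mapLat_symm {e : V ≃ₗ[ℚ] V} {Λ : Submodule ℤ V} (h : mapLat e Λ = Λ) :
    mapLat e.symm Λ = Λ := by
  ext x
  rw [mem_mapLat, e.symm_symm, apply_mem_of_mapLat h]

/-- Eichler transformations modulo `p` lift to isometries of the lattice. -/
lemma HypPair.exists_lift_eichler {Λ : Submodule ℤ V} {u v : V} (h : HypPair B Λ u v)
    {p : ℕ} (hp : p.Prime) {ζ ω : V} (hζ : ζ ∈ Λ) (hω : ω ∈ Λ) {k k' m : ℤ}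
    (hk : B ζ ζ = 2 * (p * k)) (hk' : B ω ω = 2 * (p * k')) (hm : B ζ ω = p * m)
    {l : V} (hl : l ∈ Λ) {n : ℤ} (hn : B ζ l = n) (hpn : ¬ (p : ℤ) ∣ n) :
    ∃ E : V ≃ₗ[ℚ] V, Isometry B B E ∧ mapLat E Λ = Λ ∧
      ∀ t ∈ Λ, ∃ r ∈ Λ, E t = t + B t ζ • ω - B t ω • ζ + (p : ℚ) • r := by
  obtain ⟨g, hg, hgΛ, c, -, l, hl, hgζ⟩ := h.exists_isometry_of_dual hp hζ hk hl hn hpn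
  rw [← Int.cast_smul_eq_zsmul ℚ, ← Int.cast_smul_eq_zsmul ℚ, Int.cast_natCast] at hgζ
  have hgω : g ω ∈ Λ := (apply_mem_of_mapLat hgΛ).mpr hω
  have hsm : ∀ (a : ℤ) {x : V}, x ∈ Λ → (a : ℚ) • x ∈ Λ := fun a x hx => qsmul_mem hx ⟨a, rfl⟩
  have hcu : (c : ℚ) * B u (g ω) + p * B l (g ω) = p * m := by
    have := hg ζ ω
    rw [hgζ, hm] at this
    simpa using this
  obtain ⟨a, ha⟩ := h.int _ hl _ hgω
  have hpΛ : ∀ {x : V}, x ∈ Λ → (p : ℚ) • x ∈ Λ := fun {x} hx => by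
    simpa using hsm (p : ℤ) hx
  have hwΛ : (c : ℚ) • g ω - ((m - a : ℤ) : ℚ) • (p : ℚ) • v ∈ Λ :=
    sub_mem (hsm c hgω) (hsm _ (hpΛ h.mem₂))
  obtain ⟨E, hE, hEΛ, hEt⟩ := h.exists_eichler hwΛ (by
    simp only [map_sub, map_smul, smul_eq_mul, h.mul]
    rw [ha] at hcu
    push_cast
    linear_combination hcu)
  refine ⟨(g.trans E).trans g.symm, (hg.trans hE).trans hg.symm,
    mapLat_trans (mapLat_trans hgΛ hEΛ) (mapLat_symm hgΛ), fun t ht => ?_⟩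
  have hT : g t ∈ Λ := (apply_mem_of_mapLat hgΛ).mpr ht
  obtain ⟨s, hs, hsE⟩ : ∃ s ∈ Λ,
      E (g t) = g t + B t ζ • g ω - B t ω • g ζ + (p : ℚ) • s := by
    obtain ⟨e₁, h₁⟩ := h.int _ hT _ h.mem₁
    obtain ⟨e₂, h₂⟩ := h.int _ hT _ h.mem₂
    obtain ⟨e₃, h₃⟩ := h.int _ hT _ hgω
    obtain ⟨e₄, h₄⟩ := h.int _ hT _ hl
    obtain ⟨e₅, h₅⟩ := h.int _ hgω _ h.mem₂
    refine ⟨-((e₁ * (m - a) : ℤ) : ℚ) • v + (((m - a) * e₂ : ℤ) : ℚ) • u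
      - (((c ^ 2 * k' - c * (m - a) * e₅) * e₁ : ℤ) : ℚ) • u - (e₄ : ℚ) • g ω + (e₃ : ℚ) • l,
      ?_, ?_⟩
    · refine add_mem (sub_mem (sub_mem (add_mem ?_ (hsm _ h.mem₁)) (hsm _ h.mem₁))
        (hsm _ hgω)) (hsm _ hl)
      have := hsm (-(e₁ * (m - a))) h.mem₂
      push_cast at this ⊢
      exact this
    · have h6 : B t ζ = c * e₁ + p * e₄ := by
        rw [← hg t ζ, hgζ, map_add, map_smul, map_smul, h₁, h₄, smul_eq_mul, smul_eq_mul]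
      have h7 : B t ω = e₃ := by rw [← hg, h₃]
      have h8 : B (g ω) (g ω) = 2 * (p * k') := by rw [hg, hk']
      rw [hEt, h6, h7, hgζ]
      simp only [map_sub, map_smul, LinearMap.sub_apply, LinearMap.smul_apply, smul_eq_mul, h₁, h₂,
        h₃, h8, h₅, h.symm v (g ω), h.sq₂]
      push_cast
      module
  refine ⟨g.symm s, (apply_mem_of_mapLat (mapLat_symm hgΛ)).mpr hs, ?_⟩
  change g.symm (E (g t)) = _
  rw [hsE]
  simp

end

end Enriques

namespace Enriques
open LinearMap (BilinForm)
open Module Submodule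

set_option linter.unusedSectionVars false

section
variable {ι : Type} [Fintype ι] [DecidableEq ι] {p : ℕ}

/-- The reduction modulo `p` of the form with a given Gram matrix. -/
def modForm (p : ℕ) (G : Matrix ι ι ℤ) : BilinForm (ZMod p) (ι → ZMod p) :=
  Matrix.toBilin' (G.map Int.cast)

lemma modForm_apply (G : Matrix ι ι ℤ) (x y : ι → ZMod p) :
    modForm p G x y = x ⬝ᵥ (G.map Int.cast).mulVec y := by
  rw [modForm, Matrix.toBilin'_apply']

lemma modForm_redVec (G : Matrix ι ι ℤ) (x y : ι → ℤ) :
    modForm p G (redVec p x) (redVec p y) = ((x ⬝ᵥ G.mulVec y : ℤ) : ZMod p) := by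
  rw [modForm_apply]
  simp [dotProduct, Matrix.mulVec]

lemma modForm_symm {G : Matrix ι ι ℤ} (hG : G.IsSymm) (x y : ι → ZMod p) :
    modForm p G x y = modForm p G y x := by
  obtain ⟨x, rfl⟩ := redVec_surjective p x
  obtain ⟨y, rfl⟩ := redVec_surjective p y
  rw [modForm_redVec, modForm_redVec, dotProduct_symm hG]

lemma modForm_radical {G : Matrix ι ι ℤ} (x : ι → ZMod p) :
    x ∈ (modForm p G).orthogonal ⊤ ↔ (G.map (Int.cast : ℤ → ZMod p)).mulVec x = 0 := by
  constructor
  · intro h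
    ext i
    have := h (Pi.single i 1) trivial
    rw [modForm_apply, single_one_dotProduct] at this
    exact this
  · intro h y _
    change modForm p G y x = 0
    rw [modForm_apply, h, dotProduct_zero]

lemma finrank_radical [Fact p.Prime] {G : Matrix ι ι ℤ} {j : ℕ}
    (hG : ∀ v, ∃ w, G.mulVec w = (p : ℤ) • v) (hd : G.det.natAbs = p ^ j) :
    finrank (ZMod p) ((modForm p G).orthogonal ⊤) = j := by
  have h1 := finrank_range_of_det hG hd
  have h2 := LinearMap.finrank_range_add_finrank_ker (G.map (Int.cast : ℤ → ZMod p)).mulVecLin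
  have h3 : (modForm p G).orthogonal ⊤
      = LinearMap.ker (G.map (Int.cast : ℤ → ZMod p)).mulVecLin := by
    ext x
    rw [modForm_radical]
    rfl
  rw [h3]
  rw [finrank_fintype_fun_eq_card] at h2
  lia

/-- `φ` is the reduction modulo `p` of `E`. -/
def IsReduction (p : ℕ) (E : (ι → ℚ) ≃ₗ[ℚ] (ι → ℚ))
    (φ : (ι → ZMod p) ≃ₗ[ZMod p] (ι → ZMod p)) : Prop :=
  ∀ z z', E (intVec z) = intVec z' → φ (redVec p z) = redVec p z'

lemma exists_isReduction (p : ℕ) {E : (ι → ℚ) ≃ₗ[ℚ] (ι → ℚ)} (hE : mapLat E (stdLat ι) = stdLat ι) :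
    ∃ φ, IsReduction p E φ := by
  obtain ⟨A, hA⟩ := exists_intMatrix E.toLinearMap fun x hx => (apply_mem_of_mapLat hE).mpr hx
  obtain ⟨A', hA'⟩ := exists_intMatrix E.symm.toLinearMap fun x hx =>
    (apply_mem_of_mapLat (mapLat_symm hE)).mpr hx
  simp only [LinearEquiv.coe_coe] at hA hA'
  have h1 : ∀ z, A *ᵥ (A' *ᵥ z) = z := fun z => intVec_injective (by
    rw [← hA, ← hA', E.apply_symm_apply])
  have h2 : ∀ z, A' *ᵥ (A *ᵥ z) = z := fun z => intVec_injective (by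
    rw [← hA', ← hA, E.symm_apply_apply])
  refine ⟨LinearEquiv.ofLinearMap (A.map (Int.cast : ℤ → ZMod p)).mulVecLin
    (A'.map (Int.cast : ℤ → ZMod p)).mulVecLin (LinearMap.ext fun x => ?_)
    (LinearMap.ext fun x => ?_), fun z z' h => ?_⟩
  · obtain ⟨x, rfl⟩ := redVec_surjective p x
    simp only [LinearMap.comp_apply, mulVecLin_apply, LinearMap.id_apply, ← redVec_mulVec, h1]
  · obtain ⟨x, rfl⟩ := redVec_surjective p x
    simp only [LinearMap.comp_apply, mulVecLin_apply, LinearMap.id_apply, ← redVec_mulVec, h2]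
  · rw [hA] at h
    rw [← intVec_injective h, redVec_mulVec]
    rfl

lemma intVec_smul (c : ℤ) (z : ι → ℤ) : intVec (c • z) = (c : ℚ) • intVec z := by
  ext; simp [intVec]

lemma intVec_add (y z : ι → ℤ) : intVec (y + z) = intVec y + intVec z := by
  ext; simp [intVec]

lemma intVec_sub (y z : ι → ℤ) : intVec (y - z) = intVec y - intVec z := by
  ext; simp [intVec]

/-- The reductions of the isometries of a lattice. -/
def modIsometries (p : ℕ) (G : Matrix ι ι ℤ) : Set ((ι → ZMod p) ≃ₗ[ZMod p] (ι → ZMod p)) :=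
  {φ | ∃ E : (ι → ℚ) ≃ₗ[ℚ] (ι → ℚ), Isometry (gramForm G) (gramForm G) E ∧
    mapLat E (stdLat ι) = stdLat ι ∧ IsReduction p E φ}

lemma refl_mem_modIsometries (G : Matrix ι ι ℤ) : LinearEquiv.refl _ _ ∈ modIsometries p G := by
  refine ⟨LinearEquiv.refl _ _, Isometry.refl _, ?_, fun z z' h => ?_⟩
  · exact mapLat_eq_self (fun x hx => hx) fun x hx => hx
  · rw [← intVec_injective h]
    rfl

lemma modForm_of_mem_modIsometries {G : Matrix ι ι ℤ} {φ} (hφ : φ ∈ modIsometries p G) (x y) :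
    modForm p G (φ x) (φ y) = modForm p G x y := by
  obtain ⟨E, hE, hEΛ, hr⟩ := hφ
  obtain ⟨x, rfl⟩ := redVec_surjective p x
  obtain ⟨y, rfl⟩ := redVec_surjective p y
  obtain ⟨x', hx'⟩ := mem_stdLat.mp ((apply_mem_of_mapLat hEΛ).mpr (intVec_mem x))
  obtain ⟨y', hy'⟩ := mem_stdLat.mp ((apply_mem_of_mapLat hEΛ).mpr (intVec_mem y))
  have := hE (intVec x) (intVec y)
  rw [hx', hy', gramForm_intVec, gramForm_intVec] at this
  rw [hr _ _ hx', hr _ _ hy', modForm_redVec, modForm_redVec, Int.cast_injective this]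

lemma exists_eichler_mem_modIsometries {G : Matrix ι ι ℤ} (hp : p.Prime) (hp2 : p ≠ 2)
    (hev : ∀ z, 2 ∣ z ⬝ᵥ G *ᵥ z) {u v} (h : HypPair (gramForm G) (stdLat ι) u v) :
    ∀ φ ∈ modIsometries p G, ∀ z w, modForm p G z z = 0 → modForm p G w w = 0 →
      modForm p G z w = 0 → (∃ t, modForm p G z t ≠ 0) →
      ∃ ψ ∈ modIsometries p G, ∀ t, ψ t = φ t + modForm p G (φ t) z • w
        - modForm p G (φ t) w • z := by
  rintro φ ⟨E, hE, hEΛ, hr⟩ z w hzz hww hzw ⟨t, ht⟩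
  obtain ⟨z, rfl⟩ := redVec_surjective p z
  obtain ⟨w, rfl⟩ := redVec_surjective p w
  obtain ⟨t, rfl⟩ := redVec_surjective p t
  rw [modForm_redVec, ZMod.intCast_zmod_eq_zero_iff_dvd] at hzz hww hzw
  rw [modForm_redVec, Ne, ZMod.intCast_zmod_eq_zero_iff_dvd] at ht
  have hcop : IsCoprime (2 : ℤ) p := by
    have := (Nat.coprime_primes Nat.prime_two hp).mpr hp2.symm
    exact_mod_cast Nat.isCoprime_iff_coprime.mpr this
  obtain ⟨k, hk⟩ := hcop.mul_dvd (hev z) hzz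
  obtain ⟨k', hk'⟩ := hcop.mul_dvd (hev w) hww
  obtain ⟨m, hm⟩ := hzw
  obtain ⟨E', hE', hE'Λ, hE't⟩ := h.exists_lift_eichler hp (intVec_mem z) (intVec_mem w)
    (k := k) (k' := k') (m := m) (by rw [gramForm_intVec, hk]; push_cast; ring)
    (by rw [gramForm_intVec, hk']; push_cast; ring) (by rw [gramForm_intVec, hm]; push_cast; ring)
    (intVec_mem t) (gramForm_intVec _ _ _) ht
  have hEE := mapLat_trans hEΛ hE'Λ
  obtain ⟨ψ, hψ⟩ := exists_isReduction p hEE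
  refine ⟨ψ, ⟨_, hE.trans hE', hEE, hψ⟩, fun t => ?_⟩
  obtain ⟨t, rfl⟩ := redVec_surjective p t
  obtain ⟨t', ht'⟩ := mem_stdLat.mp ((apply_mem_of_mapLat hEΛ).mpr (intVec_mem t))
  obtain ⟨r, hr', hEr⟩ := hE't _ (intVec_mem t')
  obtain ⟨r, rfl⟩ := mem_stdLat.mp hr'
  have h3 : (E.trans E') (intVec t) = intVec (t' + (t' ⬝ᵥ G *ᵥ z) • w - (t' ⬝ᵥ G *ᵥ w) • z
      + (p : ℤ) • r) := by
    rw [LinearEquiv.trans_apply, ht', hEr, gramForm_intVec, gramForm_intVec, intVec_add,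
      intVec_sub, intVec_add, intVec_smul, intVec_smul, intVec_smul]
    rfl
  rw [hψ _ _ h3, hr _ _ ht', modForm_redVec, modForm_redVec, map_add, map_sub, map_add, redVec_smul,
    redVec_smul, redVec_smul]
  simp

/-- Some isometry moves the sublattice `Pℤⁿ` to one containing all the vectors orthogonal modulo `p`
to a large totally isotropic subspace. -/
theorem exists_isometry_range_ge {G P : Matrix ι ι ℤ} (hp : p.Prime) (hp2 : p ≠ 2)
    (hs : G.IsSymm) (hev : ∀ z, 2 ∣ z ⬝ᵥ G *ᵥ z) {u v} (h : HypPair (gramForm G) (stdLat ι) u v)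
    {j s : ℕ} (hG : ∀ v, ∃ w, G *ᵥ w = (p : ℤ) • v) (hd : G.det.natAbs = p ^ j)
    (hP : ∀ v, ∃ w, P *ᵥ w = (p : ℤ) • v) (hPd : P.det.natAbs = p ^ s)
    (hPG : ∀ v, ∃ w, (Pᵀ * G * P) *ᵥ w = (p : ℤ) • v)
    {F : Submodule (ZMod p) (ι → ZMod p)} (hF : F ≤ (modForm p G).orthogonal F)
    (hRF : (modForm p G).orthogonal ⊤ ≤ F) (hFd : s + j ≤ finrank (ZMod p) F)
    (hdim : 2 * s + 3 * j + 6 < Fintype.card ι) :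
    ∃ E : (ι → ℚ) ≃ₗ[ℚ] (ι → ℚ), Isometry (gramForm G) (gramForm G) E ∧
      mapLat E (stdLat ι) = stdLat ι ∧
      ∀ z, redVec p z ∈ (modForm p G).orthogonal F → ∃ w, E (intVec (P *ᵥ w)) = intVec z := by
  have : Fact p.Prime := ⟨hp⟩
  have hbs := modForm_symm (p := p) hs
  have hr : (modForm p G).IsRefl := fun x y h => by rw [hbs, h]
  set W := LinearMap.range (P.map (Int.cast : ℤ → ZMod p)).mulVecLin with hW
  have hdet : (Pᵀ * G).det ≠ 0 := by
    rw [det_mul, det_transpose]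
    refine mul_ne_zero ?_ ?_ <;> rw [← Int.natAbs_ne_zero]
    · rw [hPd]; exact pow_ne_zero _ hp.ne_zero
    · rw [hd]; exact pow_ne_zero _ hp.ne_zero
  have hDW : (modForm p G).orthogonal W ≤ W := fun x hx => by
    obtain ⟨x, rfl⟩ := redVec_surjective p x
    have h1 : redVec p ((Pᵀ * G) *ᵥ x) = 0 := by
      ext i
      have := hx (redVec p (P *ᵥ Pi.single i 1)) ⟨redVec p (Pi.single i 1), by
        rw [redVec_mulVec]; rfl⟩
      rw [modForm_redVec] at this
      have h2 := mulVec_dotProduct_mulVec P G 1 (Pi.single i 1) x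
      rw [one_mulVec, mul_one, single_one_dotProduct] at h2
      rw [redVec_apply, ← h2, this]
      rfl
    obtain ⟨v, hv⟩ := redVec_eq_zero.mp h1
    obtain ⟨w, hw⟩ := hPG v
    have h2 : x = P *ᵥ w := by
      rw [← sub_eq_zero]
      refine eq_zero_of_mulVec_eq_zero hdet ?_
      rw [mulVec_sub, hv, mulVec_mulVec, hw, sub_self]
    exact ⟨redVec p w, by rw [h2, redVec_mulVec]; rfl⟩
  have hRD : (modForm p G).orthogonal ⊤ ≤ (modForm p G).orthogonal W :=
    LinearMap.BilinForm.orthogonal_le le_top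
  have hWW := orthogonal_orthogonal_of_le hbs (hRD.trans hDW)
  have hR := finrank_radical hG hd
  have hWd := finrank_range_of_det hP hPd
  have hDd : finrank (ZMod p) ((modForm p G).orthogonal W) = s + j := by
    have h1 := LinearMap.BilinForm.finrank_add_finrank_orthogonal hr W
    rw [inf_eq_right.mpr (hRD.trans hDW), hR, finrank_fintype_fun_eq_card] at h1
    rw [← hW] at hWd
    lia
  have h2 : (2 : ZMod p) ≠ 0 := by
    intro h0
    have : ((2 : ℕ) : ZMod p) = 0 := by exact_mod_cast h0
    rw [ZMod.natCast_eq_zero_iff] at this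
    exact hp2 ((Nat.prime_dvd_prime_iff_eq hp Nat.prime_two).mp this)
  obtain ⟨φ, hφ, hφF⟩ := exists_map_le_of_eichler (exists_eichler_mem_modIsometries hp hp2 hev h)
    hbs h2 (refl_mem_modIsometries G) (fun φ hφ => modForm_of_mem_modIsometries hφ) hRD hRF
    (hWW.symm ▸ hDW) hF (hDd.trans_le hFd) (by
      rw [hDd, hR, finrank_fintype_fun_eq_card]
      lia)
  have hφ' := hφ
  obtain ⟨E, hE, hEΛ, hEr⟩ := hφ
  refine ⟨E, hE, hEΛ, fun z hz => ?_⟩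
  have h3 : φ.symm (redVec p z) ∈ W := by
    rw [← hWW]
    intro d hd
    have := hz (φ d) (hφF ⟨d, hd, rfl⟩)
    change modForm p G d (φ.symm (redVec p z)) = 0
    rw [← modForm_of_mem_modIsometries hφ', φ.apply_symm_apply, this]
  obtain ⟨w, hw⟩ := h3
  obtain ⟨w, rfl⟩ := redVec_surjective p w
  rw [mulVecLin_apply, ← redVec_mulVec, ← LinearEquiv.symm_apply_eq, LinearEquiv.symm_symm] at hw
  obtain ⟨z', hz'⟩ := mem_stdLat.mp ((apply_mem_of_mapLat hEΛ).mpr (intVec_mem (P *ᵥ w)))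
  rw [hEr _ _ hz', ← sub_eq_zero, ← map_sub] at hw
  obtain ⟨y, hy⟩ := redVec_eq_zero.mp hw
  obtain ⟨y', hy'⟩ := mem_stdLat.mp
    ((apply_mem_of_mapLat (mapLat_symm hEΛ)).mpr (intVec_mem y))
  obtain ⟨w', hw'⟩ := hP y'
  refine ⟨w - w', ?_⟩
  rw [mulVec_sub, hw', intVec_sub, map_sub, hz', intVec_smul, map_smul, ← hy',
    E.apply_symm_apply, ← intVec_smul, ← hy, intVec_sub]
  abel

end

end Enriques

namespace Enriques
open LinearMap (BilinForm)
open Module Submodule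

set_option linter.unusedSectionVars false

section
variable {ι κ : Type} [Fintype ι] [DecidableEq ι] [Fintype κ] [DecidableEq κ]

/-- The Gram matrix of the orthogonal sum of `G` and the negative of `H`. -/
def blockGram (G : Matrix ι ι ℤ) (H : Matrix κ κ ℤ) : Matrix (ι ⊕ κ) (ι ⊕ κ) ℤ :=
  fromBlocks G 0 0 (-H)

lemma blockGram_mulVec (G : Matrix ι ι ℤ) (H : Matrix κ κ ℤ) (a : ι → ℤ) (b : κ → ℤ) :
    blockGram G H *ᵥ Sum.elim a b = Sum.elim (G *ᵥ a) (-(H *ᵥ b)) := by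
  rw [blockGram, fromBlocks_mulVec]
  simp [neg_mulVec]

lemma dotProduct_blockGram (G : Matrix ι ι ℤ) (H : Matrix κ κ ℤ) (a a' : ι → ℤ) (b b' : κ → ℤ) :
    Sum.elim a b ⬝ᵥ blockGram G H *ᵥ Sum.elim a' b' = a ⬝ᵥ G *ᵥ a' - b ⬝ᵥ H *ᵥ b' := by
  rw [blockGram_mulVec, sumElim_dotProduct_sumElim, dotProduct_neg, sub_eq_add_neg]

lemma gramForm_blockGram (G : Matrix ι ι ℤ) (H : Matrix κ κ ℤ) (a a' : ι → ℚ) (b b' : κ → ℚ) :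
    gramForm (blockGram G H) (Sum.elim a b) (Sum.elim a' b')
      = gramForm G a a' - gramForm H b b' := by
  rw [gramForm_apply, gramForm_apply, gramForm_apply, blockGram, fromBlocks_map, fromBlocks_mulVec,
    sumElim_dotProduct_sumElim]
  have h : (-H).map (Int.cast : ℤ → ℚ) = -H.map Int.cast := by ext; simp
  simp [h, neg_mulVec, sub_eq_add_neg]

lemma blockGram_isSymm {G : Matrix ι ι ℤ} {H : Matrix κ κ ℤ} (hG : G.IsSymm) (hH : H.IsSymm) :
    (blockGram G H).IsSymm := by
  rw [Matrix.IsSymm, blockGram, fromBlocks_transpose, hG.eq, transpose_neg, hH.eq]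
  simp

lemma blockGram_det (G : Matrix ι ι ℤ) (H : Matrix κ κ ℤ) :
    (blockGram G H).det.natAbs = G.det.natAbs * H.det.natAbs := by
  rw [blockGram, det_fromBlocks_zero₂₁, det_neg, Int.natAbs_mul, Int.natAbs_mul, Int.natAbs_pow]
  simp

lemma blockGram_even {G : Matrix ι ι ℤ} {H : Matrix κ κ ℤ} (hG : ∀ z, 2 ∣ z ⬝ᵥ G *ᵥ z)
    (hH : ∀ z, 2 ∣ z ⬝ᵥ H *ᵥ z) (z : ι ⊕ κ → ℤ) : 2 ∣ z ⬝ᵥ blockGram G H *ᵥ z := by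
  rw [← Sum.elim_comp_inl_inr z, dotProduct_blockGram]
  exact dvd_sub (hG _) (hH _)

lemma blockGram_elementary {G : Matrix ι ι ℤ} {H : Matrix κ κ ℤ} {p : ℤ}
    (hG : ∀ v, ∃ w, G *ᵥ w = p • v) (hH : ∀ v, ∃ w, H *ᵥ w = p • v) (v : ι ⊕ κ → ℤ) :
    ∃ w, blockGram G H *ᵥ w = p • v := by
  obtain ⟨a, ha⟩ := hG (v ∘ Sum.inl)
  obtain ⟨b, hb⟩ := hH (-(v ∘ Sum.inr))
  refine ⟨Sum.elim a b, ?_⟩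
  rw [blockGram_mulVec, ha, hb]
  ext (i | i) <;> simp

lemma exists_isometry_blockGram {μ ν : Type} [Fintype μ] [Fintype ν] {G : Matrix ι ι ℤ}
    {H : Matrix κ κ ℤ} {f : μ → ℚ} {g : ν → ℚ} {e : (ι → ℚ) ≃ₗ[ℚ] (μ → ℚ)}
    {e' : (κ → ℚ) ≃ₗ[ℚ] (ν → ℚ)} (he : Isometry (gramForm G) (dform f) e)
    (he' : Isometry (gramForm H) (dform g) e') :
    ∃ e'', Isometry (gramForm (blockGram G H)) (dform (Sum.elim f fun i => -g i)) e'' := by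
  refine ⟨(LinearEquiv.sumArrowLequivProdArrow ι κ ℚ ℚ).trans ((e.prodCongr e').trans
    (LinearEquiv.sumArrowLequivProdArrow μ ν ℚ ℚ).symm), fun x y => ?_⟩
  have h : ∀ x y, dform (fun i => -g i) x y = -dform g x y := fun x y => by
    simp [dform_apply]
  rw [← Sum.elim_comp_inl_inr x, ← Sum.elim_comp_inl_inr y, gramForm_blockGram, dform_sumElim, h,
    ← he, ← he', sub_eq_add_neg]
  rfl

lemma exists_isometry_of_diagonal {G F : Matrix ι ι ℤ} {d : ι → ℤ} (hd : ∀ i, d i ≠ 0)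
    (h : Fᵀ * G * F = diagonal d) :
    ∃ e, Isometry (gramForm G) (dform fun i => (d i : ℚ)) e := by
  have hF : F.det ≠ 0 := fun h0 => by
    have := congrArg Matrix.det h
    rw [det_mul, h0, mul_zero, det_diagonal] at this
    exact Finset.prod_ne_zero_iff.mpr (fun i _ => hd i) this.symm
  have hF' : IsUnit (F.map (Int.cast : ℤ → ℚ)).det := by
    have : (F.map (Int.cast : ℤ → ℚ)).det = (F.det : ℚ) := by
      simpa using (Int.cast_det (R := ℚ) F).symm
    rw [this, isUnit_iff_ne_zero]
    exact_mod_cast hF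
  have hQ : (F.map (Int.cast : ℤ → ℚ))ᵀ * G.map Int.cast * F.map Int.cast
      = diagonal fun i => (d i : ℚ) := by
    have : (Fᵀ * G * F).map (Int.castRingHom ℚ) = (diagonal d).map (Int.castRingHom ℚ) := by rw [h]
    rw [Matrix.map_mul, Matrix.map_mul, diagonal_map (map_zero _)] at this
    exact this
  refine ⟨(Matrix.toLin'OfInv (nonsing_inv_mul _ hF') (mul_nonsing_inv _ hF')).symm,
    (Isometry.symm fun x y => ?_)⟩
  change gramForm G (F.map (Int.cast : ℤ → ℚ) *ᵥ x) (F.map (Int.cast : ℤ → ℚ) *ᵥ y) =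
    dform (fun i => (d i : ℚ)) x y
  rw [gramForm_apply, mulVec_dotProduct_mulVec, hQ, dform_apply]
  simp [dotProduct, mulVec_diagonal, mul_comm, mul_left_comm]

end

end Enriques

namespace Enriques
open LinearMap (BilinForm)
open Module Submodule

set_option linter.unusedSectionVars false

/-- A similarity of `Γ` multiplying the form by `2`. -/
def simMat : Matrix (Fin 10) (Fin 10) ℤ :=
  !![1,0,0,0,0,0,0,0,0,0;
     0,2,0,0,0,0,0,0,0,0;
     0,0,0,1,-1,0,0,-1,0,2;
     0,0,0,0,0,-1,1,-2,0,3;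
     0,0,0,0,0,0,0,-2,0,4;
     0,0,1,0,0,-1,0,-1,-1,5;
     0,0,0,0,0,-1,-1,0,-2,7;
     0,0,1,-1,0,0,-1,0,-2,5;
     0,0,0,0,0,0,0,0,-2,2;
     0,0,0,0,-1,0,0,0,-1,3]

/-- Vectors whose halves, taken modulo `Γ`, are dual to `Γ / simMat Γ`. -/
def glueMat : Matrix (Fin 5) (Fin 10) ℤ :=
  !![1,0,0,0,0,0,0,0,0,0;
     0,0,0,0,0,1,0,1,0,0;
     0,0,1,0,0,0,0,-1,0,0;
     0,0,-1,0,0,0,0,0,0,-1;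
     0,0,0,-1,0,-1,-1,0,0,0]

/-- Vectors dual modulo `2` to the rows of `glueMat`. -/
def coglueMat : Matrix (Fin 5) (Fin 10) ℤ :=
  !![0,1,0,0,0,0,0,0,0,0;
     0,0,0,0,1,0,0,0,0,0;
     0,0,0,0,1,0,0,0,1,0;
     0,0,0,1,1,0,0,0,1,0;
     0,0,0,0,0,0,0,0,0,1]

/-- With `glueCoord'`, coordinates witnessing `mul_glueCoord`. -/
def glueCoord : Matrix (Fin 10) (Fin 5) ℤ :=
  !![0,0,0,0,0;
     1,0,0,0,0;
     0,0,0,1,0;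
     0,1,0,0,0;
     0,0,1,1,0;
     0,1,0,1,0;
     0,0,1,1,1;
     0,1,1,1,0;
     0,1,0,1,1;
     0,1,1,0,1]

/-- With `glueCoord`, coordinates witnessing `mul_glueCoord`. -/
def glueCoord' : Matrix (Fin 10) (Fin 10) ℤ :=
  !![1,0,0,0,0,0,0,0,0,0;
     0,0,0,0,0,0,0,0,0,0;
     0,0,-1,0,0,1,0,0,0,-1;
     0,0,0,-1,0,2,-1,0,0,0;
     0,0,-1,-1,1,1,1,-2,1,-1;
     0,0,-2,-1,1,2,-1,0,0,0;
     0,0,-1,-2,2,1,0,-2,1,1;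
     0,0,-1,-1,0,2,0,-1,0,0;
     0,0,-1,-1,1,1,-1,1,-1,0;
     0,0,1,-2,1,1,-1,0,0,1]

set_option maxRecDepth 100000 in
lemma simMat_gram : simMatᵀ * GammaGram * simMat = GammaTwoGram := by
  rw [GammaTwoGram]
  decide

set_option maxRecDepth 100000 in
lemma mul_glueCoord : simMat * (glueCoord * (glueMat * GammaGram) + (2 : ℤ) • glueCoord') =
    (2 : ℤ) • 1 := by decide

set_option maxRecDepth 100000 in
lemma glueMat_mul_simMat (i : Fin 5) (j : Fin 10) : 2 ∣ (glueMat * GammaGram * simMat) i j := by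
  revert i j
  decide

set_option maxRecDepth 100000 in
lemma glueMat_gram (i j : Fin 5) : 2 ∣ (glueMat * GammaGram * glueMatᵀ) i j := by
  revert i j
  decide

set_option maxRecDepth 100000 in
lemma glueMat_gram_self (i : Fin 5) : 4 ∣ (glueMat * GammaGram * glueMatᵀ) i i := by
  revert i
  decide

set_option maxRecDepth 100000 in
lemma coglueMat_gram (i j : Fin 5) :
    2 ∣ (coglueMat * GammaGram * glueMatᵀ) i j - (1 : Matrix (Fin 5) (Fin 5) ℤ) i j := by
  revert i j
  decide

lemma mul_apply_row {l m : Type} [Fintype l] [Fintype m] {κ κ' : Type} (A : Matrix κ l ℤ)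
    (G : Matrix l m ℤ) (B : Matrix κ' m ℤ) (i : κ) (j : κ') :
    (A * G * Bᵀ) i j = A i ⬝ᵥ G *ᵥ B j := by
  rw [Matrix.mul_assoc]
  rfl

/-- A symmetric integer matrix with even diagonal is an even Gram matrix. -/
lemma two_dvd_of_diag {ι : Type*} [Fintype ι] [LinearOrder ι] {G : Matrix ι ι ℤ} (hs : Gᵀ = G)
    (hd : ∀ i, 2 ∣ G i i) (x : ι → ℤ) : 2 ∣ x ⬝ᵥ G *ᵥ x := by
  let A : Matrix ι ι ℤ := Matrix.of fun i j => if i < j then G i j else if i = j then G i j / 2 else 0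
  have hA : G = A + Aᵀ := by
    ext i j
    obtain ⟨k, hk⟩ := hd i
    have h : G j i = G i j := congrFun (congrFun hs i) j
    rcases lt_trichotomy i j with hij | rfl | hij
    · simp [A, hij, hij.not_gt, hij.ne']
    · simp only [A, Matrix.add_apply, transpose_apply, of_apply, lt_irrefl, if_false, if_true]
      lia
    · simp [A, hij, hij.not_gt, hij.ne', h]
  refine ⟨x ⬝ᵥ A *ᵥ x, ?_⟩
  have h : x ⬝ᵥ Aᵀ *ᵥ x = x ⬝ᵥ A *ᵥ x := by
    rw [mulVec_transpose, dotProduct_comm, dotProduct_mulVec]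
  rw [hA, add_mulVec, dotProduct_add, h]
  ring

lemma gamma_even (x : Fin 10 → ℤ) : 2 ∣ x ⬝ᵥ GammaGram *ᵥ x :=
  two_dvd_of_diag gamma_transpose (by decide) x

/-- Gluing vectors for the sublattice `Γ(2)` of `Γ`, with prescribed inner products. -/
lemma exists_gamma_glue (N : Matrix (Fin 5) (Fin 5) ℤ) (hNs : ∀ i j, N i j = N j i)
    (hN : ∀ i j, 2 ∣ N i j) (hN' : ∀ i, 4 ∣ N i i) :
    ∃ w m : Fin 5 → Fin 10 → ℤ,
      (∀ i j, 2 ∣ m i ⬝ᵥ GammaGram *ᵥ w j - if i = j then 1 else 0) ∧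
      (∀ i j, 4 ∣ w i ⬝ᵥ GammaGram *ᵥ w j - N i j) ∧
      (∀ i, 8 ∣ w i ⬝ᵥ GammaGram *ᵥ w i - N i i) ∧
      (∀ x, (∀ i, 2 ∣ w i ⬝ᵥ GammaGram *ᵥ x) → ∃ z, x = simMat *ᵥ z) ∧
      ∀ z i, 2 ∣ w i ⬝ᵥ GammaGram *ᵥ (simMat *ᵥ z) := by
  let b : BilinForm ℤ (Fin 10 → ℤ) := Matrix.toBilin' GammaGram
  have hb : ∀ x y, x ⬝ᵥ GammaGram *ᵥ y = b x y := fun x y =>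
    (Matrix.toBilin'_apply' _ _ _).symm
  have hbs : ∀ x y, b x y = b y x := fun x y => by
    rw [← hb, ← hb, dotProduct_symm gamma_transpose]
  have hev : ∀ x, 2 ∣ b x x := fun x => by
    rw [← hb]
    exact gamma_even x
  have e1 : ∀ i j, 2 ∣ b (coglueMat i) (glueMat j) - if i = j then 1 else 0 := fun i j => by
    rw [← hb, ← mul_apply_row, ← Matrix.one_apply]
    exact coglueMat_gram i j
  have e2 : ∀ i j, 2 ∣ b (glueMat i) (glueMat j) := fun i j => by
    rw [← hb, ← mul_apply_row]
    exact glueMat_gram i j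
  have e3 : ∀ i, 4 ∣ b (glueMat i) (glueMat i) := fun i => by
    rw [← hb, ← mul_apply_row]
    exact glueMat_gram_self i
  choose e he using e1
  let c : Fin 5 → Fin 5 → ℤ := fun i j =>
    if i < j then (N i j - b (glueMat i) (glueMat j)) / 2 else
      if i = j then (N i i - b (glueMat i) (glueMat i)) / 4 else 0
  let a : Fin 5 → Fin 10 → ℤ := fun i => ∑ k, c i k • coglueMat k
  have ha : ∀ i j, b (a i) (glueMat j) = c i j + 2 * ∑ k, c i k * e k j := fun i j => by
    have : ∀ k, b (coglueMat k) (glueMat j) = (if k = j then 1 else 0) + 2 * e k j := fun k => by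
      linear_combination he k j
    simp only [a, map_sum, LinearMap.sum_apply, map_smul, LinearMap.smul_apply, this, smul_eq_mul,
      mul_add, Finset.sum_add_distrib, Finset.mul_sum]
    congr 1
    · simp
    · exact Finset.sum_congr rfl fun k _ => by ring
  let w : Fin 5 → Fin 10 → ℤ := fun i => glueMat i + (2 : ℤ) • a i
  have hw : ∀ i x, b (w i) x = b (glueMat i) x + 2 * b (a i) x := fun i x => by
    simp only [w, map_add, map_smul, LinearMap.add_apply, LinearMap.smul_apply, smul_eq_mul]
  have hww : ∀ i j, b (w i) (w j) = b (glueMat i) (glueMat j)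
      + 2 * (b (a i) (glueMat j) + b (a j) (glueMat i)) + 4 * b (a i) (a j) := fun i j => by
    rw [hw, hbs _ (w j), hbs _ (w j), hw, hw]
    linear_combination 4 * hbs (a j) (a i) + 2 * hbs (glueMat j) (a i) + hbs (glueMat j) (glueMat i)
  have key : ∀ i j, i < j → 4 ∣ b (w i) (w j) - N i j := fun i j hij => by
    have h1 : c j i = 0 := by simp [c, hij.not_gt, hij.ne']
    obtain ⟨n, hn⟩ := hN i j
    obtain ⟨n', hn'⟩ := e2 i j
    have h2 : c i j = n - n' := by
      simp only [c, hij, if_true, hn, hn']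
      lia
    rw [hww, ha, ha, h1, h2, hn, hn']
    exact ⟨(∑ k, c i k * e k j) + (∑ k, c j k * e k i) + b (a i) (a j), by ring⟩
  have key' : ∀ i, 8 ∣ b (w i) (w i) - N i i := fun i => by
    obtain ⟨n, hn⟩ := hN' i
    obtain ⟨n', hn'⟩ := e3 i
    obtain ⟨s, hs⟩ := hev (a i)
    have h2 : c i i = n - n' := by
      simp only [c, lt_irrefl, if_false, if_true, hn, hn']
      lia
    rw [hww, ha, h2, hn, hn', hs]
    exact ⟨(∑ k, c i k * e k i) + s, by ring⟩
  refine ⟨w, coglueMat, fun i j => ?_, fun i j => ?_, fun i => ?_, fun x hx => ?_, fun z i => ?_⟩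
  · rw [hb, hbs, hw, hbs (glueMat j), sub_eq_iff_eq_add.mp (he i j)]
    exact ⟨e i j + b (a j) (coglueMat i), by ring⟩
  · rw [hb]
    rcases lt_trichotomy i j with h | rfl | h
    · exact key i j h
    · exact (show (4 : ℤ) ∣ 8 by norm_num).trans (key' i)
    · rw [hbs, hNs]
      exact key j i h
  · rw [hb]
    exact key' i
  · have h1 : ∀ i, 2 ∣ glueMat i ⬝ᵥ GammaGram *ᵥ x := fun i => by
      have := hx i
      rw [hb, hw] at this
      rw [hb]
      exact (dvd_add_left ⟨_, rfl⟩).mp this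
    choose y hy using h1
    have h2 : (glueMat * GammaGram) *ᵥ x = (2 : ℤ) • y := by
      rw [← mulVec_mulVec]
      exact funext hy
    refine ⟨glueCoord *ᵥ y + glueCoord' *ᵥ x, ?_⟩
    have h3 := congrArg (· *ᵥ x) mul_glueCoord
    simp only [← mulVec_mulVec, add_mulVec, smul_mulVec, one_mulVec] at h3
    rw [mulVec_mulVec _ glueMat, h2, mulVec_smul, ← smul_add, mulVec_smul] at h3
    exact (smul_right_injective _ (two_ne_zero (α := ℤ)) h3).symm
  · rw [hb, hw, ← hb]
    refine dvd_add ?_ ⟨_, rfl⟩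
    change 2 ∣ (glueMat *ᵥ (GammaGram *ᵥ (simMat *ᵥ z))) i
    rw [mulVec_mulVec, mulVec_mulVec, mulVec, dotProduct]
    exact Finset.dvd_sum fun j _ => (glueMat_mul_simMat i j).mul_right (z j)

end Enriques

namespace Enriques
open LinearMap (BilinForm)
open Module Submodule

set_option linter.unusedSectionVars false

variable {ι : Type} [Fintype ι] [DecidableEq ι]

/-- Eight orthogonal vectors of equal square, prime to `p`, span a space which contains a
four-dimensional totally isotropic subspace modulo `p`. -/
lemma exists_isotropic {p : ℕ} (hp : p.Prime) {G : Matrix ι ι ℤ} (hs : G.IsSymm) {c : ℤ}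
    (hc : ¬ (p : ℤ) ∣ c) {s : Fin 8 → ι → ℤ}
    (h : ∀ i j, s i ⬝ᵥ G *ᵥ s j = if i = j then c else 0) :
    ∃ F, F ≤ (modForm p G).orthogonal F ∧ (modForm p G).orthogonal ⊤ ≤ F ∧
      finrank (ZMod p) ((modForm p G).orthogonal ⊤) + 4 ≤ finrank (ZMod p) F ∧
      ∀ z, (∀ j, s j ⬝ᵥ G *ᵥ z = 0) → redVec p z ∈ (modForm p G).orthogonal F := by
  have : Fact p.Prime := ⟨hp⟩
  let b := modForm p G
  have hb : ∀ x y, b x y = b y x := modForm_symm hs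
  let t : Fin 8 → ι → ZMod p := fun i => redVec p (s i)
  have ht : ∀ i j, b (t i) (t j) = if i = j then (c : ZMod p) else 0 := fun i j => by
    simp only [b, t, modForm_redVec, h]
    split_ifs <;> simp
  have hc' : (c : ZMod p) ≠ 0 := fun h0 => hc ((ZMod.intCast_zmod_eq_zero_iff_dvd _ _).mp h0)
  obtain ⟨α, β, hαβ⟩ := ZMod.sq_add_sq p (-1)
  let f : Fin 4 → ι → ZMod p := ![t 0 + α • t 2 + β • t 3, t 1 + β • t 2 - α • t 3,
    t 4 + α • t 6 + β • t 7, t 5 + β • t 6 - α • t 7]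
  have hf : ∀ i j, b (f i) (f j) = 0 := by
    intro i j
    fin_cases i <;> fin_cases j <;>
      simp [f, ht] <;> first | ring1 | linear_combination (c : ZMod p) * hαβ
  let l : Fin 4 → Fin 8 := ![0, 1, 4, 5]
  have hl : ∀ i j, b (f i) (t (l j)) = if i = j then (c : ZMod p) else 0 := by
    intro i j
    fin_cases i <;> fin_cases j <;> simp [f, l, ht]
  let R := b.orthogonal ⊤
  have hR : ∀ x ∈ R, ∀ y, b y x = 0 := fun x hx y => hx y trivial
  let W := span (ZMod p) (Set.range f)
  have hW : ∀ x ∈ W, ∀ y ∈ W, b y x = 0 := by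
    intro x hx y hy
    have h1 : ∀ i, W ≤ LinearMap.ker (b.flip (f i)) := fun i =>
      span_le.mpr (by rintro _ ⟨j, rfl⟩; exact hf j i)
    have h2 : W ≤ LinearMap.ker (b y) :=
      span_le.mpr (by rintro _ ⟨j, rfl⟩; exact h1 j hy)
    exact h2 hx
  refine ⟨W ⊔ R, ?_, le_sup_right, ?_, ?_⟩
  · intro x hx y hy
    change b y x = 0
    obtain ⟨x₁, hx₁, x₂, hx₂, rfl⟩ := mem_sup.mp hx
    obtain ⟨y₁, hy₁, y₂, hy₂, rfl⟩ := mem_sup.mp hy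
    rw [map_add, hR _ hx₂, add_zero, map_add, LinearMap.add_apply, hW _ hx₁ _ hy₁, hb, hR _ hy₂,
      add_zero]
  · let L : (ι → ZMod p) →ₗ[ZMod p] (Fin 4 → ZMod p) := LinearMap.pi fun j => b.flip (t (l j))
    have h1 : (W ⊔ R).map L = ⊤ := by
      rw [eq_top_iff, ← (Pi.basisFun (ZMod p) (Fin 4)).span_eq, span_le]
      rintro _ ⟨i, rfl⟩
      refine ⟨(c : ZMod p)⁻¹ • f i, (W ⊔ R).smul_mem _ (mem_sup_left (subset_span ⟨i, rfl⟩)), ?_⟩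
      ext j
      have h2 : L (f i) j = if i = j then (c : ZMod p) else 0 := hl i j
      simp only [map_smul, Pi.smul_apply, h2, Pi.basisFun_apply, Pi.single_apply, smul_eq_mul,
        eq_comm (a := j)]
      split_ifs
      · exact inv_mul_cancel₀ hc'
      · simp
    have h2 := (L.domRestrict (W ⊔ R)).finrank_range_add_finrank_ker
    rw [LinearMap.range_domRestrict, h1, finrank_top, finrank_fin_fun] at h2
    have h3 : finrank (ZMod p) R ≤ finrank (ZMod p) (LinearMap.ker (L.domRestrict (W ⊔ R))) := by
      refine LinearMap.finrank_le_finrank_of_injective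
        (f := (Submodule.inclusion (le_sup_right : R ≤ W ⊔ R)).codRestrict _ fun x => ?_) ?_
      · ext j
        change b x (t (l j)) = 0
        rw [hb, hR _ x.2]
      · exact fun x y hxy => Submodule.inclusion_injective _ (congrArg Subtype.val hxy)
    change finrank (ZMod p) R + 4 ≤ finrank (ZMod p) (W ⊔ R : Submodule _ _)
    lia
  · intro z hz y hy
    change b y (redVec p z) = 0
    obtain ⟨y₁, hy₁, y₂, hy₂, rfl⟩ := mem_sup.mp hy
    have h1 : ∀ j, b (t j) (redVec p z) = 0 := fun j => by
      simp only [b, t, modForm_redVec, hz, Int.cast_zero]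
    have h2 : W ≤ LinearMap.ker (b.flip (redVec p z)) := span_le.mpr (by
      rintro _ ⟨i, rfl⟩
      change b (f i) (redVec p z) = 0
      fin_cases i <;> simp [f, h1])
    have h3 : b y₁ (redVec p z) = 0 := h2 hy₁
    rw [map_add, LinearMap.add_apply, h3, hb, hR _ hy₂, add_zero]

end Enriques

namespace Enriques
open LinearMap (BilinForm)
open Module Submodule

set_option linter.unusedSectionVars false

variable {κ : Type} [Fintype κ] [DecidableEq κ]

/-- A positive definite even lattice of rank `12`, `p`-elementary of determinant `p ^ 2`, with
vectors `w` whose halves glue it to `Γ(2)` without leaving a root orthogonal to `Γ(2)`. -/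
structure IsComplement (p : ℕ) (H : Matrix κ κ ℤ) (w k : Fin 5 → κ → ℤ) (r : Fin 8 → κ → ℤ) :
    Prop where
  card : Fintype.card κ = 12
  symm : H.IsSymm
  even : ∀ x, 2 ∣ x ⬝ᵥ H *ᵥ x
  det : H.det.natAbs = p ^ 2
  elementary : ∀ v, ∃ u, H *ᵥ u = (p : ℤ) • v
  pos : ∀ x : κ → ℚ, x ≠ 0 → 0 < gramForm H x x
  glue_even : ∀ i j, 2 ∣ w i ⬝ᵥ H *ᵥ w j
  glue_self : ∀ i, 4 ∣ w i ⬝ᵥ H *ᵥ w i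
  coglue : ∀ i j, 2 ∣ k i ⬝ᵥ H *ᵥ w j - if i = j then 1 else 0
  frame : ∀ i j, r i ⬝ᵥ H *ᵥ r j = if i = j then 2 else 0
  no_root : ∀ x, x ⬝ᵥ H *ᵥ x = 2 → ∃ i, ¬ 2 ∣ x ⬝ᵥ H *ᵥ w i

lemma gamma_det : GammaGram.det.natAbs = 1 := by
  have h := congrArg Matrix.det gamma_mul_inv
  rw [det_mul, det_one] at h
  exact Int.natAbs_of_isUnit (IsUnit.of_mul_eq_one _ h)

lemma gamma_elementary (p : ℤ) (v : Fin 10 → ℤ) : ∃ u, GammaGram *ᵥ u = p • v :=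
  ⟨p • gammaInv *ᵥ v, by rw [mulVec_smul, mulVec_mulVec, gamma_mul_inv, one_mulVec]⟩

set_option maxRecDepth 100000 in
lemma exists_diag_gamma : ∃ e, Isometry (gramForm GammaGram)
    (dform fun i : Fin 10 => (((if i = 0 then 2 else -2 : ℤ)) : ℚ)) e := by
  let A : Matrix (Fin 10) (Fin 10) ℤ := Matrix.of fun i j =>
    if i = 1 ∧ j = 1 then -1 else if i = j ∨ i = 0 ∧ j = 1 ∨ i = 1 ∧ j = 0 then 1 else 0
  refine exists_isometry_of_diagonal (F := (A * frameMat)ᵀ) (by decide) ?_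
  have : (A * frameMat)ᵀᵀ * GammaGram * (A * frameMat)ᵀ = A * frameGram * Aᵀ := by
    rw [transpose_transpose, transpose_mul, ← frame_gram]
    simp only [Matrix.mul_assoc]
  rw [this]
  decide

lemma exists_diag_of_pos {H : Matrix κ κ ℤ} (hs : H.IsSymm) (hd : H.det ≠ 0)
    (hpos : ∀ x : κ → ℚ, x ≠ 0 → 0 < gramForm H x x) :
    ∃ (f : Fin (Fintype.card κ) → ℚ) (e : (κ → ℚ) ≃ₗ[ℚ] (Fin (Fintype.card κ) → ℚ)),
      (∀ i, 0 < f i) ∧ Isometry (gramForm H) (dform f) e := by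
  have h := exists_diag (gramForm_nondegenerate hd) (gramForm_isSymm hs)
  rw [finrank_fintype_fun_eq_card] at h
  obtain ⟨f, e, -, he⟩ := h
  refine ⟨f, e, fun i => ?_, he⟩
  have h1 := hpos (e.symm (Pi.single i 1)) (by simp)
  rw [← he, e.apply_symm_apply, dform_apply] at h1
  simpa [Pi.single_apply] using h1

variable {p : ℕ} {H : Matrix κ κ ℤ} {w k : Fin 5 → κ → ℤ} {r : Fin 8 → κ → ℤ}

/-- `Γ ⊕ H(-1)` -/
abbrev host (H : Matrix κ κ ℤ) : Matrix (Fin 10 ⊕ κ) (Fin 10 ⊕ κ) ℤ := blockGram GammaGram H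

lemma host_det (h : IsComplement p H w k r) : (host H).det.natAbs = p ^ 2 := by
  rw [blockGram_det, gamma_det, h.det, one_mul]

lemma host_isSymm (h : IsComplement p H w k r) : (host H).IsSymm :=
  blockGram_isSymm gamma_transpose h.symm

lemma host_even (h : IsComplement p H w k r) (x : Fin 10 ⊕ κ → ℤ) : 2 ∣ x ⬝ᵥ host H *ᵥ x :=
  blockGram_even gamma_even h.even x

lemma host_elementary (h : IsComplement p H w k r) (v : Fin 10 ⊕ κ → ℤ) :
    ∃ u, host H *ᵥ u = (p : ℤ) • v :=
  blockGram_elementary (gamma_elementary p) h.elementary v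

lemma isEvenLat_stdLat {ι : Type} [Fintype ι] [DecidableEq ι] {G : Matrix ι ι ℤ}
    (h : ∀ x, 2 ∣ x ⬝ᵥ G *ᵥ x) : IsEvenLat (gramForm G) (stdLat ι) := by
  rintro _ hx
  obtain ⟨z, rfl⟩ := mem_stdLat.mp hx
  obtain ⟨m, hm⟩ := h z
  exact ⟨m, by rw [gramForm_intVec, hm]; push_cast; ring⟩

lemma host_hypPair (h : IsComplement p H w k r) :
    HypPair (gramForm (host H)) (stdLat (Fin 10 ⊕ κ)) (intVec (Sum.elim (Pi.single 0 1) 0))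
      (intVec (Sum.elim (Pi.single 1 1) 0)) := by
  refine ⟨(gramForm_isSymm (host_isSymm h)).eq, isEvenLat_stdLat (host_even h), ?_,
    intVec_mem _, intVec_mem _, ?_, ?_, ?_⟩
  · intro x hx y hy
    obtain ⟨x, rfl⟩ := mem_stdLat.mp hx
    obtain ⟨y, rfl⟩ := mem_stdLat.mp hy
    exact ⟨_, gramForm_intVec _ _ _⟩
  all_goals
    rw [gramForm_intVec, dotProduct_blockGram]
    simp [GammaGram]

lemma host_diag (hp : p.Prime) (h : IsComplement p H w k r) :
    ∃ (f : Fin 10 ⊕ Fin (Fintype.card κ) → ℚ) (e : _ ≃ₗ[ℚ] _), (∀ i, f i ≠ 0) ∧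
      Isometry (gramForm (host H)) (dform f) e ∧ {i | 0 < f i}.ncard = 1 := by
  obtain ⟨e, he⟩ := exists_diag_gamma
  have hd : H.det ≠ 0 := fun h0 => by
    have := h.det
    rw [h0] at this
    exact pow_ne_zero 2 hp.ne_zero this.symm
  obtain ⟨g, e', hg, he'⟩ := exists_diag_of_pos h.symm hd h.pos
  obtain ⟨e'', he''⟩ := exists_isometry_blockGram he he'
  refine ⟨_, e'', ?_, he'', ?_⟩
  · rintro (i | i)
    · simp only [Sum.elim_inl]
      split_ifs <;> norm_num
    · exact neg_ne_zero.mpr (hg i).ne'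
  · rw [Set.ncard_eq_one]
    refine ⟨Sum.inl 0, ?_⟩
    ext (i | i)
    · simp only [Set.mem_ofPred_eq, Sum.elim_inl, Set.mem_singleton_iff, Sum.inl.injEq]
      split_ifs with hi <;> simp [hi]
    · simpa using (hg i).le

lemma host_isMaxEven (hp : p.Prime) (h : IsComplement p H w k r) :
    IsMaxEven (gramForm (host H)) (stdLat (Fin 10 ⊕ κ)) := by
  obtain ⟨f, e, hf, he, h1⟩ := host_diag hp h
  refine isMaxEven_of_det (host_isSymm h) (host_even h) hp (host_det h) (host_elementary h) hf he ?_
  rw [h1, Fintype.card_sum, Fintype.card_fin, Fintype.card_fin, h.card]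
  norm_num

end Enriques

namespace Enriques
open LinearMap (BilinForm)
open Module Submodule

set_option linter.unusedSectionVars false

variable {κ : Type} [Fintype κ] [DecidableEq κ]
variable {p : ℕ} {H : Matrix κ κ ℤ} {w k : Fin 5 → κ → ℤ} {r : Fin 8 → κ → ℤ}

/-- The supersingular lattices embed into the host lattice of the same characteristic. -/
lemma exists_embedding (hp : p.Prime) (hp3 : 3 ≤ p) (h : IsComplement p H w k r)
    {G : Matrix (Fin 10 ⊕ κ) (Fin 10 ⊕ κ) ℤ} {σ : ℕ} (hs : G.IsSymm)
    (hev : ∀ x, 2 ∣ x ⬝ᵥ G *ᵥ x) (hdet : G.det.natAbs = p ^ (2 * σ))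
    (hP : ∀ v, ∃ u, G *ᵥ u = (p : ℤ) • v) {μ : Type} [Fintype μ] {f : μ → ℚ} (hf : ∀ i, f i ≠ 0)
    {e : _ ≃ₗ[ℚ] (μ → ℚ)} (he : Isometry (gramForm G) (dform f) e)
    (hμ : Fintype.card μ = 22) (hpos : {i | 0 < f i}.ncard = 1) :
    ∃ P : Matrix (Fin 10 ⊕ κ) (Fin 10 ⊕ κ) ℤ, Pᵀ * host H * P = G ∧
      p * P.det.natAbs = p ^ σ ∧ ∀ v, ∃ u, P *ᵥ u = (p : ℤ) • v := by
  obtain ⟨G', P', j, e', hG', he', hmax', hP', hs', hdet', -⟩ :=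
    exists_maximal_gram hs hev hp hdet hP
  have hj : j ≠ 0 := by
    rintro rfl
    have h8 := eight_dvd_of_isometry hf (he'.symm.trans he) (stdLat _)
      (dual_stdLat_eq hs' (by simpa using hdet')) hmax'.1
    rw [hpos, hμ] at h8
    norm_num at h8
  obtain ⟨a₁, a₂, α₁, α₂, hA⟩ := hmax'.exists_anisoPlane hp hp3 hs' hdet' hj hP'
  obtain ⟨b₁, b₂, β₁, β₂, hB⟩ := (host_isMaxEven hp h).exists_anisoPlane hp hp3 (host_isSymm h)
    (j := 1) (by rw [host_det h]) one_ne_zero (host_elementary h)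
  obtain ⟨g, d, hg, hd, hg1⟩ := host_diag hp h
  obtain ⟨φ, hφ⟩ := exists_isometry_of_anisoPlane hf hg (he'.symm.trans he) hd
    (by rw [hμ, Fintype.card_sum, Fintype.card_fin, Fintype.card_fin, h.card]) (by rw [hpos, hg1])
    hp hp3 hA hB
  have hΦ := he'.trans hφ
  have hL : IsEvenLat (gramForm (host H)) (mapLat (e'.trans φ) (stdLat _)) :=
    (isEvenLat_stdLat hev).map hΦ
  have hlat : IsLattice ℚ (mapLat (e'.trans φ) (stdLat (Fin 10 ⊕ κ))) := mapLat_isLattice _ _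
  obtain ⟨g', hg', hle⟩ := (host_hypPair h).exists_le_mapLat (host_isMaxEven hp h) hlat.fg hL
  have hΨ := hΦ.trans hg'.symm
  obtain ⟨P, hPe⟩ := exists_intMatrix ((e'.trans φ).trans g'.symm).toLinearMap fun x hx =>
    mem_mapLat.mp (hle (mem_mapLat.mpr (by simpa using hx)))
  have hPG := (eq_transpose_mul_mul hΨ hPe).symm
  refine ⟨P, hPG, ?_, fun v => ?_⟩
  · have h1 := congrArg (fun M => M.det.natAbs) hPG
    simp only [det_mul, det_transpose, Int.natAbs_mul, host_det h, hdet] at h1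
    refine Nat.pow_left_injective (two_ne_zero) ?_
    simp only
    rw [← pow_mul, mul_comm σ, ← h1]
    ring
  · obtain ⟨u, hu⟩ := hP ((Pᵀ * host H) *ᵥ v)
    refine ⟨u, ?_⟩
    have hd0 : (Pᵀ * host H).det ≠ 0 := fun h0 => by
      have h1 := congrArg Matrix.det hPG
      rw [det_mul, h0, zero_mul] at h1
      rw [← h1] at hdet
      exact (pow_ne_zero _ hp.ne_zero) hdet.symm
    refine mulVec_injective_of_det_ne_zero hd0 ?_
    rw [mulVec_mulVec, hPG, hu, mulVec_smul]

end Enriques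

namespace Enriques
open LinearMap (BilinForm)
open Module Submodule

set_option linter.unusedSectionVars false

lemma isEvenLat_span_range {V : Type*} [AddCommGroup V] [Module ℚ V] {B : BilinForm ℚ V}
    (hB : B.IsSymm) {n : ℕ} {x : Fin n → V} (hx : ∀ i j, ∃ k : ℤ, B (x i) (x j) = k)
    (hxx : ∀ i, ∃ k : ℤ, B (x i) (x i) = 2 * k) : IsEvenLat B (span ℤ (Set.range x)) := by
  intro y hy
  obtain ⟨c, rfl⟩ := (mem_span_range_iff_exists_fun ℤ).mp hy
  choose N hN using hx
  have hs : (Matrix.of N)ᵀ = Matrix.of N := by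
    ext i j
    have := hB.eq (x j) (x i)
    rw [hN, hN] at this
    exact_mod_cast this
  have hd : ∀ i, 2 ∣ (Matrix.of N) i i := fun i => by
    obtain ⟨m, hm⟩ := hxx i
    rw [hN] at hm
    exact ⟨m, by exact_mod_cast hm⟩
  obtain ⟨m, hm⟩ := two_dvd_of_diag hs hd c
  refine ⟨m, ?_⟩
  have : (2 : ℚ) * m = ((c ⬝ᵥ (Matrix.of N) *ᵥ c : ℤ) : ℚ) := by rw [hm]; push_cast; ring
  rw [this]
  simp only [map_sum, LinearMap.sum_apply, ← Int.cast_smul_eq_zsmul ℚ, map_smul,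
    LinearMap.smul_apply, hN, dotProduct, mulVec, of_apply, smul_eq_mul, Int.cast_sum,
    Int.cast_mul, Finset.mul_sum]
  rw [Finset.sum_comm]
  exact Finset.sum_congr rfl fun i _ => Finset.sum_congr rfl fun j _ => by ring

variable {κ : Type} [Fintype κ] [DecidableEq κ]
variable {p : ℕ} {H : Matrix κ κ ℤ} {w k : Fin 5 → κ → ℤ} {r : Fin 8 → κ → ℤ}

lemma intVec_sumElim {ι : Type} (a : ι → ℤ) (b : κ → ℤ) :
    intVec (Sum.elim a b) = Sum.elim (intVec a) (intVec b) := by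
  ext (i | i) <;> rfl

lemma host_intVec (a a' : Fin 10 → ℤ) (b b' : κ → ℤ) :
    gramForm (host H) (intVec (Sum.elim a b)) (intVec (Sum.elim a' b'))
      = ((a ⬝ᵥ GammaGram *ᵥ a' - b ⬝ᵥ H *ᵥ b' : ℤ) : ℚ) := by
  rw [gramForm_intVec, dotProduct_blockGram]

/-- A copy of the host lattice containing the prescribed glue. -/
lemma exists_glued (hp : p.Prime) (h : IsComplement p H w k r) {w' : Fin 5 → Fin 10 → ℤ}
    (h1 : ∀ i j, 4 ∣ w' i ⬝ᵥ GammaGram *ᵥ w' j - w i ⬝ᵥ H *ᵥ w j)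
    (h2 : ∀ i, 8 ∣ w' i ⬝ᵥ GammaGram *ᵥ w' i - w i ⬝ᵥ H *ᵥ w i) :
    ∃ g : (Fin 10 ⊕ κ → ℚ) ≃ₗ[ℚ] (Fin 10 ⊕ κ → ℚ),
      Isometry (gramForm (host H)) (gramForm (host H)) g ∧
      (∀ m n, (∀ i, 2 ∣ w' i ⬝ᵥ GammaGram *ᵥ m - w i ⬝ᵥ H *ᵥ n) →
        intVec (Sum.elim m n) ∈ mapLat g (stdLat (Fin 10 ⊕ κ))) ∧
      ∀ i, (1 / 2 : ℚ) • intVec (Sum.elim (w' i) (w i)) ∈ mapLat g (stdLat (Fin 10 ⊕ κ)) := by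
  obtain ⟨B, hBdef⟩ : ∃ B, gramForm (host H) = B := ⟨_, rfl⟩
  have hB : B.IsSymm := hBdef ▸ gramForm_isSymm (host_isSymm h)
  have hc : ∀ x y, B x y = B y x := hB.eq
  let x : Fin 5 → Fin 10 ⊕ κ → ℚ := fun i => (1 / 2 : ℚ) • intVec (Sum.elim (w' i) (w i))
  have hx : ∀ m n i, B (intVec (Sum.elim m n)) (x i)
      = 1 / 2 * ((w' i ⬝ᵥ GammaGram *ᵥ m - w i ⬝ᵥ H *ᵥ n : ℤ) : ℚ) := fun m n i => by
    rw [hc (intVec (Sum.elim m n))]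
    simp only [x, map_smul, LinearMap.smul_apply, ← hBdef, host_intVec, smul_eq_mul]
  have hxx : ∀ i j, B (x i) (x j)
      = 1 / 4 * ((w' i ⬝ᵥ GammaGram *ᵥ w' j - w i ⬝ᵥ H *ᵥ w j : ℤ) : ℚ) := fun i j => by
    simp only [x, map_smul, LinearMap.smul_apply, ← hBdef, host_intVec, smul_eq_mul]
    ring
  let Λ₀ : Submodule ℤ (Fin 10 ⊕ κ → ℚ) :=
    stdLat (Fin 10 ⊕ κ) ⊓ B.dualSubmodule (span ℤ (Set.range x))
  have hsp : IsEvenLat B (span ℤ (Set.range x)) := by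
    refine isEvenLat_span_range hB (fun i j => ?_) fun i => ?_
    · obtain ⟨m, hm⟩ := h1 i j
      exact ⟨m, by rw [hxx, hm]; push_cast; ring⟩
    · obtain ⟨m, hm⟩ := h2 i
      exact ⟨m, by rw [hxx, hm]; push_cast; ring⟩
  have hev : IsEvenLat B (Λ₀ ⊔ span ℤ (Set.range x)) := by
    refine IsEvenLat.sup hB ?_ hsp fun y hy z hz => mem_dual_iff.mp hy.2 z hz
    exact (hBdef ▸ isEvenLat_stdLat (host_even h)).mono inf_le_left
  have hfg : (Λ₀ ⊔ span ℤ (Set.range x)).FG := by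
    refine FG.sup ?_ (fg_span (Set.finite_range x))
    have : IsNoetherian ℤ (stdLat (Fin 10 ⊕ κ)) :=
      isNoetherian_of_fg_of_noetherian _ (IsLattice.fg (A := ℚ))
    exact isNoetherian_submodule.mp this _ inf_le_left
  subst hBdef
  obtain ⟨g, hg, hle⟩ := (host_hypPair h).exists_le_mapLat (host_isMaxEven hp h) hfg hev
  refine ⟨g, hg, fun m n hmn => hle (mem_sup_left ⟨intVec_mem _, mem_dual_iff.mpr fun y hy => ?_⟩),
    fun i => hle (mem_sup_right (subset_span ⟨i, rfl⟩))⟩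
  obtain ⟨c, rfl⟩ := (mem_span_range_iff_exists_fun ℤ).mp hy
  choose l hl using hmn
  refine ⟨∑ i, c i * l i, ?_⟩
  simp only [map_sum, ← Int.cast_smul_eq_zsmul ℚ, map_smul, hx, hl, smul_eq_mul]
  push_cast
  exact Finset.sum_congr rfl fun i _ => by ring

/-- The supersingular lattice, embedded in a copy of the host lattice so as to contain all vectors
orthogonal to the frame. -/
lemma exists_framed (hp : p.Prime) (hp3 : 3 ≤ p) (h : IsComplement p H w k r)
    {G P : Matrix (Fin 10 ⊕ κ) (Fin 10 ⊕ κ) ℤ} {s : ℕ} (hs : s ≤ 4) (hPG : Pᵀ * host H * P = G)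
    (hdet : P.det.natAbs = p ^ s) (hP : ∀ v, ∃ u, P *ᵥ u = (p : ℤ) • v)
    (hG : ∀ v, ∃ u, G *ᵥ u = (p : ℤ) • v)
    {g : (Fin 10 ⊕ κ → ℚ) ≃ₗ[ℚ] (Fin 10 ⊕ κ → ℚ)}
    (hg : Isometry (gramForm (host H)) (gramForm (host H)) g)
    (hr : ∀ j, intVec (Sum.elim 0 ((2 : ℤ) • r j)) ∈ mapLat g (stdLat (Fin 10 ⊕ κ))) :
    ∃ τ : (Fin 10 ⊕ κ → ℤ) →+ (Fin 10 ⊕ κ → ℚ),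
      (∀ z z', gramForm (host H) (τ z) (τ z') = ((z ⬝ᵥ G *ᵥ z' : ℤ) : ℚ)) ∧
      Function.Injective τ ∧ (∀ z, τ z ∈ mapLat g (stdLat (Fin 10 ⊕ κ))) ∧
      ∀ y ∈ mapLat g (stdLat (Fin 10 ⊕ κ)),
        (∀ j, gramForm (host H) (intVec (Sum.elim 0 ((2 : ℤ) • r j))) y = 0) → ∃ z, τ z = y := by
  choose t ht using fun j => mem_stdLat.mp (mem_mapLat.mp (hr j))
  have hp2 : p ≠ 2 := by lia
  have htt : ∀ i j, t i ⬝ᵥ host H *ᵥ t j = if i = j then -8 else 0 := fun i j => by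
    have h1 : ((t i ⬝ᵥ host H *ᵥ t j : ℤ) : ℚ) = ((if i = j then -8 else 0 : ℤ) : ℚ) := by
      rw [← gramForm_intVec, ← ht, ← ht, hg.symm, host_intVec]
      simp only [mulVec_smul, smul_dotProduct, dotProduct_smul, h.frame, zero_dotProduct]
      split_ifs <;> norm_num
    exact_mod_cast h1
  have hc : ¬ (p : ℤ) ∣ -8 := fun h8 => by
    have h9 : p ∣ 2 ^ 3 := by
      have := Int.natCast_dvd.mp h8
      simpa using this
    exact hp2 ((Nat.prime_dvd_prime_iff_eq hp Nat.prime_two).mp (hp.dvd_of_dvd_pow h9))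
  obtain ⟨F, hF, hRF, hFd, hFz⟩ := exists_isotropic hp (host_isSymm h) hc htt
  have : Fact p.Prime := ⟨hp⟩
  rw [finrank_radical (host_elementary h) (host_det h)] at hFd
  obtain ⟨E, hE, hEΛ, hEP⟩ := exists_isometry_range_ge hp hp2 (host_isSymm h) (host_even h)
    (host_hypPair h) (host_elementary h) (host_det h) hP hdet (by rwa [hPG]) hF hRF
    (by lia) (by rw [Fintype.card_sum, Fintype.card_fin, h.card]; lia)
  let τ : (Fin 10 ⊕ κ → ℤ) →+ (Fin 10 ⊕ κ → ℚ) :=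
    { toFun := fun z => g (E (intVec (P *ᵥ z)))
      map_zero' := by
        rw [mulVec_zero, (show intVec (0 : Fin 10 ⊕ κ → ℤ) = 0 from funext fun _ => Int.cast_zero),
          map_zero, map_zero]
      map_add' := fun x y => by rw [mulVec_add, intVec_add, map_add, map_add] }
  have hτ : ∀ z, τ z = g (E (intVec (P *ᵥ z))) := fun _ => rfl
  refine ⟨τ, fun z z' => ?_, fun z z' hz => ?_, fun z => ?_, fun y hy hyr => ?_⟩
  · rw [hτ, hτ, hg, hE, gramForm_intVec, mulVec_dotProduct_mulVec, hPG]
  · have hd0 : P.det ≠ 0 := fun h0 => by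
      rw [h0] at hdet
      exact pow_ne_zero _ hp.ne_zero hdet.symm
    exact mulVec_injective_of_det_ne_zero hd0
      (intVec_injective (E.injective (g.injective hz)))
  · rw [hτ, mem_mapLat, g.symm_apply_apply, apply_mem_of_mapLat hEΛ]
    exact intVec_mem _
  · obtain ⟨z, hz⟩ := mem_stdLat.mp (mem_mapLat.mp hy)
    have hy' : y = g (intVec z) := by rw [← hz, g.apply_symm_apply]
    obtain ⟨v, hv⟩ := hEP z (hFz z fun j => by
      have h1 := hyr j
      rw [hy', ← g.apply_symm_apply (intVec (Sum.elim _ _)), ht, hg, gramForm_intVec] at h1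
      exact_mod_cast h1)
    exact ⟨v, by rw [hτ, hv, hy']⟩

end Enriques

namespace Enriques
open LinearMap (BilinForm)
open Module Submodule

set_option linter.unusedSectionVars false

variable {κ : Type} [Fintype κ] [DecidableEq κ]
variable {p : ℕ} {H : Matrix κ κ ℤ} {w k : Fin 5 → κ → ℤ} {r : Fin 8 → κ → ℤ}

/-- Vectors dual modulo `2` to a family solve linear congruences modulo `2`. -/
lemma exists_congruent {ι : Type} [Fintype ι] [DecidableEq ι] {G : Matrix ι ι ℤ} (hs : G.IsSymm)
    {v m : Fin 5 → ι → ℤ} (h : ∀ i j, 2 ∣ m i ⬝ᵥ G *ᵥ v j - if i = j then 1 else 0)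
    (c : Fin 5 → ℤ) : ∃ n : ι → ℤ, ∀ i, 2 ∣ v i ⬝ᵥ G *ᵥ n - c i := by
  choose e he using h
  refine ⟨∑ j, c j • m j, fun i => ⟨∑ j, c j * e j i, ?_⟩⟩
  have h1 : v i ⬝ᵥ G *ᵥ (∑ j, c j • m j) = ∑ j, c j * (m j ⬝ᵥ G *ᵥ v i) := by
    rw [dotProduct_symm hs, sum_dotProduct]
    exact Finset.sum_congr rfl fun j _ => by rw [smul_dotProduct, smul_eq_mul]
  have h2 : ∀ j, c j * (m j ⬝ᵥ G *ᵥ v i) = 2 * (c j * e j i) + if j = i then c i else 0 :=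
    fun j => by
    have := he j i
    split_ifs at this ⊢ with hj
    · subst hj
      linear_combination c j * this
    · linear_combination c j * this
  rw [h1, Finset.sum_congr rfl fun j _ => h2 j, Finset.sum_add_distrib, Finset.mul_sum]
  simp

lemma mem_stdLat_of_int {ι : Type} [Fintype ι] [DecidableEq ι] {G : Matrix ι ι ℤ} (hs : G.IsSymm)
    (hd : G.det.natAbs = 1) {y : ι → ℚ} (h : ∀ m, ∃ k : ℤ, gramForm G (intVec m) y = k) :
    ∃ z, y = intVec z := by
  rw [← mem_stdLat, ← dual_stdLat_eq hs hd, mem_dual_iff]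
  intro x hx
  obtain ⟨m, rfl⟩ := mem_stdLat.mp hx
  obtain ⟨l, hl⟩ := h m
  exact ⟨l, by rw [← hl]; exact (gramForm_isSymm hs).eq _ _⟩

lemma eq_zero_of_orthogonal {ι : Type} [Fintype ι] [DecidableEq ι] {G : Matrix ι ι ℤ}
    (hd : G.det ≠ 0) {y : ι → ℚ} (h : ∀ m, gramForm G y (intVec m) = 0) :
    y = 0 := by
  refine (gramForm_nondegenerate hd).1 y fun x => ?_
  obtain ⟨n, hn, hx⟩ := exists_smul_mem (stdLat ι) x
  obtain ⟨m, hm⟩ := mem_stdLat.mp hx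
  have h1 := h m
  rw [← hm, ← Int.cast_smul_eq_zsmul ℚ, map_smul, smul_eq_zero] at h1
  exact h1.resolve_left (by exact_mod_cast hn)

lemma host_sumElim (a a' : Fin 10 → ℚ) (b b' : κ → ℚ) :
    gramForm (host H) (Sum.elim a b) (Sum.elim a' b')
      = gramForm GammaGram a a' - gramForm H b b' := gramForm_blockGram _ _ _ _ _ _

lemma enriquesSet_nonempty (hp : p.Prime) (h : IsComplement p H w k r) {w' m' : Fin 5 → Fin 10 → ℤ}
    (hm' : ∀ i j, 2 ∣ m' i ⬝ᵥ GammaGram *ᵥ w' j - if i = j then 1 else 0)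
    (hsim : ∀ x, (∀ i, 2 ∣ w' i ⬝ᵥ GammaGram *ᵥ x) → ∃ z, x = simMat *ᵥ z)
    (hsim' : ∀ z i, 2 ∣ w' i ⬝ᵥ GammaGram *ᵥ (simMat *ᵥ z))
    {L : Submodule ℤ (Fin 10 ⊕ κ → ℚ)} (hL : IsEvenLat (gramForm (host H)) L)
    (hmL : ∀ m n, (∀ i, 2 ∣ w' i ⬝ᵥ GammaGram *ᵥ m - w i ⬝ᵥ H *ᵥ n) → intVec (Sum.elim m n) ∈ L)
    (hxL : ∀ i, (1 / 2 : ℚ) • intVec (Sum.elim (w' i) (w i)) ∈ L)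
    {G : Matrix (Fin 22) (Fin 22) ℤ} {τ : (Fin 22 → ℤ) →+ (Fin 10 ⊕ κ → ℚ)}
    (hτ : ∀ z z', gramForm (host H) (τ z) (τ z') = ((z ⬝ᵥ G *ᵥ z' : ℤ) : ℚ))
    (hinj : Function.Injective τ) (hτL : ∀ z, τ z ∈ L)
    (hrange : ∀ y ∈ L, (∀ j, gramForm (host H) (intVec (Sum.elim 0 ((2 : ℤ) • r j))) y = 0) →
      ∃ z, τ z = y) : (EnriquesSet G).Nonempty := by
  have hBs := gramForm_isSymm (host_isSymm h)
  have hzero : intVec (0 : κ → ℤ) = 0 := funext fun _ => Int.cast_zero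
  choose Z hZ using fun c => hrange (intVec (Sum.elim (simMat *ᵥ c) 0))
    (hmL _ _ fun i => by rw [mulVec_zero, dotProduct_zero, sub_zero]; exact hsim' c i)
    (fun j => by simp [host_intVec])
  let f : (Fin 10 → ℤ) →+ (Fin 22 → ℤ) := AddMonoidHom.mk' Z fun x y => hinj <| by
    rw [map_add, hZ, hZ, hZ, mulVec_add, ← intVec_add, ← Sum.elim_add_add, add_zero]
  let e : Matrix (Fin 22) (Fin 10) ℤ := LinearMap.toMatrix' f.toIntLinearMap
  have he : ∀ c, e *ᵥ c = Z c := fun c => by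
    rw [← toLin'_apply, toLin'_toMatrix']
    rfl
  have hτe : ∀ c, τ (e *ᵥ c) = intVec (Sum.elim (simMat *ᵥ c) 0) := fun c => by rw [he, hZ]
  have hhalf : ∀ (a : Fin 10 → ℤ) (b : κ → ℤ), intVec (Sum.elim a b) ∈ L → ∀ i,
      2 ∣ w' i ⬝ᵥ GammaGram *ᵥ a - w i ⬝ᵥ H *ᵥ b := fun a b hab i => by
    obtain ⟨l, hl⟩ := hL.exists_int hBs (hxL i) hab
    rw [LinearMap.map_smul₂, host_intVec, smul_eq_mul] at hl
    refine ⟨l, ?_⟩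
    have : ((w' i ⬝ᵥ GammaGram *ᵥ a - w i ⬝ᵥ H *ᵥ b : ℤ) : ℚ) = ((2 * l : ℤ) : ℚ) := by
      push_cast at hl ⊢
      linarith
    exact_mod_cast this
  refine ⟨LinearMap.range e.mulVecLin, ?_, ⟨e, rfl, ?_⟩, ?_⟩
  · rintro c x hc ⟨z, hz⟩
    have hcx : τ x = Sum.elim ((c : ℚ)⁻¹ • intVec (simMat *ᵥ z)) 0 := by
      have h1 : (c : ℚ) • τ x = Sum.elim (intVec (simMat *ᵥ z)) 0 := by
        rw [Int.cast_smul_eq_zsmul, ← map_zsmul, ← hz, mulVecLin_apply, hτe, intVec_sumElim, hzero]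
      rw [← inv_smul_smul₀ (show (c : ℚ) ≠ 0 by exact_mod_cast hc) (τ x), h1]
      ext (i | i) <;> simp
    obtain ⟨y, hy⟩ := mem_stdLat_of_int gamma_transpose gamma_det
      (y := (c : ℚ)⁻¹ • intVec (simMat *ᵥ z)) fun m => by
        obtain ⟨n, hn⟩ := exists_congruent h.symm h.coglue fun i => w' i ⬝ᵥ GammaGram *ᵥ m
        obtain ⟨l, hl⟩ := hL.exists_int hBs
          (hmL m n fun i => (dvd_sub_comm).mp (hn i)) (hτL x)
        refine ⟨l, ?_⟩
        rw [← hl, hcx, intVec_sumElim, host_sumElim, map_zero, sub_zero]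
    rw [hy, ← hzero, ← intVec_sumElim] at hcx
    obtain ⟨z', rfl⟩ := hsim y fun i => by
      simpa using hhalf y 0 (hcx ▸ hτL x) i
    exact ⟨z', hinj (by rw [mulVecLin_apply, hτe, hcx])⟩
  · refine gram_ext fun x y => ?_
    have h1 : (((e *ᵥ x) ⬝ᵥ G *ᵥ (e *ᵥ y) : ℤ) : ℚ)
        = (((simMat *ᵥ x) ⬝ᵥ GammaGram *ᵥ (simMat *ᵥ y) : ℤ) : ℚ) := by
      rw [← hτ, hτe, hτe, host_intVec, mulVec_zero, dotProduct_zero, sub_zero]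
    rw [← simMat_gram, ← mulVec_dotProduct_mulVec, ← mulVec_dotProduct_mulVec]
    exact_mod_cast h1
  · intro x hx hxM
    have hτx : τ x = Sum.elim (τ x ∘ Sum.inl) (τ x ∘ Sum.inr) := (Sum.elim_comp_inl_inr _).symm
    have ha : τ x ∘ Sum.inl = 0 := by
      refine eq_zero_of_orthogonal gammaGram_det_ne_zero fun m => ?_
      obtain ⟨n, hn⟩ : ∃ n, simMat *ᵥ n = (2 : ℤ) • m :=
        ⟨(glueCoord * (glueMat * GammaGram) + (2 : ℤ) • glueCoord') *ᵥ m, by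
          rw [mulVec_mulVec, mul_glueCoord, smul_mulVec, one_mulVec]⟩
      have h1 : gramForm (host H) (τ x) (τ (e *ᵥ n)) = 0 := by
        rw [hτ]
        exact_mod_cast hxM _ ⟨n, rfl⟩
      rw [hτe, hn, hτx, intVec_sumElim, host_sumElim, hzero, map_zero, sub_zero, intVec_smul,
        map_smul, smul_eq_zero] at h1
      exact h1.resolve_left (by norm_num)
    rw [ha] at hτx
    have hdual : τ x ∈ (gramForm (host H)).dualSubmodule (stdLat (Fin 10 ⊕ κ)) := by
      refine mem_dual_iff.mpr fun y hy => ?_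
      obtain ⟨y, rfl⟩ := mem_stdLat.mp hy
      obtain ⟨m, hm⟩ := exists_congruent gamma_transpose hm'
        fun i => w i ⬝ᵥ H *ᵥ (y ∘ Sum.inr)
      obtain ⟨l, hl⟩ := hL.exists_int hBs (hτL x) (hmL m (y ∘ Sum.inr) hm)
      refine ⟨l, ?_⟩
      rw [← hl, ← Sum.elim_comp_inl_inr y, hτx, intVec_sumElim, intVec_sumElim, host_sumElim,
        host_sumElim, Sum.elim_comp_inr, LinearMap.map_zero₂, LinearMap.map_zero₂]
    have hxx : gramForm (host H) (τ x) (τ x) = 2 * ((-1 : ℤ) : ℚ) := by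
      rw [hτ, (show x ⬝ᵥ G *ᵥ x = -2 from hx)]
      norm_num
    obtain ⟨y, hy⟩ := mem_stdLat.mp ((host_isMaxEven hp h).2 _ hdual ⟨_, hxx⟩)
    have hy0 : y = Sum.elim (0 : Fin 10 → ℤ) (y ∘ Sum.inr) := by
      ext (i | i)
      · have := congrFun hτx (Sum.inl i)
        rw [hy] at this
        simpa [intVec] using this
      · rfl
    have hroot : (y ∘ Sum.inr) ⬝ᵥ H *ᵥ (y ∘ Sum.inr) = 2 := by
      rw [hy, hy0, host_intVec] at hxx
      simp only [zero_dotProduct, zero_sub] at hxx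
      push_cast at hxx
      have : (((y ∘ Sum.inr) ⬝ᵥ H *ᵥ (y ∘ Sum.inr) : ℤ) : ℚ) = ((2 : ℤ) : ℚ) := by
        push_cast
        linarith
      exact_mod_cast this
    obtain ⟨i, hi⟩ := h.no_root _ hroot
    refine hi ?_
    have := hhalf 0 (y ∘ Sum.inr) (by rw [← hy0, ← hy]; exact hτL x) i
    rw [mulVec_zero, dotProduct_zero, zero_sub, dvd_neg] at this
    rwa [dotProduct_symm h.symm]

end Enriques

namespace Enriques
open LinearMap (BilinForm)
open Module Submodule

set_option linter.unusedSectionVars false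

variable {κ : Type} [Fintype κ] [DecidableEq κ]
variable {p : ℕ} {H : Matrix κ κ ℤ} {w k : Fin 5 → κ → ℤ} {r : Fin 8 → κ → ℤ}

lemma dotProduct_reindex {ι ι' : Type} [Fintype ι] [Fintype ι'] {R : Type} [CommRing R]
    (ε : ι ≃ ι') (G : Matrix ι ι R) (x y : ι' → R) :
    x ⬝ᵥ reindex ε ε G *ᵥ y = (x ∘ ε) ⬝ᵥ G *ᵥ (y ∘ ε) := by
  rw [reindex_apply, submatrix_mulVec_equiv, Equiv.symm_symm, ← comp_equiv_dotProduct_comp_equiv _ _ ε]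
  congr 1
  ext i
  simp

/-- A suitable definite lattice provides an Enriques sublattice in each supersingular lattice of
Artin invariant at most five. -/
theorem enriquesSet_nonempty_of_isComplement (hp : p.Prime) (hp3 : 3 ≤ p)
    (h : IsComplement p H w k r) {σ : ℕ} (hσ1 : 1 ≤ σ) (hσ : σ ≤ 5)
    {G : Matrix (Fin 22) (Fin 22) ℤ} (hG : IsSSK3Gram p σ G) : (EnriquesSet G).Nonempty := by
  obtain ⟨hs, hev, hdet, hel, S, hS, hSG⟩ := hG
  have hd0 : G.det ≠ 0 := by
    rw [hdet]
    exact neg_ne_zero.mpr (pow_ne_zero _ (by exact_mod_cast hp.ne_zero))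
  obtain ⟨f, d, hf, hd⟩ := exists_diag (gramForm_nondegenerate hd0) (gramForm_isSymm hs)
  have hpos := card_pos_eq_of_real hd hS hSG
  rw [ncard_pos_lorentz 21] at hpos
  obtain ⟨ε⟩ : Nonempty (Fin 22 ≃ Fin 10 ⊕ κ) := Fintype.card_eq.mp (by
    rw [Fintype.card_sum, Fintype.card_fin, Fintype.card_fin, h.card])
  have hε : Isometry (gramForm (reindex ε ε G)) (gramForm G) (LinearEquiv.funCongrLeft ℚ ℚ ε) :=
    fun x y => by
      rw [gramForm_apply, gramForm_apply]
      exact (dotProduct_reindex ε (G.map Int.cast) x y).symm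
  have hs' : (reindex ε ε G).IsSymm := by
    rw [IsSymm, transpose_reindex, hs.eq]
  have hel' : ∀ v, ∃ u, reindex ε ε G *ᵥ u = (p : ℤ) • v := fun v => by
    obtain ⟨u, hu⟩ := hel (v ∘ ε)
    refine ⟨u ∘ ε.symm, ?_⟩
    rw [reindex_apply, submatrix_mulVec_equiv, Equiv.symm_symm, Function.comp_assoc,
      Equiv.symm_comp_self, Function.comp_id, hu]
    ext i
    simp
  obtain ⟨P, hPG, hPd, hP⟩ := exists_embedding hp hp3 h (σ := σ) hs'
    (fun x => by rw [dotProduct_reindex]; exact hev _)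
    (by rw [det_reindex_self, hdet]; simp [Int.natAbs_pow]) hel' hf (hε.trans hd) (by simp) hpos
  obtain ⟨σ, rfl⟩ := Nat.exists_eq_add_of_le' hσ1
  have hPd' : P.det.natAbs = p ^ σ := by
    rw [pow_succ'] at hPd
    exact Nat.eq_of_mul_eq_mul_left hp.pos hPd
  obtain ⟨w', m', h1, h2, h3, h4, h5⟩ := exists_gamma_glue (Matrix.of fun i j => w i ⬝ᵥ H *ᵥ w j)
    (fun i j => dotProduct_symm h.symm _ _) h.glue_even h.glue_self
  obtain ⟨g, hg, hg1, hg2⟩ := exists_glued hp h h2 h3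
  obtain ⟨τ, hτ, hinj, hτL, hrange⟩ := exists_framed hp hp3 h (by lia) hPG hPd' hP hel' hg
    fun j => hg1 _ _ fun i => by
      rw [mulVec_zero, dotProduct_zero, zero_sub, dvd_neg, mulVec_smul, dotProduct_smul]
      exact ⟨_, rfl⟩
  have hL : IsEvenLat (gramForm (host H)) (mapLat g (stdLat (Fin 10 ⊕ κ))) :=
    (isEvenLat_stdLat (host_even h)).map hg
  let c : (Fin 22 → ℤ) →+ (Fin 10 ⊕ κ → ℤ) :=
    { toFun := fun z => z ∘ ε.symm, map_zero' := rfl, map_add' := fun _ _ => rfl }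
  refine enriquesSet_nonempty hp h h1 h4 h5 hL hg1 hg2 (τ := τ.comp c) (fun z z' => ?_)
    (hinj.comp ε.symm.surjective.injective_comp_right) (fun z => hτL _) fun y hy hyr => ?_
  · have : ∀ z : Fin 22 → ℤ, (z ∘ ε.symm) ∘ ε = z := fun z => by ext; simp
    change gramForm (host H) (τ (z ∘ ε.symm)) (τ (z' ∘ ε.symm)) = _
    rw [hτ, dotProduct_reindex, this, this]
  · obtain ⟨z, rfl⟩ := hrange y hy hyr
    refine ⟨z ∘ ε, ?_⟩
    change τ ((z ∘ ε) ∘ ε.symm) = _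
    rw [Function.comp_assoc, Equiv.self_comp_symm, Function.comp_id]

end Enriques

namespace Enriques
open LinearMap (BilinForm)
open Module Submodule

set_option linter.unusedSectionVars false

section
variable {κ μ : Type} [Fintype κ] [DecidableEq κ] [Fintype μ] [DecidableEq μ]

lemma gramForm_pos_of_diagonal {G F : Matrix κ κ ℤ} {d : κ → ℤ} (hd : ∀ i, 0 < d i)
    (h : Fᵀ * G * F = diagonal d) (x : κ → ℚ) (hx : x ≠ 0) : 0 < gramForm G x x := by
  obtain ⟨e, he⟩ := exists_isometry_of_diagonal (fun i => (hd i).ne') h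
  rw [← he, dform_apply]
  obtain ⟨i, hi⟩ := Function.ne_iff.mp (e.map_ne_zero_iff.mpr hx)
  have hd' : ∀ i, (0 : ℚ) < d i := fun i => by exact_mod_cast hd i
  refine Finset.sum_pos' (fun i _ => ?_) ⟨i, Finset.mem_univ i, ?_⟩
  · rw [mul_assoc]
    exact mul_nonneg (hd' i).le (mul_self_nonneg _)
  · rw [mul_assoc]
    exact mul_pos (hd' i) (mul_self_pos.mpr hi)

lemma dotProduct_mulVec_pos {G : Matrix κ κ ℤ} (h : ∀ x : κ → ℚ, x ≠ 0 → 0 < gramForm G x x)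
    {x : κ → ℤ} (hx : x ≠ 0) : 0 < x ⬝ᵥ G *ᵥ x := by
  have := h (intVec x) fun h0 => hx (intVec_injective (by rw [h0]; ext; simp [intVec]))
  rw [gramForm_intVec] at this
  exact_mod_cast this

lemma four_dvd_of_orthogonal {l : Type} [Fintype l] [LinearOrder l] {G : Matrix κ κ ℤ}
    {X : Matrix (Fin 5) κ ℤ} {Z : Matrix l κ ℤ} {A : Matrix κ (Fin 5) ℤ} {B : Matrix κ κ ℤ}
    {C : Matrix l κ ℤ} {N : Matrix l l ℤ} (hs : G.IsSymm) (he : ∀ x, 2 ∣ x ⬝ᵥ G *ᵥ x)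
    (h : A * (X * G) + (2 : ℤ) • B + Zᵀ * C = 1) (hN : Z * G * Zᵀ = (2 : ℤ) • N)
    (hNs : Nᵀ = N) (hNd : ∀ i, 2 ∣ N i i) (a : κ → ℤ) (ha : ∀ i, 2 ∣ a ⬝ᵥ G *ᵥ X i) :
    4 ∣ a ⬝ᵥ G *ᵥ a := by
  choose c hc using ha
  have hXa : (X * G) *ᵥ a = (2 : ℤ) • c := by
    ext i
    rw [← mulVec_mulVec]
    change X i ⬝ᵥ G *ᵥ a = _
    rw [dotProduct_symm hs, hc, Pi.smul_apply, smul_eq_mul]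
  obtain ⟨b, u, hu⟩ : ∃ b u, a = (2 : ℤ) • b + Zᵀ *ᵥ u := by
    refine ⟨A *ᵥ c + B *ᵥ a, C *ᵥ a, ?_⟩
    conv_lhs => rw [← one_mulVec a, ← h]
    rw [add_mulVec, add_mulVec, ← mulVec_mulVec, hXa, mulVec_smul, smul_mulVec, smul_add,
      mulVec_mulVec]
  obtain ⟨y, hy⟩ := he b
  obtain ⟨n, hn⟩ := two_dvd_of_diag hNs hNd u
  have h1 : (Zᵀ *ᵥ u) ⬝ᵥ G *ᵥ (Zᵀ *ᵥ u) = 2 * (2 * n) := by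
    rw [mulVec_dotProduct_mulVec, transpose_transpose, hN, smul_mulVec, dotProduct_smul, hn,
      smul_eq_mul]
  have h2 := dotProduct_symm hs (Zᵀ *ᵥ u) b
  refine ⟨2 * y + b ⬝ᵥ G *ᵥ (Zᵀ *ᵥ u) + n, ?_⟩
  rw [hu]
  simp only [mulVec_add, mulVec_smul, dotProduct_add, add_dotProduct, smul_dotProduct,
    dotProduct_smul, smul_eq_mul]
  linear_combination 4 * hy + h1 + 2 * h2

lemma dotProduct_blockGram_neg (G : Matrix κ κ ℤ) (H : Matrix μ μ ℤ) (a a' : κ → ℤ)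
    (b b' : μ → ℤ) : Sum.elim a b ⬝ᵥ blockGram G (-H) *ᵥ Sum.elim a' b'
      = a ⬝ᵥ G *ᵥ a' + b ⬝ᵥ H *ᵥ b' := by
  rw [dotProduct_blockGram, neg_mulVec, dotProduct_neg, sub_neg_eq_add]

/-- A criterion for an orthogonal sum to be a complement. -/
lemma isComplement_sum {p : ℕ} {G : Matrix κ κ ℤ} {H : Matrix μ μ ℤ} {x k : Fin 5 → κ → ℤ}
    {y : Fin 5 → μ → ℤ} {r : Fin 8 → κ → ℤ} {s : Fin 8 → μ → ℤ}
    (hcard : Fintype.card κ + Fintype.card μ = 12) (hG : G.IsSymm) (hH : H.IsSymm)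
    (hGe : ∀ a, 2 ∣ a ⬝ᵥ G *ᵥ a) (hHe : ∀ b, 2 ∣ b ⬝ᵥ H *ᵥ b)
    (hdet : G.det.natAbs * H.det.natAbs = p ^ 2) (hGp : ∀ v, ∃ u, G *ᵥ u = (p : ℤ) • v)
    (hHp : ∀ v, ∃ u, H *ᵥ u = (p : ℤ) • v)
    (hG0 : ∀ a : κ → ℚ, a ≠ 0 → 0 < gramForm G a a)
    (hH0 : ∀ b : μ → ℚ, b ≠ 0 → 0 < gramForm H b b)
    (hglue : ∀ i j, 2 ∣ x i ⬝ᵥ G *ᵥ x j + y i ⬝ᵥ H *ᵥ y j)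
    (hself : ∀ i, 4 ∣ x i ⬝ᵥ G *ᵥ x i + y i ⬝ᵥ H *ᵥ y i)
    (hco : ∀ i j, 2 ∣ k i ⬝ᵥ G *ᵥ x j - if i = j then 1 else 0)
    (hframe : ∀ i j, r i ⬝ᵥ G *ᵥ r j + s i ⬝ᵥ H *ᵥ s j = if i = j then 2 else 0)
    (hGr : ∀ a, a ⬝ᵥ G *ᵥ a = 2 → ∃ i, ¬ 2 ∣ a ⬝ᵥ G *ᵥ x i)
    (hHr : ∀ b, b ⬝ᵥ H *ᵥ b = 2 → ∃ i, ¬ 2 ∣ b ⬝ᵥ H *ᵥ y i) :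
    IsComplement p (blockGram G (-H)) (fun i => Sum.elim (x i) (y i))
      (fun i => Sum.elim (k i) 0) (fun i => Sum.elim (r i) (s i)) := by
  have hH' : (-H).IsSymm := by rw [IsSymm, transpose_neg, hH.eq]
  have hsplit : ∀ z : κ ⊕ μ → ℤ, ∃ a b, z = Sum.elim a b := fun z =>
    ⟨_, _, (Sum.elim_comp_inl_inr z).symm⟩
  refine
    { card := by rw [Fintype.card_sum, hcard]
      symm := blockGram_isSymm hG hH'
      even := blockGram_even hGe fun z => by
        rw [neg_mulVec, dotProduct_neg, dvd_neg]
        exact hHe z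
      det := by rw [blockGram_det, det_neg, Int.natAbs_mul, Int.natAbs_pow]; simpa using hdet
      elementary := blockGram_elementary hGp fun v => ?_
      pos := fun z hz => ?_
      glue_even := fun i j => by rw [dotProduct_blockGram_neg]; exact hglue i j
      glue_self := fun i => by rw [dotProduct_blockGram_neg]; exact hself i
      coglue := fun i j => by rw [dotProduct_blockGram_neg, zero_dotProduct, add_zero]; exact hco i j
      frame := fun i j => by rw [dotProduct_blockGram_neg]; exact hframe i j
      no_root := fun z hz => ?_ }
  · obtain ⟨u, hu⟩ := hHp v
    exact ⟨-u, by rw [mulVec_neg, neg_mulVec, neg_neg, hu]⟩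
  · have hneg : ∀ b : μ → ℚ, gramForm (-H) b b = -gramForm H b b := fun b => by
      have : (-H).map (Int.cast : ℤ → ℚ) = -H.map Int.cast := by ext; simp
      rw [gramForm_apply, gramForm_apply, this, neg_mulVec, dotProduct_neg]
    obtain ⟨a, b, rfl⟩ : ∃ a b, z = Sum.elim a b := ⟨_, _, (Sum.elim_comp_inl_inr z).symm⟩
    rw [gramForm_blockGram, hneg, sub_neg_eq_add]
    by_cases ha : a = 0
    · have hb : b ≠ 0 := fun hb => hz (by rw [ha, hb]; ext (i | i) <;> rfl)
      rw [ha]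
      simpa using hH0 b hb
    · by_cases hb : b = 0
      · rw [hb]
        simpa using hG0 a ha
      · exact add_pos (hG0 a ha) (hH0 b hb)
  · obtain ⟨a, b, rfl⟩ := hsplit z
    rw [dotProduct_blockGram_neg] at hz
    simp only [dotProduct_blockGram_neg]
    by_cases ha : a = 0
    · subst ha
      simp only [zero_dotProduct, zero_add] at hz ⊢
      exact hHr b hz
    by_cases hb : b = 0
    · subst hb
      simp only [zero_dotProduct, add_zero] at hz ⊢
      exact hGr a hz
    have h1 := dotProduct_mulVec_pos hG0 ha
    have h2 := dotProduct_mulVec_pos hH0 hb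
    have h3 := hGe a
    have h4 := hHe b
    omega

end

lemma natAbs_det_of_diagonal {n : ℕ} {G F : Matrix (Fin n) (Fin n) ℤ} {d : Fin n → ℤ}
    (h : Fᵀ * G * F = diagonal d) (hF : ∀ j i, F i j = 0 ∨ i ≤ j) :
    (∏ i, F i i) ^ 2 * G.det = ∏ i, d i := by
  have h1 := congrArg Matrix.det h
  rw [det_mul, det_mul, det_transpose, det_diagonal,
    det_of_isUpperTriangular (M := F) fun i j hij => (hF j i).resolve_right hij.not_ge] at h1
  linear_combination h1

end Enriques

namespace Enriques
open LinearMap (BilinForm)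
open Module Submodule

set_option linter.unusedSectionVars false

/-- A Gram matrix of the root lattice `E6`. -/
def e6Gram : Matrix (Fin 6) (Fin 6) ℤ :=
  !![2,-1,0,0,0,0;
     -1,2,-1,0,0,0;
     0,-1,2,-1,0,-1;
     0,0,-1,2,-1,0;
     0,0,0,-1,2,0;
     0,0,-1,0,0,2]

def e6Inv : Matrix (Fin 6) (Fin 6) ℤ :=
  !![4,5,6,4,2,3;
     5,10,12,8,4,6;
     6,12,18,12,6,9;
     4,8,12,10,5,6;
     2,4,6,5,4,3;
     3,6,9,6,3,6]

/-- Rows spanning, modulo 2, the subspace orthogonal to the rows of `e6Iso`. -/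
def e6Glue : Matrix (Fin 5) (Fin 6) ℤ :=
  !![0,0,0,0,0,1;
     0,0,0,0,1,0;
     0,1,0,0,0,0;
     1,0,0,0,0,0;
     0,0,1,1,0,0]

def e6Coglue : Matrix (Fin 5) (Fin 6) ℤ :=
  !![1,0,1,0,1,0;
     0,0,0,1,1,0;
     1,0,0,0,0,0;
     0,1,0,0,1,0;
     0,0,0,0,1,0]

/-- Rows spanning a totally singular subspace modulo 2. -/
def e6Iso : Matrix (Fin 1) (Fin 6) ℤ :=
  !![0,0,0,0,1,1]

def e6A : Matrix (Fin 6) (Fin 5) ℤ :=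
  !![1,0,1,0,0;
     0,0,0,1,0;
     1,0,0,0,0;
     0,1,0,0,0;
     0,0,0,0,0;
     1,1,0,1,1]

def e6B : Matrix (Fin 6) (Fin 6) ℤ :=
  !![1,-1,1,0,0,-1;
     -1,1,0,0,0,0;
     0,0,1,0,0,-1;
     0,0,0,1,-1,0;
     0,0,0,0,0,0;
     -1,1,0,0,-1,0]

def e6C : Matrix (Fin 1) (Fin 6) ℤ :=
  !![0,0,0,0,1,0]

/-- Pairwise orthogonal roots. -/
def e6Roots : Matrix (Fin 4) (Fin 6) ℤ :=
  !![0,0,0,0,0,1;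
     0,0,0,0,1,0;
     0,1,0,0,0,0;
     0,1,2,2,1,1]

def e6Diag : Matrix (Fin 6) (Fin 6) ℤ :=
  !![1,1,1,1,1,1;
     0,2,2,2,2,2;
     0,0,3,3,3,3;
     0,0,0,4,4,2;
     0,0,0,0,5,1;
     0,0,0,0,0,2]

lemma e6_isSymm : e6Gram.IsSymm := by
  unfold Matrix.IsSymm
  decide

lemma e6_even (x : Fin 6 → ℤ) : 2 ∣ x ⬝ᵥ e6Gram *ᵥ x := two_dvd_of_diag e6_isSymm (by decide) x

set_option maxRecDepth 100000 in
lemma e6_mul_inv : e6Gram * e6Inv = (3 : ℤ) • 1 := by decide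

set_option maxRecDepth 100000 in
lemma e6_diag : e6Diagᵀ * e6Gram * e6Diag = diagonal ![2, 6, 12, 20, 30, 2] := by decide

lemma e6_pos (x : Fin 6 → ℚ) (hx : x ≠ 0) : 0 < gramForm e6Gram x x :=
  gramForm_pos_of_diagonal (by decide) e6_diag x hx

set_option maxRecDepth 100000 in
lemma e6_det : e6Gram.det = 3 := by
  have h := natAbs_det_of_diagonal e6_diag (by decide)
  have h1 : ∏ i, e6Diag i i = 240 := by decide
  have h2 : ∏ i, (![2, 6, 12, 20, 30, 2] : Fin 6 → ℤ) i = 172800 := by decide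
  rw [h1, h2] at h
  lia

set_option maxRecDepth 100000 in
lemma e6_four_dvd (a : Fin 6 → ℤ) (ha : ∀ i, 2 ∣ a ⬝ᵥ e6Gram *ᵥ e6Glue i) :
    4 ∣ a ⬝ᵥ e6Gram *ᵥ a :=
  four_dvd_of_orthogonal (Z := e6Iso) (A := e6A) (B := e6B) (C := e6C)
    (N := !![2])
    e6_isSymm e6_even (by decide) (by decide) (by decide) (by decide) a ha

set_option maxRecDepth 100000 in
lemma e6_coglue (i j : Fin 5) :
    2 ∣ e6Coglue i ⬝ᵥ e6Gram *ᵥ e6Glue j - if i = j then 1 else 0 := by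
  revert i j
  decide

set_option maxRecDepth 100000 in
lemma exists_isComplement_three : ∃ H : Matrix (Fin 6 ⊕ Fin 6) (Fin 6 ⊕ Fin 6) ℤ,
    ∃ w k r, IsComplement 3 H w k r := by
  have hroot : ∀ a, a ⬝ᵥ e6Gram *ᵥ a = 2 → ∃ i, ¬ 2 ∣ a ⬝ᵥ e6Gram *ᵥ e6Glue i := fun a ha => by
    by_contra! h
    have := e6_four_dvd a h
    lia
  have hel : ∀ v, ∃ u, e6Gram *ᵥ u = ((3 : ℕ) : ℤ) • v := fun v =>
    ⟨e6Inv *ᵥ v, by rw [mulVec_mulVec, e6_mul_inv, smul_mulVec, one_mulVec]; rfl⟩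
  refine ⟨_, _, _, _, isComplement_sum (G := e6Gram) (H := e6Gram) (x := e6Glue) (k := e6Coglue)
    (y := e6Glue) (r := Fin.append (m := 4) (n := 4) e6Roots 0)
    (s := Fin.append (m := 4) (n := 4) 0 e6Roots) (by simp) e6_isSymm
    e6_isSymm e6_even e6_even (by rw [e6_det]; rfl) hel hel e6_pos e6_pos (fun i j => ?_)
    (fun i => ?_) e6_coglue (fun i j => ?_) hroot hroot⟩
  · rw [← two_mul]
    exact ⟨_, rfl⟩
  · obtain ⟨c, hc⟩ := e6_even (e6Glue i)
    exact ⟨c, by rw [hc]; ring1⟩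
  · revert i j
    decide

end Enriques

namespace Enriques
open LinearMap (BilinForm)
open Module Submodule

set_option linter.unusedSectionVars false

/-- A Gram matrix of the root lattice `E8`. -/
def e8Gram : Matrix (Fin 8) (Fin 8) ℤ :=
  !![2,-1,0,0,0,0,0,0;
     -1,2,-1,0,0,0,0,0;
     0,-1,2,-1,0,0,0,0;
     0,0,-1,2,-1,0,0,0;
     0,0,0,-1,2,-1,0,-1;
     0,0,0,0,-1,2,-1,0;
     0,0,0,0,0,-1,2,0;
     0,0,0,0,-1,0,0,2]

def e8Inv : Matrix (Fin 8) (Fin 8) ℤ :=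
  !![2,3,4,5,6,4,2,3;
     3,6,8,10,12,8,4,6;
     4,8,12,15,18,12,6,9;
     5,10,15,20,24,16,8,12;
     6,12,18,24,30,20,10,15;
     4,8,12,16,20,14,7,10;
     2,4,6,8,10,7,4,5;
     3,6,9,12,15,10,5,8]

/-- The first three rows span a totally singular space modulo 2, and the last two extend it. -/
def e8Glue : Matrix (Fin 5) (Fin 8) ℤ :=
  !![0,0,0,0,0,0,1,1;
     0,0,0,1,0,0,0,1;
     0,1,0,0,0,0,0,1;
     1,0,0,0,1,1,0,0;
     1,0,0,0,1,1,0,1]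

def e8Coglue : Matrix (Fin 5) (Fin 8) ℤ :=
  !![0,1,0,0,0,1,0,0;
     1,0,1,0,0,0,0,0;
     1,0,0,0,0,0,0,0;
     1,1,0,0,1,1,0,0;
     1,0,0,0,1,1,0,0]

/-- Rows spanning a totally singular subspace modulo 2. -/
def e8Iso : Matrix (Fin 3) (Fin 8) ℤ :=
  !![0,0,0,0,0,0,1,1;
     0,0,0,1,0,0,0,1;
     0,1,0,0,0,0,0,1]

def e8A : Matrix (Fin 8) (Fin 5) ℤ :=
  !![0,1,1,1,1;
     0,0,0,0,0;
     0,1,0,0,0;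
     0,0,0,0,0;
     0,0,0,1,1;
     1,0,0,1,1;
     0,0,0,0,0;
     1,0,0,1,0]

def e8B : Matrix (Fin 8) (Fin 8) ℤ :=
  !![-1,0,1,0,1,-1,1,-2;
     0,0,0,0,0,0,0,0;
     0,0,1,-1,1,0,0,-1;
     0,0,0,0,0,0,0,0;
     -2,1,0,1,0,-1,1,0;
     -2,1,0,1,0,0,0,-1;
     0,0,0,0,0,0,0,0;
     -1,0,0,0,0,0,-1,0]

def e8C : Matrix (Fin 3) (Fin 8) ℤ :=
  !![0,0,0,0,0,0,1,0;
     0,0,0,1,0,0,0,0;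
     0,1,0,0,0,0,0,0]

/-- Pairwise orthogonal roots. -/
def e8Roots : Matrix (Fin 8) (Fin 8) ℤ :=
  !![0,0,0,0,0,0,0,1;
     0,0,0,0,0,0,1,0;
     0,0,0,1,0,0,0,0;
     0,1,0,0,0,0,0,0;
     0,0,0,1,2,2,1,1;
     0,1,2,2,2,2,1,1;
     0,1,2,3,4,2,1,2;
     2,3,4,5,6,4,2,3]

def e8Diag : Matrix (Fin 8) (Fin 8) ℤ :=
  !![1,1,1,1,1,1,1,3;
     0,2,2,2,2,2,2,6;
     0,0,3,3,3,3,3,9;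
     0,0,0,4,4,4,4,12;
     0,0,0,0,5,5,5,15;
     0,0,0,0,0,6,6,10;
     0,0,0,0,0,0,7,5;
     0,0,0,0,0,0,0,8]

lemma e8_isSymm : e8Gram.IsSymm := by
  unfold Matrix.IsSymm
  decide

lemma e8_even (x : Fin 8 → ℤ) : 2 ∣ x ⬝ᵥ e8Gram *ᵥ x := two_dvd_of_diag e8_isSymm (by decide) x

set_option maxRecDepth 100000 in
lemma e8_mul_inv : e8Gram * e8Inv = 1 := by decide

set_option maxRecDepth 100000 in
lemma e8_diag : e8Diagᵀ * e8Gram * e8Diag = diagonal ![2, 6, 12, 20, 30, 42, 56, 8] := by decide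

lemma e8_pos (x : Fin 8 → ℚ) (hx : x ≠ 0) : 0 < gramForm e8Gram x x :=
  gramForm_pos_of_diagonal (by decide) e8_diag x hx

set_option maxRecDepth 100000 in
lemma e8_det : e8Gram.det = 1 := by
  have h := natAbs_det_of_diagonal e8_diag (by decide)
  have h1 : ∏ i, e8Diag i i = 40320 := by decide
  have h2 : ∏ i, (![2, 6, 12, 20, 30, 42, 56, 8] : Fin 8 → ℤ) i = 1625702400 := by decide
  rw [h1, h2] at h
  lia

set_option maxRecDepth 100000 in
lemma e8_four_dvd (a : Fin 8 → ℤ) (ha : ∀ i, 2 ∣ a ⬝ᵥ e8Gram *ᵥ e8Glue i) :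
    4 ∣ a ⬝ᵥ e8Gram *ᵥ a :=
  four_dvd_of_orthogonal (Z := e8Iso) (A := e8A) (B := e8B) (C := e8C)
    (N := !![2, 1, 1; 1, 2, 1; 1, 1, 2])
    e8_isSymm e8_even (by decide) (by decide) (by decide) (by decide) a ha

set_option maxRecDepth 100000 in
lemma e8_coglue (i j : Fin 5) :
    2 ∣ e8Coglue i ⬝ᵥ e8Gram *ᵥ e8Glue j - if i = j then 1 else 0 := by
  revert i j
  decide

set_option maxRecDepth 100000 in
lemma e8_roots (i j : Fin 8) :
    e8Roots i ⬝ᵥ e8Gram *ᵥ e8Roots j = if i = j then 2 else 0 := by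
  revert i j
  decide

end Enriques

namespace Enriques
open LinearMap (BilinForm)
open Module Submodule

set_option linter.unusedSectionVars false

/-- A rank four form with determinant `p ^ 2`, when `k * (2 * m - 1) = 1 + p * t ^ 2`. -/
def tailGram (p k m t : ℤ) : Matrix (Fin 4) (Fin 4) ℤ :=
  !![2 * k, k, 0, -(p * t);
     k, k * m, p * t, 0;
     0, p * t, 2 * p, p;
     -(p * t), 0, p, p * m]

/-- `p` times the inverse of `tailGram p k m t`. -/
def tailInv (p k m t : ℤ) : Matrix (Fin 4) (Fin 4) ℤ :=
  !![p * m, -p, 0, p * t;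
     -p, 2 * p, -(p * t), 0;
     0, -(p * t), k * m, -k;
     p * t, 0, -k, 2 * k]

section
variable {p k m t : ℤ}

lemma tailGram_isSymm : (tailGram p k m t).IsSymm := by
  ext i j
  fin_cases i <;> fin_cases j <;> rfl

lemma tailGram_apply (x y : Fin 4 → ℤ) : x ⬝ᵥ tailGram p k m t *ᵥ y =
    k * (2 * x 0 * y 0 + x 0 * y 1 + x 1 * y 0 + m * x 1 * y 1)
      + p * t * (x 1 * y 2 + x 2 * y 1 - x 0 * y 3 - x 3 * y 0)
      + p * (2 * x 2 * y 2 + x 2 * y 3 + x 3 * y 2 + m * x 3 * y 3) := by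
  simp [tailGram, dotProduct, mulVec, Fin.sum_univ_four]
  ring

lemma gramForm_tailGram (x : Fin 4 → ℚ) : gramForm (tailGram p k m t) x x =
    k * (2 * x 0 * x 0 + x 0 * x 1 + x 1 * x 0 + m * x 1 * x 1)
      + p * t * (x 1 * x 2 + x 2 * x 1 - x 0 * x 3 - x 3 * x 0)
      + p * (2 * x 2 * x 2 + x 2 * x 3 + x 3 * x 2 + m * x 3 * x 3) := by
  rw [gramForm_apply]
  simp [tailGram, dotProduct, mulVec, Fin.sum_univ_four]
  ring

lemma tailGram_even (hm : 2 ∣ m) (x : Fin 4 → ℤ) : 2 ∣ x ⬝ᵥ tailGram p k m t *ᵥ x := by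
  obtain ⟨n, rfl⟩ := hm
  rw [tailGram_apply]
  exact ⟨k * (x 0 * x 0 + x 0 * x 1 + n * x 1 * x 1) + p * t * (x 1 * x 2 - x 0 * x 3)
    + p * (x 2 * x 2 + x 2 * x 3 + n * x 3 * x 3), by ring1⟩

lemma tailGram_pos (hp : 0 < p) (hk : 0 < k) (h : k * (2 * m - 1) = 1 + p * t ^ 2)
    (x : Fin 4 → ℚ) (hx : x ≠ 0) : 0 < gramForm (tailGram p k m t) x x := by
  have hp' : (0 : ℚ) < p := by exact_mod_cast hp
  have hk' : (0 : ℚ) < k := by exact_mod_cast hk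
  have h' : (k : ℚ) * (2 * m - 1) = 1 + p * t ^ 2 := by exact_mod_cast h
  have key : 2 * k * gramForm (tailGram p k m t) x x =
      (2 * k * x 0 + k * x 1 - p * t * x 3) ^ 2 + k * p * (2 * x 2 + x 3 + t * x 1) ^ 2
        + k * x 1 ^ 2 + p * x 3 ^ 2 := by
    rw [gramForm_tailGram]
    linear_combination (k * x 1 ^ 2 + p * x 3 ^ 2) * h'
  by_contra hneg
  have h0 : 2 * k * gramForm (tailGram p k m t) x x ≤ 0 :=
    mul_nonpos_of_nonneg_of_nonpos (by positivity) (not_lt.mp hneg)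
  rw [key] at h0
  have e1 : (0 : ℚ) ≤ (2 * k * x 0 + k * x 1 - p * t * x 3) ^ 2 := sq_nonneg _
  have e2 : (0 : ℚ) ≤ k * p * (2 * x 2 + x 3 + t * x 1) ^ 2 := by positivity
  have e3 : (0 : ℚ) ≤ k * x 1 ^ 2 := by positivity
  have e4 : (0 : ℚ) ≤ p * x 3 ^ 2 := by positivity
  have f1 : 2 * k * x 0 + k * x 1 - p * t * x 3 = 0 := by
    rw [← sq_eq_zero_iff]
    linarith
  have f2 : (k * p * (2 * x 2 + x 3 + t * x 1) ^ 2 : ℚ) = 0 := by linarith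
  have f3 : (k * x 1 ^ 2 : ℚ) = 0 := by linarith
  have f4 : (p * x 3 ^ 2 : ℚ) = 0 := by linarith
  simp only [mul_eq_zero, hp'.ne', hk'.ne', false_or, sq_eq_zero_iff] at f2 f3 f4
  have f0 : x 0 = 0 := by
    rw [f3, f4] at f1
    simpa [hk'.ne'] using f1
  have f5 : x 2 = 0 := by
    rw [f3, f4] at f2
    simpa using f2
  exact hx (by ext i; fin_cases i <;> assumption)

lemma tailGram_det (h : k * (2 * m - 1) = 1 + p * t ^ 2) : (tailGram p k m t).det = p ^ 2 := by
  have : (tailGram p k m t).det = p ^ 2 * (k * (2 * m - 1) - p * t ^ 2) ^ 2 := by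
    simp [tailGram, det_succ_row_zero, Fin.sum_univ_succ, Fin.succAbove]
    ring
  rw [this, h]
  ring

lemma tailGram_mul_inv (h : k * (2 * m - 1) = 1 + p * t ^ 2) :
    tailGram p k m t * tailInv p k m t = p • 1 := by
  ext i j
  fin_cases i <;> fin_cases j <;>
    simp [tailGram, tailInv, Matrix.mul_apply, Fin.sum_univ_four] <;>
    first | ring1 | linear_combination p * h

end

section
variable {k m : ℤ} {p : ℕ} {t : ℤ}

lemma dvd_six_of_roots {x y z : Fin 4 → ℤ} {ε : ℤ} (hε : ε ^ 2 = 1)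
    (hx : x ⬝ᵥ tailGram p k m t *ᵥ x = 2) (hy : y ⬝ᵥ tailGram p k m t *ᵥ y = 2)
    (hz : z ⬝ᵥ tailGram p k m t *ᵥ z = 2) (hxy : x ⬝ᵥ tailGram p k m t *ᵥ y = 0)
    (hxz : x ⬝ᵥ tailGram p k m t *ᵥ z = 0) (hyz : y ⬝ᵥ tailGram p k m t *ᵥ z = ε) :
    (p : ℤ) ∣ 6 := by
  have hmod : ∀ u v : Fin 4 → ℤ, ((u ⬝ᵥ tailGram p k m t *ᵥ v : ℤ) : ZMod p) =
      k * (2 * u 0 * v 0 + u 0 * v 1 + u 1 * v 0 + m * u 1 * v 1) := fun u v => by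
    rw [tailGram_apply]
    push_cast
    simp
  have e1 := hmod x x
  have e2 := hmod y y
  have e3 := hmod z z
  have e4 := hmod x y
  have e5 := hmod x z
  have e6 := hmod y z
  rw [hx] at e1
  rw [hy] at e2
  rw [hz] at e3
  rw [hxy] at e4
  rw [hxz] at e5
  rw [hyz] at e6
  have hε' : (ε : ZMod p) ^ 2 = 1 := by exact_mod_cast congrArg (Int.cast : ℤ → ZMod p) hε
  have h : ∀ a₀ a₁ b₀ b₁ c₀ c₁ k m : ZMod p,
      let f : ZMod p → ZMod p → ZMod p → ZMod p → ZMod p := fun u₀ u₁ v₀ v₁ =>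
        k * (2 * u₀ * v₀ + u₀ * v₁ + u₁ * v₀ + m * u₁ * v₁)
      f a₀ a₁ a₀ a₁ * (f b₀ b₁ b₀ b₁ * f c₀ c₁ c₀ c₁ - f b₀ b₁ c₀ c₁ ^ 2)
        - f a₀ a₁ b₀ b₁ * (f a₀ a₁ b₀ b₁ * f c₀ c₁ c₀ c₁ - f b₀ b₁ c₀ c₁ * f a₀ a₁ c₀ c₁)
        + f a₀ a₁ c₀ c₁ * (f a₀ a₁ b₀ b₁ * f b₀ b₁ c₀ c₁ - f b₀ b₁ b₀ b₁ * f a₀ a₁ c₀ c₁) = 0 := by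
    intro a₀ a₁ b₀ b₁ c₀ c₁ k m f
    simp only [f]
    ring
  have h' := h (x 0) (x 1) (y 0) (y 1) (z 0) (z 1) k m
  simp only at h'
  rw [← e1, ← e2, ← e3, ← e4, ← e5, ← e6] at h'
  push_cast at h'
  rw [← ZMod.intCast_zmod_eq_zero_iff_dvd]
  push_cast
  linear_combination h' + 2 * hε'

lemma odd_form_of_root {n : ℤ} {x : Fin 4 → ℤ}
    (hx : x ⬝ᵥ tailGram p k (2 * n) t *ᵥ x = 2) :
    k * (x 0 * x 0 + x 0 * x 1 + n * x 1 * x 1) + p * t * (x 1 * x 2 - x 0 * x 3)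
      + p * (x 2 * x 2 + x 2 * x 3 + n * x 3 * x 3) = 1 := by
  rw [tailGram_apply] at hx
  lia

/-- Gluing vectors in the rank four lattice. -/
lemma exists_tail_glue {n : ℤ} (hp : 5 ≤ p) (hpp : p.Prime) (hk : 0 < k) (hk2 : ¬ Even k)
    (hn : ¬ Even n) (ht : Even t) (h : k * (2 * (2 * n) - 1) = 1 + p * t ^ 2) :
    ∃ a b : Fin 4 → ℤ, 4 ∣ a ⬝ᵥ tailGram p k (2 * n) t *ᵥ a ∧
      4 ∣ b ⬝ᵥ tailGram p k (2 * n) t *ᵥ b ∧ ¬ 2 ∣ a ⬝ᵥ tailGram p k (2 * n) t *ᵥ b ∧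
      ∀ x, x ⬝ᵥ tailGram p k (2 * n) t *ᵥ x = 2 → 2 ∣ x ⬝ᵥ tailGram p k (2 * n) t *ᵥ a →
        ¬ 2 ∣ x ⬝ᵥ tailGram p k (2 * n) t *ᵥ b := by
  have hp2 : ¬ Even (p : ℤ) := by
    rw [Int.even_coe_nat]
    exact Nat.not_even_iff_odd.mpr (hpp.odd_of_ne_two (by lia))
  by_contra! hcon
  have four : ∀ {v : ℤ} (w : ℤ), Even w → v = 2 * w → 4 ∣ v := fun {v} w hw hv => by
    obtain ⟨c, rfl⟩ := hw
    exact ⟨c, by rw [hv]; ring1⟩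
  obtain ⟨x, hx, hxa, hxb⟩ := hcon ![1, 0, 1, 0] ![1, 0, 0, 1]
    (four (k + p) (by simp [Int.even_add, hk2, hp2])
      (by rw [tailGram_apply]; simp; try ring))
    (four (k - p * t + p * n) (by simp [Int.even_add, Int.even_sub, Int.even_mul, hk2, hp2, hn, ht])
      (by rw [tailGram_apply]; simp; try ring))
    (by
      rw [tailGram_apply, ← even_iff_two_dvd]
      simp [Int.even_add, hp2, ht])
  obtain ⟨y, hy, hya, hyb⟩ := hcon ![1, 0, 1, 0] ![0, 1, 1, 0]
    (four (k + p) (by simp [Int.even_add, hk2, hp2])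
      (by rw [tailGram_apply]; simp; try ring))
    (four (k * n + p * t + p) (by simp [Int.even_add, Int.even_mul, hk2, hp2, hn, ht])
      (by rw [tailGram_apply]; simp; try ring))
    (by
      rw [tailGram_apply, ← even_iff_two_dvd]
      simp [Int.even_add, hk2, ht])
  obtain ⟨z, hz, hza, hzb⟩ := hcon ![1, 0, 0, 1] ![0, 1, 0, 1]
    (four (k - p * t + p * n) (by simp [Int.even_add, Int.even_sub, Int.even_mul, hk2, hp2, hn, ht])
      (by rw [tailGram_apply]; simp; try ring))
    (four (k * n + p * n) (by simp [Int.even_add, Int.even_mul, hk2, hp2, hn])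
      (by rw [tailGram_apply]; simp; try ring))
    (by
      rw [tailGram_apply, ← even_iff_two_dvd]
      simp [Int.even_add, hk2, ht])
  have px := congrArg Even (odd_form_of_root hx)
  have py := congrArg Even (odd_form_of_root hy)
  have pz := congrArg Even (odd_form_of_root hz)
  rw [tailGram_apply, ← even_iff_two_dvd] at hxa hxb hya hyb hza hzb
  simp [Int.even_add, Int.even_mul, hk2, hn, hp2, ht] at px py pz hxa hxb hya hyb hza hzb
  have qx : ¬ Even (x 0) ∧ Even (x 1) ∧ Even (x 2) ∧ Even (x 3) := by
    clear * - px hxa hxb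
    tauto
  have qy : Even (y 0) ∧ Even (y 1) ∧ ¬ Even (y 2) ∧ Even (y 3) := by
    clear * - py hya hyb
    tauto
  have qz : Even (z 0) ∧ Even (z 1) ∧ Even (z 2) ∧ ¬ Even (z 3) := by
    clear * - pz hza hzb
    tauto
  have hpos : ∀ u : Fin 4 → ℤ, u ≠ 0 → 0 < u ⬝ᵥ tailGram p k (2 * n) t *ᵥ u := fun u hu =>
    dotProduct_mulVec_pos (tailGram_pos (by lia) hk h) hu
  have hbound : ∀ u v : Fin 4 → ℤ, u ⬝ᵥ tailGram p k (2 * n) t *ᵥ u = 2 →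
      v ⬝ᵥ tailGram p k (2 * n) t *ᵥ v = 2 → (∃ i, ¬ (Even (u i) ↔ Even (v i))) →
      -2 < u ⬝ᵥ tailGram p k (2 * n) t *ᵥ v ∧ u ⬝ᵥ tailGram p k (2 * n) t *ᵥ v < 2 := by
    rintro u v hu hv ⟨i, hi⟩
    have h1 := hpos (u + v) fun h0 => hi (by
      rw [eq_neg_of_add_eq_zero_left h0, Pi.neg_apply, even_neg])
    have h2 := hpos (u - v) fun h0 => hi (by rw [sub_eq_zero.mp h0])
    have h3 := dotProduct_symm (tailGram_isSymm (p := p) (k := k) (m := 2 * n) (t := t)) u v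
    simp only [mulVec_add, mulVec_sub, dotProduct_add, dotProduct_sub, add_dotProduct,
      sub_dotProduct, hu, hv, ← h3] at h1 h2
    lia
  obtain ⟨xy1, xy2⟩ := hbound x y hx hy ⟨0, by simp [qx, qy]⟩
  obtain ⟨xz1, xz2⟩ := hbound x z hx hz ⟨0, by simp [qx, qz]⟩
  obtain ⟨yz1, yz2⟩ := hbound y z hy hz ⟨2, by simp [qy, qz]⟩
  have exy : Even (x ⬝ᵥ tailGram p k (2 * n) t *ᵥ y) := by
    rw [tailGram_apply]
    simp [Int.even_add, Int.even_sub, Int.even_mul, qx, qy]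
  have exz : Even (x ⬝ᵥ tailGram p k (2 * n) t *ᵥ z) := by
    rw [tailGram_apply]
    simp [Int.even_add, Int.even_mul, qx, qz, ht]
  have eyz : ¬ Even (y ⬝ᵥ tailGram p k (2 * n) t *ᵥ z) := by
    rw [tailGram_apply]
    simp [Int.even_add, Int.even_sub, Int.even_mul, qy, qz, hp2]
  obtain ⟨c, hc⟩ := exy
  obtain ⟨d, hd⟩ := exz
  obtain ⟨e, he⟩ := Int.not_even_iff_odd.mp eyz
  have he' : y ⬝ᵥ tailGram p k (2 * n) t *ᵥ z = 1 ∨ y ⬝ᵥ tailGram p k (2 * n) t *ᵥ z = -1 := by lia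
  have h6 := dvd_six_of_roots (sq_eq_one_iff.mpr he') hx hy hz (by lia) (by lia) rfl
  have h7 := Int.le_of_dvd (by norm_num) h6
  have h8 : p = 5 ∨ p = 6 := by lia
  rcases h8 with rfl | rfl <;> revert h6 hpp <;> norm_num

end

end Enriques

namespace Enriques
open LinearMap (BilinForm)
open Module Submodule

set_option linter.unusedSectionVars false

/-- A prime `q ≡ 3 mod 8` modulo which `p` is not a square. -/
lemma exists_prime_not_isSquare {p : ℕ} (hp : p.Prime) (hp2 : p ≠ 2) :
    ∃ q : ℕ, q.Prime ∧ q % 8 = 3 ∧ ¬ IsSquare (p : ZMod q) := by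
  have : Fact p.Prime := ⟨hp⟩
  have hodd : p % 2 = 1 := hp.eq_two_or_odd.resolve_left hp2
  have hcop : Nat.Coprime 8 p := by
    rw [show 8 = 2 ^ 3 by rfl]
    exact (Nat.coprime_primes Nat.prime_two hp).mpr hp2.symm |>.pow_left 3
  have main : ∀ a : ℕ, (a : ZMod p) ≠ 0 →
      ∃ q : ℕ, p < q ∧ q.Prime ∧ q % 8 = 3 ∧ (q : ZMod p) = a := fun a ha => by
    obtain ⟨c, hc8, hcp⟩ := Nat.chineseRemainder hcop 3 a
    have hcu : c.Coprime (8 * p) := by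
      refine Nat.Coprime.mul_right ?_ ?_
      · rw [Nat.Coprime, Nat.ModEq.gcd_eq hc8]
        rfl
      · rw [Nat.coprime_comm, hp.coprime_iff_not_dvd, ← ZMod.natCast_eq_zero_iff,
          (ZMod.natCast_eq_natCast_iff _ _ _).mpr hcp]
        exact ha
    obtain ⟨q, hqp, hq, hqc⟩ := Nat.forall_exists_prime_gt_and_modEq p
      (mul_ne_zero (by norm_num) hp.ne_zero) hcu
    refine ⟨q, hqp, hq, (hqc.of_mul_right p).trans hc8, ?_⟩
    rw [ZMod.natCast_eq_natCast_iff]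
    exact (hqc.of_mul_left 8).trans hcp
  rcases Nat.odd_mod_four_iff.mp hodd with h | h
  · obtain ⟨x, hx⟩ := FiniteField.exists_nonsquare (F := ZMod p) (by rwa [ZMod.ringChar_zmod_n])
    have hx' : ((x.val : ℕ) : ZMod p) = x := ZMod.natCast_zmod_val x
    obtain ⟨q, -, hq, hq8, hqp⟩ := main x.val fun h0 => hx (by
      rw [← hx', h0]
      exact IsSquare.zero)
    have : Fact q.Prime := ⟨hq⟩
    rw [hx'] at hqp
    exact ⟨q, hq, hq8, fun hsq => hx (hqp ▸
      (ZMod.exists_sq_eq_prime_iff_of_mod_four_eq_one h (by rintro rfl; lia)).mpr hsq)⟩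
  · obtain ⟨q, hpq, hq, hq8, hqp⟩ := main 1 (by simp)
    have : Fact q.Prime := ⟨hq⟩
    refine ⟨q, hq, hq8, (ZMod.exists_sq_eq_prime_iff_of_mod_four_eq_three h (by lia) hpq.ne).mp ?_⟩
    rw [hqp, Nat.cast_one]
    exact IsSquare.one

lemma exists_tail_parameters {p : ℕ} (hp : p.Prime) (hp2 : p ≠ 2) :
    ∃ k n t : ℤ, 0 < k ∧ ¬ Even k ∧ ¬ Even n ∧ Even t ∧
      k * (2 * (2 * n) - 1) = 1 + p * t ^ 2 := by
  obtain ⟨q, hq, hq8, hsq⟩ := exists_prime_not_isSquare hp hp2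
  have : Fact q.Prime := ⟨hq⟩
  have hp0 : (p : ZMod q) ≠ 0 := fun h0 => hsq (by rw [h0]; exact IsSquare.zero)
  have hneg : ¬ IsSquare (-1 : ZMod q) := by
    rw [ZMod.exists_sq_eq_neg_one_iff]
    lia
  have hq2 : ringChar (ZMod q) ≠ 2 := by
    rw [ZMod.ringChar_zmod_n]
    rintro rfl
    lia
  obtain ⟨s, hs⟩ : IsSquare (-1 * p : ZMod q) := by
    rw [← quadraticChar_one_iff_isSquare (by simpa using hp0), map_mul,
      quadraticChar_neg_one_iff_not_isSquare.mpr hneg, quadraticChar_neg_one_iff_not_isSquare.mpr hsq]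
    rfl
  have hs0 : s ≠ 0 := by
    rintro rfl
    simp [hp0] at hs
  obtain ⟨t, ht, hts⟩ : ∃ t : ℤ, Even t ∧ (t : ZMod q) = s⁻¹ := by
    have hv : (((s⁻¹).val : ℤ) : ZMod q) = s⁻¹ := by simp
    rcases Int.even_or_odd ((s⁻¹).val : ℤ) with h | h
    · exact ⟨_, h, hv⟩
    · refine ⟨(s⁻¹).val + q, h.add_odd ?_, by simp⟩
      rw [Int.odd_iff]
      lia
  obtain ⟨k, hk⟩ : (q : ℤ) ∣ 1 + p * t ^ 2 := by
    rw [← ZMod.intCast_zmod_eq_zero_iff_dvd]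
    push_cast
    rw [hts]
    field_simp
    linear_combination -hs
  have hq0 : (0 : ℤ) < q := by exact_mod_cast hq.pos
  obtain ⟨n, hn⟩ : ∃ n : ℤ, (q : ℤ) = 2 * (2 * n) - 1 := ⟨(q + 1) / 4, by lia⟩
  refine ⟨k, n, t, ?_, fun hk2 => ?_, fun hn2 => ?_, ht, by rw [hk, ← hn, mul_comm]⟩
  · refine pos_of_mul_pos_right ?_ hq0.le
    rw [← hk]
    positivity
  · have := congrArg Even hk
    simp [Int.even_add, Int.even_pow, ht, hk2] at this
  · obtain ⟨c, rfl⟩ := hn2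
    lia

lemma exists_isComplement_of_five_le {p : ℕ} (hp : p.Prime) (hp5 : 5 ≤ p) :
    ∃ H : Matrix (Fin 8 ⊕ Fin 4) (Fin 8 ⊕ Fin 4) ℤ, ∃ w k r, IsComplement p H w k r := by
  obtain ⟨k, n, t, hk, hk2, hn, ht, h⟩ := exists_tail_parameters hp (by lia)
  obtain ⟨a, b, ha, hb, hab, hroot⟩ := exists_tail_glue hp5 hp hk hk2 hn ht h
  have hs := tailGram_isSymm (p := p) (k := k) (m := 2 * n) (t := t)
  have he := tailGram_even (p := p) (k := k) (m := 2 * n) (t := t) ⟨n, rfl⟩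
  have hba := dotProduct_symm hs b a
  have ha2 := he a
  have hb2 := he b
  have hg : ∀ i j : Fin 5, 2 ∣ e8Glue i ⬝ᵥ e8Gram *ᵥ e8Glue j
      - if (i, j) = (3, 4) ∨ (i, j) = (4, 3) then 1 else 0 := by decide
  have hg4 : ∀ i, 4 ∣ e8Glue i ⬝ᵥ e8Gram *ᵥ e8Glue i := by decide
  refine ⟨_, _, _, _, isComplement_sum (G := e8Gram) (H := tailGram p k (2 * n) t) (x := e8Glue)
    (k := e8Coglue) (y := ![0, 0, 0, a, b]) (r := e8Roots) (s := 0) (by simp) e8_isSymm hs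
    e8_even he ?_ (fun v => ⟨(p : ℤ) • e8Inv *ᵥ v, ?_⟩)
    (fun v => ⟨tailInv p k (2 * n) t *ᵥ v, ?_⟩) e8_pos
    (tailGram_pos (by exact_mod_cast hp.pos) hk h) (fun i j => ?_) (fun i => ?_) e8_coglue
    (fun i j => ?_) (fun x hx => ?_) (fun x hx => ?_)⟩
  · rw [e8_det, tailGram_det h, Int.natAbs_pow]
    simp
  · rw [mulVec_smul, mulVec_mulVec, e8_mul_inv, one_mulVec]
  · rw [mulVec_mulVec, tailGram_mul_inv h, smul_mulVec, one_mulVec]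
  · have := hg i j
    revert this
    fin_cases i <;> fin_cases j <;> simp <;> lia
  · refine dvd_add (hg4 i) ?_
    fin_cases i <;> simp [ha, hb]
  · rw [e8_roots]
    simp
  · by_contra! hcon
    have := e8_four_dvd x hcon
    lia
  · by_contra! hcon
    exact hroot x hx (hcon 3) (hcon 4)

end Enriques

/-- Let `p ≥ 3` be a prime, `1 ≤ σ ≤ 10`, and `N` the supersingular K3
lattice of characteristic `p` and Artin invariant `σ`.  There exists a primitive sublattice
`M ⊆ N` isometric to `Γ(2)` with no vector of square `-2` orthogonal to `M` if and only if
`σ ≤ 5`. -/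
theorem enriques_sublattice_exists_iff (p σ : ℕ) (hp : p.Prime) (hp3 : 3 ≤ p)
    (hσ1 : 1 ≤ σ) (hσ10 : σ ≤ 10)
    (G : Matrix (Fin 22) (Fin 22) ℤ) (hG : IsSSK3Gram p σ G) :
    (EnriquesSet G).Nonempty ↔ σ ≤ 5 := by
  constructor
  · rintro ⟨M, -, ⟨e, -, he⟩, -⟩
    by_contra hσ
    exact Enriques.not_exists_gammaTwo hp hp3 (by lia) hG he
  · intro hσ
    rcases hp3.eq_or_lt with rfl | hp4
    · obtain ⟨H, w, k, r, h⟩ := Enriques.exists_isComplement_three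
      exact Enriques.enriquesSet_nonempty_of_isComplement hp hp3 h hσ1 hσ hG
    · have hp5 : 5 ≤ p := by
        have : p ≠ 4 := by
          rintro rfl
          revert hp
          norm_num
        lia
      obtain ⟨H, w, k, r, h⟩ := Enriques.exists_isComplement_of_five_le hp hp5
      exact Enriques.enriquesSet_nonempty_of_isComplement hp hp3 h hσ1 hσ hG

end
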